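/- Fix b₀ > 0, θ₀ = arctan b₀, and α, δ, δ₀ ∈ (0, 1). Let Q = {y ∈ ℝ³ : y₁ > 0, y₃ > b₀y₁} and for L ≥ 4 let Q_L = Q ∩ {r < L} where r = √(y₁² + y₃²). Let f ∈ H^{(1−δ,2−δ₀)}_{4,α}(Q) be 2π-periodic in y₂, let f_L be its restriction to Q_L, set c_L = (1/(2πL(π/2 − θ₀)))·∫_{Q_L ∩ {0<y₂<2π}} f_L dy, and let v_L be the unique solution of the cut-off problem: Δv_L = f_L in Q_L; vanishing normal derivative on the faces {y₃ = b₀y₁} and {y₁ = 0} (for r < L); ∂_r v_L = c_L on {r = L}; 2π-periodicity in y₂; and v_L → 0 at the point (0,0,0). Then ‖v_L‖^{(−1−δ,−δ₀)}_{6,α;Q_{L/2}} ≤ C·‖f_L‖^{(1−δ,2−δ₀)}_{4,α;Q_L}, where C depends only on b₀, α, δ, δ₀ and not on L or f. In particular v_L ∈ C^{1,δ} up to the edge {y₁ = y₃ = 0} in Q_{L/2}, with ∂_{y₁}v_L and ∂_{y₃}v_L vanishing on the edge. -/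

import Mathlib

noncomputable section

open Real Set Filter MeasureTheory Topology

/-- Points of `ℝ³` (Euclidean). -/
abbrev V3 : Type := EuclideanSpace ℝ (Fin 3)

/-- `r_x = √(x₁² + x₃²)`, the distance of `x` to the `x₂`-axis. -/
def rx (x : V3) : ℝ := Real.sqrt (x 0 ^ 2 + x 2 ^ 2)

/-- The edge `{x₁ = x₃ = 0}` (the `x₂`-axis). -/
def edge : Set V3 := {x : V3 | x 0 = 0 ∧ x 2 = 0}

/-- The infinite wedge `Q = {y₁ > 0, y₃ > b₀y₁}`. -/
def wedgeQ (b₀ : ℝ) : Set V3 := {y : V3 | 0 < y 0 ∧ b₀ * y 0 < y 2}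

/-- The truncated wedge `Q_L = Q ∩ {r < L}`. -/
def wedgeQL (b₀ L : ℝ) : Set V3 := {y ∈ wedgeQ b₀ | rx y < L}

/-- `Q̄ ∖ edge`, the natural regularity set for functions on the wedge. -/
def SQ (b₀ : ℝ) : Set V3 := closure (wedgeQ b₀) \ edge

/-- `Q̄_L ∖ edge`. -/
def SL (b₀ L : ℝ) : Set V3 := closure (wedgeQL b₀ L) \ edge

/-- Partial derivative within `S` in the `i`-th coordinate direction. -/
def pdW (S : Set V3) (i : Fin 3) (u : V3 → ℝ) (x : V3) : ℝ :=
  fderivWithin ℝ u S x (EuclideanSpace.single i 1)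

/-- Laplacian of `u` at `x` (derivatives taken within `S`). -/
def lapW (S : Set V3) (u : V3 → ℝ) (x : V3) : ℝ :=
  ∑ i : Fin 3, pdW S i (pdW S i u) x

/-- `2π`-periodicity in `y₂`, on the set `D`. -/
def Per2On (D : Set V3) (u : V3 → ℝ) : Prop :=
  ∀ y ∈ D, u (y + EuclideanSpace.single 1 (2 * Real.pi)) = u y

/-- All weighted sup quantities entering `Σ_{j≤m}[u]^{(k,l)}_{j,0;D}` are `≤ M`
(derivatives taken within `S`). -/
def wsupLE (S : Set V3) (m : ℕ) (k l : ℝ) (D : Set V3) (u : V3 → ℝ) (M : ℝ) : Prop :=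
  (∀ j : ℕ, j ≤ m → ∀ x ∈ D, 0 < rx x → rx x < 1 →
      rx x ^ max (k + j) 0 * ‖iteratedFDerivWithin ℝ j u S x‖ ≤ M) ∧
  (∀ j : ℕ, j ≤ m → ∀ x ∈ D, 1 < rx x →
      rx x ^ (l + j) * ‖iteratedFDerivWithin ℝ j u S x‖ ≤ M)

/-- All quantities entering the weighted Hölder norm `‖u‖^{(k,l)}_{m,α;D}` are `≤ M`
(derivatives taken within `S`). -/
def wnormLE (S : Set V3) (m : ℕ) (α k l : ℝ) (D : Set V3) (u : V3 → ℝ) (M : ℝ) : Prop :=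
  wsupLE S m k l D u M ∧
  (∀ x ∈ D, ∀ y ∈ D, 0 < min (rx x) (rx y) → min (rx x) (rx y) < 1 →
      min (rx x) (rx y) ^ max (k + m + α) 0 *
        ‖iteratedFDerivWithin ℝ m u S x - iteratedFDerivWithin ℝ m u S y‖ ≤
        M * ‖x - y‖ ^ α) ∧
  (∀ x ∈ D, ∀ y ∈ D, 1 < min (rx x) (rx y) →
      min (rx x) (rx y) ^ (l + m + α) *
        ‖iteratedFDerivWithin ℝ m u S x - iteratedFDerivWithin ℝ m u S y‖ ≤
        M * ‖x - y‖ ^ α)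

/-- Membership in the weighted Hölder space `H^{(k,l)}_{m,α}(D)`. -/
def memH (S : Set V3) (m : ℕ) (α k l : ℝ) (D : Set V3) (u : V3 → ℝ) : Prop :=
  ContDiffOn ℝ m u S ∧ ∃ M : ℝ, 0 ≤ M ∧ wnormLE S m α k l D u M

/-- The constant `c_L` ensuring solvability of the cut-off Neumann problem (4.6). -/
def cutoffConst (b₀ L : ℝ) (f : V3 → ℝ) : ℝ :=
  (2 * Real.pi * L * (Real.pi / 2 - Real.arctan b₀))⁻¹ *
    ∫ y in {y ∈ wedgeQL b₀ L | 0 < y 1 ∧ y 1 < 2 * Real.pi}, f y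

/-- `v` solves the cut-off problem (4.4) on `Q_L` with right-hand side `f`:
`Δv = f` in `Q_L`, vanishing normal derivatives on the lateral faces `{y₃ = b₀y₁}` and
`{y₁ = 0}`, radial derivative `c_L` on `{r = L}`, `2π`-periodicity in `y₂`, and `v → 0`
at the point `(0,0,0)`. -/
def IsCutoffSolution (b₀ L : ℝ) (f v : V3 → ℝ) : Prop :=
  ContDiffOn ℝ 2 v (SL b₀ L) ∧
  (∀ y ∈ wedgeQL b₀ L, lapW (SL b₀ L) v y = f y) ∧
  (∀ y ∈ SL b₀ L, y 2 = b₀ * y 0 → rx y < L →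
      b₀ * pdW (SL b₀ L) 0 v y - pdW (SL b₀ L) 2 v y = 0) ∧
  (∀ y ∈ SL b₀ L, y 0 = 0 → rx y < L → pdW (SL b₀ L) 0 v y = 0) ∧
  (∀ y ∈ SL b₀ L, rx y = L →
      y 0 / L * pdW (SL b₀ L) 0 v y + y 2 / L * pdW (SL b₀ L) 2 v y = cutoffConst b₀ L f) ∧
  Per2On (closure (wedgeQL b₀ L)) v ∧
  Tendsto v (𝓝[SL b₀ L] (0 : V3)) (𝓝 0)


open scoped ContDiff

/-- directional derivative -/
def dd (e : V3) (g : V3 → ℝ) : V3 → ℝ := fun x => fderiv ℝ g x e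

/-- radial profile of the regularised fundamental solution -/
def kerA (τ : ℝ) : ℝ := -(Real.smoothTransition (2 * τ - 1) * τ ^ (-(1/2) : ℝ))

lemma kerA_contDiff : ContDiff ℝ ∞ kerA := by
  rw [contDiff_iff_contDiffAt]
  intro τ
  by_cases h : τ < 1/2
  · have : kerA =ᶠ[𝓝 τ] fun _ => 0 := by
      filter_upwards [gt_mem_nhds h] with s hs
      simp [kerA, Real.smoothTransition.zero_of_nonpos (show 2 * s - 1 ≤ 0 by linarith)]
    exact contDiffAt_const.congr_of_eventuallyEq this
  · have h0 : τ ≠ 0 := by intro h0; rw [h0] at h; norm_num at h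
    unfold kerA
    refine ContDiffAt.neg (ContDiffAt.mul ?_ ?_)
    · exact (Real.smoothTransition.contDiff.comp (by fun_prop)).contDiffAt
    · exact Real.contDiffAt_rpow_const_of_ne h0

lemma kerA_eq {τ : ℝ} (h : 1 ≤ τ) : kerA τ = -τ ^ (-(1/2) : ℝ) := by
  simp [kerA, Real.smoothTransition.one_of_one_le (show 1 ≤ 2 * τ - 1 by linarith)]

lemma kerA_deriv {τ : ℝ} (h : 1 < τ) : deriv kerA τ = (1/2) * τ ^ (-(3/2) : ℝ) := by
  have e : kerA =ᶠ[𝓝 τ] fun s => -s ^ (-(1/2) : ℝ) := by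
    filter_upwards [lt_mem_nhds h] with s hs using kerA_eq hs.le
  rw [e.deriv_eq]
  have := ((Real.hasDerivAt_rpow_const (x := τ) (p := -(1/2)) (Or.inl (by linarith))).neg).deriv
  rw [show (fun s : ℝ => -s ^ (-(1/2) : ℝ)) = -(fun s : ℝ => s ^ (-(1/2) : ℝ)) from rfl, this]
  norm_num

lemma kerA_deriv2 {τ : ℝ} (h : 1 < τ) : deriv (deriv kerA) τ = -(3/4) * τ ^ (-(5/2) : ℝ) := by
  have e : deriv kerA =ᶠ[𝓝 τ] fun s => (1/2) * s ^ (-(3/2) : ℝ) := by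
    filter_upwards [lt_mem_nhds h] with s hs using kerA_deriv hs
  rw [e.deriv_eq]
  have := ((Real.hasDerivAt_rpow_const (x := τ) (p := -(3/2)) (Or.inl (by linarith))).const_mul (1/2 : ℝ)).deriv
  rw [this]
  norm_num
  ring

/-- radial profile of the Laplacian -/
def kerL (τ : ℝ) : ℝ := 4 * τ * deriv (deriv kerA) τ + 6 * deriv kerA τ

lemma kerA_d1 : ContDiff ℝ ∞ (deriv kerA) := by
  have := kerA_contDiff
  exact (contDiff_infty_iff_deriv.1 this).2

lemma kerA_d2 : ContDiff ℝ ∞ (deriv (deriv kerA)) := 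
  (contDiff_infty_iff_deriv.1 kerA_d1).2

lemma kerL_contDiff : ContDiff ℝ ∞ kerL := by
  have h1 := kerA_d1
  have h2 := kerA_d2
  unfold kerL
  fun_prop

lemma kerL_zero {τ : ℝ} (h : 1 < τ) : kerL τ = 0 := by
  unfold kerL
  rw [kerA_deriv h, kerA_deriv2 h]
  have : τ * τ ^ (-(5/2) : ℝ) = τ ^ (-(3/2) : ℝ) := by
    nth_rewrite 1 [← Real.rpow_one τ]
    rw [← Real.rpow_add (by linarith)]; norm_num
  linear_combination (-3) * this

lemma dd_radial (g : ℝ → ℝ) (hg : ContDiff ℝ ∞ g) (c : ℝ) (e z : V3) :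
    HasFDerivAt (fun z : V3 => g (c * ‖z‖^2)) ((deriv g (c * ‖z‖^2) * (2 * c)) • innerSL ℝ z) z := by
  have h1 : HasFDerivAt (fun z : V3 => c * ‖z‖^2) (c • (2 • innerSL ℝ z)) z :=
    ((hasStrictFDerivAt_norm_sq z).hasFDerivAt).const_mul c
  have h2 : HasDerivAt g (deriv g (c * ‖z‖^2)) (c * ‖z‖^2) :=
    (hg.differentiable (by simp)).differentiableAt.hasDerivAt
  have := h2.comp_hasFDerivAt z h1
  refine this.congr_fderiv ?_
  ext v
  simp
  ring

lemma ddd_radial (g : ℝ → ℝ) (hg : ContDiff ℝ ∞ g) (c : ℝ) (e z : V3) :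
    dd e (dd e (fun z : V3 => g (c * ‖z‖^2))) z =
      deriv (deriv g) (c * ‖z‖^2) * (2 * c)^2 * (inner ℝ z e)^2 + deriv g (c * ‖z‖^2) * (2*c) * ‖e‖^2 := by
  have h1 : dd e (fun z : V3 => g (c * ‖z‖^2)) = fun z => (deriv g (c * ‖z‖^2) * (2 * c)) * inner ℝ z e := by
    ext z
    simp [dd, (dd_radial g hg c e z).fderiv]
  rw [h1]
  have hg' : ContDiff ℝ ∞ (deriv g) := (contDiff_infty_iff_deriv.1 hg).2
  have h2 := dd_radial (deriv g) hg' c e z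
  have h3 : HasFDerivAt (fun z : V3 => inner ℝ z e) (innerSL ℝ e) z := by
    have := (innerSL ℝ e).hasFDerivAt (x := z)
    refine this.congr_of_eventuallyEq (Eventually.of_forall fun y => ?_)
    simp [real_inner_comm]
  have h4 := (h2.mul_const (2*c)).mul h3
  have h5 := congrArg (fun (T : V3 →L[ℝ] ℝ) => T e) h4.fderiv
  refine Eq.trans h5 ?_
  simp [real_inner_comm]
  ring

lemma lap_radial (g : ℝ → ℝ) (hg : ContDiff ℝ ∞ g) (c : ℝ) (b : OrthonormalBasis (Fin 3) ℝ V3) (z : V3) :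
    ∑ i, dd (b i) (dd (b i) (fun z : V3 => g (c * ‖z‖^2))) z =
      deriv (deriv g) (c * ‖z‖^2) * (2 * c)^2 * ‖z‖^2 + 6 * c * deriv g (c * ‖z‖^2) := by
  simp_rw [ddd_radial g hg c]
  rw [Finset.sum_add_distrib, ← Finset.mul_sum]
  have h : ∑ i, (inner ℝ z (b i))^2 = ‖z‖^2 := by
    have := b.sum_sq_norm_inner_right z
    simp only [Real.norm_eq_abs, sq_abs] at this
    rw [← this]
    exact Finset.sum_congr rfl fun i _ => by rw [real_inner_comm]
  rw [h]
  simp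
  ring

lemma integral_kerL : ∫ z : V3, kerL (‖z‖^2) = 3 * (volume (Metric.ball (0:V3) 1)).toReal := by
  have h := integral_fun_norm_addHaar (volume : Measure V3) (fun y => kerL (y^2))
  rw [h]
  have h3 : Module.finrank ℝ V3 = 3 := by simp [V3]
  rw [h3]
  have hI : ∫ y in Ioi (0:ℝ), y ^ (3 - 1) • kerL (y^2) = 1 := by
    have hz : ∀ y ∈ Ioi (2:ℝ), y ^ (3 - 1) • kerL (y^2) = 0 := by
      intro y hy
      rw [kerL_zero (by nlinarith [mem_Ioi.1 hy])]; simp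
    have e1 : ∫ y in Ioi (0:ℝ), y ^ (3 - 1) • kerL (y^2) = ∫ y in (0:ℝ)..2, y ^ (3 - 1) • kerL (y^2) := by
      rw [intervalIntegral.integral_of_le (by norm_num)]
      refine (setIntegral_eq_of_subset_of_forall_sdiff_eq_zero measurableSet_Ioi Ioc_subset_Ioi_self ?_)
      intro y hy
      apply hz
      simp only [Set.mem_sdiff, mem_Ioi, mem_Ioc, not_and, not_le] at hy
      exact hy.2 hy.1
    rw [e1]
    have hd : ∀ y ∈ uIcc (0:ℝ) 2, HasDerivAt (fun y : ℝ => 2 * y^3 * deriv kerA (y^2)) (y ^ (3 - 1) • kerL (y^2)) y := by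
      intro y _
      have a1 : HasDerivAt (deriv kerA) (deriv (deriv kerA) (y^2)) (y^2) :=
        (kerA_d1.differentiable (by simp)).differentiableAt.hasDerivAt
      have a2 : HasDerivAt (fun y : ℝ => y^2) (2*y) y := by simpa using hasDerivAt_pow 2 y
      have a3 : HasDerivAt (fun y : ℝ => 2 * y^3) (6*y^2) y := by
        have := (hasDerivAt_pow 3 y).const_mul 2
        refine this.congr_deriv ?_
        norm_num; ring
      have := a3.mul (HasDerivAt.comp (h₂ := deriv kerA) (h := fun y : ℝ => y^2) y a1 a2)
      refine this.congr_deriv ?_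
      simp [kerL]; ring
    rw [intervalIntegral.integral_eq_sub_of_hasDerivAt hd]
    · rw [kerA_deriv (by norm_num)]
      have : ((2:ℝ)^2) ^ (-(3/2) : ℝ) = (2:ℝ)⁻¹^3 := by
        rw [show ((2:ℝ)^2) = (2:ℝ)^(2:ℝ) by norm_num, ← Real.rpow_mul (by norm_num)]
        rw [show (2 * -(3/2) : ℝ) = -(3:ℕ) by norm_num, Real.rpow_neg (by norm_num), Real.rpow_natCast]
        norm_num
      rw [this]; norm_num
    · apply Continuous.intervalIntegrable
      have := kerL_contDiff.continuous
      fun_prop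
  rw [hI]
  simp [Measure.real]

theorem exists_kernel : ∃ K φ : V3 → ℝ, ContDiff ℝ ∞ K ∧ ContDiff ℝ ∞ φ ∧
    (∀ z, 1 < ‖z‖ → K z = 0) ∧ (∀ z, 1 < ‖z‖ → φ z = 0) ∧ ∫ z, φ z = 1 ∧
    ∀ b : OrthonormalBasis (Fin 3) ℝ V3, ∀ z,
      ∑ i, dd (b i) (dd (b i) K) z = φ z - 8 * φ ((2:ℝ) • z) := by
  set m : ℝ := 3 * (volume (Metric.ball (0:V3) 1)).toReal with hm
  have hm0 : m ≠ 0 := by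
    have h1 : 0 < volume (Metric.ball (0:V3) 1) := Metric.measure_ball_pos _ _ one_pos
    have h2 : volume (Metric.ball (0:V3) 1) < ⊤ := measure_ball_lt_top
    have := ENNReal.toReal_pos h1.ne' h2.ne
    positivity
  have hsq : ContDiff ℝ ∞ (fun z : V3 => ‖z‖^2) := contDiff_norm_sq ℝ
  have c1 : ContDiff ℝ ∞ (fun z : V3 => kerA (1 * ‖z‖^2)) := kerA_contDiff.comp (contDiff_const.mul hsq)
  have c2 : ContDiff ℝ ∞ (fun z : V3 => kerA (4 * ‖z‖^2)) := kerA_contDiff.comp (contDiff_const.mul hsq)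
  refine ⟨fun z => m⁻¹ * (kerA (1 * ‖z‖^2) - 2 * kerA (4 * ‖z‖^2)), fun z => m⁻¹ * kerL (‖z‖^2), ?_, ?_, ?_, ?_, ?_, ?_⟩
  · exact contDiff_const.mul (c1.sub (contDiff_const.mul c2))
  · exact contDiff_const.mul (kerL_contDiff.comp hsq)
  · intro z hz
    have h1 : 1 ≤ ‖z‖^2 := by nlinarith
    simp only
    rw [kerA_eq (by linarith), kerA_eq (by linarith)]
    rw [Real.mul_rpow (x := 4) (by norm_num) (by positivity)]
    have : (4:ℝ) ^ (-(1/2) : ℝ) = 1/2 := by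
      rw [show (4:ℝ) = (2:ℝ)^(2:ℝ) by norm_num, ← Real.rpow_mul (by norm_num)]
      rw [show (2 * -(1/2) : ℝ) = -1 by norm_num, Real.rpow_neg_one]; norm_num
    rw [this]; ring_nf
  · intro z hz
    simp only
    rw [kerL_zero (by nlinarith)]; simp
  · rw [integral_const_mul, integral_kerL, inv_mul_cancel₀ hm0]
  · intro b z
    have hdd : ∀ e : V3, dd e (fun z : V3 => m⁻¹ * (kerA (1 * ‖z‖^2) - 2 * kerA (4 * ‖z‖^2))) =
        fun z => m⁻¹ * (dd e (fun z : V3 => kerA (1 * ‖z‖^2)) z - 2 * dd e (fun z : V3 => kerA (4 * ‖z‖^2)) z) := by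
      intro e; ext z
      have d1 := (c1.differentiable (by simp)).differentiableAt (x := z)
      have d2 := (c2.differentiable (by simp)).differentiableAt (x := z)
      have := ((d1.hasFDerivAt.sub (d2.hasFDerivAt.const_mul 2)).const_mul m⁻¹).fderiv
      simp only [dd]
      exact (congrArg (fun (T : V3 →L[ℝ] ℝ) => T e) this).trans (by simp)
    have hdd2 : ∀ e : V3, dd e (fun z => m⁻¹ * (dd e (fun z : V3 => kerA (1 * ‖z‖^2)) z - 2 * dd e (fun z : V3 => kerA (4 * ‖z‖^2)) z)) z = m⁻¹ * (dd e (dd e (fun z : V3 => kerA (1 * ‖z‖^2))) z - 2 * dd e (dd e (fun z : V3 => kerA (4 * ‖z‖^2))) z) := by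
      intro e
      have k1 : ContDiff ℝ ∞ (dd e (fun z : V3 => kerA (1 * ‖z‖^2))) :=
        (c1.fderiv_right (m := ∞) (by simp)).clm_apply contDiff_const
      have k2 : ContDiff ℝ ∞ (dd e (fun z : V3 => kerA (4 * ‖z‖^2))) :=
        (c2.fderiv_right (m := ∞) (by simp)).clm_apply contDiff_const
      have d1 := (k1.differentiable (by simp)).differentiableAt (x := z)
      have d2 := (k2.differentiable (by simp)).differentiableAt (x := z)
      have := ((d1.hasFDerivAt.sub (d2.hasFDerivAt.const_mul 2)).const_mul m⁻¹).fderiv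
      conv_lhs => rw [dd]
      exact (congrArg (fun (T : V3 →L[ℝ] ℝ) => T e) this).trans (by simp [dd])
    simp_rw [hdd, hdd2]
    rw [← Finset.mul_sum, Finset.sum_sub_distrib, ← Finset.mul_sum,
      lap_radial kerA kerA_contDiff, lap_radial kerA kerA_contDiff]
    simp only [kerL, norm_smul, Real.norm_ofNat, mul_pow]
    norm_num
    ring

open scoped ContDiff

structure IsK (κ : V3 → ℝ) : Prop where
  smooth : ContDiff ℝ ∞ κ
  supp : ∀ z, 1 < ‖z‖ → κ z = 0

def kK : V3 → ℝ := Classical.choose exists_kernel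
def kphi : V3 → ℝ := Classical.choose (Classical.choose_spec exists_kernel)

lemma kK_isK : IsK kK := by
  have h := Classical.choose_spec (Classical.choose_spec exists_kernel)
  exact ⟨h.1, h.2.2.1⟩
lemma kphi_isK : IsK kphi := by
  have h := Classical.choose_spec (Classical.choose_spec exists_kernel)
  exact ⟨h.2.1, h.2.2.2.1⟩
lemma kphi_int : ∫ z, kphi z = 1 := by
  have h := Classical.choose_spec (Classical.choose_spec exists_kernel)
  exact h.2.2.2.2.1
lemma kK_lap (b : OrthonormalBasis (Fin 3) ℝ V3) (z : V3) :
    ∑ i, dd (b i) (dd (b i) kK) z = kphi z - 8 * kphi ((2:ℝ) • z) := by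
  have h := Classical.choose_spec (Classical.choose_spec exists_kernel)
  exact h.2.2.2.2.2 b z

def TT (κ : V3 → ℝ) (ε : ℝ) (G : V3 → ℝ) (x : V3) : ℝ := ∫ z, κ z * G (x - ε • z)

def nK (κ : V3 → ℝ) : ℝ := ∫ z, |κ z|

lemma nK_nonneg (κ : V3 → ℝ) : 0 ≤ nK κ := integral_nonneg fun _ => abs_nonneg _

lemma IsK.cpt {κ : V3 → ℝ} (h : IsK κ) : HasCompactSupport κ :=
  HasCompactSupport.intro (isCompact_closedBall (0:V3) 1) (fun x hx => h.supp x (by simpa using hx))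

lemma IsK.dd {κ : V3 → ℝ} (h : IsK κ) (e : V3) : IsK (dd e κ) := by
  refine ⟨(h.smooth.fderiv_right (m := ∞) (by simp)).clm_apply contDiff_const, fun z hz => ?_⟩
  have : κ =ᶠ[𝓝 z] fun _ => 0 := by
    filter_upwards [continuous_norm.continuousAt.eventually (lt_mem_nhds hz)] with y hy using h.supp y hy
  simp [_root_.dd, this.fderiv_eq]

lemma IsK.int_mul {κ : V3 → ℝ} (h : IsK κ) {g : V3 → ℝ} (hg : Continuous g) :
    Integrable (fun z => κ z * g z) := by
  apply Continuous.integrable_of_hasCompactSupport (h.smooth.continuous.mul hg)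
  exact h.cpt.mul_right

lemma IsK.int {κ : V3 → ℝ} (h : IsK κ) : Integrable κ := by
  simpa using h.int_mul (g := fun _ => 1) continuous_const

lemma TT_le {κ : V3 → ℝ} (h : IsK κ) {g : V3 → ℝ} {B : ℝ} (hb : ∀ z, ‖z‖ ≤ 1 → |g z| ≤ B) :
    |∫ z, κ z * g z| ≤ nK κ * B := by
  rw [nK, ← integral_mul_const, ← Real.norm_eq_abs]
  refine norm_integral_le_of_norm_le (h.int.abs.mul_const B) (Eventually.of_forall fun z => ?_)
  rw [norm_mul, Real.norm_eq_abs, Real.norm_eq_abs]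
  rcases le_or_gt ‖z‖ 1 with hz | hz
  · exact mul_le_mul_of_nonneg_left (hb z hz) (abs_nonneg _)
  · simp [h.supp z hz]

lemma TT_bound {κ : V3 → ℝ} (h : IsK κ) {G : V3 → ℝ} {A : ℝ} (hG : ∀ x, |G x| ≤ A) (ε : ℝ) (x : V3) :
    |TT κ ε G x| ≤ nK κ * A := TT_le h fun _ _ => hG _

lemma TT_holder' {κ : V3 → ℝ} (h : IsK κ) {G : V3 → ℝ} (hc : Continuous G) {A α : ℝ} (hα : 0 ≤ α) (hA : 0 ≤ A)
    (hG : ∀ x y, |G x - G y| ≤ A * ‖x - y‖ ^ α) {ε : ℝ} (hε : 0 ≤ ε) (x : V3) :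
    |TT κ ε G x - (∫ z, κ z) * G x| ≤ nK κ * (A * ε ^ α) := by
  have e : TT κ ε G x - (∫ z, κ z) * G x = ∫ z, κ z * (G (x - ε • z) - G x) := by
    rw [TT, ← integral_mul_const, ← integral_sub]
    · congr 1; ext z; ring
    · exact h.int_mul (by fun_prop)
    · exact h.int.mul_const _
  rw [e]
  refine TT_le h fun z hz => (hG _ _).trans ?_
  gcongr
  rw [show x - ε • z - x = -(ε • z) by abel, norm_neg, norm_smul, Real.norm_of_nonneg hε]
  nlinarith

lemma TT_eq_conv (κ : V3 → ℝ) {ε : ℝ} (hε : 0 < ε) (G : V3 → ℝ) :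
    TT κ ε G = fun x => ((ε^3)⁻¹) * (convolution (fun w => κ (ε⁻¹ • w)) G (ContinuousLinearMap.lsmul ℝ ℝ) volume) x := by
  ext x
  have := Measure.integral_comp_smul (volume : Measure V3) (fun w => κ (ε⁻¹ • w) * G (x - w)) ε
  simp only [inv_smul_smul₀ hε.ne'] at this
  rw [TT, this, convolution]
  simp [abs_of_pos hε]

lemma IsK.scale {κ : V3 → ℝ} (h : IsK κ) {ε : ℝ} (hε : 0 < ε) :
    HasCompactSupport (fun w => κ (ε⁻¹ • w)) ∧ ContDiff ℝ ∞ (fun w => κ (ε⁻¹ • w)) := by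
  refine ⟨h.cpt.comp_smul (inv_ne_zero hε.ne'), h.smooth.comp (by fun_prop)⟩

lemma TT_contDiff {κ : V3 → ℝ} (h : IsK κ) {ε : ℝ} (hε : 0 < ε) {G : V3 → ℝ} (hG : Continuous G) :
    ContDiff ℝ ∞ (TT κ ε G) := by
  rw [TT_eq_conv κ hε]
  exact contDiff_const.mul ((h.scale hε).1.contDiff_convolution_left _ (h.scale hε).2 hG.locallyIntegrable)

lemma TT_diff {κ : V3 → ℝ} (h : IsK κ) {ε : ℝ} (hε : 0 < ε) {G : V3 → ℝ} (hG : Continuous G) :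
    Differentiable ℝ (TT κ ε G) := (TT_contDiff h hε hG).differentiable (by simp)

lemma TT_dd {κ : V3 → ℝ} (h : IsK κ) {ε : ℝ} (hε : 0 < ε) {G : V3 → ℝ} (hG : Continuous G) (e x : V3) :
    dd e (TT κ ε G) x = ε⁻¹ * TT (dd e κ) ε G x := by
  rw [TT_eq_conv (dd e κ) hε]
  have h1 := (h.scale hε).1.hasFDerivAt_convolution_left (ContinuousLinearMap.lsmul ℝ ℝ)
    ((h.scale hε).2.of_le (by simp)) hG.locallyIntegrable (μ := volume) x
  have h2 := h1.const_mul ((ε^3)⁻¹)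
  have h3 := congrArg (fun (T : V3 →L[ℝ] ℝ) => T e) h2.fderiv
  rw [← TT_eq_conv κ hε] at h3
  refine Eq.trans h3 ?_
  have hd : ∀ w, fderiv ℝ (fun w => κ (ε⁻¹ • w)) w e = ε⁻¹ * dd e κ (ε⁻¹ • w) := by
    intro w
    have a1 : HasFDerivAt κ (fderiv ℝ κ (ε⁻¹ • w)) (ε⁻¹ • w) :=
      (h.smooth.differentiable (by simp)).differentiableAt.hasFDerivAt
    have a2 : HasFDerivAt (fun w : V3 => ε⁻¹ • w) (ε⁻¹ • ContinuousLinearMap.id ℝ V3) w :=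
      (hasFDerivAt_id w).const_smul ε⁻¹
    refine Eq.trans (congrArg (fun (T : V3 →L[ℝ] ℝ) => T e) (HasFDerivAt.comp w a1 a2).fderiv) ?_
    simp [dd]
  have hconv : (convolution (fderiv ℝ fun w => κ (ε⁻¹ • w)) G ((ContinuousLinearMap.lsmul ℝ ℝ).precompL V3) volume) x e =
      ε⁻¹ * (convolution (fun w => dd e κ (ε⁻¹ • w)) G (ContinuousLinearMap.lsmul ℝ ℝ) volume) x := by
    have hi : Integrable (fun t => ((ContinuousLinearMap.lsmul ℝ ℝ).precompL V3) (fderiv ℝ (fun w => κ (ε⁻¹ • w)) t) (G (x - t))) := by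
      have := ((h.scale hε).1.fderiv (𝕜 := ℝ)).convolutionExists_left ((ContinuousLinearMap.lsmul ℝ ℝ).precompL V3)
        (((h.scale hε).2.continuous_fderiv (by simp))) hG.locallyIntegrable (μ := volume) x
      exact this
    rw [convolution, convolution, ContinuousLinearMap.integral_apply hi, ← integral_const_mul]
    congr 1
    ext t
    simp [hd, mul_assoc]
  simp only [FunLike.coe_smul, Pi.smul_apply, smul_eq_mul]
  rw [hconv]; ring

/-- line derivative under the integral -/
lemma TT_line {κ : V3 → ℝ} (h : IsK κ) {ε : ℝ} (hε : 0 < ε) {G Ge : V3 → ℝ} (hG : Continuous G)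
    (hGe : Continuous Ge) {B : ℝ} (hB : ∀ x, |Ge x| ≤ B) {e : V3}
    (hd : ∀ x, HasDerivAt (fun t : ℝ => G (x + t • e)) (Ge x) 0) (x : V3) :
    dd e (TT κ ε G) x = TT κ ε Ge x := by
  have hd' : ∀ x t, HasDerivAt (fun t : ℝ => G (x + t • e)) (Ge (x + t • e)) t := by
    intro x t
    have := hd (x + t • e)
    have h2 : HasDerivAt (fun s : ℝ => s - t) 1 t := (hasDerivAt_id t).sub_const t
    have h3 := HasDerivAt.comp (h₂ := fun s : ℝ => G (x + t • e + s • e)) (h := fun s => s - t) t (by simpa using this) h2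
    refine (h3.congr_deriv (by simp)).congr_of_eventuallyEq (Eventually.of_forall fun s => ?_)
    simp only [Function.comp]
    congr 1
    rw [sub_smul]; abel
  have key := hasDerivAt_integral_of_dominated_loc_of_deriv_le (μ := (volume : Measure V3))
    (F := fun (t : ℝ) z => κ z * G (x + t • e - ε • z)) (F' := fun t z => κ z * Ge (x + t • e - ε • z))
    (x₀ := 0) (s := univ) (bound := fun z => |κ z| * B) univ_mem
    (Eventually.of_forall fun t => (h.int_mul (g := fun z => G (x + t • e - ε • z)) (by fun_prop)).aestronglyMeasurable)
    (h.int_mul (g := fun z => G (x + (0:ℝ) • e - ε • z)) (by fun_prop))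
    (h.int_mul (g := fun z => Ge (x + (0:ℝ) • e - ε • z)) (by fun_prop)).aestronglyMeasurable
    (Eventually.of_forall fun z t _ => by
      rw [norm_mul, Real.norm_eq_abs, Real.norm_eq_abs]
      exact mul_le_mul_of_nonneg_left (hB _) (abs_nonneg _))
    (h.int.abs.mul_const B)
    (Eventually.of_forall fun z t _ => by
      have := (hd' (x - ε • z) t).const_mul (κ z)
      simpa only [show ∀ t : ℝ, x - ε • z + t • e = x + t • e - ε • z from fun t => by abel] using this)
  have h1 := ((TT_diff h hε hG) (x + (0:ℝ) • e)).hasFDerivAt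
  have h2 : HasDerivAt (fun t : ℝ => x + t • e) e 0 := by
    simpa using ((hasDerivAt_id (0:ℝ)).smul_const e).const_add x
  have h3 := h1.comp_hasDerivAt (0:ℝ) h2
  have h4 := h3.unique key.2
  simpa [dd, TT] using h4

lemma int_dd_zero {κ : V3 → ℝ} (h : IsK κ) (e : V3) : ∫ z, dd e κ z = 0 := by
  have h1 := TT_dd h one_pos (G := fun _ => 1) continuous_const e 0
  have h2 := TT_line h one_pos (G := fun _ => 1) (Ge := fun _ => 0) continuous_const continuous_const (B := 0) (by simp)
    (e := e) (fun x => hasDerivAt_const _ _) 0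
  rw [h2] at h1
  simpa [TT] using h1.symm

abbrev OB := OrthonormalBasis (Fin 3) ℝ V3

/-- directional derivative within a set -/
def pd (D : Set V3) (e : V3) (w : V3 → ℝ) (x : V3) : ℝ := fderivWithin ℝ w D x e

def CH (D : Set V3) (b : OB) (α ρ : ℝ) : ℕ → ℝ → (V3 → ℝ) → Prop
  | 0, A, w => (∀ x ∈ D, |w x| ≤ A) ∧ ∀ x ∈ D, ∀ y ∈ D, |w x - w y| ≤ A * (‖x - y‖ / ρ) ^ α
  | j+1, A, w => (∀ x ∈ D, |w x| ≤ A) ∧ DifferentiableOn ℝ w D ∧ ∀ i, CH D b α ρ j (A / ρ) (pd D (b i) w)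

lemma CH.bd {D : Set V3} {b : OB} {α ρ A : ℝ} {j : ℕ} {w : V3 → ℝ} (h : CH D b α ρ j A w) :
    ∀ x ∈ D, |w x| ≤ A := by
  cases j with
  | zero => exact h.1
  | succ j => exact h.1

lemma pd_congr {D : Set V3} {w w' : V3 → ℝ} (h : ∀ x ∈ D, w x = w' x) (e : V3) {x : V3} (hx : x ∈ D) :
    pd D e w x = pd D e w' x := by
  simp only [pd]
  rw [fderivWithin_congr h (h x hx)]

lemma CH.congr {D : Set V3} {b : OB} {α ρ : ℝ} {j : ℕ} : ∀ {A : ℝ} {w w' : V3 → ℝ}, CH D b α ρ j A w →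
    (∀ x ∈ D, w x = w' x) → CH D b α ρ j A w' := by
  induction j with
  | zero =>
    intro A w w' h e
    refine ⟨fun x hx => e x hx ▸ h.1 x hx, fun x hx y hy => ?_⟩
    rw [← e x hx, ← e y hy]; exact h.2 x hx y hy
  | succ j ih =>
    intro A w w' h e
    refine ⟨fun x hx => e x hx ▸ h.1 x hx, h.2.1.congr fun x hx => (e x hx).symm, fun i => ?_⟩
    exact ih (h.2.2 i) fun x hx => pd_congr e _ hx

lemma CH.mono {D : Set V3} {b : OB} {α ρ : ℝ} (hρ : 0 < ρ) {j : ℕ} : ∀ {A A' : ℝ} {w : V3 → ℝ}, CH D b α ρ j A w →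
    A ≤ A' → CH D b α ρ j A' w := by
  induction j with
  | zero =>
    intro A A' w h e
    refine ⟨fun x hx => (h.1 x hx).trans e, fun x hx y hy => (h.2 x hx y hy).trans ?_⟩
    gcongr
  | succ j ih =>
    intro A A' w h e
    exact ⟨fun x hx => (h.1 x hx).trans e, h.2.1, fun i => ih (h.2.2 i) (by gcongr)⟩

lemma CH.lin {D : Set V3} (hD : UniqueDiffOn ℝ D) {b : OB} {α ρ : ℝ} (c : ℝ) {j : ℕ} :
    ∀ {A A' : ℝ} {w w' : V3 → ℝ}, CH D b α ρ j A w → CH D b α ρ j A' w' →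
    CH D b α ρ j (A + |c| * A') (fun x => w x + c * w' x) := by
  induction j with
  | zero =>
    intro A A' w w' h h'
    refine ⟨fun x hx => ?_, fun x hx y hy => ?_⟩
    · refine (abs_add_le _ _).trans ?_
      rw [abs_mul]
      exact add_le_add (h.1 x hx) (mul_le_mul_of_nonneg_left (h'.1 x hx) (abs_nonneg _))
    · rw [show w x + c * w' x - (w y + c * w' y) = (w x - w y) + c * (w' x - w' y) by ring]
      refine (abs_add_le _ _).trans ?_
      rw [abs_mul, add_mul, mul_assoc]
      exact add_le_add (h.2 x hx y hy) (mul_le_mul_of_nonneg_left (h'.2 x hx y hy) (abs_nonneg _))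
  | succ j ih =>
    intro A A' w w' h h'
    refine ⟨fun x hx => ?_, h.2.1.add (h'.2.1.const_mul c), fun i => ?_⟩
    · refine (abs_add_le _ _).trans ?_
      rw [abs_mul]
      exact add_le_add (h.1 x hx) (mul_le_mul_of_nonneg_left (h'.1 x hx) (abs_nonneg _))
    · have := ih (h.2.2 i) (h'.2.2 i)
      rw [show A / ρ + |c| * (A' / ρ) = (A + |c| * A') / ρ by ring] at this
      refine this.congr fun x hx => ?_
      have d1 := (h.2.1 x hx).hasFDerivWithinAt
      have d2 := (h'.2.1 x hx).hasFDerivWithinAt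
      have := ((d1.add (d2.const_mul c)).fderivWithin (hD x hx))
      have t := congrArg (fun (T : V3 →L[ℝ] ℝ) => T (b i)) this
      simp only [pd]
      exact Eq.symm (Eq.trans t (by simp))

lemma pd_inter {D O : Set V3} (hO : IsOpen O) (e : V3) (w : V3 → ℝ) {x : V3} (hx : x ∈ O) :
    pd (D ∩ O) e w x = pd D e w x := by
  simp only [pd]
  rw [fderivWithin_inter (hO.mem_nhds hx)]

lemma CH.inter {D O : Set V3} (hO : IsOpen O) {b : OB} {α ρ : ℝ} {j : ℕ} :
    ∀ {A : ℝ} {w : V3 → ℝ}, CH D b α ρ j A w → CH (D ∩ O) b α ρ j A w := by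
  induction j with
  | zero => intro A w h; exact ⟨fun x hx => h.1 x hx.1, fun x hx y hy => h.2 x hx.1 y hy.1⟩
  | succ j ih =>
    intro A w h
    refine ⟨fun x hx => h.1 x hx.1, h.2.1.mono inter_subset_left, fun i => ?_⟩
    exact (ih (h.2.2 i)).congr fun x hx => (pd_inter hO _ _ hx.2).symm

lemma norm_le_basis (b : OB) (T : V3 →L[ℝ] ℝ) {B : ℝ} (hB : ∀ i, |T (b i)| ≤ B) : ‖T‖ ≤ 3 * B := by
  have hB0 : 0 ≤ B := (abs_nonneg _).trans (hB 0)
  refine T.opNorm_le_bound (by positivity) fun x => ?_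
  have hx : x = ∑ i, inner ℝ (b i) x • b i := (b.sum_repr' x).symm
  conv_lhs => rw [hx, map_sum]
  refine (norm_sum_le _ _).trans ?_
  have : ∀ i ∈ Finset.univ, ‖T (inner ℝ (b i) x • b i)‖ ≤ B * ‖x‖ := by
    intro i _
    rw [map_smul, norm_smul, mul_comm]
    have h1 : ‖inner ℝ (b i) x‖ ≤ ‖x‖ := by
      have := norm_inner_le_norm (𝕜 := ℝ) (b i) x
      simpa using this
    exact mul_le_mul (hB i) h1 (norm_nonneg _) hB0
  refine (Finset.sum_le_sum this).trans ?_
  simp; linarith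

lemma min_le_pow {t α : ℝ} (ht : 0 ≤ t) (hα0 : 0 < α) (hα1 : α < 1) : min 1 t ≤ t ^ α := by
  rcases le_total t 1 with h | h
  · refine (min_le_right _ _).trans ?_
    rcases ht.eq_or_lt with h0 | h0
    · rw [← h0, Real.zero_rpow hα0.ne']
    · conv_lhs => rw [← Real.rpow_one t]
      exact Real.rpow_le_rpow_of_exponent_ge h0 h hα1.le
  · exact (min_le_left _ _).trans (Real.one_le_rpow h hα0.le)

lemma holder_of_deriv {D : Set V3} (hD : Convex ℝ D) {b : OB} {α ρ A : ℝ} (hα0 : 0 < α) (hα1 : α < 1) (hρ : 0 < ρ)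
    {w : V3 → ℝ} (h1 : ∀ x ∈ D, |w x| ≤ A) (h2 : DifferentiableOn ℝ w D)
    (h3 : ∀ i, ∀ x ∈ D, |pd D (b i) w x| ≤ A / ρ) :
    ∀ x ∈ D, ∀ y ∈ D, |w x - w y| ≤ 3 * A * (‖x - y‖ / ρ) ^ α := by
  intro x hx y hy
  have hA : 0 ≤ A := (abs_nonneg _).trans (h1 x hx)
  have a1 : |w x - w y| ≤ 3 * A * 1 := by
    have := abs_sub (w x) (w y)
    linarith [h1 x hx, h1 y hy]
  have a2 : |w x - w y| ≤ 3 * A * (‖x - y‖ / ρ) := by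
    have := hD.norm_image_sub_le_of_norm_fderivWithin_le (f := w) (C := 3 * (A / ρ)) h2
      (fun z hz => norm_le_basis b _ fun i => h3 i z hz) hy hx
    rw [Real.norm_eq_abs] at this
    refine this.trans (le_of_eq ?_)
    ring
  have a3 := min_le_pow (t := ‖x - y‖ / ρ) (by positivity) hα0 hα1
  refine le_trans ?_ (mul_le_mul_of_nonneg_left a3 (by positivity : 0 ≤ 3 * A))
  rcases le_total 1 (‖x - y‖ / ρ) with h | h
  · rwa [min_eq_left h]
  · rwa [min_eq_right h]

lemma CH.down {D : Set V3} (hD : Convex ℝ D) {b : OB} {α ρ : ℝ} (hα0 : 0 < α) (hα1 : α < 1) (hρ : 0 < ρ) {j : ℕ} :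
    ∀ {A : ℝ} {w : V3 → ℝ}, 0 ≤ A → CH D b α ρ (j+1) A w → CH D b α ρ j (3 * A) w := by
  induction j with
  | zero =>
    intro A w hA h
    exact ⟨fun x hx => (h.1 x hx).trans (by linarith), holder_of_deriv hD hα0 hα1 hρ h.1 h.2.1 fun i => (h.2.2 i).1⟩
  | succ j ih =>
    intro A w hA h
    refine ⟨fun x hx => (h.1 x hx).trans (by linarith), h.2.1, fun i => ?_⟩
    have := ih (by positivity) (h.2.2 i)
    rwa [← mul_div_assoc] at this

/-- scale sequence -/
def ek (ε0 : ℝ) (k : ℕ) : ℝ := ε0 * (1/2) ^ k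

lemma ek_pos {ε0 : ℝ} (h : 0 < ε0) (k : ℕ) : 0 < ek ε0 k := by unfold ek; positivity
lemma ek_le {ε0 : ℝ} (h : 0 < ε0) (k : ℕ) : ek ε0 k ≤ ε0 := by
  unfold ek
  have : ((1:ℝ)/2)^k ≤ 1 := pow_le_one₀ (by norm_num) (by norm_num)
  nlinarith
lemma ek_succ (ε0 : ℝ) (k : ℕ) : ek ε0 (k+1) = ek ε0 k / 2 := by unfold ek; ring
lemma ek_tendsto (ε0 : ℝ) : Tendsto (ek ε0) atTop (𝓝 0) := by
  have := (tendsto_pow_atTop_nhds_zero_of_lt_one (r := (1:ℝ)/2) (by norm_num) (by norm_num)).const_mul ε0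
  rw [mul_zero] at this
  exact this

lemma half_rpow_lt {α : ℝ} (h : 0 < α) : ((1:ℝ)/2) ^ α < 1 := Real.rpow_lt_one (by norm_num) (by norm_num) h

lemma ek_rpow {ε0 : ℝ} (h : 0 < ε0) (α : ℝ) (k : ℕ) : ek ε0 k ^ α = ε0 ^ α * (((1:ℝ)/2) ^ α) ^ k := by
  rw [ek, Real.mul_rpow h.le (by positivity), ← Real.rpow_natCast, ← Real.rpow_mul (by norm_num), mul_comm (k:ℝ) α,
    Real.rpow_mul (by norm_num), Real.rpow_natCast]

lemma ek_summable {ε0 : ℝ} (h : 0 < ε0) {α : ℝ} (hα : 0 < α) : Summable fun k => ek ε0 k ^ α := by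
  simp_rw [ek_rpow h]
  exact (summable_geometric_of_lt_one (by positivity) (half_rpow_lt hα)).mul_left _

lemma sum_min {ε0 α : ℝ} (h0 : 0 < ε0) (hα0 : 0 < α) (hα1 : α < 1) : ∃ C, 0 < C ∧ ∀ d : ℝ, 0 < d →
    ∑' k, min (ek ε0 k ^ α) (ek ε0 k ^ (α - 1) * d) ≤ C * d ^ α := by
  set q : ℝ := ((1:ℝ)/2) ^ α with hq
  set p : ℝ := ((1:ℝ)/2) ^ (1 - α) with hp
  have hq1 : q < 1 := half_rpow_lt hα0
  have hp1 : p < 1 := half_rpow_lt (by linarith)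
  have hq0 : 0 < q := by positivity
  have hp0 : 0 < p := by positivity
  refine ⟨(1 - q)⁻¹ + (1 - p)⁻¹, by have := sub_pos.2 hq1; have := sub_pos.2 hp1; positivity, fun d hd => ?_⟩
  have hs : Summable fun k => min (ek ε0 k ^ α) (ek ε0 k ^ (α - 1) * d) :=
    Summable.of_nonneg_of_le (fun k => by have := ek_pos h0 k; positivity) (fun k => min_le_left _ _) (ek_summable h0 hα0)
  have hgeo : ∀ n, (n : ℕ) = n → ∀ E : ℝ, E ≤ d → 0 < E → (∀ k, ek ε0 (k + n) = ek E k) →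
      ∑' k, min (ek ε0 (k + n) ^ α) (ek ε0 (k + n) ^ (α - 1) * d) ≤ (1 - q)⁻¹ * d ^ α := by
    intro n _ E hE hE0 he
    have : ∀ k, min (ek ε0 (k + n) ^ α) (ek ε0 (k + n) ^ (α - 1) * d) ≤ d ^ α * q ^ k := by
      intro k
      refine (min_le_left _ _).trans ?_
      rw [he, ek_rpow hE0]
      gcongr
    refine (Summable.tsum_le_tsum this ((summable_nat_add_iff n).2 hs) ((summable_geometric_of_lt_one hq0.le hq1).mul_left _)).trans ?_
    rw [tsum_mul_left, tsum_geometric_of_lt_one hq0.le hq1, mul_comm]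
  have hpp : 0 ≤ (1 - p)⁻¹ * d ^ α := by have := sub_pos.2 hp1; positivity
  rw [add_mul]
  rcases le_or_gt ε0 d with h | h
  · have := hgeo 0 rfl ε0 h h0 (fun k => rfl)
    simp only [add_zero] at this
    linarith
  · obtain ⟨N, hN1, hN2⟩ := exists_nat_pow_near_of_lt_one (x := d / ε0) (y := 1/2) (by positivity) (by rw [div_le_one h0]; exact h.le)
      (by norm_num) (by norm_num)
    have hE : ek ε0 (N+1) ≤ d := by
      unfold ek; rw [lt_div_iff₀ h0] at hN1; linarith
    have hE2 : d ≤ ek ε0 N := by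
      unfold ek; rw [div_le_iff₀ h0] at hN2; linarith
    rw [← hs.sum_add_tsum_nat_add (N+1)]
    have a := hgeo (N+1) rfl _ hE (ek_pos h0 _) (fun k => by unfold ek; rw [pow_add]; ring)
    have b : ∑ k ∈ Finset.range (N+1), min (ek ε0 k ^ α) (ek ε0 k ^ (α - 1) * d) ≤ (1 - p)⁻¹ * d ^ α := by
      have : ∀ k ∈ Finset.range (N+1), min (ek ε0 k ^ α) (ek ε0 k ^ (α - 1) * d) ≤ d ^ α * p ^ (N - k) := by
        intro k hk
        have hk' : k ≤ N := Nat.lt_succ_iff.1 (Finset.mem_range.1 hk)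
        refine (min_le_right _ _).trans ?_
        have e1 : d * 2 ^ (N - k) ≤ ek ε0 k := by
          have : ek ε0 k = ek ε0 N * 2 ^ (N - k) := by
            unfold ek
            rw [show N = k + (N - k) by omega, pow_add]
            simp only [add_tsub_cancel_left]
            rw [mul_assoc, mul_assoc, ← mul_pow]; norm_num
          rw [this]; gcongr
        have e2 : ek ε0 k ^ (α - 1) ≤ (d * 2 ^ (N - k)) ^ (α - 1) :=
          Real.rpow_le_rpow_of_nonpos (by positivity) e1 (by linarith)
        have e3 : (d * 2 ^ (N - k)) ^ (α - 1) * d = d ^ α * p ^ (N - k) := by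
          rw [Real.mul_rpow hd.le (by positivity), Real.rpow_sub_one hd.ne']
          have : ((2:ℝ) ^ (N - k)) ^ (α - 1) = p ^ (N - k) := by
            rw [hp, ← Real.rpow_natCast, ← Real.rpow_natCast, ← Real.rpow_mul (by norm_num), ← Real.rpow_mul (by norm_num)]
            rw [one_div, Real.inv_rpow (by norm_num), ← Real.rpow_neg (by norm_num)]
            congr 1; ring
          rw [this]; field_simp
        rw [← e3]; gcongr
      refine (Finset.sum_le_sum this).trans ?_
      rw [← Finset.mul_sum, mul_comm]
      gcongr
      have := Finset.sum_range_reflect (fun k => p ^ k) (N+1)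
      simp only [Nat.add_sub_cancel] at this
      rw [this]
      rw [← tsum_geometric_of_lt_one hp0.le hp1]
      exact (summable_geometric_of_lt_one hp0.le hp1).sum_le_tsum _ (fun k _ => by positivity)
    linarith

open scoped ContDiff

lemma tsum_dd (b : OB) {f : ℕ → V3 → ℝ} {u : ℕ → ℝ} (hu : Summable u) (hf : ∀ n, Differentiable ℝ (f n))
    (hb : ∀ n i x, |dd (b i) (f n) x| ≤ u n) (hs : ∀ x, Summable fun n => f n x) :
    Differentiable ℝ (fun x => ∑' n, f n x) ∧ ∀ e x, dd e (fun x => ∑' n, f n x) x = ∑' n, dd e (f n) x := by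
  have key := fun x => hasFDerivAt_tsum (𝕜 := ℝ) (f := f) (f' := fun n x => fderiv ℝ (f n) x) (u := fun n => 3 * u n) (x₀ := 0)
    (hu.mul_left 3) (fun n x => (hf n x).hasFDerivAt) (fun n x => norm_le_basis b _ fun i => hb n i x) (hs 0) x
  refine ⟨fun x => (key x).differentiableAt, fun e x => ?_⟩
  have hsum : Summable fun n => fderiv ℝ (f n) x :=
    Summable.of_norm_bounded (hu.mul_left 3) fun n => norm_le_basis b _ fun i => hb n i x
  have h1 := (key x).fderiv
  simp only [dd]
  rw [h1]
  exact (ContinuousLinearMap.apply ℝ ℝ e).map_tsum hsum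

structure HolG (α A : ℝ) (G : V3 → ℝ) : Prop where
  bd : ∀ x, |G x| ≤ A
  ho : ∀ x y, |G x - G y| ≤ A * ‖x - y‖ ^ α

lemma HolG.nonneg {α A : ℝ} {G : V3 → ℝ} (h : HolG α A G) : 0 ≤ A := (abs_nonneg _).trans (h.bd 0)

lemma HolG.cont {α A : ℝ} {G : V3 → ℝ} (hα : 0 < α) (h : HolG α A G) : Continuous G := by
  rw [continuous_iff_continuousAt]
  intro x
  rw [ContinuousAt, tendsto_iff_norm_sub_tendsto_zero]
  have h1 : Tendsto (fun y : V3 => A * ‖y - x‖ ^ α) (𝓝 x) (𝓝 0) := by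
    have : Continuous (fun y : V3 => A * ‖y - x‖ ^ α) :=
      continuous_const.mul ((by fun_prop : Continuous fun y : V3 => ‖y - x‖).rpow_const fun _ => Or.inr hα.le)
    simpa [Real.zero_rpow hα.ne'] using this.tendsto x
  exact squeeze_zero (fun y => norm_nonneg _) (fun y => h.ho y x) h1

/-- potential -/
def PP (ε0 : ℝ) (G : V3 → ℝ) (x : V3) : ℝ := ∑' k, ek ε0 k ^ 2 * TT kK (ek ε0 k) G x

lemma ek_summable_pow {ε0 : ℝ} (h : 0 < ε0) {n : ℕ} (hn : 0 < n) : Summable fun k => ek ε0 k ^ n := by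
  have := ek_summable h (α := n) (by exact_mod_cast hn)
  simpa [Real.rpow_natCast] using this

lemma PP_summable0 {ε0 A : ℝ} (h0 : 0 < ε0) {G : V3 → ℝ} (hGb : ∀ x, |G x| ≤ A) {κ : V3 → ℝ} (hκ : IsK κ) {n : ℕ} (hn : 0 < n) (x : V3) :
    Summable fun k => ek ε0 k ^ n * TT κ (ek ε0 k) G x := by
  refine Summable.of_norm_bounded ((ek_summable_pow h0 hn).mul_right (nK κ * A)) fun k => ?_
  have := ek_pos h0 k
  rw [norm_mul, Real.norm_of_nonneg (by positivity), Real.norm_eq_abs]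
  exact mul_le_mul_of_nonneg_left (TT_bound hκ hGb _ _) (by positivity)

lemma TT_sum_bound {ε0 α A : ℝ} (h0 : 0 < ε0) (hα0 : 0 < α) {G : V3 → ℝ} (hG : HolG α A G) {κ : V3 → ℝ} (hκ : IsK κ) (hi : ∫ z, κ z = 0) (k : ℕ) (x : V3) :
    |TT κ (ek ε0 k) G x| ≤ nK κ * A * ek ε0 k ^ α := by
  have := TT_holder' hκ (hG.cont hα0) hα0.le hG.nonneg hG.ho (ek_pos h0 k).le x
  rw [hi] at this
  simpa [mul_assoc] using this

lemma TT_sum_summable {ε0 α A : ℝ} (h0 : 0 < ε0) (hα0 : 0 < α) {G : V3 → ℝ} (hG : HolG α A G) {κ : V3 → ℝ} (hκ : IsK κ) (hi : ∫ z, κ z = 0) (x : V3) :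
    Summable fun k => TT κ (ek ε0 k) G x :=
  Summable.of_norm_bounded ((ek_summable h0 hα0).mul_left (nK κ * A)) fun k => TT_sum_bound h0 hα0 hG hκ hi k x

/-- first derivative of the potential -/
lemma PP_d1 {ε0 α A : ℝ} (h0 : 0 < ε0) (hα0 : 0 < α) {G : V3 → ℝ} (hG : HolG α A G) : Differentiable ℝ (PP ε0 G) ∧ ∀ e x, dd e (PP ε0 G) x = ∑' k, ek ε0 k * TT (dd e kK) (ek ε0 k) G x := by
  have hc := hG.cont hα0
  have hdd : ∀ k e x, dd e (fun x => ek ε0 k ^ 2 * TT kK (ek ε0 k) G x) x = ek ε0 k * TT (dd e kK) (ek ε0 k) G x := by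
    intro k e x
    have hp := ek_pos h0 k
    have h1 := ((TT_diff kK_isK hp hc) x).hasFDerivAt.const_mul (ek ε0 k ^ 2)
    have h2 := congrArg (fun (T : V3 →L[ℝ] ℝ) => T e) h1.fderiv
    refine Eq.trans h2 ?_
    have h3 := TT_dd kK_isK hp hc e x
    simp only [FunLike.coe_smul, Pi.smul_apply, smul_eq_mul]
    rw [dd] at h3
    rw [h3]; field_simp
  have b : OB := EuclideanSpace.basisFun (Fin 3) ℝ
  set N : ℝ := ∑ i, nK (dd (b i) kK) with hN
  have hNi : ∀ i, nK (dd (b i) kK) ≤ N := fun i =>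
    Finset.single_le_sum (f := fun i => nK (dd (b i) kK)) (fun i _ => nK_nonneg _) (Finset.mem_univ i)
  have := tsum_dd b (f := fun k x => ek ε0 k ^ 2 * TT kK (ek ε0 k) G x) (u := fun k => ek ε0 k ^ 1 * (N * A))
    ((ek_summable_pow h0 one_pos).mul_right _)
    (fun k => (TT_diff kK_isK (ek_pos h0 k) hc).const_mul _)
    (fun k i x => by
      rw [hdd]
      have hp := ek_pos h0 k
      rw [abs_mul, abs_of_pos hp, pow_one]
      refine mul_le_mul_of_nonneg_left ((TT_bound (kK_isK.dd _) hG.bd _ _).trans ?_) hp.le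
      exact mul_le_mul_of_nonneg_right (hNi i) hG.nonneg)
    (fun x => PP_summable0 h0 hG.bd kK_isK two_pos x)
  refine ⟨this.1, fun e x => (this.2 e x).trans ?_⟩
  simp_rw [hdd]

lemma PP_d2 {ε0 α A : ℝ} (h0 : 0 < ε0) (hα0 : 0 < α) {G : V3 → ℝ} (hG : HolG α A G) (e : V3) : Differentiable ℝ (dd e (PP ε0 G)) ∧
    ∀ e' x, dd e' (dd e (PP ε0 G)) x = ∑' k, TT (dd e' (dd e kK)) (ek ε0 k) G x := by
  have hc := hG.cont hα0
  have hdd : ∀ k e' x, dd e' (fun x => ek ε0 k * TT (dd e kK) (ek ε0 k) G x) x = TT (dd e' (dd e kK)) (ek ε0 k) G x := by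
    intro k e' x
    have hp := ek_pos h0 k
    have h1 := ((TT_diff (kK_isK.dd e) hp hc) x).hasFDerivAt.const_mul (ek ε0 k)
    have h2 := congrArg (fun (T : V3 →L[ℝ] ℝ) => T e') h1.fderiv
    refine Eq.trans h2 ?_
    have h3 := TT_dd (kK_isK.dd e) hp hc e' x
    simp only [FunLike.coe_smul, Pi.smul_apply, smul_eq_mul]
    rw [dd] at h3
    rw [h3]; field_simp
  have b : OB := EuclideanSpace.basisFun (Fin 3) ℝ
  set N : ℝ := ∑ i, nK (dd (b i) (dd e kK)) with hN
  have hNi : ∀ i, nK (dd (b i) (dd e kK)) ≤ N := fun i =>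
    Finset.single_le_sum (f := fun i => nK (dd (b i) (dd e kK))) (fun i _ => nK_nonneg _) (Finset.mem_univ i)
  have heq : dd e (PP ε0 G) = fun x => ∑' k, ek ε0 k * TT (dd e kK) (ek ε0 k) G x := by
    ext x; exact (PP_d1 h0 hα0 hG).2 e x
  rw [heq]
  have := tsum_dd b (f := fun k x => ek ε0 k * TT (dd e kK) (ek ε0 k) G x) (u := fun k => N * A * ek ε0 k ^ α)
    ((ek_summable h0 hα0).mul_left _)
    (fun k => (TT_diff (kK_isK.dd e) (ek_pos h0 k) hc).const_mul _)
    (fun k i x => by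
      rw [hdd]
      have hp := ek_pos h0 k
      refine (TT_sum_bound h0 hα0 hG ((kK_isK.dd e).dd _) (int_dd_zero (kK_isK.dd e) _) k x).trans ?_
      have := hG.nonneg
      have := hNi i
      gcongr)
    (fun x => by simpa using PP_summable0 h0 hG.bd (kK_isK.dd e) one_pos x)
  refine ⟨this.1, fun e x => (this.2 e x).trans ?_⟩
  simp_rw [hdd]

/-- Hölder estimate for the singular series. -/
lemma sing_holder (b : OB) {ε0 α : ℝ} (h0 : 0 < ε0) (hα0 : 0 < α) (hα1 : α < 1) {κ : V3 → ℝ} (hκ : IsK κ)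
    (hi : ∫ z, κ z = 0) : ∃ C, 0 < C ∧ ∀ A G, HolG α A G → HolG α (C * A) (fun x => ∑' k, TT κ (ek ε0 k) G x) := by
  obtain ⟨C1, hC1, hs⟩ := sum_min h0 hα0 hα1
  set N : ℝ := ∑ i, nK (dd (b i) κ) with hN
  have hNi : ∀ i, nK (dd (b i) κ) ≤ N := fun i =>
    Finset.single_le_sum (f := fun i => nK (dd (b i) κ)) (fun i _ => nK_nonneg _) (Finset.mem_univ i)
  have hN0 : 0 ≤ N := (nK_nonneg _).trans (hNi 0)
  set M : ℝ := 2 * nK κ + 3 * N with hM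
  have hk0 := nK_nonneg κ
  have hM0 : 0 ≤ M := by positivity
  set S : ℝ := ∑' k, ek ε0 k ^ α with hS
  have hS0 : 0 ≤ S := tsum_nonneg fun k => by have := ek_pos h0 k; positivity
  refine ⟨nK κ * S + M * C1 + 1, by positivity, fun A G hG => ?_⟩
  have hc := hG.cont hα0
  have hA := hG.nonneg
  constructor
  · intro x
    have h1 : |∑' k, TT κ (ek ε0 k) G x| ≤ nK κ * A * S := by
      rw [← Real.norm_eq_abs, hS, ← tsum_mul_left]
      exact tsum_of_norm_bounded (((ek_summable h0 hα0).mul_left (nK κ * A)).hasSum) fun k => TT_sum_bound h0 hα0 hG hκ hi k x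
    have : 0 ≤ (M * C1 + 1) * A := by positivity
    nlinarith
  · intro x y
    rcases eq_or_ne x y with rfl | hxy
    · simp only [sub_self, abs_zero]; positivity
    have hd : 0 < ‖x - y‖ := norm_pos_iff.2 (sub_ne_zero.2 hxy)
    have hk : ∀ k, |TT κ (ek ε0 k) G x - TT κ (ek ε0 k) G y| ≤ M * A * min (ek ε0 k ^ α) (ek ε0 k ^ (α - 1) * ‖x - y‖) := by
      intro k
      have hp := ek_pos h0 k
      rw [mul_min_of_nonneg _ _ (by positivity)]
      apply le_min
      · have a1 := TT_sum_bound h0 hα0 hG hκ hi k x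
        have a2 := TT_sum_bound h0 hα0 hG hκ hi k y
        refine (abs_sub _ _).trans ((add_le_add a1 a2).trans ?_)
        have : 0 ≤ N * A * ek ε0 k ^ α := by positivity
        rw [hM]; nlinarith
      · have a1 := (convex_univ : Convex ℝ (univ : Set V3)).norm_image_sub_le_of_norm_fderiv_le (𝕜 := ℝ) (f := TT κ (ek ε0 k) G)
          (C := 3 * (N * A * ek ε0 k ^ (α - 1))) (x := y) (y := x) (fun z _ => TT_diff hκ hp hc z)
          (fun z _ => norm_le_basis b _ fun i => by
            have e1 := TT_dd hκ hp hc (b i) z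
            rw [dd] at e1
            rw [e1, abs_mul, abs_of_pos (inv_pos.2 hp)]
            have e2 := TT_sum_bound h0 hα0 hG (hκ.dd (b i)) (int_dd_zero hκ _) k z
            calc (ek ε0 k)⁻¹ * |TT (dd (b i) κ) (ek ε0 k) G z| ≤ (ek ε0 k)⁻¹ * (nK (dd (b i) κ) * A * ek ε0 k ^ α) := by gcongr
              _ ≤ (ek ε0 k)⁻¹ * (N * A * ek ε0 k ^ α) := by gcongr; exact hNi i
              _ = _ := by rw [Real.rpow_sub_one hp.ne']; field_simp) (mem_univ _) (mem_univ _)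
        rw [Real.norm_eq_abs] at a1
        refine a1.trans ?_
        have : 0 ≤ nK κ * A * (ek ε0 k ^ (α - 1) * ‖x - y‖) := by positivity
        rw [hM]; nlinarith
    have hsm : Summable fun k => min (ek ε0 k ^ α) (ek ε0 k ^ (α - 1) * ‖x - y‖) :=
      Summable.of_nonneg_of_le (fun k => by have := ek_pos h0 k; positivity) (fun k => min_le_left _ _) (ek_summable h0 hα0)
    rw [← Summable.tsum_sub (TT_sum_summable h0 hα0 hG hκ hi x) (TT_sum_summable h0 hα0 hG hκ hi y)]
    have h1 : |∑' k, (TT κ (ek ε0 k) G x - TT κ (ek ε0 k) G y)| ≤ M * A * (C1 * ‖x - y‖ ^ α) := by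
      refine le_trans ?_ (mul_le_mul_of_nonneg_left (hs _ hd) (by positivity))
      rw [← Real.norm_eq_abs, ← tsum_mul_left]
      exact tsum_of_norm_bounded ((hsm.mul_left (M * A)).hasSum) hk
    have : 0 ≤ (nK κ * S + 1) * A * ‖x - y‖ ^ α := by positivity
    nlinarith

open scoped ContDiff

lemma pd_univ (e : V3) (w : V3 → ℝ) : pd univ e w = dd e w := by
  ext x; simp [pd, dd]

lemma pd_open {O : Set V3} (hO : IsOpen O) (e : V3) (w : V3 → ℝ) {x : V3} (hx : x ∈ O) : pd O e w x = dd e w x := by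
  simp only [pd, dd]; rw [fderivWithin_of_isOpen hO hx]

lemma fderivWithin_basis (b : OB) (D : Set V3) (w : V3 → ℝ) (x : V3) :
    fderivWithin ℝ w D x = ∑ i, pd D (b i) w x • innerSL ℝ (b i) := by
  ext v
  conv_lhs => rw [← b.sum_repr' v, map_sum]
  simp [pd, mul_comm]

lemma contDiffOn_succ_pd (b : OB) {D : Set V3} (hD : UniqueDiffOn ℝ D) {n : ℕ} {w : V3 → ℝ} (h1 : DifferentiableOn ℝ w D)
    (h2 : ∀ i, ContDiffOn ℝ n (pd D (b i) w) D) : ContDiffOn ℝ ((n : ℕ) + 1 : ℕ) w D := by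
  push_cast
  rw [contDiffOn_succ_iff_fderivWithin hD]
  refine ⟨h1, by simp, ?_⟩
  have : fderivWithin ℝ w D = fun x => ∑ i, pd D (b i) w x • innerSL ℝ (b i) := by
    ext1 x; exact fderivWithin_basis b D w x
  rw [this]
  exact ContDiffOn.sum fun i _ => (h2 i).smul contDiffOn_const

lemma cont_of_holder {D : Set V3} {w : V3 → ℝ} {α ρ A : ℝ} (hα : 0 < α)
    (h : ∀ x ∈ D, ∀ y ∈ D, |w x - w y| ≤ A * (‖x - y‖ / ρ) ^ α) : ContinuousOn w D := by
  intro x hx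
  rw [ContinuousWithinAt, tendsto_iff_norm_sub_tendsto_zero]
  have h1 : Tendsto (fun y : V3 => A * (‖y - x‖ / ρ) ^ α) (𝓝[D] x) (𝓝 0) := by
    have : Continuous (fun y : V3 => A * (‖y - x‖ / ρ) ^ α) :=
      continuous_const.mul ((by fun_prop : Continuous fun y : V3 => ‖y - x‖ / ρ).rpow_const fun _ => Or.inr hα.le)
    have h2 := this.tendsto x
    simp [Real.zero_rpow hα.ne'] at h2
    exact h2.mono_left nhdsWithin_le_nhds
  exact squeeze_zero' (Eventually.of_forall fun y => norm_nonneg _)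
    (eventually_mem_nhdsWithin.mono fun y hy => h y hy x hx) h1

lemma CH.contDiffOn {D : Set V3} (hD : UniqueDiffOn ℝ D) {b : OB} {α ρ : ℝ} (hα : 0 < α) {j : ℕ} :
    ∀ {A : ℝ} {w : V3 → ℝ}, CH D b α ρ j A w → ContDiffOn ℝ j w D := by
  induction j with
  | zero => intro A w h; exact contDiffOn_zero.2 (cont_of_holder hα h.2)
  | succ j ih => intro A w h; exact contDiffOn_succ_pd b hD h.2.1 fun i => ih (h.2.2 i)

lemma TT_half (κ : V3 → ℝ) (ε : ℝ) (G : V3 → ℝ) (x : V3) :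
    ∫ z, (8 * κ ((2:ℝ) • z)) * G (x - ε • z) = TT κ (ε/2) G x := by
  have := Measure.integral_comp_smul (volume : Measure V3) (fun w => κ w * G (x - (ε/2) • w)) 2
  have h3 : Module.finrank ℝ V3 = 3 := by simp [V3]
  rw [h3] at this
  simp only [smul_smul, div_mul_cancel₀ ε (two_ne_zero)] at this
  simp_rw [mul_assoc]
  rw [integral_const_mul, this, TT]
  norm_num
  ring

lemma TT_lap (b : OB) {G : V3 → ℝ} (hG : Continuous G) (ε : ℝ) (x : V3) :
    ∑ i, TT (dd (b i) (dd (b i) kK)) ε G x = TT kphi ε G x - TT kphi (ε/2) G x := by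
  simp only [TT]
  rw [← integral_finsetSum _ (fun i _ => ((kK_isK.dd (b i)).dd (b i)).int_mul (g := fun z => G (x - ε • z)) (by fun_prop))]
  have h2 : IsK (fun z => 8 * kphi ((2:ℝ) • z)) := by
    refine ⟨contDiff_const.mul (kphi_isK.smooth.comp (by fun_prop)), fun z hz => ?_⟩
    rw [kphi_isK.supp _ (by rw [norm_smul]; simp; linarith)]; simp
  rw [← TT, ← TT, ← TT_half kphi ε G x, TT, ← integral_sub (kphi_isK.int_mul (g := fun z => G (x - ε • z)) (by fun_prop)) (h2.int_mul (g := fun z => G (x - ε • z)) (by fun_prop))]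
  congr 1
  ext z
  rw [← Finset.sum_mul, kK_lap b z]; ring

lemma tele {g : ℕ → ℝ} {l : ℝ} (hg : Tendsto g atTop (𝓝 l)) (hs : Summable fun k => g k - g (k+1)) :
    ∑' k, (g k - g (k+1)) = g 0 - l := by
  have h1 := hs.hasSum.tendsto_sum_nat
  have h2 : Tendsto (fun n => ∑ k ∈ Finset.range n, (g k - g (k+1))) atTop (𝓝 (g 0 - l)) := by
    simp_rw [Finset.sum_range_sub']
    exact tendsto_const_nhds.sub hg
  exact tendsto_nhds_unique h1 h2

lemma TT_tendsto {G : V3 → ℝ} (hc : Continuous G) {A α ε0 : ℝ} (h0 : 0 < ε0) (hα : 0 < α) (hA : 0 ≤ A)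
    (hG : ∀ x y, |G x - G y| ≤ A * ‖x - y‖ ^ α) (x : V3) :
    Tendsto (fun k => TT kphi (ek ε0 k) G x) atTop (𝓝 (G x)) := by
  rw [tendsto_iff_norm_sub_tendsto_zero]
  have h1 : Tendsto (fun k => nK kphi * (A * ek ε0 k ^ α)) atTop (𝓝 0) := by
    have := (ek_summable h0 hα).tendsto_atTop_zero
    simpa using (this.const_mul A).const_mul (nK kphi)
  refine squeeze_zero (fun k => norm_nonneg _) (fun k => ?_) h1
  have := TT_holder' kphi_isK hc hα.le hA hG (ek_pos h0 k).le x
  rwa [kphi_int, one_mul] at this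

lemma PP_lap (b : OB) {ε0 α A : ℝ} (h0 : 0 < ε0) (hα0 : 0 < α) {G : V3 → ℝ} (hG : HolG α A G) (x : V3) :
    ∑ i, dd (b i) (dd (b i) (PP ε0 G)) x = TT kphi ε0 G x - G x := by
  have hc := hG.cont hα0
  simp_rw [fun i => (PP_d2 h0 hα0 hG (b i)).2 (b i) x]
  have hs : ∀ i ∈ Finset.univ, Summable fun k => TT (dd (b i) (dd (b i) kK)) (ek ε0 k) G x := fun i _ =>
    TT_sum_summable h0 hα0 hG ((kK_isK.dd _).dd _) (int_dd_zero (kK_isK.dd _) _) x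
  rw [← Summable.tsum_finsetSum hs]
  have hs2 := summable_sum hs
  simp_rw [TT_lap b hc, ← ek_succ] at hs2 ⊢
  rw [tele (g := fun k => TT kphi (ek ε0 k) G x) (TT_tendsto hc h0 hα0 hG.nonneg hG.ho x) hs2]
  simp [ek]

lemma hasDerivAt_line {G : V3 → ℝ} {x : V3} (h : DifferentiableAt ℝ G x) (e : V3) :
    HasDerivAt (fun t : ℝ => G (x + t • e)) (dd e G x) 0 := by
  have h1 : HasFDerivAt G (fderiv ℝ G x) (x + (0:ℝ) • e) := by simpa using h.hasFDerivAt
  have h2 : HasDerivAt (fun t : ℝ => x + t • e) e 0 := by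
    simpa using ((hasDerivAt_id (0:ℝ)).smul_const e).const_add x
  exact h1.comp_hasDerivAt (0:ℝ) h2

/-- second order line derivatives pass under `TT` -/
lemma TT_dd2 {κ : V3 → ℝ} (hκ : IsK κ) {ε : ℝ} (hε : 0 < ε) {U : V3 → ℝ} (hU : ContDiff ℝ 2 U) (hs : HasCompactSupport U) (e x : V3) :
    dd e (dd e (TT κ ε U)) x = TT κ ε (dd e (dd e U)) x ∧ TT (dd e (dd e κ)) ε U x = ε^2 * TT κ ε (dd e (dd e U)) x := by
  have c1 : ContDiff ℝ 1 (dd e U) := (hU.fderiv_right (m := 1) (by norm_num)).clm_apply contDiff_const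
  have c2 : Continuous (dd e (dd e U)) := (c1.continuous_fderiv (by simp)).clm_apply continuous_const
  have s1 : HasCompactSupport (dd e U) := hs.fderiv_apply (𝕜 := ℝ) e
  have s2 : HasCompactSupport (dd e (dd e U)) := s1.fderiv_apply (𝕜 := ℝ) e
  obtain ⟨B1, hB1⟩ := s1.exists_bound_of_continuous c1.continuous
  obtain ⟨B2, hB2⟩ := s2.exists_bound_of_continuous c2
  have d0 := hU.differentiable (by simp)
  have d1 := c1.differentiable (by simp)
  have k1 : ∀ κ, IsK κ → dd e (TT κ ε U) = TT κ ε (dd e U) := fun κ hκ => by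
    ext y; exact TT_line hκ hε hU.continuous c1.continuous hB1 (fun x => hasDerivAt_line (d0 x) e) y
  have k2 : ∀ κ, IsK κ → dd e (TT κ ε (dd e U)) = TT κ ε (dd e (dd e U)) := fun κ hκ => by
    ext y; exact TT_line hκ hε c1.continuous c2 hB2 (fun x => hasDerivAt_line (d1 x) e) y
  constructor
  · rw [k1 κ hκ, k2 κ hκ]
  · have e1 := TT_dd (hκ.dd e) hε hU.continuous e x
    rw [k1 _ (hκ.dd e)] at e1
    have e2 := TT_dd hκ hε c1.continuous e x
    rw [k2 κ hκ] at e2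
    rw [e2, e1]; field_simp

def lapb (b : OB) (U : V3 → ℝ) (x : V3) : ℝ := ∑ i, dd (b i) (dd (b i) U) x

lemma lapb_cont (b : OB) {U : V3 → ℝ} (hU : ContDiff ℝ 2 U) : Continuous (lapb b U) := by
  refine continuous_finsetSum _ fun i _ => ?_
  have c1 : ContDiff ℝ 1 (dd (b i) U) := (hU.fderiv_right (m := 1) (by norm_num)).clm_apply contDiff_const
  exact (c1.continuous_fderiv (by simp)).clm_apply continuous_const

lemma TT_sum_right {κ : V3 → ℝ} (hκ : IsK κ) {ε : ℝ} {g : Fin 3 → V3 → ℝ} (hg : ∀ i, Continuous (g i)) (x : V3) :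
    ∑ i, TT κ ε (g i) x = TT κ ε (fun y => ∑ i, g i y) x := by
  simp only [TT]
  rw [← integral_finsetSum _ (fun i _ => hκ.int_mul (g := fun z => g i (x - ε • z)) (by have := hg i; fun_prop))]
  simp_rw [Finset.mul_sum]

lemma TT_lapb (b : OB) {κ : V3 → ℝ} (hκ : IsK κ) {ε : ℝ} (hε : 0 < ε) {U : V3 → ℝ} (hU : ContDiff ℝ 2 U) (hs : HasCompactSupport U) (x : V3) :
    lapb b (TT κ ε U) x = TT κ ε (lapb b U) x := by
  unfold lapb
  rw [← TT_sum_right hκ (g := fun i => dd (b i) (dd (b i) U))]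
  · exact Finset.sum_congr rfl fun i _ => (TT_dd2 hκ hε hU hs (b i) x).1
  · intro i
    have c1 : ContDiff ℝ 1 (dd (b i) U) := (hU.fderiv_right (m := 1) (by norm_num)).clm_apply contDiff_const
    exact (c1.continuous_fderiv (by simp)).clm_apply continuous_const

lemma rep (b : OB) {ε0 : ℝ} (h0 : 0 < ε0) {U : V3 → ℝ} (hU : ContDiff ℝ 2 U) (hs : HasCompactSupport U) (x : V3) :
    U x = TT kphi ε0 U x - PP ε0 (lapb b U) x := by
  obtain ⟨C, hC⟩ := (hU.of_le (by norm_num : (1 : WithTop ℕ∞) ≤ 2)).lipschitzWith_of_hasCompactSupport hs (by simp)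
  have hL : ∀ x y, |U x - U y| ≤ C * ‖x - y‖ ^ (1:ℝ) := fun x y => by
    have := hC.dist_le_mul x y
    rwa [Real.dist_eq, dist_eq_norm, ← Real.rpow_one ‖x - y‖] at this
  have ht := TT_tendsto hU.continuous h0 one_pos C.2 hL x
  have e1 : ∀ k, ek ε0 k ^ 2 * TT kK (ek ε0 k) (lapb b U) x = TT kphi (ek ε0 k) U x - TT kphi (ek ε0 (k+1)) U x := by
    intro k
    rw [ek_succ, ← TT_lap b hU.continuous]
    unfold lapb
    rw [← TT_sum_right kK_isK (g := fun i => dd (b i) (dd (b i) U)), Finset.mul_sum]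
    · exact Finset.sum_congr rfl fun i _ => (TT_dd2 kK_isK (ek_pos h0 k) hU hs (b i) x).2.symm
    · intro i
      have c1 : ContDiff ℝ 1 (dd (b i) U) := (hU.fderiv_right (m := 1) (by norm_num)).clm_apply contDiff_const
      exact (c1.continuous_fderiv (by simp)).clm_apply continuous_const
  have hsl : HasCompactSupport (lapb b U) := by
    have : ∀ i, HasCompactSupport (dd (b i) (dd (b i) U)) := fun i => (hs.fderiv_apply (𝕜 := ℝ) (b i)).fderiv_apply (𝕜 := ℝ) (b i)
    have h3 : lapb b U = dd (b 0) (dd (b 0) U) + dd (b 1) (dd (b 1) U) + dd (b 2) (dd (b 2) U) := by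
      ext y; simp [lapb, Fin.sum_univ_three]
    rw [h3]
    exact ((this 0).add (this 1)).add (this 2)
  obtain ⟨B, hB⟩ := hsl.exists_bound_of_continuous (lapb_cont b hU)
  have hsum := PP_summable0 h0 (A := B) hB kK_isK two_pos x
  unfold PP
  simp_rw [e1] at hsum ⊢
  rw [tele (g := fun k => TT kphi (ek ε0 k) U x) ht hsum]
  simp [ek]

open scoped ContDiff

lemma CH_univ_TT (b : OB) {κ : V3 → ℝ} (hκ : IsK κ) {ε α : ℝ} (hε : 0 < ε) (hα0 : 0 < α) (hα1 : α < 1) (j : ℕ) :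
    ∃ C, 0 < C ∧ ∀ A G, Continuous G → (∀ x, |G x| ≤ A) → CH univ b α 1 j (C * A) (TT κ ε G) := by
  induction j generalizing κ with
  | zero =>
    set N : ℝ := nK κ + ∑ i, ε⁻¹ * nK (dd (b i) κ) with hN
    have hk0 := nK_nonneg κ
    have hS : 0 ≤ ∑ i, ε⁻¹ * nK (dd (b i) κ) := Finset.sum_nonneg fun i _ => by have := nK_nonneg (dd (b i) κ); positivity
    have hNi : ∀ i, ε⁻¹ * nK (dd (b i) κ) ≤ N := fun i => by
      have := Finset.single_le_sum (f := fun i => ε⁻¹ * nK (dd (b i) κ)) (fun i _ => by have := nK_nonneg (dd (b i) κ); positivity) (Finset.mem_univ i)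
      rw [hN]; linarith
    refine ⟨3 * N + 1, by positivity, fun A G hc hG => ?_⟩
    have hA : 0 ≤ A := (abs_nonneg _).trans (hG 0)
    have h1 : ∀ x ∈ (univ : Set V3), |TT κ ε G x| ≤ N * A := fun x _ => (TT_bound hκ hG ε x).trans (by gcongr; linarith)
    have h2 := holder_of_deriv (D := univ) convex_univ (b := b) hα0 hα1 one_pos h1 (TT_diff hκ hε hc).differentiableOn
      (fun i x _ => by
        rw [pd_univ, TT_dd hκ hε hc, abs_mul, abs_of_pos (inv_pos.2 hε), div_one]
        have := TT_bound (hκ.dd (b i)) hG ε x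
        calc ε⁻¹ * |TT (dd (b i) κ) ε G x| ≤ ε⁻¹ * (nK (dd (b i) κ) * A) := by gcongr
          _ = ε⁻¹ * nK (dd (b i) κ) * A := by ring
          _ ≤ N * A := by gcongr; exact hNi i)
    have hNA : 0 ≤ N * A := by positivity
    refine ⟨fun x hx => (h1 x hx).trans (by nlinarith), fun x hx y hy => (h2 x hx y hy).trans ?_⟩
    refine mul_le_mul_of_nonneg_right ?_ (by positivity)
    nlinarith
  | succ j ih =>
    choose C hC hCC using fun i => ih (hκ.dd (b i))
    have hs : ∀ i, ε⁻¹ * C i ≤ ∑ i, ε⁻¹ * C i := fun i =>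
      Finset.single_le_sum (f := fun i => ε⁻¹ * C i) (fun i _ => by have := hC i; positivity) (Finset.mem_univ i)
    have hs0 : 0 ≤ ∑ i, ε⁻¹ * C i := Finset.sum_nonneg fun i _ => by have := hC i; positivity
    have hk0 := nK_nonneg κ
    refine ⟨nK κ + ∑ i, ε⁻¹ * C i + 1, by positivity, fun A G hc hG => ?_⟩
    have hA : 0 ≤ A := (abs_nonneg _).trans (hG 0)
    refine ⟨fun x _ => (TT_bound hκ hG ε x).trans (by gcongr; linarith), (TT_diff hκ hε hc).differentiableOn, fun i => ?_⟩
    have e : ∀ x, pd univ (b i) (TT κ ε G) x = 0 + ε⁻¹ * TT (dd (b i) κ) ε G x := fun x => by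
      rw [pd_univ, TT_dd hκ hε hc, zero_add]
    have hz : CH univ b α 1 j 0 (fun _ => (0:ℝ)) := by
      clear ih
      have : ∀ j, CH univ b α 1 j 0 (fun _ => (0:ℝ)) := by
        intro j
        induction j with
        | zero => exact ⟨by simp, by simp⟩
        | succ j ih => 
          refine ⟨by simp, differentiableOn_const _, fun i => ?_⟩
          rw [zero_div]
          exact ih.congr fun x _ => by simp [pd]
      exact this j
    have := CH.lin uniqueDiffOn_univ ε⁻¹ hz (hCC i A G hc hG)
    refine (this.mono one_pos ?_).congr fun x _ => (e x).symm
    rw [abs_of_pos (inv_pos.2 hε), zero_add, div_one, ← mul_assoc]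
    gcongr
    linarith [hs i]

lemma CH_univ_PP (b : OB) {ε0 α : ℝ} (h0 : 0 < ε0) (hα0 : 0 < α) (hα1 : α < 1) :
    ∃ C, 0 < C ∧ ∀ A G, HolG α A G → CH univ b α 1 2 (C * A) (PP ε0 G) := by
  choose C hC hCC using fun i j => sing_holder b h0 hα0 hα1 ((kK_isK.dd (b i)).dd (b j)) (int_dd_zero (kK_isK.dd (b i)) (b j))
  set N0 : ℝ := (∑' k, ek ε0 k ^ 2) * nK kK with hN0
  set N1 : Fin 3 → ℝ := fun i => (∑' k, ek ε0 k ^ 1) * nK (dd (b i) kK) with hN1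
  have hS2 : 0 ≤ ∑' k, ek ε0 k ^ 2 := tsum_nonneg fun k => by have := ek_pos h0 k; positivity
  have hS1 : 0 ≤ ∑' k, ek ε0 k ^ 1 := tsum_nonneg fun k => by have := ek_pos h0 k; positivity
  have hN00 : 0 ≤ N0 := mul_nonneg hS2 (nK_nonneg _)
  have hN10 : ∀ i, 0 ≤ N1 i := fun i => mul_nonneg hS1 (nK_nonneg _)
  set T : ℝ := N0 + ∑ i, N1 i + ∑ i, ∑ j, C i j with hT
  have hs1 : 0 ≤ ∑ i, N1 i := Finset.sum_nonneg fun i _ => hN10 i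
  have hs2 : ∀ i, 0 < ∑ j, C i j := fun i => Finset.sum_pos (fun j _ => hC i j) ⟨0, Finset.mem_univ _⟩
  have hs3 : 0 < ∑ i, ∑ j, C i j := Finset.sum_pos (fun i _ => hs2 i) ⟨0, Finset.mem_univ _⟩
  refine ⟨T, by positivity, fun A G hG => ?_⟩
  have hA := hG.nonneg
  have bound : ∀ κ, IsK κ → ∀ n, 0 < n → ∀ x, |∑' k, ek ε0 k ^ n * TT κ (ek ε0 k) G x| ≤ (∑' k, ek ε0 k ^ n) * nK κ * A := by
    intro κ hκ n hn x
    rw [mul_assoc, ← tsum_mul_right, ← Real.norm_eq_abs]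
    refine tsum_of_norm_bounded (((ek_summable_pow h0 hn).mul_right (nK κ * A)).hasSum) fun k => ?_
    have := ek_pos h0 k
    rw [norm_mul, Real.norm_of_nonneg (by positivity), Real.norm_eq_abs]
    exact mul_le_mul_of_nonneg_left (TT_bound hκ hG.bd _ _) (by positivity)
  have hle0 : N0 ≤ T := by rw [hT]; linarith
  have hle1 : ∀ i, N1 i ≤ T := fun i => by
    have := Finset.single_le_sum (f := N1) (fun i _ => hN10 i) (Finset.mem_univ i)
    rw [hT]; linarith
  have hle2 : ∀ i j, C i j ≤ T := fun i j => by
    have h1 := Finset.single_le_sum (f := C i) (fun j _ => (hC i j).le) (Finset.mem_univ j)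
    have h2 := Finset.single_le_sum (f := fun i => ∑ j, C i j) (fun i _ => (hs2 i).le) (Finset.mem_univ i)
    rw [hT]; linarith
  refine ⟨fun x _ => (bound kK kK_isK 2 two_pos x).trans (by gcongr), (PP_d1 h0 hα0 hG).1.differentiableOn, fun i => ?_⟩
  rw [pd_univ]
  refine ⟨fun x _ => ?_, (PP_d2 h0 hα0 hG (b i)).1.differentiableOn, fun j => ?_⟩
  · rw [(PP_d1 h0 hα0 hG).2, div_one]
    have := bound (dd (b i) kK) (kK_isK.dd _) 1 one_pos x
    simp only [pow_one] at this
    refine this.trans ?_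
    have := hle1 i
    simp only [hN1, pow_one] at this
    gcongr
  · rw [pd_univ, div_one, div_one]
    have e : dd (b j) (dd (b i) (PP ε0 G)) = fun x => ∑' k, TT (dd (b j) (dd (b i) kK)) (ek ε0 k) G x := by
      ext x; exact (PP_d2 h0 hα0 hG (b i)).2 _ x
    rw [e]
    have h := hCC i j A G hG
    have hc := hle2 i j
    refine ⟨fun x _ => (h.bd x).trans (by gcongr), fun x _ y _ => (h.ho x y).trans ?_⟩
    rw [div_one]
    gcongr

/-- multiplication by a cutoff gives a globally Hölder function -/
lemma cut_holder {g : V3 → ℝ} {s α : ℝ} (hα0 : 0 < α) (hα1 : α < 1) (hg : ContDiff ℝ ∞ g) (hgs : HasCompactSupport g)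
    (hz : ∀ x, s ≤ ‖x‖ → g x = 0) (b : OB) : ∃ C, 0 < C ∧ ∀ A F, 0 ≤ A → CH (Metric.ball 0 s) b α 1 0 A F →
      HolG α (C * A) (fun x => g x * F x) := by
  obtain ⟨L, hL⟩ := (hg.of_le (by simp : (1 : WithTop ℕ∞) ≤ ∞)).lipschitzWith_of_hasCompactSupport hgs (by simp)
  obtain ⟨B, hB⟩ := hgs.exists_bound_of_continuous hg.continuous
  have hB0 : 0 ≤ B := (norm_nonneg _).trans (hB 0)
  have hL0 : (0:ℝ) ≤ L := L.2
  have hd : ∀ x y, |g x - g y| ≤ (2 * B + L) * ‖x - y‖ ^ α := by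
    intro x y
    have a1 : |g x - g y| ≤ (2 * B + L) * 1 := by
      have := abs_sub (g x) (g y)
      have h1 := hB x; have h2 := hB y
      rw [Real.norm_eq_abs] at h1 h2
      linarith
    have a2 : |g x - g y| ≤ (2 * B + L) * ‖x - y‖ := by
      have := hL.dist_le_mul x y
      rw [Real.dist_eq, dist_eq_norm] at this
      have : 0 ≤ 2 * B * ‖x - y‖ := by positivity
      linarith
    have a3 := min_le_pow (t := ‖x - y‖) (by positivity) hα0 hα1
    refine le_trans ?_ (mul_le_mul_of_nonneg_left a3 (by positivity))
    rcases le_total 1 ‖x - y‖ with h | h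
    · rwa [min_eq_left h]
    · rwa [min_eq_right h]
  refine ⟨3 * B + L + 1, by positivity, fun A F hA hF => ?_⟩
  have hin : ∀ x, ‖x‖ < s → x ∈ Metric.ball (0:V3) s := fun x hx => by simpa using hx
  have half : ∀ x y, ‖x‖ < s → s ≤ ‖y‖ → |g x * F x| ≤ (3 * B + L + 1) * A * ‖x - y‖ ^ α := by
    intro x y hx hy
    have := hd x y
    rw [hz y hy, sub_zero] at this
    rw [abs_mul]
    calc |g x| * |F x| ≤ ((2 * B + L) * ‖x - y‖ ^ α) * A := mul_le_mul this (hF.1 x (hin x hx)) (abs_nonneg _) (by positivity)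
      _ = (2 * B + L) * A * ‖x - y‖ ^ α := by ring
      _ ≤ _ := mul_le_mul_of_nonneg_right (mul_le_mul_of_nonneg_right (by linarith) hA) (by positivity)
  constructor
  · intro x
    rcases lt_or_ge ‖x‖ s with hx | hx
    · rw [abs_mul]
      have := mul_le_mul (hB x) (hF.1 x (hin x hx)) (abs_nonneg _) hB0
      rw [Real.norm_eq_abs] at this
      refine this.trans ?_
      gcongr; linarith
    · rw [hz x hx]; simp; positivity
  · intro x y
    rcases lt_or_ge ‖x‖ s with hx | hx <;> rcases lt_or_ge ‖y‖ s with hy | hy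
    · rw [show g x * F x - g y * F y = g x * (F x - F y) + (g x - g y) * F y by ring]
      refine (abs_add_le _ _).trans ?_
      rw [abs_mul, abs_mul]
      have h1 := mul_le_mul (hB x) (hF.2 x (hin x hx) y (hin y hy)) (abs_nonneg _) hB0
      have h2 := mul_le_mul (hd x y) (hF.1 y (hin y hy)) (abs_nonneg _) (by positivity)
      rw [Real.norm_eq_abs, div_one] at h1
      have : 0 ≤ A * ‖x - y‖ ^ α := by positivity
      nlinarith
    · rw [hz y hy]; simpa using half x y hx hy
    · rw [hz x hx]
      have := half y x hy hx
      rw [norm_sub_rev] at this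
      simpa using this
    · rw [hz x hx, hz y hy]; simp; positivity

open scoped ContDiff

lemma two_le_inf : (2 : WithTop ℕ∞) ≤ ∞ := WithTop.coe_le_coe.2 (le_top : (2:ℕ∞) ≤ ⊤)

lemma TT_congr {κ : V3 → ℝ} (hκ : IsK κ) {ε s t : ℝ} (hε : 0 < ε) (hst : s + ε ≤ t) {G G' : V3 → ℝ}
    (h : ∀ x, ‖x‖ < t → G x = G' x) {x : V3} (hx : ‖x‖ < s) : TT κ ε G x = TT κ ε G' x := by
  unfold TT
  congr 1; ext z
  rcases le_or_gt ‖z‖ 1 with hz | hz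
  · rw [h]
    calc ‖x - ε • z‖ ≤ ‖x‖ + ‖ε • z‖ := norm_sub_le _ _
      _ = ‖x‖ + ε * ‖z‖ := by rw [norm_smul, Real.norm_of_nonneg hε.le]
      _ ≤ ‖x‖ + ε := by nlinarith
      _ < t := by linarith
  · rw [hκ.supp z hz]; simp

lemma PP_congr {ε s t : ℝ} (hε : 0 < ε) (hst : s + ε ≤ t) {G G' : V3 → ℝ}
    (h : ∀ x, ‖x‖ < t → G x = G' x) {x : V3} (hx : ‖x‖ < s) : PP ε G x = PP ε G' x := by
  unfold PP
  congr 1; ext k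
  rw [TT_congr kK_isK (ek_pos hε k) (by have := ek_le hε k; linarith : s + ek ε k ≤ t) h hx]

lemma dd_congr {O : Set V3} (hO : IsOpen O) {f g : V3 → ℝ} (h : ∀ x ∈ O, f x = g x) (e : V3) : ∀ x ∈ O, dd e f x = dd e g x := by
  intro x hx
  have : f =ᶠ[𝓝 x] g := Filter.eventuallyEq_of_mem (hO.mem_nhds hx) h
  simp only [dd]; rw [this.fderiv_eq]

lemma lapb_congr (b : OB) {O : Set V3} (hO : IsOpen O) {f g : V3 → ℝ} (h : ∀ x ∈ O, f x = g x) : ∀ x ∈ O, lapb b f x = lapb b g x := by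
  intro x hx
  exact Finset.sum_congr rfl fun i _ => dd_congr hO (dd_congr hO h (b i)) (b i) x hx

lemma dd_lin {f g : V3 → ℝ} {x : V3} (hf : DifferentiableAt ℝ f x) (hg : DifferentiableAt ℝ g x) (c : ℝ) (e : V3) :
    dd e (fun x => c * f x - g x) x = c * dd e f x - dd e g x := by
  have := (hf.hasFDerivAt.const_mul c).sub hg.hasFDerivAt
  exact (congrArg (fun (T : V3 →L[ℝ] ℝ) => T e) this.fderiv).trans (by simp [dd])

lemma lapb_lin (b : OB) {f g : V3 → ℝ} (hf : Differentiable ℝ f) (hg : Differentiable ℝ g)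
    (hf' : ∀ e, Differentiable ℝ (dd e f)) (hg' : ∀ e, Differentiable ℝ (dd e g)) (c : ℝ) (x : V3) :
    lapb b (fun x => c * f x - g x) x = c * lapb b f x - lapb b g x := by
  unfold lapb
  rw [Finset.mul_sum, ← Finset.sum_sub_distrib]
  refine Finset.sum_congr rfl fun i _ => ?_
  have : dd (b i) (fun x => c * f x - g x) = fun x => c * dd (b i) f x - dd (b i) g x := by
    ext y; exact dd_lin (hf y) (hg y) c _
  rw [this]; exact dd_lin (hf' _ x) (hg' _ x) c _

lemma mul_cut_contDiff {s t : ℝ} (hst : t < s) {η U : V3 → ℝ} {n : ℕ∞} (hη : ContDiff ℝ n η) (hz : ∀ x, t ≤ ‖x‖ → η x = 0)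
    (hU : ContDiffOn ℝ n U (Metric.ball 0 s)) : ContDiff ℝ n fun x => η x * U x := by
  rw [contDiff_iff_contDiffAt]
  intro x
  rcases lt_or_ge ‖x‖ s with h | h
  · exact hη.contDiffAt.mul (hU.contDiffAt (Metric.isOpen_ball.mem_nhds (by simpa using h)))
  · have : (fun x => η x * U x) =ᶠ[𝓝 x] fun _ => 0 := by
      have ho : IsOpen {y : V3 | t < ‖y‖} := isOpen_lt continuous_const continuous_norm
      refine Filter.eventuallyEq_of_mem (ho.mem_nhds (by simp; linarith)) fun y hy => ?_
      simp [hz y (le_of_lt hy)]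
    exact contDiffAt_const.congr_of_eventuallyEq this

lemma TT_swap {κ : V3 → ℝ} (h : IsK κ) {ε : ℝ} (hε : 0 < ε) {G Ge : V3 → ℝ} (hG : Continuous G)
    (hGe : Continuous Ge) {B : ℝ} (hB : ∀ x, |Ge x| ≤ B) {e : V3}
    (hd : ∀ x, HasDerivAt (fun t : ℝ => G (x + t • e)) (Ge x) 0) (x : V3) :
    TT (dd e κ) ε G x = ε * TT κ ε Ge x := by
  have h1 := TT_line h hε hG hGe hB hd x
  have h2 := TT_dd h hε hG e x
  rw [← h1, h2]; field_simp

theorem step (b : OB) {α s : ℝ} (hα0 : 0 < α) (hα1 : α < 1) (hs : 0 < s) :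
    ∃ C, 1 ≤ C ∧ ∀ (U F : V3 → ℝ) (A : ℝ), 0 ≤ A → ContDiffOn ℝ 2 U (Metric.ball 0 s) →
      (∀ x ∈ Metric.ball (0:V3) s, lapb b U x = F x) → (∀ x ∈ Metric.ball (0:V3) s, |U x| ≤ A) →
      CH (Metric.ball 0 s) b α 1 0 A F →
      CH (Metric.ball 0 (s/2)) b α 1 2 (C * A) U ∧
      ∀ e Fe, (∀ x ∈ Metric.ball (0:V3) s, HasDerivAt (fun t : ℝ => F (x + t • e)) (Fe x) 0) →
        (∃ A', 0 ≤ A' ∧ CH (Metric.ball 0 s) b α 1 0 A' Fe) →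
        ContDiffOn ℝ 2 (dd e U) (Metric.ball 0 (s/2)) ∧ ∀ x ∈ Metric.ball (0:V3) (s/2), lapb b (dd e U) x = Fe x := by
  set η : ContDiffBump (0:V3) := ⟨3*s/4, 7*s/8, by positivity, by linarith⟩ with hη
  have hηs : ContDiff ℝ ∞ (η : V3 → ℝ) := η.contDiff
  have hηc : HasCompactSupport (η : V3 → ℝ) := η.hasCompactSupport
  have hη0 : ∀ x : V3, 7*s/8 ≤ ‖x‖ → η x = 0 := fun x hx => η.zero_of_le_dist (by simpa [hη] using hx)
  have hη1 : ∀ x : V3, ‖x‖ < 3*s/4 → η x = 1 := fun x hx => η.one_of_mem_closedBall (by simpa [hη] using hx.le)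
  have hηb : ∀ x : V3, |η x| ≤ 1 := fun x => by rw [abs_of_nonneg η.nonneg]; exact η.le_one
  have h0 : 0 < s/4 := by positivity
  obtain ⟨C1, hC1, H1⟩ := CH_univ_TT b kphi_isK h0 hα0 hα1 2
  obtain ⟨C2, hC2, H2⟩ := CH_univ_PP b h0 hα0 hα1
  obtain ⟨C3, hC3, H3⟩ := cut_holder hα0 hα1 hηs hηc (s := s) (fun x hx => hη0 x (by linarith)) b
  refine ⟨C1 + C2 * C3 + 1, by nlinarith [mul_pos hC2 hC3], fun U F A hA hU hL hb hF => ?_⟩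
  set U' : V3 → ℝ := fun x => η x * U x with hU'
  set G : V3 → ℝ := fun x => η x * F x with hG
  have hU'c : ContDiff ℝ 2 U' := mul_cut_contDiff (n := 2) (by linarith : 7*s/8 < s) (hηs.of_le two_le_inf) hη0 hU
  have hU's : HasCompactSupport U' := hηc.mul_right
  have hU'b : ∀ x, |U' x| ≤ A := by
    intro x
    rcases lt_or_ge ‖x‖ s with h | h
    · rw [hU', abs_mul]
      have := mul_le_mul (hηb x) (hb x (by simpa using h)) (abs_nonneg _) one_pos.le
      simpa using this
    · simp only [hU', hη0 x (by linarith)]; simpa using hA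
  have hGh : HolG α (C3 * A) G := H3 A F hA hF
  have hGc := hGh.cont hα0
  have hob : IsOpen {x : V3 | ‖x‖ < 3*s/4} := isOpen_lt continuous_norm continuous_const
  have hLG : ∀ x : V3, ‖x‖ < 3*s/4 → lapb b U' x = G x := by
    intro x hx
    rw [lapb_congr b hob (g := U) (fun y hy => by simp [hU', hη1 y hy]) x hx, hL x (by simp; linarith)]
    simp [hG, hη1 x hx]
  have hrep : ∀ x ∈ Metric.ball (0:V3) (s/2), U x = TT kphi (s/4) U' x - PP (s/4) G x := by
    intro x hx
    have hx' : ‖x‖ < s/2 := by simpa using hx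
    have := rep b h0 hU'c hU's x
    rw [PP_congr h0 (by linarith : s/2 + s/4 ≤ 3*s/4) hLG hx'] at this
    rw [← this]; simp [hU', hη1 x (by linarith)]
  constructor
  · have h1 := H1 A U' hU'c.continuous hU'b
    have h2 := H2 _ G hGh
    have h3 := (CH.lin uniqueDiffOn_univ (-1) h1 h2).inter (O := Metric.ball 0 (s/2)) Metric.isOpen_ball
    rw [univ_inter] at h3
    refine (h3.mono one_pos ?_).congr fun x hx => ?_
    · simp; nlinarith
    · rw [hrep x hx]; ring
  · rintro e Fe hFe ⟨A', hA', hFeH⟩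
    have hdη : ContDiff ℝ ∞ (dd e (η : V3 → ℝ)) := (hηs.fderiv_right (m := ∞) (by simp)).clm_apply contDiff_const
    have hdηc : HasCompactSupport (dd e (η : V3 → ℝ)) := hηc.fderiv_apply (𝕜 := ℝ) e
    have hdη0 : ∀ x : V3, s ≤ ‖x‖ → dd e (η : V3 → ℝ) x = 0 := fun x hx => by
      have ho : IsOpen {y : V3 | 7*s/8 < ‖y‖} := isOpen_lt continuous_const continuous_norm
      rw [dd_congr ho (g := fun _ => 0) (fun y hy => hη0 y (le_of_lt hy)) e x (by simp; linarith)]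
      simp [dd]
    have hdη1 : ∀ x : V3, ‖x‖ < 3*s/4 → dd e (η : V3 → ℝ) x = 0 := fun x hx => by
      rw [dd_congr hob (g := fun _ => 1) (fun y hy => hη1 y hy) e x hx]
      simp [dd]
    obtain ⟨C4, hC4, H4⟩ := cut_holder hα0 hα1 hdη hdηc (s := s) hdη0 b
    set Ge : V3 → ℝ := fun x => dd e η x * F x + η x * Fe x with hGe
    have hGeh : HolG α (C4 * A + C3 * A') Ge := by
      have a := H4 A F hA hF
      have c := H3 A' Fe hA' hFeH
      refine ⟨fun x => (abs_add_le _ _).trans (add_le_add (a.bd x) (c.bd x)), fun x y => ?_⟩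
      have : Ge x - Ge y = (dd e η x * F x - dd e η y * F y) + (η x * Fe x - η y * Fe y) := by simp only [hGe]; ring
      rw [this, add_mul]
      exact (abs_add_le _ _).trans (add_le_add (a.ho x y) (c.ho x y))
    have hGec := hGeh.cont hα0
    have hline : ∀ x, HasDerivAt (fun t : ℝ => G (x + t • e)) (Ge x) 0 := by
      intro x
      rcases lt_or_ge ‖x‖ s with h | h
      · have a := hasDerivAt_line ((hηs.differentiable (by simp)) x) e
        have c := a.mul (hFe x (by simpa using h))
        refine (c.congr_deriv ?_)
        simp [hGe]
      · have hz : (fun t : ℝ => G (x + t • e)) =ᶠ[𝓝 0] fun _ => 0 := by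
          have ho : IsOpen {t : ℝ | 7*s/8 < ‖x + t • e‖} := isOpen_lt continuous_const (by fun_prop)
          refine Filter.eventuallyEq_of_mem (ho.mem_nhds (by simp; linarith)) fun y hy => ?_
          simp [hG, hη0 _ (le_of_lt hy)]
        have : Ge x = 0 := by simp [hGe, hdη0 x h, hη0 x (by linarith)]
        rw [this]
        exact (hasDerivAt_const (0:ℝ) (0:ℝ)).congr_of_eventuallyEq hz
    have hsw : ∀ κ, IsK κ → ∀ ε, 0 < ε → ∀ x, TT (dd e κ) ε G x = ε * TT κ ε Ge x := fun κ hκ ε hε x =>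
      TT_swap hκ hε hGc hGec hGeh.bd hline x
    have hdU : ∀ x ∈ Metric.ball (0:V3) (s/2), dd e U x = (s/4)⁻¹ * TT (dd e kphi) (s/4) U' x - PP (s/4) Ge x := by
      intro x hx
      rw [dd_congr Metric.isOpen_ball (g := fun x => 1 * TT kphi (s/4) U' x - PP (s/4) G x) (fun y hy => by rw [hrep y hy, one_mul]) e x hx,
        dd_lin ((TT_diff kphi_isK h0 hU'c.continuous) x) ((PP_d1 h0 hα0 hGh).1 x), TT_dd kphi_isK h0 hU'c.continuous,
        (PP_d1 h0 hα0 hGh).2, one_mul]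
      congr 1
      unfold PP
      congr 1; ext k
      rw [hsw kK kK_isK _ (ek_pos h0 k)]; ring
    have cT : ContDiff ℝ ∞ (TT (dd e kphi) (s/4) U') := TT_contDiff (kphi_isK.dd e) h0 hU'c.continuous
    have cP : ContDiff ℝ 2 (PP (s/4) Ge) := by
      have := (H2 _ Ge hGeh).contDiffOn uniqueDiffOn_univ hα0
      exact contDiffOn_univ.1 this
    refine ⟨?_, fun x hx => ?_⟩
    · have : ContDiff ℝ 2 (fun x => (s/4)⁻¹ * TT (dd e kphi) (s/4) U' x - PP (s/4) Ge x) :=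
        (contDiff_const.mul (cT.of_le two_le_inf)).sub cP
      exact this.contDiffOn.congr hdU
    · have hx' : ‖x‖ < s/2 := by simpa using hx
      rw [lapb_congr b Metric.isOpen_ball hdU x hx, lapb_lin b (cT.differentiable (by simp)) (cP.differentiable (by simp))
        (fun e' => ((cT.fderiv_right (m := ∞) (by simp)).clm_apply contDiff_const).differentiable (by simp))
        (fun e' => ((cP.fderiv_right (m := 1) (by norm_num)).clm_apply contDiff_const).differentiable (by simp)),
        TT_lapb b (kphi_isK.dd e) h0 hU'c hU's, TT_congr (kphi_isK.dd e) h0 (by linarith : s/2 + s/4 ≤ 3*s/4) hLG hx',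
        hsw kphi kphi_isK _ h0]
      have := PP_lap b h0 hα0 hGeh x
      rw [show lapb b (PP (s/4) Ge) x = _ from this]
      have h3 : Ge x = Fe x := by simp [hGe, hdη1 x (by linarith), hη1 x (by linarith)]
      rw [← h3]; field_simp; ring

open scoped ContDiff

def TH (b : OB) (α s : ℝ) : ℕ → ℝ → (V3 → ℝ) → Prop
  | 0, A, F => CH (Metric.ball 0 s) b α 1 0 A F
  | j+1, A, F => CH (Metric.ball 0 s) b α 1 0 A F ∧ ∀ i : Fin 3, i ≠ 2 → ∃ Fe : V3 → ℝ,
      (∀ x ∈ Metric.ball (0:V3) s, HasDerivAt (fun t : ℝ => F (x + t • b i)) (Fe x) 0) ∧ TH b α s j A Fe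

def TSU (b : OB) (α s : ℝ) : ℕ → ℝ → (V3 → ℝ) → (V3 → ℝ) → Prop
  | 0, A, U, F => CH (Metric.ball 0 s) b α 1 2 A U ∧ ∀ x ∈ Metric.ball (0:V3) s, lapb b U x = F x
  | j+1, A, U, F => (CH (Metric.ball 0 s) b α 1 2 A U ∧ ∀ x ∈ Metric.ball (0:V3) s, lapb b U x = F x) ∧
      ∀ i : Fin 3, i ≠ 2 → ∃ Fe : V3 → ℝ,
      (∀ x ∈ Metric.ball (0:V3) s, HasDerivAt (fun t : ℝ => F (x + t • b i)) (Fe x) 0) ∧ TSU b α s j A (dd (b i) U) Fe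

lemma CH.ball {b : OB} {α s t A : ℝ} {j : ℕ} {w : V3 → ℝ} (h : CH (Metric.ball 0 s) b α 1 j A w) (hts : t ≤ s) :
    CH (Metric.ball 0 t) b α 1 j A w := by
  have := h.inter (O := Metric.ball 0 t) Metric.isOpen_ball
  rwa [inter_eq_self_of_subset_right (Metric.ball_subset_ball hts)] at this

lemma TH.base {b : OB} {α s A : ℝ} {j : ℕ} {F : V3 → ℝ} (h : TH b α s j A F) : CH (Metric.ball 0 s) b α 1 0 A F := by
  cases j with
  | zero => exact h
  | succ j => exact h.1

lemma TSU.base {b : OB} {α s A : ℝ} {j : ℕ} {U F : V3 → ℝ} (h : TSU b α s j A U F) :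
    CH (Metric.ball 0 s) b α 1 2 A U ∧ ∀ x ∈ Metric.ball (0:V3) s, lapb b U x = F x := by
  cases j with
  | zero => exact h
  | succ j => exact h.1

lemma TH.mono {b : OB} {α s t : ℝ} {j : ℕ} (hts : t ≤ s) : ∀ {A A' : ℝ} {F : V3 → ℝ}, TH b α s j A F → A ≤ A' → TH b α t j A' F := by
  induction j with
  | zero => intro A A' F h hA; exact (CH.mono one_pos h hA).ball hts
  | succ j ih =>
    intro A A' F h hA
    refine ⟨(CH.mono one_pos h.1 hA).ball hts, fun i hi => ?_⟩
    obtain ⟨Fe, h1, h2⟩ := h.2 i hi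
    exact ⟨Fe, fun x hx => h1 x (Metric.ball_subset_ball hts hx), ih h2 hA⟩

lemma TSU.mono {b : OB} {α s t : ℝ} {j : ℕ} (hts : t ≤ s) : ∀ {A A' : ℝ} {U F : V3 → ℝ}, TSU b α s j A U F → A ≤ A' → TSU b α t j A' U F := by
  induction j with
  | zero => intro A A' U F h hA; exact ⟨(CH.mono one_pos h.1 hA).ball hts, fun x hx => h.2 x (Metric.ball_subset_ball hts hx)⟩
  | succ j ih =>
    intro A A' U F h hA
    refine ⟨⟨(CH.mono one_pos h.1.1 hA).ball hts, fun x hx => h.1.2 x (Metric.ball_subset_ball hts hx)⟩, fun i hi => ?_⟩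
    obtain ⟨Fe, h1, h2⟩ := h.2 i hi
    exact ⟨Fe, fun x hx => h1 x (Metric.ball_subset_ball hts hx), ih h2 hA⟩

lemma TSU_of (b : OB) {α : ℝ} (hα0 : 0 < α) (hα1 : α < 1) (j : ℕ) : ∀ s : ℝ, 0 < s → ∃ C, 1 ≤ C ∧ ∀ (U F : V3 → ℝ) (A : ℝ), 0 ≤ A →
      ContDiffOn ℝ 2 U (Metric.ball 0 s) →
      (∀ x ∈ Metric.ball (0:V3) s, lapb b U x = F x) → (∀ x ∈ Metric.ball (0:V3) s, |U x| ≤ A) →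
      TH b α s j A F → TSU b α (s / 2^(j+1)) j (C * A) U F := by
  induction j with
  | zero =>
    intro s hs
    obtain ⟨C, hC, H⟩ := step b hα0 hα1 hs
    refine ⟨C, hC, fun U F A hA h1 h2 h3 h4 => ?_⟩
    rw [zero_add, pow_one]
    exact ⟨(H U F A hA h1 h2 h3 h4).1, fun x hx => h2 x (Metric.ball_subset_ball (by linarith) hx)⟩
  | succ j ih =>
    intro s hs
    obtain ⟨C, hC, H⟩ := step b hα0 hα1 hs
    obtain ⟨C', hC', H'⟩ := ih (s/2) (by positivity)
    have hC0 : 0 < C := by linarith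
    refine ⟨C' * C, by nlinarith, fun U F A hA h1 h2 h3 h4 => ?_⟩
    have hr : s / 2^(j+1+1) ≤ s/2 := by
      rw [pow_succ' (2:ℝ) (j+1), ← div_div]
      exact div_le_self (by positivity) (one_le_pow₀ (by norm_num))
    have hr2 : s / 2^(j+1+1) = s/2 / 2^(j+1) := by rw [pow_succ' (2:ℝ) (j+1), ← div_div]
    have hsub : Metric.ball (0:V3) (s / 2^(j+1+1)) ⊆ Metric.ball 0 s := Metric.ball_subset_ball (by linarith)
    have hst := H U F A hA h1 h2 h3 h4.1
    refine ⟨⟨(hst.1.mono one_pos (by nlinarith [mul_nonneg hC0.le hA])).ball hr, fun x hx => h2 x (hsub hx)⟩, fun i hi => ?_⟩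
    obtain ⟨Fe, hFe, hT⟩ := h4.2 i hi
    refine ⟨Fe, fun x hx => hFe x (hsub hx), ?_⟩
    have hb := hst.2 (b i) Fe hFe ⟨A, hA, hT.base⟩
    rw [hr2, mul_assoc]
    refine H' (dd (b i) U) Fe (C * A) (by positivity) hb.1 hb.2 (fun x hx => ?_) (hT.mono (by linarith) (by nlinarith))
    have := (hst.1.2.2 i).bd x hx
    rwa [pd_open Metric.isOpen_ball _ _ hx, div_one] at this

/-- restriction from an open set to a subset of unique differentiability -/
lemma CH.subset {O D : Set V3} (hO : IsOpen O) (hD : UniqueDiffOn ℝ D) (hDO : D ⊆ O) {b : OB} {α ρ : ℝ} {j : ℕ} :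
    ∀ {A : ℝ} {w : V3 → ℝ}, CH O b α ρ j A w → CH D b α ρ j A w := by
  induction j with
  | zero => intro A w h; exact ⟨fun x hx => h.1 x (hDO hx), fun x hx y hy => h.2 x (hDO hx) y (hDO hy)⟩
  | succ j ih =>
    intro A w h
    refine ⟨fun x hx => h.1 x (hDO hx), h.2.1.mono hDO, fun i => ?_⟩
    refine (ih (h.2.2 i)).congr fun x hx => ?_
    simp only [pd]
    rw [fderivWithin_of_isOpen hO (hDO hx), fderivWithin_eq_fderiv (hD x hx) ((h.2.1 x (hDO hx)).differentiableAt (hO.mem_nhds (hDO hx)))]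

lemma pd_eq_dd {D : Set V3} (hD : UniqueDiffOn ℝ D) {w : V3 → ℝ} {x : V3} (hx : x ∈ D) (h : DifferentiableAt ℝ w x) (e : V3) :
    pd D e w x = dd e w x := by
  simp only [pd, dd]; rw [fderivWithin_eq_fderiv (hD x hx) h]

lemma dd_symm {U : V3 → ℝ} {x : V3} (h : ContDiffAt ℝ 2 U x) (e e' : V3) : dd e (dd e' U) x = dd e' (dd e U) x := by
  have hs := h.isSymmSndFDerivAt (by simp)
  have hd : DifferentiableAt ℝ (fderiv ℝ U) x := (h.fderiv_right (m := 1) (by norm_num)).differentiableAt (by simp)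
  have key : ∀ e e', dd e (dd e' U) x = fderiv ℝ (fderiv ℝ U) x e e' := by
    intro e e'
    have := hd.hasFDerivAt.clm_apply (hasFDerivAt_const e' x)
    exact (congrArg (fun (T : V3 →L[ℝ] ℝ) => T e) this.fderiv).trans (by simp)
  rw [key, key]; exact hs e e'

/-- normal regularity from tangential regularity -/
lemma normal_reg (b : OB) {α s : ℝ} (hα0 : 0 < α) (hα1 : α < 1) {D : Set V3} (hD : UniqueDiffOn ℝ D)
    (hDs : D ⊆ Metric.ball 0 s) (hT : ∀ i : Fin 3, i ≠ 2 → ∀ x ∈ D, ∀ᶠ t in 𝓝 (0:ℝ), x + t • b i ∈ D) (j : ℕ) :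
    ∃ C, 1 ≤ C ∧ ∀ (U F : V3 → ℝ) (A : ℝ), 0 ≤ A → TSU b α s j A U F → CH D b α 1 j A F → CH D b α 1 (j+2) (C * A) U := by
  induction j with
  | zero => exact ⟨1, le_rfl, fun U F A hA h1 h2 => by rw [one_mul]; exact h1.1.subset Metric.isOpen_ball hD hDs⟩
  | succ j ih =>
    obtain ⟨C, hC, H⟩ := ih
    refine ⟨2 * C + 1, by linarith, fun U F A hA h1 h2 => ?_⟩
    have hCA : 0 ≤ C * A := by positivity
    have hU2 : ∀ x ∈ D, ContDiffAt ℝ 2 U x := fun x hx =>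
      (h1.1.1.contDiffOn Metric.isOpen_ball.uniqueDiffOn hα0).contDiffAt (Metric.isOpen_ball.mem_nhds (hDs hx))
    have hUb := h1.1.1.subset Metric.isOpen_ball hD hDs
    have hd1 : ∀ x ∈ D, ∀ e, DifferentiableAt ℝ (dd e U) x := fun x hx e =>
      (((hU2 x hx).fderiv_right (m := 1) (by norm_num)).clm_apply contDiffAt_const).differentiableAt (by simp)
    have hp1 : ∀ e, ∀ x ∈ D, dd e U x = pd D e U x := fun e x hx => (pd_eq_dd hD hx ((hU2 x hx).differentiableAt (by simp)) e).symm
    have hp2 : ∀ e e', ∀ x ∈ D, pd D e' (pd D e U) x = dd e' (dd e U) x := fun e e' x hx => by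
      rw [← pd_congr (hp1 e) e' hx, pd_eq_dd hD hx (hd1 x hx e)]
    have htan : ∀ i : Fin 3, i ≠ 2 → CH D b α 1 (j+2) (C * A) (pd D (b i) U) := by
      intro i hi
      obtain ⟨Fe, hFe, hS⟩ := h1.2 i hi
      refine (H _ Fe A hA hS ?_).congr (hp1 (b i))
      have := h2.2.2 i
      rw [div_one] at this
      refine this.congr fun x hx => ?_
      have hg : HasFDerivWithinAt F (fderivWithin ℝ F D x) D (x + (0:ℝ) • b i) := by
        simpa using (h2.2.1 x hx).hasFDerivWithinAt
      have hl : HasDerivAt (fun t : ℝ => x + t • b i) (b i) 0 := by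
        simpa using ((hasDerivAt_id (0:ℝ)).smul_const (b i)).const_add x
      have h3 : HasDerivWithinAt (fun t : ℝ => F (x + t • b i)) (pd D (b i) F x) {t | x + t • b i ∈ D} 0 :=
        hg.comp_hasDerivWithinAt (0:ℝ) hl.hasDerivWithinAt (fun t ht => ht)
      exact (h3.hasDerivAt (hT i hi x hx)).unique (hFe x (hDs hx))
    have hnor : CH D b α 1 (j+2) ((2 * C + 1) * A) (pd D (b 2) U) := by
      have e0 := hUb.2.2 2
      rw [div_one] at e0
      refine ⟨fun x hx => (e0.1 x hx).trans (by nlinarith), e0.2.1, fun i => ?_⟩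
      rw [div_one]
      by_cases hi : i = 2
      · subst hi
        have a0 := (htan 0 (by decide)).2.2 0
        have a1 := (htan 1 (by decide)).2.2 1
        rw [div_one] at a0 a1
        refine ((CH.lin hD (-1) (CH.lin hD (-1) h2 a0) a1).mono one_pos ?_).congr fun x hx => ?_
        · simp; nlinarith
        · have hl := h1.1.2 x (hDs hx)
          rw [lapb, Fin.sum_univ_three] at hl
          rw [hp2 _ _ x hx, hp2 _ _ x hx, hp2 _ _ x hx]
          linarith
      · have a0 := (htan i hi).2.2 2
        rw [div_one] at a0
        refine (a0.mono one_pos (by nlinarith)).congr fun x hx => ?_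
        rw [hp2 _ _ x hx, hp2 _ _ x hx, dd_symm (hU2 x hx)]
    refine ⟨fun x hx => (hUb.1 x hx).trans (by nlinarith), hUb.2.1, fun i => ?_⟩
    rw [div_one]
    by_cases hi : i = 2
    · subst hi; exact hnor
    · exact (htan i hi).mono one_pos (by nlinarith)

open scoped ContDiff

def sg (b : OB) : V3 →L[ℝ] V3 := ContinuousLinearMap.id ℝ V3 - (2:ℝ) • (innerSL ℝ (b 2)).smulRight (b 2)

lemma sg_apply (b : OB) (x : V3) : sg b x = x - (2 * inner ℝ (b 2) x) • b 2 := by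
  simp [sg, smul_smul]

lemma b_self (b : OB) (i : Fin 3) : inner ℝ (b i) (b i) = (1:ℝ) := by
  rw [real_inner_self_eq_norm_sq, b.norm_eq_one]; norm_num

lemma b_ne (b : OB) {i j : Fin 3} (h : i ≠ j) : inner ℝ (b i) (b j) = (0:ℝ) := b.orthonormal.2 h

lemma sg_inner (b : OB) (x : V3) : inner ℝ (b 2) (sg b x) = - (inner ℝ (b 2) x : ℝ) := by
  rw [sg_apply, inner_sub_right, inner_smul_right, b_self]; ring

lemma sg_sg (b : OB) (x : V3) : sg b (sg b x) = x := by
  rw [sg_apply b (sg b x), sg_inner, sg_apply]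
  module

lemma sg_tan (b : OB) {i : Fin 3} (h : i ≠ 2) : sg b (b i) = b i := by
  rw [sg_apply, b_ne b h.symm]; simp

lemma sg_nor (b : OB) : sg b (b 2) = - b 2 := by
  rw [sg_apply, b_self]; module

lemma norm_sub_sg (b : OB) (x y : V3) : ‖x - sg b y‖ ^ 2 = ‖x - y‖ ^ 2 + 4 * inner ℝ (b 2) x * inner ℝ (b 2) y := by
  have : x - sg b y = (x - y) + (2 * inner ℝ (b 2) y) • b 2 := by rw [sg_apply]; module
  rw [this, norm_add_sq_real, inner_smul_right, norm_smul, b.norm_eq_one, real_inner_comm _ (x - y), inner_sub_right,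
    Real.norm_eq_abs, mul_one, sq_abs]
  ring

lemma norm_sg (b : OB) (x : V3) : ‖sg b x‖ = ‖x‖ := by
  have := norm_sub_sg b 0 x
  simp at this
  exact this

def HS (b : OB) : Set V3 := {x | 0 ≤ (inner ℝ (b 2) x : ℝ)}
def HSm (b : OB) : Set V3 := {x | (inner ℝ (b 2) x : ℝ) ≤ 0}

def rext (b : OB) (c : ℝ) (q : V3 → ℝ) (x : V3) : ℝ := open Classical in if 0 ≤ (inner ℝ (b 2) x : ℝ) then q x else c * q (sg b x)

def HB (b : OB) (s : ℝ) : Set V3 := HS b ∩ Metric.ball 0 s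

lemma HS_closed (b : OB) : IsClosed (HS b) := isClosed_le continuous_const (by fun_prop)
lemma HSm_closed (b : OB) : IsClosed (HSm b) := isClosed_le (by fun_prop) continuous_const

lemma HS_convex (b : OB) : Convex ℝ (HS b) := convex_halfSpace_ge (innerSL ℝ (b 2)).toLinearMap.isLinear 0

lemma HB_convex (b : OB) (s : ℝ) : Convex ℝ (HB b s) := (HS_convex b).inter (convex_ball _ _)

lemma HB_int (b : OB) {s : ℝ} (hs : 0 < s) : (interior (HB b s)).Nonempty := by
  have ho : IsOpen ({x : V3 | 0 < (inner ℝ (b 2) x : ℝ)} ∩ Metric.ball 0 s) :=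
    (isOpen_lt continuous_const (by fun_prop)).inter Metric.isOpen_ball
  refine ⟨(s/2) • b 2, interior_maximal (s := HB b s) (fun x hx => ⟨by have := hx.1; simp only [mem_ofPred_eq] at this; simp only [HS, mem_ofPred_eq]; exact this.le, hx.2⟩) ho ⟨?_, ?_⟩⟩
  · simp only [mem_ofPred_eq]; rw [inner_smul_right, b_self]; linarith
  · simp [norm_smul, b.norm_eq_one]; rw [abs_of_pos hs]; linarith

lemma HB_ud (b : OB) {s : ℝ} (hs : 0 < s) : UniqueDiffOn ℝ (HB b s) := uniqueDiffOn_convex (HB_convex b s) (HB_int b hs)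

lemma HB_clint (b : OB) {s : ℝ} (hs : 0 < s) : HB b s ⊆ closure (interior (HB b s)) :=
  fun _ hx => by rw [(HB_convex b s).closure_interior_eq_closure_of_nonempty_interior (HB_int b hs)]; exact subset_closure hx

lemma glue (b : OB) {s : ℝ} {U : V3 → ℝ} {L : V3 → V3 →L[ℝ] ℝ}
    (h1 : ∀ x ∈ HS b ∩ Metric.ball 0 s, HasFDerivWithinAt U (L x) (HS b ∩ Metric.ball 0 s) x)
    (h2 : ∀ x ∈ HSm b ∩ Metric.ball 0 s, HasFDerivWithinAt U (L x) (HSm b ∩ Metric.ball 0 s) x) :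
    ∀ x ∈ Metric.ball (0:V3) s, HasFDerivAt U (L x) x := by
  intro x hx
  have hn : Metric.ball (0:V3) s ∈ 𝓝 x := Metric.isOpen_ball.mem_nhds hx
  have a1 : HasFDerivWithinAt U (L x) (HS b) x := by
    by_cases h : x ∈ HS b
    · exact (hasFDerivWithinAt_inter hn).1 (h1 x ⟨h, hx⟩)
    · exact HasFDerivWithinAt.of_notMem_closure (by rwa [(HS_closed b).closure_eq])
  have a2 : HasFDerivWithinAt U (L x) (HSm b) x := by
    by_cases h : x ∈ HSm b
    · exact (hasFDerivWithinAt_inter hn).1 (h2 x ⟨h, hx⟩)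
    · exact HasFDerivWithinAt.of_notMem_closure (by rwa [(HSm_closed b).closure_eq])
  have := a1.union a2
  have hu : HS b ∪ HSm b = univ := by
    ext y; simp [HS, HSm]; exact le_total _ _
  rwa [hu, hasFDerivWithinAt_univ] at this

lemma rext_sg {b : OB} {c : ℝ} {q : V3 → ℝ} {x : V3} (hx : x ∈ HSm b)
    (h0 : (inner ℝ (b 2) x : ℝ) = 0 → q x = c * q x) : rext b c q x = c * q (sg b x) := by
  unfold rext
  split_ifs with h
  · have h1 : (inner ℝ (b 2) x : ℝ) = 0 := le_antisymm hx h
    have : sg b x = x := by rw [sg_apply, h1]; simp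
    rw [this, ← h0 h1]
  · rfl

lemma rext_pos {b : OB} {c : ℝ} {q : V3 → ℝ} {x : V3} (hx : x ∈ HS b) : rext b c q x = q x := by
  unfold rext; exact if_pos hx

lemma sg_mem {b : OB} {s : ℝ} {x : V3} (hx : x ∈ HSm b ∩ Metric.ball 0 s) : sg b x ∈ HB b s := by
  refine ⟨?_, ?_⟩
  · have := hx.1; simp only [HSm, HS, mem_ofPred_eq] at *; rw [sg_inner]; linarith
  · have := hx.2; simp only [mem_ball_zero_iff] at *; rwa [norm_sg]

lemma rext_diff (b : OB) {s c : ℝ} {q : V3 → ℝ} (hq : DifferentiableOn ℝ q (HB b s))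
    (h0 : ∀ x ∈ HB b s, (inner ℝ (b 2) x : ℝ) = 0 → q x = c * q x)
    (h1 : ∀ x ∈ HB b s, (inner ℝ (b 2) x : ℝ) = 0 → ∀ i : Fin 3, i ≠ 2 → pd (HB b s) (b i) q x = c * pd (HB b s) (b i) q x)
    (h2 : ∀ x ∈ HB b s, (inner ℝ (b 2) x : ℝ) = 0 → pd (HB b s) (b 2) q x = - c * pd (HB b s) (b 2) q x) :
    ∀ x ∈ Metric.ball (0:V3) s, DifferentiableAt ℝ (rext b c q) x ∧
      (∀ i : Fin 3, i ≠ 2 → dd (b i) (rext b c q) x = rext b c (pd (HB b s) (b i) q) x) ∧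
      dd (b 2) (rext b c q) x = rext b (-c) (pd (HB b s) (b 2) q) x := by
  classical
  set T := fderivWithin ℝ q (HB b s) with hT
  set L : V3 → V3 →L[ℝ] ℝ := fun x => if 0 ≤ (inner ℝ (b 2) x : ℝ) then T x else c • (T (sg b x)).comp (sg b) with hL
  have key : ∀ x ∈ Metric.ball (0:V3) s, HasFDerivAt (rext b c q) (L x) x := by
    refine glue b ?_ ?_
    · intro x hx
      have : L x = T x := if_pos hx.1
      rw [this]
      exact (hq x hx).hasFDerivWithinAt.congr (fun y hy => rext_pos hy.1) (rext_pos hx.1)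
    · intro x hx
      have hc : HasFDerivWithinAt (fun y => c * q (sg b y)) (c • (T (sg b x)).comp (sg b)) (HSm b ∩ Metric.ball 0 s) x :=
        (((hq _ (sg_mem hx)).hasFDerivWithinAt).comp x (sg b).hasFDerivWithinAt (fun y hy => sg_mem hy)).const_mul c
      have hee : ∀ y ∈ HSm b ∩ Metric.ball 0 s, rext b c q y = c * q (sg b y) := fun y hy =>
        rext_sg hy.1 fun h => h0 y ⟨h.ge, hy.2⟩ h
      have hc' := hc.congr hee (hee x hx)
      by_cases h : 0 ≤ (inner ℝ (b 2) x : ℝ)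
      · have hz : (inner ℝ (b 2) x : ℝ) = 0 := le_antisymm hx.1 h
        have hxx : sg b x = x := by rw [sg_apply, hz]; simp
        have hxB : x ∈ HB b s := ⟨h, hx.2⟩
        have : L x = c • (T (sg b x)).comp (sg b) := by
          have e1 : L x = T x := if_pos h
          rw [e1, hxx]
          refine ContinuousLinearMap.coe_injective (b.toBasis.ext fun i => ?_)
          simp only [OrthonormalBasis.coe_toBasis, ContinuousLinearMap.coe_coe, FunLike.coe_smul, Pi.smul_apply, ContinuousLinearMap.comp_apply, smul_eq_mul]
          by_cases hi : i = 2
          · subst hi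
            rw [sg_nor, map_neg]
            have := h2 x hxB hz
            simp only [pd] at this
            linarith
          · rw [sg_tan b hi]; exact h1 x hxB hz i hi
        rw [this]; exact hc'
      · have : L x = c • (T (sg b x)).comp (sg b) := if_neg h
        rw [this]; exact hc'
  intro x hx
  have hd : ∀ e, dd e (rext b c q) x = L x e := fun e => by simp only [dd]; rw [(key x hx).fderiv]
  refine ⟨(key x hx).differentiableAt, fun i hi => ?_, ?_⟩
  · rw [hd]
    simp only [hL, rext]
    split_ifs
    · rfl
    · simp [sg_tan b hi, pd, hT]
  · rw [hd]
    simp only [hL, rext]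
    split_ifs
    · rfl
    · simp [sg_nor b, pd, hT]

lemma rext_one (b : OB) (q : V3 → ℝ) (x : V3) : ∃ y, rext b 1 q x = q y ∧ y ∈ HS b ∧ ‖y‖ = ‖x‖ := by
  unfold rext
  split_ifs with h
  · exact ⟨x, rfl, h, rfl⟩
  · exact ⟨sg b x, one_mul _, by simp only [HS, mem_ofPred_eq]; rw [sg_inner]; linarith, norm_sg b x⟩

lemma rext_bd (b : OB) {q : V3 → ℝ} {c s A : ℝ} (hc : |c| = 1) (h : ∀ x ∈ HB b s, |q x| ≤ A) : ∀ x ∈ Metric.ball (0:V3) s, |rext b c q x| ≤ A := by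
  intro x hx
  unfold rext
  split_ifs with hh
  · exact h x ⟨hh, hx⟩
  · rw [abs_mul, hc, one_mul]
    exact h _ (sg_mem ⟨le_of_not_ge hh, hx⟩)

lemma fold_lip (b : OB) {x y : V3} (hx : x ∈ HS b) (hy : y ∈ HSm b) : ‖x - sg b y‖ ≤ ‖x - y‖ := by
  have := norm_sub_sg b x y
  have h2 : (inner ℝ (b 2) x : ℝ) * inner ℝ (b 2) y ≤ 0 := mul_nonpos_of_nonneg_of_nonpos hx hy
  exact abs_le_of_sq_le_sq' (by nlinarith) (norm_nonneg _) |>.2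

open scoped ContDiff

lemma pd_line {D : Set V3} {q : V3 → ℝ} {x e : V3} (hq : DifferentiableWithinAt ℝ q D x) (hT : ∀ᶠ t in 𝓝 (0:ℝ), x + t • e ∈ D) :
    HasDerivAt (fun t : ℝ => q (x + t • e)) (pd D e q x) 0 := by
  have hg : HasFDerivWithinAt q (fderivWithin ℝ q D x) D (x + (0:ℝ) • e) := by
    simpa using hq.hasFDerivWithinAt
  have hl : HasDerivAt (fun t : ℝ => x + t • e) e 0 := by
    simpa using ((hasDerivAt_id (0:ℝ)).smul_const e).const_add x
  have h3 : HasDerivWithinAt (fun t : ℝ => q (x + t • e)) (pd D e q x) {t | x + t • e ∈ D} 0 :=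
    hg.comp_hasDerivWithinAt (0:ℝ) hl.hasDerivWithinAt (fun t ht => ht)
  exact h3.hasDerivAt hT

lemma pd_pd {D : Set V3} (hD : UniqueDiffOn ℝ D) {w : V3 → ℝ} {x : V3} (hx : x ∈ D) (h : ContDiffOn ℝ 2 w D) (e e' : V3) :
    pd D e (pd D e' w) x = fderivWithin ℝ (fderivWithin ℝ w D) D x e e' := by
  have hd : DifferentiableWithinAt ℝ (fderivWithin ℝ w D) D x := (h.fderivWithin hD (m := 1) (by norm_num)).differentiableOn (by simp) x hx
  have := hd.hasFDerivWithinAt.clm_apply (hasFDerivWithinAt_const e' x D)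
  exact (congrArg (fun (T : V3 →L[ℝ] ℝ) => T e) (this.fderivWithin (hD x hx))).trans (by simp)

lemma pd_symm {D : Set V3} (hD : UniqueDiffOn ℝ D) (hDi : D ⊆ closure (interior D)) {w : V3 → ℝ} {x : V3} (hx : x ∈ D) (h : ContDiffOn ℝ 2 w D) (e e' : V3) :
    pd D e (pd D e' w) x = pd D e' (pd D e w) x := by
  rw [pd_pd hD hx h, pd_pd hD hx h]
  exact (h x hx).isSymmSndFDerivWithinAt (by simp) hD (hDi hx) hx e e'

lemma pd_contDiffOn {D : Set V3} (hD : UniqueDiffOn ℝ D) {w : V3 → ℝ} {n m : ℕ} (hm : m + 1 ≤ n) (h : ContDiffOn ℝ n w D) (e : V3) :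
    ContDiffOn ℝ m (pd D e w) D := (h.fderivWithin hD (m := m) (by exact_mod_cast hm)).clm_apply contDiffOn_const

lemma HB_line (b : OB) {s : ℝ} {i : Fin 3} (hi : i ≠ 2) {x : V3} (hx : x ∈ HB b s) : ∀ᶠ t in 𝓝 (0:ℝ), x + t • b i ∈ HB b s := by
  have ho : IsOpen {t : ℝ | x + t • b i ∈ Metric.ball (0:V3) s} := Metric.isOpen_ball.preimage (by fun_prop)
  filter_upwards [ho.mem_nhds (by simpa using hx.2)] with t ht
  refine ⟨?_, ht⟩
  have := hx.1
  simp only [HS, mem_ofPred_eq] at *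
  rw [inner_add_right, inner_smul_right, b_ne b hi.symm]; simpa using this

lemma pd_face (b : OB) {s : ℝ} {q : V3 → ℝ} (hq : DifferentiableOn ℝ q (HB b s))
    (h0 : ∀ x ∈ HB b s, (inner ℝ (b 2) x : ℝ) = 0 → q x = 0) {i : Fin 3} (hi : i ≠ 2) {x : V3} (hx : x ∈ HB b s) (hz : (inner ℝ (b 2) x : ℝ) = 0) :
    pd (HB b s) (b i) q x = 0 := by
  have h1 := pd_line (hq x hx) (HB_line b hi hx)
  have h2 : (fun t : ℝ => q (x + t • b i)) =ᶠ[𝓝 0] fun _ => 0 := by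
    filter_upwards [HB_line b hi hx] with t ht
    refine h0 _ ht ?_
    rw [inner_add_right, inner_smul_right, b_ne b hi.symm, hz]; simp
  exact h1.unique ((hasDerivAt_const (0:ℝ) (0:ℝ)).congr_of_eventuallyEq h2)

lemma rext_cont (b : OB) {s c : ℝ} {q : V3 → ℝ} (hq : ContinuousOn q (HB b s))
    (h0 : ∀ x ∈ HB b s, (inner ℝ (b 2) x : ℝ) = 0 → q x = c * q x) : ContinuousOn (rext b c q) (Metric.ball 0 s) := by
  intro x hx
  have hn : Metric.ball (0:V3) s ∈ 𝓝 x := Metric.isOpen_ball.mem_nhds hx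
  have a1 : ContinuousWithinAt (rext b c q) (HS b) x := by
    by_cases h : x ∈ HS b
    · exact (continuousWithinAt_inter hn).1 ((hq x ⟨h, hx⟩).congr (fun y hy => rext_pos hy.1) (rext_pos h))
    · exact continuousWithinAt_of_notMem_closure (by rwa [(HS_closed b).closure_eq])
  have a2 : ContinuousWithinAt (rext b c q) (HSm b) x := by
    by_cases h : x ∈ HSm b
    · refine (continuousWithinAt_inter hn).1 ?_
      have hee : ∀ y ∈ HSm b ∩ Metric.ball 0 s, rext b c q y = c * q (sg b y) := fun y hy =>
        rext_sg hy.1 fun h => h0 y ⟨h.ge, hy.2⟩ h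
      refine ContinuousWithinAt.congr ?_ hee (hee x ⟨h, hx⟩)
      exact continuousWithinAt_const.mul ((hq _ (sg_mem ⟨h, hx⟩)).comp (sg b).continuous.continuousWithinAt (fun y hy => sg_mem hy))
    · exact continuousWithinAt_of_notMem_closure (by rwa [(HSm_closed b).closure_eq])
  have := a1.union a2
  have hu : HS b ∪ HSm b = univ := by
    ext y; simp [HS, HSm]; exact le_total _ _
  rw [hu] at this
  exact this.mono (subset_univ _)

lemma rext_C2 (b : OB) {s : ℝ} (hs : 0 < s) {w : V3 → ℝ} (hw : ContDiffOn ℝ 2 w (HB b s))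
    (hn : ∀ x ∈ HB b s, (inner ℝ (b 2) x : ℝ) = 0 → pd (HB b s) (b 2) w x = 0) :
    ContDiffOn ℝ 2 (rext b 1 w) (Metric.ball 0 s) ∧
    ∀ x ∈ Metric.ball (0:V3) s, lapb b (rext b 1 w) x = rext b 1 (fun y => ∑ i, pd (HB b s) (b i) (pd (HB b s) (b i) w) y) x := by
  have hD := HB_ud b hs
  have hDi := HB_clint b hs
  have hB := Metric.isOpen_ball (x := (0:V3)) (ε := s)
  have hw1 : ∀ e, ContDiffOn ℝ 1 (pd (HB b s) e w) (HB b s) := fun e => pd_contDiffOn hD (n := 2) (m := 1) le_rfl hw e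
  have hw1d : ∀ e, DifferentiableOn ℝ (pd (HB b s) e w) (HB b s) := fun e => (hw1 e).differentiableOn (by simp)
  have hw2 : ∀ e e', ContinuousOn (pd (HB b s) e' (pd (HB b s) e w)) (HB b s) := fun e e' =>
    (pd_contDiffOn hD (n := 1) (m := 0) le_rfl (hw1 e) e').continuousOn
  have hte : ∀ i : Fin 3, i ≠ 2 → ∀ x ∈ HB b s, (inner ℝ (b 2) x : ℝ) = 0 → pd (HB b s) (b i) (pd (HB b s) (b 2) w) x = 0 :=
    fun i hi x hx hz => pd_face b (hw1d _) hn hi hx hz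
  have hnt : ∀ i : Fin 3, i ≠ 2 → ∀ x ∈ HB b s, (inner ℝ (b 2) x : ℝ) = 0 → pd (HB b s) (b 2) (pd (HB b s) (b i) w) x = 0 :=
    fun i hi x hx hz => by rw [pd_symm hD hDi hx hw]; exact hte i hi x hx hz
  have E0 := rext_diff b (c := 1) (hw.differentiableOn (by simp)) (fun x _ _ => (one_mul _).symm) (fun x _ _ _ _ => (one_mul _).symm)
    (fun x hx hz => by rw [hn x hx hz]; simp)
  have E1 : ∀ i : Fin 3, i ≠ 2 → _ := fun i hi => rext_diff b (c := 1) (hw1d (b i)) (fun x _ _ => (one_mul _).symm)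
    (fun x _ _ _ _ => (one_mul _).symm) (fun x hx hz => by rw [hnt i hi x hx hz]; simp)
  have E2 := rext_diff b (c := -1) (hw1d (b 2)) (fun x hx hz => by rw [hn x hx hz]; simp)
    (fun x hx hz i hi => by rw [hte i hi x hx hz]; simp) (fun x hx hz => by simp)
  have hc1 : ∀ q, ContinuousOn q (HB b s) → ContinuousOn (rext b 1 q) (Metric.ball 0 s) := fun q hq => rext_cont b hq fun x _ _ => (one_mul _).symm
  have hc2 : ∀ q, ContinuousOn q (HB b s) → (∀ x ∈ HB b s, (inner ℝ (b 2) x : ℝ) = 0 → q x = 0) → ContinuousOn (rext b (-1) q) (Metric.ball 0 s) :=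
    fun q hq h => rext_cont b hq fun x hx hz => by rw [h x hx hz]; simp
  have d1t : ∀ i : Fin 3, i ≠ 2 → ∀ x ∈ Metric.ball (0:V3) s, dd (b i) (rext b 1 w) x = rext b 1 (pd (HB b s) (b i) w) x :=
    fun i hi x hx => (E0 x hx).2.1 i hi
  have d1n : ∀ x ∈ Metric.ball (0:V3) s, dd (b 2) (rext b 1 w) x = rext b (-1) (pd (HB b s) (b 2) w) x :=
    fun x hx => (E0 x hx).2.2
  constructor
  · refine contDiffOn_succ_pd b (n := 1) hB.uniqueDiffOn (fun x hx => (E0 x hx).1.differentiableWithinAt) fun i => ?_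
    refine contDiffOn_succ_pd b (n := 0) hB.uniqueDiffOn ?_ fun k => contDiffOn_zero.2 ?_
    · by_cases hi : i = 2
      · subst hi
        intro x hx
        exact (E2 x hx).1.differentiableWithinAt.congr (fun y hy => by rw [pd_open hB _ _ hy, d1n y hy]) (by rw [pd_open hB _ _ hx, d1n x hx])
      · intro x hx
        exact ((E1 i hi) x hx).1.differentiableWithinAt.congr (fun y hy => by rw [pd_open hB _ _ hy, d1t i hi y hy]) (by rw [pd_open hB _ _ hx, d1t i hi x hx])
    · by_cases hi : i = 2
      · subst hi
        have e : ∀ x ∈ Metric.ball (0:V3) s, pd (Metric.ball 0 s) (b k) (pd (Metric.ball 0 s) (b 2) (rext b 1 w)) x =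
            dd (b k) (rext b (-1) (pd (HB b s) (b 2) w)) x := fun x hx => by
          rw [pd_congr (fun y hy => (pd_open hB _ _ hy).trans (d1n y hy)) _ hx, pd_open hB _ _ hx]
        refine ContinuousOn.congr ?_ e
        by_cases hk : k = 2
        · subst hk
          have := hc1 _ (hw2 (b 2) (b 2))
          refine this.congr fun x hx => ?_
          rw [(E2 x hx).2.2, neg_neg]
        · exact (hc2 _ (hw2 (b 2) (b k)) (hte k hk)).congr fun x hx => (E2 x hx).2.1 k hk
      · have e : ∀ x ∈ Metric.ball (0:V3) s, pd (Metric.ball 0 s) (b k) (pd (Metric.ball 0 s) (b i) (rext b 1 w)) x =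
            dd (b k) (rext b 1 (pd (HB b s) (b i) w)) x := fun x hx => by
          rw [pd_congr (fun y hy => (pd_open hB _ _ hy).trans (d1t i hi y hy)) _ hx, pd_open hB _ _ hx]
        refine ContinuousOn.congr ?_ e
        by_cases hk : k = 2
        · subst hk
          exact (hc2 _ (hw2 (b i) (b 2)) (hnt i hi)).congr fun x hx => ((E1 i hi) x hx).2.2
        · exact (hc1 _ (hw2 (b i) (b k))).congr fun x hx => ((E1 i hi) x hx).2.1 k hk
  · intro x hx
    rw [lapb, Fin.sum_univ_three, dd_congr hB (d1t 0 (by decide)) _ x hx, dd_congr hB (d1t 1 (by decide)) _ x hx,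
      dd_congr hB d1n _ x hx, ((E1 0 (by decide)) x hx).2.1 0 (by decide), ((E1 1 (by decide)) x hx).2.1 1 (by decide), (E2 x hx).2.2]
    unfold rext
    simp only [Fin.sum_univ_three, neg_neg]
    split_ifs
    · rfl
    · ring

lemma rext_CH0 (b : OB) {s α A : ℝ} (hα : 0 < α) (hA : 0 ≤ A) {q : V3 → ℝ} (h : CH (HB b s) b α 1 0 A q) : CH (Metric.ball 0 s) b α 1 0 A (rext b 1 q) := by
  refine ⟨rext_bd b (by simp) h.1, fun x hx y hy => ?_⟩
  have hm : ∀ z : V3, ¬ 0 ≤ (inner ℝ (b 2) z : ℝ) → z ∈ HSm b := fun z hz => le_of_not_ge hz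
  unfold rext
  split_ifs with h1 h2 h2
  · exact h.2 x ⟨h1, hx⟩ y ⟨h2, hy⟩
  · rw [one_mul]
    refine (h.2 x ⟨h1, hx⟩ _ (sg_mem ⟨hm y h2, hy⟩)).trans ?_
    have := fold_lip b (x := x) h1 (hm y h2)
    gcongr
  · rw [one_mul]
    refine (h.2 _ (sg_mem ⟨hm x h1, hx⟩) y ⟨h2, hy⟩).trans ?_
    have := fold_lip b (x := y) h2 (hm x h1)
    rw [norm_sub_rev, norm_sub_rev x y]
    gcongr
  · rw [one_mul, one_mul]
    refine (h.2 _ (sg_mem ⟨hm x h1, hx⟩) _ (sg_mem ⟨hm y h2, hy⟩)).trans ?_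
    rw [← map_sub, norm_sg]

lemma rext_line (b : OB) {s : ℝ} {q : V3 → ℝ} (hq : DifferentiableOn ℝ q (HB b s)) {i : Fin 3} (hi : i ≠ 2) {x : V3} (hx : x ∈ Metric.ball 0 s) :
    HasDerivAt (fun t : ℝ => rext b 1 q (x + t • b i)) (rext b 1 (pd (HB b s) (b i) q) x) 0 := by
  have hin : ∀ t : ℝ, (inner ℝ (b 2) (x + t • b i) : ℝ) = inner ℝ (b 2) x := fun t => by
    rw [inner_add_right, inner_smul_right, b_ne b hi.symm]; simp
  unfold rext
  simp only [hin]
  split_ifs with h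
  · exact pd_line (hq x ⟨h, hx⟩) (HB_line b hi ⟨h, hx⟩)
  · simp only [one_mul, map_add, map_smul, sg_tan b hi]
    have hm := sg_mem (b := b) (s := s) (x := x) ⟨le_of_not_ge h, hx⟩
    exact pd_line (hq _ hm) (HB_line b hi hm)

lemma CH.downs {D : Set V3} (hD : Convex ℝ D) {b : OB} {α ρ : ℝ} (hα0 : 0 < α) (hα1 : α < 1) (hρ : 0 < ρ) {j : ℕ} :
    ∀ {A : ℝ} {w : V3 → ℝ}, 0 ≤ A → CH D b α ρ j A w → CH D b α ρ 0 (3 ^ j * A) w := by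
  induction j with
  | zero => intro A w hA h; simpa using h
  | succ j ih =>
    intro A w hA h
    have := ih (by positivity) (CH.down hD hα0 hα1 hρ hA h)
    rwa [← mul_assoc, ← pow_succ] at this

lemma rext_TH (b : OB) {s α : ℝ} (hα0 : 0 < α) (hα1 : α < 1) {j : ℕ} : ∀ {A : ℝ} {q : V3 → ℝ}, 0 ≤ A → CH (HB b s) b α 1 j A q →
    TH b α s j (3 ^ j * A) (rext b 1 q) := by
  induction j with
  | zero => intro A q hA h; simpa [TH] using rext_CH0 b hα0 hA h
  | succ j ih =>
    intro A q hA h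
    refine ⟨rext_CH0 b hα0 (by positivity) (CH.downs (HB_convex b s) hα0 hα1 one_pos hA h), fun i hi => ?_⟩
    refine ⟨_, fun x hx => rext_line b h.2.1 hi hx, ?_⟩
    have := h.2.2 i
    rw [div_one] at this
    refine (ih hA this).mono le_rfl ?_
    gcongr
    · norm_num
    · simp

lemma int_TH (b : OB) {s α : ℝ} (hα0 : 0 < α) (hα1 : α < 1) {j : ℕ} : ∀ {A : ℝ} {q : V3 → ℝ}, 0 ≤ A → CH (Metric.ball 0 s) b α 1 j A q →
    TH b α s j (3 ^ j * A) q := by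
  induction j with
  | zero => intro A q hA h; simpa [TH] using h
  | succ j ih =>
    intro A q hA h
    refine ⟨CH.downs (convex_ball _ _) hα0 hα1 one_pos hA h, fun i hi => ?_⟩
    refine ⟨_, fun x hx => pd_line (h.2.1 x hx) ?_, ?_⟩
    · have ho : IsOpen {t : ℝ | x + t • b i ∈ Metric.ball (0:V3) s} := Metric.isOpen_ball.preimage (by fun_prop)
      exact ho.mem_nhds (by simpa using hx)
    have := h.2.2 i
    rw [div_one] at this
    refine (ih hA this).mono le_rfl ?_
    gcongr
    · norm_num
    · simp

/-- Laplacian within a set, in the frame `b` -/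
def lapD (b : OB) (D : Set V3) (w : V3 → ℝ) (x : V3) : ℝ := ∑ i, pd D (b i) (pd D (b i) w) x

theorem half_est (b : OB) {α : ℝ} (hα0 : 0 < α) (hα1 : α < 1) : ∃ C, 1 ≤ C ∧ ∀ (u f : V3 → ℝ) (A : ℝ), 0 ≤ A →
    ContDiffOn ℝ 2 u (HB b 1) → (∀ x ∈ HB b 1, lapD b (HB b 1) u x = f x) → (∀ x ∈ HB b 1, |u x| ≤ A) →
    (∀ x ∈ HB b 1, (inner ℝ (b 2) x : ℝ) = 0 → pd (HB b 1) (b 2) u x = 0) → CH (HB b 1) b α 1 4 A f →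
    CH (HB b (1/32)) b α 1 6 (C * A) u := by
  obtain ⟨C, hC, H⟩ := TSU_of b hα0 hα1 4 1 one_pos
  obtain ⟨C', hC', H'⟩ := normal_reg b hα0 hα1 (s := 1/2^(4+1)) (HB_ud b (by norm_num : (0:ℝ) < 1/32)) (by norm_num; exact fun x hx => hx.2)
    (fun i hi x hx => HB_line b hi hx) 4
  refine ⟨C' * (C * 3^4), by nlinarith, fun u f A hA h1 h2 h3 h4 h5 => ?_⟩
  have hE := rext_C2 b one_pos h1 h4
  have hT := rext_TH b hα0 hα1 hA h5
  have hsub : HB b (1/32) = HB b 1 ∩ Metric.ball 0 (1/32) := by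
    unfold HB; rw [inter_assoc, inter_eq_self_of_subset_right (Metric.ball_subset_ball (by norm_num : (1:ℝ)/32 ≤ 1))]
  have hS := H (rext b 1 u) (rext b 1 f) (3^4 * A) (by positivity) hE.1 (fun x hx => by
    rw [hE.2 x hx]
    unfold rext
    split_ifs with h
    · exact h2 x ⟨h, hx⟩
    · rw [← h2 _ (sg_mem ⟨le_of_not_ge h, hx⟩)]; rfl)
    (fun x hx => (rext_bd b (by simp) h3 x hx).trans (by linarith)) hT
  have hf : CH (HB b (1/32)) b α 1 4 (C * (3^4 * A)) (rext b 1 f) := by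
    rw [hsub]
    refine ((h5.inter Metric.isOpen_ball).mono one_pos ?_).congr fun x hx => (rext_pos hx.1.1).symm
    nlinarith
  have := H' _ _ _ (by positivity) hS hf
  rw [show C' * (C * 3^4) * A = C' * (C * (3^4 * A)) by ring]
  exact this.congr fun x hx => rext_pos hx.1

theorem int_est (b : OB) {α : ℝ} (hα0 : 0 < α) (hα1 : α < 1) : ∃ C, 1 ≤ C ∧ ∀ (u f : V3 → ℝ) (A : ℝ), 0 ≤ A →
    ContDiffOn ℝ 2 u (Metric.ball 0 1) → (∀ x ∈ Metric.ball (0:V3) 1, lapD b (Metric.ball 0 1) u x = f x) → (∀ x ∈ Metric.ball (0:V3) 1, |u x| ≤ A) →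
    CH (Metric.ball 0 1) b α 1 4 A f →
    CH (Metric.ball 0 (1/32)) b α 1 6 (C * A) u := by
  obtain ⟨C, hC, H⟩ := TSU_of b hα0 hα1 4 1 one_pos
  have hl : ∀ i : Fin 3, i ≠ 2 → ∀ x ∈ Metric.ball (0:V3) (1/32), ∀ᶠ t in 𝓝 (0:ℝ), x + t • b i ∈ Metric.ball (0:V3) (1/32) := fun i _ x hx => by
    have ho : IsOpen {t : ℝ | x + t • b i ∈ Metric.ball (0:V3) (1/32)} := Metric.isOpen_ball.preimage (by fun_prop)
    exact ho.mem_nhds (by simpa using hx)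
  obtain ⟨C', hC', H'⟩ := normal_reg b hα0 hα1 (s := 1/2^(4+1)) (Metric.isOpen_ball.uniqueDiffOn) (by norm_num) hl 4
  refine ⟨C' * (C * 3^4), by nlinarith, fun u f A hA h1 h2 h3 h5 => ?_⟩
  have hT := int_TH b hα0 hα1 hA h5
  have hS := H u f (3^4 * A) (by positivity) h1 (fun x hx => by
    rw [← h2 x hx]
    refine Finset.sum_congr rfl fun i _ => ?_
    rw [pd_open Metric.isOpen_ball _ _ hx, dd_congr Metric.isOpen_ball (fun y hy => pd_open Metric.isOpen_ball _ _ hy) _ x hx])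
    (fun x hx => (h3 x hx).trans (by linarith)) hT
  have hf : CH (Metric.ball 0 (1/32)) b α 1 4 (C * (3^4 * A)) f :=
    (CH.ball h5 (by norm_num)).mono one_pos (by nlinarith)
  have := H' _ _ _ (by positivity) hS hf
  rwa [show C' * (C * 3^4) * A = C' * (C * (3^4 * A)) by ring]

open scoped ContDiff

lemma pd_affine {D D' : Set V3} (hD' : UniqueDiffOn ℝ D') {p : V3} {c : ℝ} (hm : ∀ x ∈ D', p + c • x ∈ D) {w : V3 → ℝ}
    (hw : DifferentiableOn ℝ w D) (e : V3) {x : V3} (hx : x ∈ D') :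
    pd D' e (fun x => w (p + c • x)) x = c * pd D e w (p + c • x) := by
  have h1 : HasFDerivWithinAt (fun x : V3 => p + c • x) (c • ContinuousLinearMap.id ℝ V3) D' x :=
    ((hasFDerivWithinAt_id x D').const_smul c).const_add p
  have h2 := (hw _ (hm x hx)).hasFDerivWithinAt.comp x h1 hm
  exact (congrArg (fun (T : V3 →L[ℝ] ℝ) => T e) (h2.fderivWithin (hD' x hx))).trans (by simp [pd])

lemma CH.affine {D D' : Set V3} (hD' : UniqueDiffOn ℝ D') {p : V3} {c : ℝ} (hc : 0 < c) (hm : ∀ x ∈ D', p + c • x ∈ D)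
    {b : OB} {α ρ : ℝ} {j : ℕ} : ∀ {A : ℝ} {w : V3 → ℝ}, CH D b α ρ j A w → CH D' b α (ρ / c) j A (fun x => w (p + c • x)) := by
  induction j with
  | zero =>
    intro A w h
    refine ⟨fun x hx => h.1 _ (hm x hx), fun x hx y hy => (h.2 _ (hm x hx) _ (hm y hy)).trans (le_of_eq ?_)⟩
    congr 2
    rw [show p + c • x - (p + c • y) = c • (x - y) by rw [smul_sub]; abel, norm_smul, Real.norm_of_nonneg hc.le]
    rw [div_div_eq_mul_div, mul_comm]
  | succ j ih =>
    intro A w h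
    refine ⟨fun x hx => h.1 _ (hm x hx), ?_, fun i => ?_⟩
    · exact h.2.1.comp (by fun_prop) hm
    · have h0 : CH D' b α (ρ / c) j 0 (fun _ => (0:ℝ)) := by
        clear ih h
        have : ∀ j, CH D' b α (ρ / c) j 0 (fun _ => (0:ℝ)) := by
          intro j
          induction j with
          | zero => exact ⟨by simp, by simp⟩
          | succ j ih => 
            refine ⟨by simp, differentiableOn_const _, fun i => ?_⟩
            rw [zero_div]
            refine ih.congr fun x hx => ?_
            simp [pd]
        exact this j
      have h2 := CH.lin hD' c h0 (ih (h.2.2 i))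
      rw [abs_of_pos hc, zero_add, show c * (A / ρ) = A / (ρ / c) by rw [div_div_eq_mul_div]; ring] at h2
      refine h2.congr fun x hx => ?_
      rw [pd_affine hD' hm h.2.1 _ hx, zero_add]

def IB (D : Set V3) (α ρ : ℝ) (j : ℕ) (A : ℝ) (w : V3 → ℝ) : Prop :=
  ContDiffOn ℝ j w D ∧ (∀ k ≤ j, ∀ x ∈ D, ‖iteratedFDerivWithin ℝ k w D x‖ ≤ A / ρ ^ k) ∧
  ∀ x ∈ D, ∀ y ∈ D, ‖iteratedFDerivWithin ℝ j w D x - iteratedFDerivWithin ℝ j w D y‖ ≤ A / ρ ^ j * (‖x - y‖ / ρ) ^ α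

lemma norm_sub_fderivWithin {D : Set V3} (hD : UniqueDiffOn ℝ D) {n : ℕ} {w : V3 → ℝ} {x y : V3} (hx : x ∈ D) (hy : y ∈ D) :
    ‖iteratedFDerivWithin ℝ n (fderivWithin ℝ w D) D x - iteratedFDerivWithin ℝ n (fderivWithin ℝ w D) D y‖ =
    ‖iteratedFDerivWithin ℝ (n+1) w D x - iteratedFDerivWithin ℝ (n+1) w D y‖ := by
  rw [iteratedFDerivWithin_succ_eq_comp_right hD hx, iteratedFDerivWithin_succ_eq_comp_right hD hy, Function.comp_apply, Function.comp_apply]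
  have := (continuousMultilinearCurryRightEquiv' ℝ n V3 ℝ).symm.isometry.dist_eq (iteratedFDerivWithin ℝ n (fderivWithin ℝ w D) D x) (iteratedFDerivWithin ℝ n (fderivWithin ℝ w D) D y)
  rw [dist_eq_norm, dist_eq_norm] at this
  exact this.symm

lemma iFDW_pd {D : Set V3} (hD : UniqueDiffOn ℝ D) {n k : ℕ} (hk : k ≤ n) {w : V3 → ℝ} (hw : ContDiffOn ℝ (n+1 : ℕ) w D) (e : V3) {x : V3} (hx : x ∈ D) :
    iteratedFDerivWithin ℝ k (pd D e w) D x = (ContinuousLinearMap.apply ℝ ℝ e).compContinuousMultilinearMap (iteratedFDerivWithin ℝ k (fderivWithin ℝ w D) D x) := by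
  have h1 : ContDiffWithinAt ℝ n (fderivWithin ℝ w D) D x := hw.fderivWithin hD (m := n) (by push_cast; rfl) x hx
  exact ContinuousLinearMap.iteratedFDerivWithin_comp_left (ContinuousLinearMap.apply ℝ ℝ e) h1 hD hx (by exact_mod_cast hk)

lemma apply_norm_le {e : V3} (he : ‖e‖ = 1) : ‖(ContinuousLinearMap.apply ℝ ℝ e : (V3 →L[ℝ] ℝ) →L[ℝ] ℝ)‖ ≤ 1 := by
  refine ContinuousLinearMap.opNorm_le_bound _ zero_le_one fun T => ?_
  have := T.le_opNorm e
  rw [he] at this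
  simpa using this

lemma IB.toCH {D : Set V3} (hD : UniqueDiffOn ℝ D) {b : OB} {α ρ : ℝ} (hρ : 0 < ρ) {j : ℕ} : ∀ {A : ℝ} {w : V3 → ℝ}, IB D α ρ j A w → CH D b α ρ j A w := by
  induction j with
  | zero =>
    intro A w h
    refine ⟨fun x hx => ?_, fun x hx y hy => ?_⟩
    · simpa using h.2.1 0 le_rfl x hx
    · have := h.2.2 x hx y hy
      rw [iteratedFDerivWithin_zero_eq_comp, Function.comp_apply, Function.comp_apply, ← map_sub, LinearIsometryEquiv.norm_map] at this
      simpa using this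
  | succ j ih =>
    intro A w h
    refine ⟨fun x hx => by simpa using h.2.1 0 (by omega) x hx, h.1.differentiableOn (by simp), fun i => ih ⟨?_, ?_, ?_⟩⟩
    · exact pd_contDiffOn hD le_rfl h.1 _
    · intro k hk x hx
      rw [iFDW_pd hD hk h.1 _ hx]
      refine (ContinuousLinearMap.norm_compContinuousMultilinearMap_le _ _).trans ?_
      refine (mul_le_of_le_one_left (norm_nonneg _) (apply_norm_le (b.orthonormal.1 i))).trans ?_
      rw [norm_iteratedFDerivWithin_fderivWithin hD hx]
      refine (h.2.1 (k+1) (by omega) x hx).trans (le_of_eq ?_)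
      field_simp; ring
    · intro x hx y hy
      rw [iFDW_pd hD le_rfl h.1 _ hx, iFDW_pd hD le_rfl h.1 _ hy]
      have : ∀ (g : (V3 →L[ℝ] ℝ) →L[ℝ] ℝ) (S T : ContinuousMultilinearMap ℝ (fun _ : Fin j => V3) (V3 →L[ℝ] ℝ)), g.compContinuousMultilinearMap S - g.compContinuousMultilinearMap T = g.compContinuousMultilinearMap (S - T) := by
        intro g S T; ext m; simp
      rw [this]
      refine (ContinuousLinearMap.norm_compContinuousMultilinearMap_le _ _).trans ?_
      refine (mul_le_of_le_one_left (norm_nonneg _) (apply_norm_le (b.orthonormal.1 i))).trans ?_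
      rw [norm_sub_fderivWithin hD hx hy]
      refine (h.2.2 x hx y hy).trans (le_of_eq ?_)
      congr 1
      field_simp; ring

lemma iFDW_basis {D : Set V3} (hD : UniqueDiffOn ℝ D) (b : OB) {n k : ℕ} (hk : k ≤ n) {w : V3 → ℝ} (hw : ∀ i, ContDiffOn ℝ n (pd D (b i) w) D) {x : V3} (hx : x ∈ D) :
    iteratedFDerivWithin ℝ k (fderivWithin ℝ w D) D x = ∑ i, (ContinuousLinearMap.toSpanSingleton ℝ (innerSL ℝ (b i) : V3 →L[ℝ] ℝ)).compContinuousMultilinearMap (iteratedFDerivWithin ℝ k (pd D (b i) w) D x) := by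
  have e : fderivWithin ℝ w D = fun x => ∑ i, ((ContinuousLinearMap.toSpanSingleton ℝ (innerSL ℝ (b i) : V3 →L[ℝ] ℝ)) ∘ (pd D (b i) w)) x := by
    ext1 x; rw [fderivWithin_basis b D w x]; simp [ContinuousLinearMap.toSpanSingleton_apply]
  conv_lhs => rw [e]
  rw [iteratedFDerivWithin_fun_sum_apply hD hx]
  · refine Finset.sum_congr rfl fun i _ => ?_
    exact ContinuousLinearMap.iteratedFDerivWithin_comp_left _ (hw i x hx) hD hx (by exact_mod_cast hk)
  · intro i _
    exact ContDiffWithinAt.continuousLinearMap_comp _ ((hw i x hx).of_le (by exact_mod_cast hk))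

lemma CH.toIB {D : Set V3} (hD : UniqueDiffOn ℝ D) {b : OB} {α ρ : ℝ} (hα : 0 < α) (hρ : 0 < ρ) {j : ℕ} : ∀ {A : ℝ} {w : V3 → ℝ}, 0 ≤ A → CH D b α ρ j A w → IB D α ρ j (3^j * A) w := by
  have hn : ∀ i, ‖ContinuousLinearMap.toSpanSingleton ℝ (innerSL ℝ (b i) : V3 →L[ℝ] ℝ)‖ = 1 := by
    intro i
    rw [ContinuousLinearMap.norm_toSpanSingleton, innerSL_apply_norm]; exact b.orthonormal.1 i
  induction j with
  | zero =>
    intro A w hA h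
    refine ⟨h.contDiffOn hD hα, ?_, ?_⟩
    · intro k hk x hx
      obtain rfl : k = 0 := by omega
      simpa using h.1 x hx
    · intro x hx y hy
      rw [iteratedFDerivWithin_zero_eq_comp, Function.comp_apply, Function.comp_apply, ← map_sub, LinearIsometryEquiv.norm_map]
      simpa using h.2 x hx y hy
  | succ j ih =>
    intro A w hA h
    have H := fun i => ih (by positivity) (h.2.2 i)
    refine ⟨h.contDiffOn hD hα, ?_, ?_⟩
    · intro k hk x hx
      rcases k with _ | k
      · have := h.1 x hx
        have h3 : A ≤ 3^(j+1) * A := le_mul_of_one_le_left hA (one_le_pow₀ (by norm_num))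
        simpa using this.trans h3
      · rw [← norm_iteratedFDerivWithin_fderivWithin hD hx, iFDW_basis hD b (show k ≤ j by omega) (fun i => (H i).1) hx]
        refine (norm_sum_le _ _).trans ((Finset.sum_le_sum (g := fun _ => 3^j * (A/ρ) / ρ^k) fun i _ => ?_).trans (le_of_eq ?_))
        · refine (ContinuousLinearMap.norm_compContinuousMultilinearMap_le _ _).trans ?_
          rw [hn, one_mul]
          exact (H i).2.1 k (by omega) x hx
        · rw [Finset.sum_const, Finset.card_univ, Fintype.card_fin, nsmul_eq_mul]
          push_cast; field_simp; ring
    · intro x hx y hy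
      rw [← norm_sub_fderivWithin hD hx hy, iFDW_basis hD b le_rfl (fun i => (H i).1) hx, iFDW_basis hD b le_rfl (fun i => (H i).1) hy, ← Finset.sum_sub_distrib]
      refine (norm_sum_le _ _).trans ((Finset.sum_le_sum (g := fun _ => 3^j * (A/ρ) / ρ^j * (‖x - y‖ / ρ) ^ α) fun i _ => ?_).trans (le_of_eq ?_))
      · have : ∀ (g : ℝ →L[ℝ] (V3 →L[ℝ] ℝ)) (S T : ContinuousMultilinearMap ℝ (fun _ : Fin j => V3) ℝ), g.compContinuousMultilinearMap S - g.compContinuousMultilinearMap T = g.compContinuousMultilinearMap (S - T) := by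
          intro g S T; ext m; simp
        rw [this]
        refine (ContinuousLinearMap.norm_compContinuousMultilinearMap_le _ _).trans ?_
        rw [hn, one_mul]
        exact (H i).2.2 x hx y hy
      · rw [Finset.sum_const, Finset.card_univ, Fintype.card_fin, nsmul_eq_mul, ← mul_assoc]
        congr 1
        push_cast; field_simp; ring

open scoped ContDiff

lemma IB.sub {D O : Set V3} (hO : IsOpen O) {α ρ A : ℝ} {j : ℕ} {w : V3 → ℝ} (h : IB D α ρ j A w) : IB (D ∩ O) α ρ j A w := by
  refine ⟨h.1.mono inter_subset_left, fun k hk x hx => ?_, fun x hx y hy => ?_⟩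
  · rw [iteratedFDerivWithin_inter_open hO hx.2]; exact h.2.1 k hk x hx.1
  · rw [iteratedFDerivWithin_inter_open hO hx.2, iteratedFDerivWithin_inter_open hO hy.2]; exact h.2.2 x hx.1 y hy.1

lemma IB.mono {D : Set V3} {α ρ A A' : ℝ} (hρ : 0 < ρ) {j : ℕ} {w : V3 → ℝ} (h : IB D α ρ j A w) (hA : A ≤ A') : IB D α ρ j A' w := by
  refine ⟨h.1, fun k hk x hx => (h.2.1 k hk x hx).trans (by gcongr), fun x hx y hy => (h.2.2 x hx y hy).trans (by gcongr)⟩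

/-- shrink the length scale -/
lemma IB.shrink {D : Set V3} {α ρ r A : ℝ} (hα : 0 < α) (hρ : 0 < ρ) (hr : ρ ≤ r) (hA : 0 ≤ A) {j : ℕ} {w : V3 → ℝ} (h : IB D α r j A w) : IB D α ρ j A w := by
  have hr0 : 0 < r := hρ.trans_le hr
  refine ⟨h.1, fun k hk x hx => (h.2.1 k hk x hx).trans (by gcongr), fun x hx y hy => (h.2.2 x hx y hy).trans (by gcongr)⟩

lemma IB.grow {D : Set V3} {α τ r A : ℝ} (hα0 : 0 < α) (hα1 : α < 1) (hr : 0 < r) (hτ : 0 < τ) (hτ1 : τ ≤ 1) (hA : 0 ≤ A) {j : ℕ} {w : V3 → ℝ} (h : IB D α (τ * r) j A w) :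
    IB D α r j (A / τ ^ (j+1)) w := by
  refine ⟨h.1, fun k hk x hx => (h.2.1 k hk x hx).trans ?_, fun x hx y hy => (h.2.2 x hx y hy).trans ?_⟩
  · rw [mul_pow, ← div_div]
    gcongr ?_ / _
    exact div_le_div_of_nonneg_left hA (by positivity) (pow_le_pow_of_le_one hτ.le hτ1 (by omega))
  · rw [mul_comm τ r, ← div_div, Real.div_rpow (by positivity) hτ.le, pow_succ, mul_pow]
    have : τ ≤ τ ^ α := by simpa using Real.rpow_le_rpow_of_exponent_ge hτ hτ1 hα1.le
    calc A / (r ^ j * τ ^ j) * ((‖x - y‖ / r) ^ α / τ ^ α) ≤ A / (r ^ j * τ ^ j) * ((‖x - y‖ / r) ^ α / τ) := by gcongr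
      _ = _ := by field_simp

lemma lapD_basis {D : Set V3} (hD : UniqueDiffOn ℝ D) {w : V3 → ℝ} {x : V3} (hx : x ∈ D) (h : ContDiffOn ℝ 2 w D) (b b' : OB) : lapD b D w x = lapD b' D w x := by
  simp only [lapD, pd_pd hD hx h]
  set B := fderivWithin ℝ (fderivWithin ℝ w D) D x
  have e : ∀ i, B (b i) (b i) = ∑ j, ∑ k, (inner ℝ (b' j) (b i) * inner ℝ (b i) (b' k)) * B (b' j) (b' k) := by
    intro i
    conv_lhs => rw [← b'.sum_repr' (b i)]
    simp only [map_sum, map_smul, _root_.sum_apply, FunLike.coe_smul, Pi.smul_apply, smul_eq_mul, Finset.mul_sum]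
    rw [Finset.sum_comm]
    refine Finset.sum_congr rfl fun j _ => Finset.sum_congr rfl fun k _ => ?_
    rw [real_inner_comm (b' k) (b i)]; ring
  simp only [e]
  rw [Finset.sum_comm]
  refine Finset.sum_congr rfl fun j _ => ?_
  rw [Finset.sum_comm]
  simp only [← Finset.sum_mul, b.sum_inner_mul_inner]
  rw [Finset.sum_eq_single j]
  · rw [b_self, one_mul]
  · intro k _ hk; rw [b_ne b' hk.symm, zero_mul]
  · simp

lemma pdW_eq (S : Set V3) (i : Fin 3) (u : V3 → ℝ) : pdW S i u = pd S (EuclideanSpace.basisFun (Fin 3) ℝ i) u := by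
  ext x; simp [pdW, pd]

lemma lapW_eq (S : Set V3) (u : V3 → ℝ) (x : V3) : lapW S u x = lapD (EuclideanSpace.basisFun (Fin 3) ℝ) S u x := by
  simp only [lapW, lapD, pdW_eq]

lemma lapD_affine {D D' : Set V3} (hD : UniqueDiffOn ℝ D) (hD' : UniqueDiffOn ℝ D') {p : V3} {c : ℝ} (hm : ∀ x ∈ D', p + c • x ∈ D) {w : V3 → ℝ}
    (hw : ContDiffOn ℝ 2 w D) (b : OB) {x : V3} (hx : x ∈ D') :
    lapD b D' (fun x => w (p + c • x)) x = c ^ 2 * lapD b D w (p + c • x) := by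
  simp only [lapD, Finset.mul_sum]
  refine Finset.sum_congr rfl fun i _ => ?_
  have h1 : DifferentiableOn ℝ (pd D (b i) w) D := (pd_contDiffOn hD (n := 2) (m := 1) (by norm_num) hw (b i)).differentiableOn (by simp)
  rw [pd_congr (w' := fun x => (fun y => c * pd D (b i) w y) (p + c • x)) (fun y hy => pd_affine hD' hm (hw.differentiableOn (by simp)) _ hy) _ hx,
    pd_affine hD' hm (h1.const_mul c) _ hx]
  have := ((h1 _ (hm x hx)).hasFDerivWithinAt.const_mul c).fderivWithin (hD _ (hm x hx))
  have t : pd D (b i) (fun y => c * pd D (b i) w y) (p + c • x) = c * pd D (b i) (pd D (b i) w) (p + c • x) :=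
    (congrArg (fun (T : V3 →L[ℝ] ℝ) => T (b i)) this).trans (by simp [pd])
  rw [t]; ring

lemma CH.smul {D : Set V3} (hD : UniqueDiffOn ℝ D) {b : OB} {α ρ : ℝ} {c : ℝ} (hc : 0 < c) {j : ℕ} 
    {A : ℝ} {w : V3 → ℝ} (h : CH D b α ρ j A w) : CH D b α ρ j (c * A) (fun x => c * w x) := by
  have h2 := CH.lin hD (c - 1) h h
  have h0 : CH D b α ρ j 0 (fun _ => (0:ℝ)) := by
    clear h2 h
    induction j with
    | zero => exact ⟨by simp, by simp⟩
    | succ j ih => 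
      refine ⟨by simp, differentiableOn_const _, fun i => ?_⟩
      rw [zero_div]
      refine ih.congr fun x hx => ?_
      simp [pd]
  have := CH.lin hD c h0 h
  rw [zero_add, abs_of_pos hc] at this
  exact this.congr fun x _ => by simp

lemma scaled_est (b : OB) {α : ℝ} (hα0 : 0 < α) (X : ℝ → Set V3) (hX : ∀ s, 0 < s → UniqueDiffOn ℝ (X s))
    (NC : Prop) (C : ℝ) (hC : 1 ≤ C)
    (H : ∀ (u f : V3 → ℝ) (A : ℝ), 0 ≤ A → ContDiffOn ℝ 2 u (X 1) → (∀ x ∈ X 1, lapD b (X 1) u x = f x) → (∀ x ∈ X 1, |u x| ≤ A) →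
      (NC → ∀ x ∈ X 1, (inner ℝ (b 2) x : ℝ) = 0 → pd (X 1) (b 2) u x = 0) → CH (X 1) b α 1 4 A f → CH (X (1/32)) b α 1 6 (C * A) u)
    {D D₂ : Set V3} (hD : UniqueDiffOn ℝ D) (hD₂ : UniqueDiffOn ℝ D₂) {p : V3} {ρ : ℝ} (hρ : 0 < ρ) (h1 : ∀ z ∈ X 1, p + ρ • z ∈ D) (h2 : ∀ x ∈ D₂, -(ρ⁻¹ • p) + ρ⁻¹ • x ∈ X (1/32))
    {u f : V3 → ℝ} {A : ℝ} (hA : 0 ≤ A) (hu : ContDiffOn ℝ 2 u D) (hf : ∀ x ∈ D, lapW D u x = f x) (hb : ∀ x ∈ D, |u x| ≤ A)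
    (hN : NC → ∀ x ∈ D, (inner ℝ (b 2) (x - p) : ℝ) = 0 → pd D (b 2) u x = 0) (hF : IB D α ρ 4 (A / ρ ^ 2) f) :
    IB D₂ α ρ 6 (3 ^ 6 * (C * A)) u := by
  have d1 := hX 1 one_pos
  have k := H (fun x => u (p + ρ • x)) (fun x => ρ ^ 2 * f (p + ρ • x)) A hA (hu.comp (by fun_prop) h1) ?_ (fun x hx => hb _ (h1 x hx)) ?_ ?_
  · have k2 := CH.affine hD₂ (inv_pos.2 hρ) h2 k
    rw [one_div, inv_inv] at k2
    refine CH.toIB hD₂ hα0 hρ (mul_nonneg (by linarith) hA) (k2.congr fun x _ => ?_)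
    congr 1
    rw [smul_add, smul_neg, smul_inv_smul₀ hρ.ne', smul_inv_smul₀ hρ.ne']; abel
  · intro x hx
    rw [lapD_affine hD d1 h1 hu b hx, lapD_basis hD (h1 x hx) hu b (EuclideanSpace.basisFun (Fin 3) ℝ), ← lapW_eq, hf _ (h1 x hx)]
  · intro nc x hx hx0
    rw [pd_affine d1 h1 (hu.differentiableOn (by simp)) _ hx, hN nc _ (h1 x hx), mul_zero]
    rw [add_sub_cancel_left, inner_smul_right, hx0, mul_zero]
  · have k3 := CH.smul d1 (pow_pos hρ 2) (CH.affine d1 hρ h1 (hF.toCH hD (b := b) hρ))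
    rw [div_self hρ.ne', mul_div_cancel₀ _ (by positivity)] at k3
    exact k3

open scoped ContDiff

lemma rx_eq (x : V3) : rx x = ‖(⟨x 0, x 2⟩ : ℂ)‖ := by
  rw [rx, Complex.norm_def, Complex.normSq_mk]; ring_nf

lemma rx_nonneg (x : V3) : 0 ≤ rx x := Real.sqrt_nonneg _
lemma rx_sq (x : V3) : rx x ^ 2 = x 0 ^ 2 + x 2 ^ 2 := Real.sq_sqrt (by positivity)
lemma rx_cont : Continuous rx := by unfold rx; fun_prop

lemma rx_add (x y : V3) : rx (x + y) ≤ rx x + rx y := by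
  rw [rx_eq, rx_eq, rx_eq]
  exact (le_of_eq (by congr 1)).trans (norm_add_le _ _)

lemma rx_smul (c : ℝ) (x : V3) : rx (c • x) = |c| * rx x := by
  unfold rx
  rw [← Real.sqrt_sq_eq_abs, ← Real.sqrt_mul (by positivity)]
  congr 1; simp; ring

lemma rx_le_norm (x : V3) : rx x ≤ ‖x‖ := by
  refine abs_le_of_sq_le_sq' ?_ (norm_nonneg _) |>.2
  rw [rx_sq, EuclideanSpace.norm_sq_eq, Fin.sum_univ_three]
  simp only [Real.norm_eq_abs, sq_abs]; nlinarith [sq_nonneg (x 1)]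

lemma rx_lip (x y : V3) : rx x ≤ rx y + ‖x - y‖ := by
  have := rx_add y (x - y)
  rw [add_sub_cancel] at this
  linarith [rx_le_norm (x - y)]

lemma abs_coord_le (x : V3) (i : Fin 3) : |x i| ≤ ‖x‖ := PiLp.norm_apply_le x i

lemma rx_zero_iff (x : V3) : rx x = 0 ↔ x ∈ edge := by
  have := rx_sq x
  constructor
  · intro h; rw [h] at this
    constructor <;> nlinarith [sq_nonneg (x 0), sq_nonneg (x 2)]
  · rintro ⟨h1, h2⟩; simp [rx, h1, h2]

lemma edge_closed : IsClosed edge := by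
  have : edge = rx ⁻¹' {0} := by ext x; simp [rx_zero_iff]
  rw [this]; exact isClosed_singleton.preimage rx_cont

/-- closed (truncated) wedge -/
def cW (b₀ : ℝ) : Set V3 := {x | 0 ≤ x 0 ∧ b₀ * x 0 ≤ x 2}

lemma cW_closed (b₀ : ℝ) : IsClosed (cW b₀) := by
  have h1 : IsClosed {x : V3 | 0 ≤ x 0} := isClosed_le (by fun_prop) (by fun_prop)
  have h2 : IsClosed {x : V3 | b₀ * x 0 ≤ x 2} := isClosed_le (by fun_prop) (by fun_prop)
  exact h1.inter h2

lemma wedge_approx {b₀ : ℝ} (x : V3) (hx : x ∈ cW b₀) {L : ℝ} (hL : 0 < L) :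
    ∃ q ∈ wedgeQ b₀, rx q < L ∧ ∀ t ∈ Ioc (0:ℝ) 1, x + t • (q - x) ∈ wedgeQ b₀ ∧ (rx x ≤ L → rx (x + t • (q - x)) < L) := by
  obtain ⟨s, hs, hs2⟩ : ∃ s : ℝ, 0 < s ∧ s * (1 + |b₀| + 1) < L := by
    refine ⟨L / (2 * (1 + |b₀| + 1)), by positivity, ?_⟩
    rw [div_mul_eq_mul_div, div_lt_iff₀ (by positivity)]; nlinarith [abs_nonneg b₀]
  have hq : rx (!₂[s, x 1, s * (|b₀| + 1)] : V3) < L := by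
    refine lt_of_le_of_lt ?_ hs2
    refine abs_le_of_sq_le_sq' ?_ (by positivity) |>.2
    rw [rx_sq]; simp
    nlinarith [abs_nonneg b₀, mul_pos hs hs, mul_nonneg (mul_pos hs hs).le (abs_nonneg b₀)]
  refine ⟨!₂[s, x 1, s * (|b₀| + 1)], ⟨by simpa using hs, ?_⟩, hq, fun t ht => ⟨⟨?_, ?_⟩, fun h => ?_⟩⟩
  · simp; nlinarith [le_abs_self b₀]
  · simp; nlinarith [hx.1, ht.1, ht.2, mul_pos ht.1 hs]
  · simp
    have h3 : b₀ * s < s * (|b₀| + 1) := by nlinarith [le_abs_self b₀]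
    nlinarith [hx.2, ht.1, ht.2, mul_lt_mul_of_pos_left h3 ht.1]
  · set q : V3 := !₂[s, x 1, s * (|b₀| + 1)]
    rw [show x + t • (q - x) = (1 - t) • x + t • q by module]
    refine (rx_add _ _).trans_lt ?_
    rw [rx_smul, rx_smul, abs_of_pos ht.1, abs_of_nonneg (by linarith [ht.2])]
    nlinarith [ht.1, ht.2, rx_nonneg x]

lemma mem_clQ {b₀ : ℝ} {x : V3} : x ∈ closure (wedgeQ b₀) ↔ x ∈ cW b₀ := by
  constructor
  · refine fun h => closure_minimal (fun y hy => ?_) (cW_closed b₀) h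
    exact ⟨hy.1.le, hy.2.le⟩
  · intro h
    obtain ⟨q, -, -, hq⟩ := wedge_approx x h one_pos
    have ht : Tendsto (fun t : ℝ => x + t • (q - x)) (𝓝[>] 0) (𝓝 (x + (0:ℝ) • (q - x))) :=
      (Continuous.tendsto (by fun_prop) 0).mono_left nhdsWithin_le_nhds
    rw [zero_smul, add_zero] at ht
    refine mem_closure_of_tendsto ht ?_
    filter_upwards [Ioc_mem_nhdsGT (zero_lt_one (α := ℝ))] with t h2 using (hq t h2).1

lemma mem_clQL {b₀ L : ℝ} (hL : 0 < L) {x : V3} : x ∈ closure (wedgeQL b₀ L) ↔ x ∈ cW b₀ ∧ rx x ≤ L := by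
  constructor
  · refine fun h => closure_minimal (t := cW b₀ ∩ {x | rx x ≤ L}) (fun y hy => ?_) ((cW_closed b₀).inter (isClosed_le rx_cont continuous_const)) h
    exact ⟨⟨hy.1.1.le, hy.1.2.le⟩, hy.2.le⟩
  · intro h
    obtain ⟨q, -, -, hq⟩ := wedge_approx x h.1 hL
    have ht : Tendsto (fun t : ℝ => x + t • (q - x)) (𝓝[>] 0) (𝓝 (x + (0:ℝ) • (q - x))) :=
      (Continuous.tendsto (by fun_prop) 0).mono_left nhdsWithin_le_nhds
    rw [zero_smul, add_zero] at ht
    refine mem_closure_of_tendsto ht ?_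
    filter_upwards [Ioc_mem_nhdsGT (zero_lt_one (α := ℝ))] with t h2 using ⟨(hq t h2).1, (hq t h2).2 h.2⟩

lemma rx_pos_iff {x : V3} : 0 < rx x ↔ x ∉ edge := by
  rw [← rx_zero_iff]; exact ⟨fun h => h.ne', fun h => lt_of_le_of_ne (rx_nonneg x) (Ne.symm h)⟩

lemma mem_SQ {b₀ : ℝ} {x : V3} : x ∈ SQ b₀ ↔ x ∈ cW b₀ ∧ 0 < rx x := by
  rw [SQ, Set.mem_sdiff, mem_clQ, rx_pos_iff]

lemma mem_SL {b₀ L : ℝ} (hL : 0 < L) {x : V3} : x ∈ SL b₀ L ↔ x ∈ cW b₀ ∧ 0 < rx x ∧ rx x ≤ L := by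
  rw [SL, Set.mem_sdiff, mem_clQL hL, rx_pos_iff]; tauto

lemma wedgeQ_open (b₀ : ℝ) : IsOpen (wedgeQ b₀) := by
  have h1 : IsOpen {x : V3 | 0 < x 0} := isOpen_lt (by fun_prop) (by fun_prop)
  have h2 : IsOpen {x : V3 | b₀ * x 0 < x 2} := isOpen_lt (by fun_prop) (by fun_prop)
  exact h1.inter h2

lemma wedgeQL_open (b₀ L : ℝ) : IsOpen (wedgeQL b₀ L) := (wedgeQ_open b₀).inter (isOpen_lt rx_cont continuous_const)

lemma wedgeQ_convex (b₀ : ℝ) : Convex ℝ (wedgeQ b₀) := by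
  intro x hx y hy s t hs ht hst
  have : 0 < s ∨ 0 < t := by by_contra! h; linarith
  refine ⟨?_, ?_⟩
  · simp
    rcases this with h | h
    · nlinarith [mul_pos h hx.1, mul_nonneg ht hy.1.le]
    · nlinarith [mul_pos h hy.1, mul_nonneg hs hx.1.le]
  · simp
    rcases this with h | h
    · nlinarith [mul_lt_mul_of_pos_left hx.2 h, mul_le_mul_of_nonneg_left hy.2.le ht]
    · nlinarith [mul_lt_mul_of_pos_left hy.2 h, mul_le_mul_of_nonneg_left hx.2.le hs]

lemma wedgeQL_convex (b₀ L : ℝ) : Convex ℝ (wedgeQL b₀ L) := by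
  intro x hx y hy s t hs ht hst
  refine ⟨wedgeQ_convex b₀ hx.1 hy.1 hs ht hst, (rx_add _ _).trans_lt ?_⟩
  rw [rx_smul, rx_smul, abs_of_nonneg hs, abs_of_nonneg ht]
  have h1 := hx.2
  have h2 := hy.2
  have : 0 < s ∨ 0 < t := by by_contra! h; linarith
  rw [show L = s * L + t * L by rw [← add_mul, hst, one_mul]] 
  rcases this with h | h
  · nlinarith [mul_lt_mul_of_pos_left h1 h, mul_le_mul_of_nonneg_left h2.le ht]
  · nlinarith [mul_lt_mul_of_pos_left h2 h, mul_le_mul_of_nonneg_left h1.le hs]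

lemma wedgeQL_ne (b₀ : ℝ) {L : ℝ} (hL : 0 < L) : (wedgeQL b₀ L).Nonempty := by
  obtain ⟨q, h1, h2, -⟩ := wedge_approx (b₀ := b₀) 0 ⟨by simp, by simp⟩ hL
  exact ⟨q, h1, h2⟩

lemma wedgeQL_sub (b₀ L : ℝ) : wedgeQL b₀ L ⊆ wedgeQ b₀ := fun _ h => h.1

lemma SQ_ud (b₀ : ℝ) : UniqueDiffOn ℝ (SQ b₀) := by
  refine (uniqueDiffOn_convex (wedgeQ_convex b₀).closure ?_).inter edge_closed.isOpen_compl
  obtain ⟨q, hq⟩ := wedgeQL_ne b₀ one_pos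
  exact ⟨q, interior_maximal subset_closure (wedgeQ_open b₀) hq.1⟩

lemma SL_ud (b₀ : ℝ) {L : ℝ} (hL : 0 < L) : UniqueDiffOn ℝ (SL b₀ L) := by
  refine (uniqueDiffOn_convex (wedgeQL_convex b₀ L).closure ?_).inter edge_closed.isOpen_compl
  obtain ⟨q, hq⟩ := wedgeQL_ne b₀ hL
  exact ⟨q, interior_maximal subset_closure (wedgeQL_open b₀ L) hq⟩

lemma wedgeQL_sub_SL {b₀ L : ℝ} : wedgeQL b₀ L ⊆ SL b₀ L := fun x hx =>
  ⟨subset_closure hx, fun h => by have := hx.1.1; have := h.1; linarith⟩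
lemma wedgeQ_sub_SQ {b₀ : ℝ} : wedgeQ b₀ ⊆ SQ b₀ := fun x hx =>
  ⟨subset_closure hx, fun h => by have := hx.1; have := h.1; linarith⟩

lemma SL_inter {b₀ L : ℝ} (hL : 0 < L) : SL b₀ L ∩ {x | rx x < L} = SQ b₀ ∩ {x | rx x < L} := by
  ext x
  simp only [mem_inter_iff, mem_SL hL, mem_SQ, mem_ofPred_eq]
  constructor
  · rintro ⟨⟨h1, h2, h3⟩, h4⟩; exact ⟨⟨h1, h2⟩, h4⟩
  · rintro ⟨⟨h1, h2⟩, h4⟩; exact ⟨⟨h1, h2, h4.le⟩, h4⟩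

lemma rxlt_open (L : ℝ) : IsOpen {x : V3 | rx x < L} := isOpen_lt rx_cont continuous_const

lemma exists_OB (n : V3) (hn : ‖n‖ = 1) : ∃ b : OB, b 2 = n := by
  have hv : Orthonormal ℝ (({2} : Set (Fin 3)).domRestrict (fun _ => n)) := by
    constructor
    · intro i; exact hn
    · intro i j hij
      exact absurd (Subsingleton.elim i j) hij
  obtain ⟨b, hb⟩ := hv.exists_orthonormalBasis_extension_of_card_eq (by simp)
  exact ⟨b, hb 2 rfl⟩

open scoped ContDiff

lemma face_est (n : V3) (hn : ‖n‖ = 1) {α : ℝ} (hα0 : 0 < α) (hα1 : α < 1) : ∃ C, 1 ≤ C ∧ ∀ (b₀ : ℝ) (m x₀ : V3) (ρ : ℝ), ‖m‖ = 1 → 0 < ρ → 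
    (∀ x, x ∈ SQ b₀ ↔ (0 ≤ (inner ℝ n x : ℝ) ∧ 0 ≤ (inner ℝ m x : ℝ)) ∧ 0 < rx x) → x₀ ∈ SQ b₀ → 4 * ρ ≤ inner ℝ m x₀ → inner ℝ n x₀ ≤ ρ / 64 → 8 * ρ ≤ rx x₀ →
    ∀ (u f : V3 → ℝ) (A : ℝ), 0 ≤ A → ContDiffOn ℝ 2 u (SQ b₀ ∩ Metric.ball x₀ (rx x₀ / 2)) →
    (∀ x ∈ SQ b₀ ∩ Metric.ball x₀ (rx x₀ / 2), lapW (SQ b₀ ∩ Metric.ball x₀ (rx x₀ / 2)) u x = f x) →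
    (∀ x ∈ SQ b₀ ∩ Metric.ball x₀ (rx x₀ / 2), |u x| ≤ A) →
    (∀ x ∈ SQ b₀ ∩ Metric.ball x₀ (rx x₀ / 2), (inner ℝ n x : ℝ) = 0 → pd (SQ b₀ ∩ Metric.ball x₀ (rx x₀ / 2)) n u x = 0) →
    IB (SQ b₀ ∩ Metric.ball x₀ (rx x₀ / 2)) α ρ 4 (A / ρ ^ 2) f → 
    IB (SQ b₀ ∩ Metric.ball x₀ (ρ / 64)) α ρ 6 (3 ^ 6 * (C * A)) u := by
  obtain ⟨b, hb⟩ := exists_OB n hn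
  obtain ⟨C, hC, H⟩ := half_est b hα0 hα1
  refine ⟨C, hC, fun b₀ m x₀ ρ hm hρ hmem hx₀ h4 h5 h6 u f A hA hu hf hbd hN hF => ?_⟩
  set p := x₀ - (inner ℝ n x₀ : ℝ) • n with hp
  have hn0 := ((hmem x₀).1 hx₀).1.1
  have hnn : (inner ℝ n n : ℝ) = 1 := by rw [real_inner_self_eq_norm_sq, hn]; norm_num
  have hpx : ‖x₀ - p‖ ≤ ρ / 64 := by
    rw [hp, sub_sub_cancel, norm_smul, hn, mul_one, Real.norm_of_nonneg hn0]; exact h5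
  have hnp : (inner ℝ n p : ℝ) = 0 := by
    rw [hp, inner_sub_right, inner_smul_right, hnn]; ring
  refine scaled_est b hα0 (HB b) (fun s hs => HB_ud b hs) True C hC (fun u f A a1 a2 a3 a4 a5 a6 => H u f A a1 a2 a3 a4 (a5 trivial) a6)
    ((SQ_ud b₀).inter Metric.isOpen_ball) ((SQ_ud b₀).inter Metric.isOpen_ball) hρ (p := p) ?_ ?_ hA hu hf hbd ?_ hF
  · rintro z ⟨hz1, hz2⟩
    rw [mem_ball_zero_iff] at hz2
    have e1 : ‖p + ρ • z - x₀‖ < ρ + ρ / 64 := by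
      rw [show p + ρ • z - x₀ = ρ • z - (x₀ - p) by abel]
      refine (norm_sub_le _ _).trans_lt ?_
      rw [norm_smul, Real.norm_of_nonneg hρ.le]
      nlinarith
    refine ⟨(hmem _).2 ⟨⟨?_, ?_⟩, ?_⟩, ?_⟩
    · rw [inner_add_right, hnp, inner_smul_right, zero_add]
      have : 0 ≤ (inner ℝ (b 2) z : ℝ) := hz1
      rw [hb] at this; positivity
    · have : (inner ℝ m (p + ρ • z) : ℝ) = inner ℝ m x₀ + inner ℝ m (p + ρ • z - x₀) := by rw [← inner_add_right]; congr 1; abel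
      rw [this]
      have := abs_real_inner_le_norm m (p + ρ • z - x₀)
      rw [hm, one_mul] at this
      linarith [neg_abs_le (inner ℝ m (p + ρ • z - x₀) : ℝ)]
    · have := rx_lip x₀ (p + ρ • z)
      rw [norm_sub_rev] at this
      linarith
    · rw [mem_ball_iff_norm]; linarith
  · rintro x ⟨hx1, hx2⟩
    rw [mem_ball_iff_norm] at hx2
    have e : -(ρ⁻¹ • p) + ρ⁻¹ • x = ρ⁻¹ • (x - p) := by rw [smul_sub ρ⁻¹ x p]; exact neg_add_eq_sub _ _
    rw [e]
    constructor
    · change 0 ≤ (inner ℝ (b 2) _ : ℝ)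
      rw [hb, inner_smul_right, inner_sub_right, hnp, sub_zero]
      have := ((hmem x).1 hx1).1.1
      positivity
    · rw [mem_ball_zero_iff, norm_smul, norm_inv, Real.norm_of_nonneg hρ.le, inv_mul_lt_iff₀ hρ]
      rw [show x - p = (x - x₀) + (x₀ - p) by abel]
      refine (norm_add_le _ _).trans_lt ?_
      linarith
  · intro _ x hx h0
    rw [hb] at h0 ⊢
    refine hN x hx ?_
    rwa [inner_sub_right, hnp, sub_zero] at h0

lemma inner_e (i : Fin 3) (x : V3) : (inner ℝ (EuclideanSpace.single i 1 : V3) x : ℝ) = x i := by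
  rw [EuclideanSpace.inner_single_left]; simp

lemma inner_e0 (x : V3) : (inner ℝ (EuclideanSpace.single 0 1 : V3) x : ℝ) = x 0 := inner_e 0 x

/-- unit normal to the face `y₃ = b₀ y₁` -/
def nf (b₀ : ℝ) : V3 := (√(1 + b₀^2))⁻¹ • (EuclideanSpace.single 2 1 - b₀ • EuclideanSpace.single 0 1)

lemma inner_nf (b₀ : ℝ) (x : V3) : (inner ℝ (nf b₀) x : ℝ) = (√(1 + b₀^2))⁻¹ * (x 2 - b₀ * x 0) := by
  rw [nf, inner_smul_left, inner_sub_left, inner_smul_left, inner_e, inner_e]; simp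

lemma norm_nf (b₀ : ℝ) : ‖nf b₀‖ = 1 := by
  have h : 0 < 1 + b₀^2 := by positivity
  have : ‖nf b₀‖^2 = 1 := by
    rw [← real_inner_self_eq_norm_sq, inner_nf]
    have : nf b₀ 2 - b₀ * nf b₀ 0 = (√(1 + b₀^2))⁻¹ * (1 + b₀^2) := by simp [nf]; ring
    rw [this, ← mul_assoc, ← mul_inv, Real.mul_self_sqrt h.le, inv_mul_cancel₀ h.ne']
  nlinarith [norm_nonneg (nf b₀)]

lemma pd_nf {D : Set V3} (b₀ : ℝ) (u : V3 → ℝ) (x : V3) : pd D (nf b₀) u x = (√(1 + b₀^2))⁻¹ * (pdW D 2 u x - b₀ * pdW D 0 u x) := by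
  simp [pd, pdW, nf]

lemma local_est {b₀ α : ℝ} (hb₀ : 0 < b₀) (hα0 : 0 < α) (hα1 : α < 1) : ∃ C c, 1 ≤ C ∧ 0 < c ∧ c < 1/8 ∧ ∀ (x₀ : V3), x₀ ∈ SQ b₀ →
    ∀ (u f : V3 → ℝ) (A : ℝ), 0 ≤ A → ContDiffOn ℝ 2 u (SQ b₀ ∩ Metric.ball x₀ (rx x₀ / 2)) →
    (∀ x ∈ SQ b₀ ∩ Metric.ball x₀ (rx x₀ / 2), lapW (SQ b₀ ∩ Metric.ball x₀ (rx x₀ / 2)) u x = f x) →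
    (∀ x ∈ SQ b₀ ∩ Metric.ball x₀ (rx x₀ / 2), |u x| ≤ A) →
    (∀ x ∈ SQ b₀ ∩ Metric.ball x₀ (rx x₀ / 2), x 0 = 0 → pdW (SQ b₀ ∩ Metric.ball x₀ (rx x₀ / 2)) 0 u x = 0) →
    (∀ x ∈ SQ b₀ ∩ Metric.ball x₀ (rx x₀ / 2), x 2 = b₀ * x 0 → b₀ * pdW (SQ b₀ ∩ Metric.ball x₀ (rx x₀ / 2)) 0 u x - pdW (SQ b₀ ∩ Metric.ball x₀ (rx x₀ / 2)) 2 u x = 0) →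
    IB (SQ b₀ ∩ Metric.ball x₀ (rx x₀ / 2)) α (rx x₀) 4 (A / rx x₀ ^ 2) f → 
    IB (SQ b₀ ∩ Metric.ball x₀ (c * rx x₀)) α (rx x₀) 6 (C * A) u := by
  obtain ⟨C1, hC1, H1⟩ := face_est (EuclideanSpace.single 0 1) (by simp) hα0 hα1
  obtain ⟨C2, hC2, H2⟩ := face_est (nf b₀) (norm_nf b₀) hα0 hα1
  obtain ⟨C3, hC3, H3⟩ := int_est (EuclideanSpace.basisFun (Fin 3) ℝ) hα0 hα1
  set s := √(1 + b₀^2) with hs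
  have hs0 : 1 ≤ s := by rw [hs, Real.one_le_sqrt]; nlinarith
  set τ := 1 / (4 * (1 + b₀ + s)) with hτ
  have hτ0 : 0 < τ := by positivity
  have hτ1 : τ ≤ 1 / 8 := by rw [hτ]; gcongr; linarith
  refine ⟨3 ^ 6 * (C1 + C2 + C3) / (τ / 64) ^ 7, τ / 64 / 32, ?_, by positivity, by linarith, ?_⟩
  · rw [le_div_iff₀ (by positivity)]
    have : (τ / 64) ^ 7 ≤ 1 := pow_le_one₀ (by positivity) (by linarith)
    linarith
  intro x₀ hx₀ u f A hA hu hf hbd hN1 hN2 hF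
  obtain ⟨⟨hx1, hx2⟩, hr⟩ := mem_SQ.1 hx₀
  set r := rx x₀
  have hsp : 0 < s := by linarith
  have hd2 : ∀ x : V3, x 2 = s * inner ℝ (nf b₀) x + b₀ * x 0 := by
    intro x; rw [inner_nf, ← hs, mul_inv_cancel_left₀ hsp.ne']; ring
  have hmem : ∀ x, x ∈ SQ b₀ ↔ (0 ≤ (inner ℝ (EuclideanSpace.single 0 1 : V3) x : ℝ) ∧ 0 ≤ (inner ℝ (nf b₀) x : ℝ)) ∧ 0 < rx x := by
    intro x; rw [mem_SQ, inner_e0]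
    have : b₀ * x 0 ≤ x 2 ↔ 0 ≤ (inner ℝ (nf b₀) x : ℝ) := by
      rw [inner_nf, ← hs, ← sub_nonneg, mul_nonneg_iff_of_pos_left (by positivity)]
    rw [← this]; rfl
  have hr2 : r ≤ (1 + b₀) * x₀ 0 + s * inner ℝ (nf b₀) x₀ := by
    refine abs_le_of_sq_le_sq' (a := r) (b := (1 + b₀) * x₀ 0 + s * inner ℝ (nf b₀) x₀) ?_ ?_ |>.2
    · rw [rx_sq]
      have e : (1 + b₀) * x₀ 0 + s * inner ℝ (nf b₀) x₀ = x₀ 0 + x₀ 2 := by rw [hd2 x₀]; ring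
      rw [e]; nlinarith [mul_nonneg hx1 ((mul_nonneg hb₀.le hx1).trans hx2)]
    · have := ((hmem x₀).1 hx₀).1.2; positivity
  have hτr : 0 < τ * r := by positivity
  have hKr : r = 4 * (τ * r) * (1 + b₀ + s) := by rw [hτ]; field_simp
  have key : ∀ {σ C' : ℝ} {O : Set V3}, 0 ≤ C' → C' ≤ C1 + C2 + C3 → 0 < σ → σ ≤ 1 → (τ / 64) ≤ σ → Metric.ball x₀ (τ / 64 / 32 * r) ⊆ O → IB (SQ b₀ ∩ O) α (σ * r) 6 (3 ^ 6 * (C' * A)) u → IB (SQ b₀ ∩ Metric.ball x₀ (τ / 64 / 32 * r)) α r 6 (3 ^ 6 * (C1 + C2 + C3) / (τ / 64) ^ 7 * A) u := by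
    intro σ C' O h0 h1 h2 h3 h4 h5 h6
    have h7 := (h6.grow hα0 hα1 hr h2 h3 (by positivity)).sub (Metric.isOpen_ball (x := x₀) (ε := τ / 64 / 32 * r))
    rw [inter_assoc, inter_eq_self_of_subset_right h5] at h7
    refine h7.mono hr ?_
    rw [mul_comm C', div_mul_eq_mul_div, mul_assoc, mul_comm _ A]
    gcongr
  have hA2 : ∀ {ρ}, 0 < ρ → ρ ≤ r → IB (SQ b₀ ∩ Metric.ball x₀ (r / 2)) α ρ 4 (A / ρ ^ 2) f := by
    intro ρ h1 h2
    refine (hF.shrink hα0 h1 h2 (by positivity)).mono h1 (by gcongr)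
  by_cases c1 : x₀ 0 ≤ τ * r / 64
  · have := H1 b₀ (nf b₀) x₀ (τ * r) (norm_nf b₀) hτr hmem hx₀ ?_ ?_ ?_ u f A hA hu hf hbd ?_ (hA2 hτr (by nlinarith))
    · exact key (by linarith) (by linarith) hτ0 (by linarith) (by linarith) (Metric.ball_subset_ball (by nlinarith)) this
    · by_contra! h
      have : s * inner ℝ (nf b₀) x₀ < s * (4 * (τ * r)) := by gcongr
      have : (1 + b₀) * x₀ 0 ≤ (1 + b₀) * (τ * r / 64) := by gcongr
      nlinarith
    · rw [inner_e0]; exact c1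
    · nlinarith
    · intro x hx h0
      rw [inner_e0] at h0
      exact hN1 x hx h0
  by_cases c2 : inner ℝ (nf b₀) x₀ ≤ τ * r / 64
  · have := H2 b₀ (EuclideanSpace.single 0 1) x₀ (τ * r) (by simp) hτr (fun x => by rw [hmem x]; tauto) hx₀ ?_ ?_ ?_ u f A hA hu hf hbd ?_ (hA2 hτr (by nlinarith))
    · exact key (by linarith) (by linarith) hτ0 (by linarith) (by linarith) (Metric.ball_subset_ball (by nlinarith)) this
    · rw [inner_e0]
      by_contra! h
      have : s * inner ℝ (nf b₀) x₀ ≤ s * (τ * r / 64) := by gcongr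
      have : (1 + b₀) * x₀ 0 < (1 + b₀) * (4 * (τ * r)) := by gcongr
      nlinarith
    · exact c2
    · nlinarith
    · intro x hx h0
      rw [inner_nf, ← hs] at h0
      have h1 := (mul_eq_zero.1 h0).resolve_left (by positivity)
      rw [pd_nf, ← hs]
      have := hN2 x hx (by linarith)
      rw [show pdW (SQ b₀ ∩ Metric.ball x₀ (rx x₀ / 2)) 2 u x - b₀ * pdW (SQ b₀ ∩ Metric.ball x₀ (rx x₀ / 2)) 0 u x = 0 by linarith, mul_zero]
  push Not at c1 c2
  have hρ : 0 < τ / 64 * r := by positivity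
  have := scaled_est (EuclideanSpace.basisFun (Fin 3) ℝ) hα0 (fun s => Metric.ball 0 s) (fun s hs => Metric.isOpen_ball.uniqueDiffOn) False C3 hC3 (fun u f A a1 a2 a3 a4 a5 a6 => H3 u f A a1 a2 a3 a4 a6)
    ((SQ_ud b₀).inter Metric.isOpen_ball) (((SQ_ud b₀).inter (Metric.isOpen_ball (x := x₀) (ε := τ / 64 / 32 * r)))) hρ (p := x₀) ?_ ?_ hA hu hf hbd (fun h => h.elim) (hA2 hρ (by nlinarith))
  · exact key (by linarith) (by linarith) (by positivity) (by linarith) (by linarith) subset_rfl this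
  · intro z hz
    rw [mem_ball_zero_iff] at hz
    have e : ‖(τ / 64 * r) • z‖ < τ / 64 * r := by
      rw [norm_smul, Real.norm_of_nonneg hρ.le]; nlinarith
    have e2 : τ / 64 * r ≤ r / 8 := by nlinarith
    refine ⟨(hmem _).2 ⟨⟨?_, ?_⟩, ?_⟩, ?_⟩
    · rw [inner_add_right, inner_e0 x₀]
      have := abs_real_inner_le_norm (EuclideanSpace.single 0 1 : V3) ((τ / 64 * r) • z)
      rw [show ‖(EuclideanSpace.single 0 1 : V3)‖ = 1 by simp, one_mul] at this
      linarith [neg_abs_le (inner ℝ (EuclideanSpace.single 0 1 : V3) ((τ / 64 * r) • z) : ℝ)]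
    · rw [inner_add_right]
      have := abs_real_inner_le_norm (nf b₀) ((τ / 64 * r) • z)
      rw [norm_nf, one_mul] at this
      linarith [neg_abs_le (inner ℝ (nf b₀) ((τ / 64 * r) • z) : ℝ)]
    · have := rx_lip x₀ (x₀ + (τ / 64 * r) • z)
      rw [sub_add_cancel_left, norm_neg] at this
      linarith
    · rw [mem_ball_iff_norm, add_sub_cancel_left]; linarith
  · rintro x ⟨hx1, hx2⟩
    rw [mem_ball_iff_norm] at hx2
    rw [show -((τ / 64 * r)⁻¹ • x₀) + (τ / 64 * r)⁻¹ • x = (τ / 64 * r)⁻¹ • (x - x₀) by rw [smul_sub]; abel]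
    rw [mem_ball_zero_iff, norm_smul, norm_inv, Real.norm_of_nonneg hρ.le, inv_mul_lt_iff₀ hρ]
    linarith

open scoped ContDiff

/-- symmetric second derivative -/
def SD (g : ℝ → ℝ) (x l : ℝ) : Prop := Tendsto (fun ε : ℝ => (g (x + ε) + g (x - ε) - 2 * g x) / ε ^ 2) (𝓝[>] 0) (𝓝 l)

lemma SD.add {g k : ℝ → ℝ} {x l m : ℝ} (h : SD g x l) (h' : SD k x m) : SD (fun y => g y + k y) x (l + m) := by
  refine (Tendsto.add h h').congr fun ε => ?_
  ring

lemma SD.cmul {g : ℝ → ℝ} {x l : ℝ} (h : SD g x l) (c : ℝ) : SD (fun y => c * g y) x (c * l) := by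
  refine (Tendsto.const_mul c h).congr fun ε => ?_
  ring

lemma SD.sub {g k : ℝ → ℝ} {x l m : ℝ} (h : SD g x l) (h' : SD k x m) : SD (fun y => g y - k y) x (l - m) := by
  refine (Tendsto.sub h h').congr fun ε => ?_
  ring

lemma SD.neg {g : ℝ → ℝ} {x l : ℝ} (h : SD g x l) : SD (fun y => - g y) x (- l) := by
  refine (Tendsto.neg h).congr fun ε => ?_
  ring

lemma SD_const (c x : ℝ) : SD (fun _ => c) x 0 := by
  refine tendsto_const_nhds.congr fun ε => ?_
  ring

lemma SD.shift {g : ℝ → ℝ} {a x l : ℝ} (h : SD g (a + x) l) : SD (fun y => g (a + y)) x l := by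
  refine Tendsto.congr (fun ε => ?_) h
  show (g (a + x + ε) + g (a + x - ε) - 2 * g (a + x)) / ε ^ 2 = (g (a + (x + ε)) + g (a + (x - ε)) - 2 * g (a + x)) / ε ^ 2
  rw [show a + (x + ε) = a + x + ε by ring, show a + (x - ε) = a + x - ε by ring]

lemma SD.rshift {g : ℝ → ℝ} {a x l : ℝ} (h : SD g (a - x) l) : SD (fun y => g (a - y)) x l := by
  refine Tendsto.congr (fun ε => ?_) h
  show (g (a - x + ε) + g (a - x - ε) - 2 * g (a - x)) / ε ^ 2 = (g (a - (x + ε)) + g (a - (x - ε)) - 2 * g (a - x)) / ε ^ 2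
  rw [show a - (x + ε) = a - x - ε by ring, show a - (x - ε) = a - x + ε by ring]; ring

lemma SD.nonpos {g : ℝ → ℝ} {x l r : ℝ} (hr : 0 < r) (h : SD g x l) (hm : ∀ y, |y - x| < r → g y ≤ g x) : l ≤ 0 := by
  refine le_of_tendsto h ?_
  filter_upwards [Ioo_mem_nhdsGT hr] with ε hε
  have h1 := hm (x + ε) (by rw [add_sub_cancel_left, abs_of_pos hε.1]; exact hε.2)
  have h2 := hm (x - ε) (by rw [sub_sub_cancel_left, abs_neg, abs_of_pos hε.1]; exact hε.2)
  exact div_nonpos_of_nonpos_of_nonneg (by linarith) (by positivity)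

lemma SD_of_deriv {g g' : ℝ → ℝ} {x l r : ℝ} (hr : 0 < r) (h1 : ∀ y, |y - x| < r → HasDerivAt g (g' y) y) (h2 : HasDerivAt g' l x) : SD g x l := by
  have hp : ∀ ε ∈ Ioo 0 r, HasDerivAt (fun ε => g (x + ε) + g (x - ε) - 2 * g x) (g' (x + ε) - g' (x - ε)) ε := by
    intro ε hε
    have a1 := (h1 (x + ε) (by rw [add_sub_cancel_left, abs_of_pos hε.1]; exact hε.2)).comp_const_add x ε
    have a2 := (h1 (x - ε) (by rw [sub_sub_cancel_left, abs_neg, abs_of_pos hε.1]; exact hε.2)).comp_const_sub x ε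
    exact ((a1.add a2).sub_const _).congr_deriv (by ring)
  have hcont := (h1 x (by simpa using hr)).continuousAt
  refine HasDerivAt.lhopital_zero_nhdsGT (f' := fun ε => g' (x + ε) - g' (x - ε)) (g' := fun ε => 2 * ε) ?_ ?_ ?_ ?_ ?_ ?_
  · filter_upwards [Ioo_mem_nhdsGT hr] with ε hε using hp ε hε
  · filter_upwards with ε
    simpa using hasDerivAt_pow 2 ε
  · filter_upwards [self_mem_nhdsWithin] with ε hε
    have : 0 < ε := hε
    positivity
  · have c1 : Tendsto (fun ε : ℝ => g (x + ε)) (𝓝 0) (𝓝 (g x)) := by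
      have : Tendsto (fun ε : ℝ => x + ε) (𝓝 0) (𝓝 x) := by simpa using (continuous_const_add x).tendsto 0
      exact hcont.tendsto.comp this
    have c2 : Tendsto (fun ε : ℝ => g (x - ε)) (𝓝 0) (𝓝 (g x)) := by
      have : Tendsto (fun ε : ℝ => x - ε) (𝓝 0) (𝓝 x) := by simpa using (continuous_sub_left x).tendsto 0
      exact hcont.tendsto.comp this
    have := ((c1.add c2).sub_const (2 * g x)).mono_left (nhdsWithin_le_nhds (s := Ioi 0))
    simpa [two_mul] using this
  · have := ((continuous_pow 2).tendsto (0:ℝ)).mono_left (nhdsWithin_le_nhds (s := Ioi 0))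
    simpa using this
  · have d1 : HasDerivAt (fun ε => g' (x + ε)) l 0 := by
      have := HasDerivAt.comp_const_add x 0 (f := g') (f' := l) (by simpa using h2); exact this
    have d2 : HasDerivAt (fun ε => g' (x - ε)) (-l) 0 := by
      have := HasDerivAt.comp_const_sub x 0 (f := g') (f' := l) (by simpa using h2); exact this
    have d := ((d1.sub d2).const_mul (1/2)).tendsto_slope_zero_right
    have e : (1/2 : ℝ) * (l - -l) = l := by ring
    rw [e] at d
    refine d.congr' ?_
    filter_upwards [self_mem_nhdsWithin] with ε hε
    have : 0 < ε := hε
    simp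
    field_simp

/-- edge barrier -/
def ee (T t : ℝ) : ℝ := (T - t) + Real.exp (2 * (t - T))

lemma ee_nonneg {T t : ℝ} (h : t ≤ T) : 0 ≤ ee T t := by
  unfold ee; have := Real.exp_pos (2 * (t - T)); linarith
lemma ee_hd (T t : ℝ) : HasDerivAt (ee T) (-1 + 2 * Real.exp (2 * (t - T))) t := by
  have h1 : HasDerivAt (fun t : ℝ => 2 * (t - T)) 2 t := by simpa using ((hasDerivAt_id t).sub_const T).const_mul 2
  have h2 : HasDerivAt (fun t : ℝ => T - t) (-1) t := by simpa using (hasDerivAt_id t).const_sub T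
  exact (h2.add h1.exp).congr_deriv (by ring)
lemma ee_cont (T : ℝ) : Continuous (ee T) := by unfold ee; fun_prop
lemma ee_SD (T t : ℝ) : SD (ee T) t (4 * Real.exp (2 * (t - T))) := by
  refine SD_of_deriv one_pos (fun y _ => ee_hd T y) ?_
  have h1 : HasDerivAt (fun t : ℝ => 2 * (t - T)) 2 t := by simpa using ((hasDerivAt_id t).sub_const T).const_mul 2
  exact ((h1.exp.const_mul 2).const_add (-1)).congr_deriv (by ring)

lemma deriv_max {g : ℝ → ℝ} {T d : ℝ} (h : HasDerivWithinAt g d (Iic T) T) (hm : ∀ t ≤ T, g t ≤ g T) : 0 ≤ d := by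
  have h1 := hasDerivWithinAt_iff_tendsto_slope.1 h
  have h2 : (𝓝[Iic T \ {T}] T).NeBot := by
    have : Iic T \ {T} = Iio T := by ext x; simp [lt_iff_le_and_ne]
    rw [this]; infer_instance
  refine ge_of_tendsto h1 ?_
  filter_upwards [self_mem_nhdsWithin] with t ht
  have h3 : t ≤ T := ht.1
  have h4 : t ≠ T := ht.2
  rw [slope_def_field]
  have := hm t h3
  exact div_nonneg_of_nonpos (by linarith) (by linarith)

lemma MP {Z : Type*} [TopologicalSpace Z] {T B : ℝ} {K Zs : Set Z} (hK : IsCompact K) (hKZ : K ⊆ Zs) (G : ℝ → Z → ℝ)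
    (hc : ContinuousOn (fun p : ℝ × Z => G p.1 p.2) (Iic T ×ˢ K)) (hret : ∀ z ∈ Zs, ∃ z' ∈ K, ∀ t ≤ T, G t z = G t z')
    (hB : ∀ t ≤ T, ∀ z ∈ K, G t z ≤ B) {ε₀ : ℝ} (hε₀ : 0 < ε₀)
    (hmax : ∀ ε, 0 < ε → ε < ε₀ → ∀ t ≤ T, ∀ z ∈ Zs, (∀ t' ≤ T, ∀ z' ∈ Zs, G t' z' - ε * ee T t' ≤ G t z - ε * ee T t) → 0 < G t z → False) :
    ∀ t ≤ T, ∀ z ∈ Zs, G t z ≤ 0 := by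
  intro t₀ ht₀ z₀ hz₀
  by_contra! hpos
  obtain ⟨z₁, hz₁, hz₁e⟩ := hret z₀ hz₀
  set e0 := ee T t₀ with he0
  have he0n : 0 ≤ e0 := ee_nonneg ht₀
  obtain ⟨ε, hε, hε1, hε2⟩ : ∃ ε, 0 < ε ∧ ε < ε₀ ∧ 0 < G t₀ z₁ - ε * e0 := by
    rw [hz₁e t₀ ht₀] at hpos
    refine ⟨min (ε₀ / 2) (G t₀ z₁ / (2 * (e0 + 1))), by positivity, (min_le_left _ _).trans_lt (by linarith), ?_⟩
    have h2 := mul_le_mul_of_nonneg_right (min_le_right (ε₀ / 2) (G t₀ z₁ / (2 * (e0 + 1)))) he0n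
    have h3 : G t₀ z₁ / (2 * (e0 + 1)) * e0 < G t₀ z₁ := by
      rw [div_mul_eq_mul_div, div_lt_iff₀ (by positivity)]; nlinarith
    linarith
  set t₁ := min t₀ (T - (|B| + 1) / ε) with ht₁
  have hcomp : IsCompact (Icc t₁ T ×ˢ K) := isCompact_Icc.prod hK
  have hne : (Icc t₁ T ×ˢ K).Nonempty := ⟨(t₀, z₁), ⟨min_le_left _ _, ht₀⟩, hz₁⟩
  have hcg : ContinuousOn (fun p : ℝ × Z => G p.1 p.2 - ε * ee T p.1) (Icc t₁ T ×ˢ K) := by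
    refine (hc.mono (prod_mono (fun x hx => hx.2) subset_rfl)).sub ?_
    exact (continuous_const.mul ((ee_cont T).comp continuous_fst)).continuousOn
  obtain ⟨⟨tm, zm⟩, ⟨hm1, hm2⟩, hm3⟩ := hcomp.exists_isMaxOn hne hcg
  have hbig : G t₀ z₁ - ε * e0 ≤ G tm zm - ε * ee T tm :=
    hm3 (show (t₀, z₁) ∈ Icc t₁ T ×ˢ K from ⟨⟨min_le_left _ _, ht₀⟩, hz₁⟩)
  have hall : ∀ t' ≤ T, ∀ z' ∈ K, G t' z' - ε * ee T t' ≤ G tm zm - ε * ee T tm := by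
    intro t' ht' z' hz'
    by_cases h : t₁ ≤ t'
    · exact hm3 (show (t', z') ∈ Icc t₁ T ×ˢ K from ⟨⟨h, ht'⟩, hz'⟩)
    · push Not at h
      have h1 : t' < T - (|B| + 1) / ε := h.trans_le (min_le_right _ _)
      have h2 : (|B| + 1) / ε < ee T t' := by unfold ee; linarith [Real.exp_pos (2 * (t' - T))]
      rw [div_lt_iff₀ hε] at h2
      have := hB t' ht' z' hz'
      linarith [le_abs_self B]
  refine hmax ε hε hε1 tm hm1.2 zm (hKZ hm2) ?_ ?_
  · intro t' ht' z' hz'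
    obtain ⟨z'', h1, h2⟩ := hret z' hz'
    rw [h2 t' ht']; exact hall t' ht' z'' h1
  · have := mul_nonneg hε.le (ee_nonneg hm1.2 : 0 ≤ ee T tm)
    linarith

lemma exists_per {P : ℝ} (hP : 0 < P) (x : ℝ) : ∃ x' ∈ Icc 0 P, ∃ n : ℤ, x = x' + n * P := by
  refine ⟨toIcoMod hP 0 x, ⟨(toIcoMod_mem_Ico hP 0 x).1, ?_⟩, toIcoDiv hP 0 x, ?_⟩
  · have := (toIcoMod_mem_Ico hP 0 x).2; linarith
  · have := toIcoMod_add_toIcoDiv_zsmul hP 0 x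
    rw [zsmul_eq_mul] at this; exact this.symm

structure PD (T om M κ B δ δ₀ : ℝ) (w F : ℝ → ℝ → ℝ → ℝ) : Prop where
  cont : ContinuousOn (fun p : ℝ × ℝ × ℝ => w p.1 p.2.1 p.2.2) {p | p.1 ≤ T}
  perT : ∀ t ≤ T, ∀ θ y, w t (θ + 2 * om) y = w t θ y
  perY : ∀ t ≤ T, ∀ θ y, w t θ (y + 2 * π) = w t θ y
  sd : ∀ t < T, ∀ θ y, ∃ a b c, SD (fun t => w t θ y) t a ∧ SD (fun θ => w t θ y) θ b ∧ SD (fun y => w t θ y) y c ∧ Real.exp (-2 * t) * (a + b) + c = F t θ y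
  Fb : ∀ s ∈ ({δ₀, 1 + δ} : Set ℝ), ∀ t < T, ∀ θ y, |F t θ y| ≤ M * Real.exp ((s - 2) * t)
  der : ∀ θ y, HasDerivWithinAt (fun t => w t θ y) κ (Iic T) T
  bd : ∀ t ≤ T, ∀ θ y, |w t θ y| ≤ B
  dy : ∀ t ≤ T, ∀ θ, Differentiable ℝ (fun y => w t θ y)
  zero : Tendsto (fun t => w t 0 0) atBot (𝓝 0)

lemma PD.neg {T om M κ B δ δ₀ : ℝ} {w F : ℝ → ℝ → ℝ → ℝ} (h : PD T om M κ B δ δ₀ w F) :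
    PD T om M (-κ) B δ δ₀ (fun t θ y => - w t θ y) (fun t θ y => - F t θ y) where
  cont := h.cont.neg
  perT t ht θ y := by rw [h.perT t ht]
  perY t ht θ y := by rw [h.perY t ht]
  sd t ht θ y := by
    obtain ⟨a, b, c, h1, h2, h3, h4⟩ := h.sd t ht θ y
    exact ⟨-a, -b, -c, h1.neg, h2.neg, h3.neg, by rw [← h4]; ring⟩
  Fb s hs t ht θ y := by rw [abs_neg]; exact h.Fb s hs t ht θ y
  der θ y := (h.der θ y).neg
  bd t ht θ y := by rw [abs_neg]; exact h.bd t ht θ y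
  dy t ht θ := (h.dy t ht θ).neg
  zero := by simpa using h.zero.neg

lemma PD.perTz {T om M κ B δ δ₀ : ℝ} {w F : ℝ → ℝ → ℝ → ℝ} (h : PD T om M κ B δ δ₀ w F) {t : ℝ} (ht : t ≤ T) (θ y : ℝ) (n : ℤ) :
    w t (θ + n * (2 * om)) y = w t θ y := by
  have : Function.Periodic (fun θ => w t θ y) (2 * om) := fun θ => h.perT t ht θ y
  exact this.int_mul n θ

lemma PD.perYz {T om M κ B δ δ₀ : ℝ} {w F : ℝ → ℝ → ℝ → ℝ} (h : PD T om M κ B δ δ₀ w F) {t : ℝ} (ht : t ≤ T) (θ y : ℝ) (n : ℤ) :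
    w t θ (y + n * (2 * π)) = w t θ y := by
  have : Function.Periodic (fun y => w t θ y) (2 * π) := fun y => h.perY t ht θ y
  exact this.int_mul n y

open scoped ContDiff

lemma exp_hd (s t : ℝ) : HasDerivAt (fun t => Real.exp (s * t)) (s * Real.exp (s * t)) t := by
  have h1 : HasDerivAt (fun t : ℝ => s * t) s t := by simpa using (hasDerivAt_id t).const_mul s
  exact h1.exp.congr_deriv (by ring)

lemma exp_SD (s t : ℝ) : SD (fun t => Real.exp (s * t)) t (s ^ 2 * Real.exp (s * t)) :=
  SD_of_deriv one_pos (fun y _ => exp_hd s y) (((exp_hd s t).const_mul s).congr_deriv (by ring))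

lemma cos_SD (o h : ℝ) : SD (fun h => Real.cos (2 * h - o)) h (-4 * Real.cos (2 * h - o)) := by
  have h1 : ∀ h, HasDerivAt (fun h : ℝ => 2 * h - o) 2 h := fun h => by simpa using ((hasDerivAt_id h).const_mul 2).sub_const o
  refine SD_of_deriv (g' := fun h => - Real.sin (2 * h - o) * 2) one_pos (fun y _ => (h1 y).cos) ?_
  exact ((h1 h).sin.neg.mul_const 2).congr_deriv (by ring)

lemma SD.nonpos_Ioo {g : ℝ → ℝ} {x l : ℝ} {s : Set ℝ} (hs : s ∈ 𝓝 x) (h : SD g x l) (hm : ∀ y ∈ s, g y ≤ g x) : l ≤ 0 := by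
  obtain ⟨r, hr, hr2⟩ := Metric.mem_nhds_iff.1 hs
  exact h.nonpos hr fun y hy => hm y (hr2 (by rwa [Metric.mem_ball, Real.dist_eq]))

lemma cos_lb {om h : ℝ} (ho : om < π / 2) (h0 : 0 ≤ h) (h1 : h ≤ om) : Real.cos om ≤ Real.cos (2 * h - om) := by
  rw [← Real.cos_abs (2 * h - om)]
  refine Real.cos_le_cos_of_nonneg_of_le_pi (abs_nonneg _) (by linarith [Real.pi_pos]) ?_
  rw [abs_le]; constructor <;> linarith

lemma C1a {T om M κ B δ δ₀ s : ℝ} {w F : ℝ → ℝ → ℝ → ℝ} (H : PD T om M κ B δ δ₀ w F) (ho0 : 0 < om) (ho : om < π / 2)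
    (hM : 0 ≤ M) (hs : s ∈ ({δ₀, 1 + δ} : Set ℝ)) (hs0 : 0 < s) (hs2 : s < 2) {η : ℝ} (hη : 0 < η) (θ : ℝ) :
    ∀ t ≤ T, ∀ z ∈ {z : ℝ × ℝ | z.2 ∈ Icc 0 om}, w t (θ + z.2) z.1 - w t (θ - z.2) z.1 -
      (2 / ((4 - s ^ 2) * Real.cos om) * (M + η)) * (Real.exp (s * t) * Real.cos (2 * z.2 - om)) ≤ 0 := by
  have hco : 0 < Real.cos om := Real.cos_pos_of_mem_Ioo ⟨by linarith, ho⟩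
  have h4 : 0 < 4 - s ^ 2 := by nlinarith
  set c := 2 / ((4 - s ^ 2) * Real.cos om) * (M + η) with hc
  have hcpos : 0 < c := by positivity
  have hcc : c * (4 - s ^ 2) * Real.cos om = 2 * (M + η) := by rw [hc]; field_simp
  refine MP (B := 2 * B) (K := Icc 0 (2 * π) ×ˢ Icc 0 om) (ε₀ := η * Real.exp (s * T) / 2) (isCompact_Icc.prod isCompact_Icc) (fun z hz => hz.2)
    (fun t (z : ℝ × ℝ) => w t (θ + z.2) z.1 - w t (θ - z.2) z.1 - c * (Real.exp (s * t) * Real.cos (2 * z.2 - om))) ?_ ?_ ?_ (by positivity) ?_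
  · refine ContinuousOn.sub (ContinuousOn.sub ?_ ?_) (Continuous.continuousOn (by fun_prop))
    · exact H.cont.comp (f := fun p : ℝ × ℝ × ℝ => (p.1, θ + p.2.2, p.2.1)) (Continuous.continuousOn (by fun_prop)) (fun p hp => hp.1)
    · exact H.cont.comp (f := fun p : ℝ × ℝ × ℝ => (p.1, θ - p.2.2, p.2.1)) (Continuous.continuousOn (by fun_prop)) (fun p hp => hp.1)
  · rintro ⟨y, h⟩ hz
    obtain ⟨y', hy', n, hn⟩ := exists_per Real.two_pi_pos y
    refine ⟨(y', h), ⟨hy', hz⟩, fun t ht => ?_⟩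
    rw [hn, H.perYz ht, H.perYz ht]
  · intro t ht z hz
    have h1 := abs_le.1 (H.bd t ht (θ + z.2) z.1)
    have h2 := abs_le.1 (H.bd t ht (θ - z.2) z.1)
    have h3 := cos_lb ho hz.2.1 hz.2.2
    have h5 : 0 ≤ c * (Real.exp (s * t) * Real.cos (2 * z.2 - om)) := mul_nonneg hcpos.le (mul_nonneg (Real.exp_pos _).le (hco.le.trans h3))
    linarith [h1.2, h2.1]
  · rintro ε hε hε2 t ht ⟨y, h⟩ ⟨hz0, hz1⟩ hmax hpos
    simp only at hz0 hz1 hpos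
    have h3 := cos_lb ho hz0 hz1
    have hψ : 0 < Real.cos (2 * h - om) := hco.trans_le h3
    have h5 : 0 < c * (Real.exp (s * t) * Real.cos (2 * h - om)) := by positivity
    have hh0 : 0 < h := by
      rcases hz0.eq_or_lt with h' | h'
      · exfalso; rw [← h', add_zero, sub_zero, h'] at hpos; linarith
      · exact h'
    have hh1 : h < om := by
      rcases hz1.eq_or_lt with h' | h'
      · exfalso
        have := H.perT t ht (θ - om) y
        rw [show θ - om + 2 * om = θ + om by ring] at this
        rw [h', this] at hpos; rw [h'] at h5; linarith
      · exact h'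
    rcases ht.eq_or_lt with rfl | htT
    · have hd : HasDerivWithinAt (fun t' => w t' (θ + h) y - w t' (θ - h) y - c * (Real.exp (s * t') * Real.cos (2 * h - om)) - ε * ee t t')
          (κ - κ - c * (s * Real.exp (s * t) * Real.cos (2 * h - om)) - ε * (-1 + 2 * Real.exp (2 * (t - t)))) (Iic t) t :=
        (((H.der _ _).sub (H.der _ _)).sub (((exp_hd s t).mul_const _).const_mul c).hasDerivWithinAt).sub ((ee_hd t t).const_mul ε).hasDerivWithinAt
      have := deriv_max hd (fun t' ht' => hmax t' ht' (y, h) ⟨hz0, hz1⟩)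
      simp at this
      have h6 : 0 < c * (s * Real.exp (s * t) * Real.cos (2 * h - om)) := by positivity
      linarith
    · obtain ⟨a1, b1, c1, p1, q1, r1, e1⟩ := H.sd t htT (θ + h) y
      obtain ⟨a2, b2, c2, p2, q2, r2, e2⟩ := H.sd t htT (θ - h) y
      have f1 := abs_le.1 (H.Fb s hs t htT (θ + h) y)
      have f2 := abs_le.1 (H.Fb s hs t htT (θ - h) y)
      have i1 : a1 - a2 - c * (Real.cos (2 * h - om) * (s ^ 2 * Real.exp (s * t))) - ε * (4 * Real.exp (2 * (t - T))) ≤ 0 := by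
        refine SD.nonpos_Ioo (Iic_mem_nhds htT) (((p1.sub p2).sub (((exp_SD s t).cmul (Real.cos (2 * h - om))).cmul c)).sub ((ee_SD T t).cmul ε)) ?_
        intro t' ht'
        have := hmax t' ht' (y, h) ⟨hz0, hz1⟩
        simp only at this ⊢
        rw [mul_comm (Real.cos _) (Real.exp (s * t')), mul_comm (Real.cos _) (Real.exp (s * t))]; exact this
      have i2 : b1 - b2 - c * (Real.exp (s * t) * (-4 * Real.cos (2 * h - om))) ≤ 0 := by
        refine SD.nonpos_Ioo (Icc_mem_nhds hh0 hh1) ((q1.shift.sub q2.rshift).sub (((cos_SD om h).cmul (Real.exp (s * t))).cmul c)) ?_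
        intro h' hh'
        have := hmax t ht (y, h') hh'
        simp only at this ⊢
        linarith
      have i3 : c1 - c2 ≤ 0 := by
        refine SD.nonpos_Ioo univ_mem (r1.sub r2) ?_
        intro y' _
        have := hmax t ht (y', h) ⟨hz0, hz1⟩
        simp only at this ⊢
        linarith
      have E : 0 < Real.exp (-2 * t) := Real.exp_pos _
      have j1 := mul_le_mul_of_nonneg_left (add_le_add i1 i2) E.le
      have x1 : Real.exp (-2 * t) * Real.exp (s * t) = Real.exp ((s - 2) * t) := by rw [← Real.exp_add]; congr 1; ring
      have x2 : Real.exp (-2 * t) * Real.exp (2 * (t - T)) = Real.exp (-2 * T) := by rw [← Real.exp_add]; congr 1; ring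
      have x3 : Real.exp (s * T) * Real.exp (-2 * T) ≤ Real.exp ((s - 2) * t) := by
        rw [← Real.exp_add]; apply Real.exp_le_exp.2; nlinarith
      have k1 : c * (4 - s ^ 2) * Real.cos (2 * h - om) ≥ 2 * (M + η) := by
        rw [← hcc]; exact mul_le_mul_of_nonneg_left h3 (by positivity)
      have k2 := mul_le_mul_of_nonneg_right k1 (Real.exp_pos ((s - 2) * t)).le
      have k3 : Real.exp (-2 * t) * ((a1 - a2 - c * (Real.cos (2 * h - om) * (s ^ 2 * Real.exp (s * t))) - ε * (4 * Real.exp (2 * (t - T)))) +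
          (b1 - b2 - c * (Real.exp (s * t) * (-4 * Real.cos (2 * h - om)))))
          = (F t (θ + h) y - c1) - (F t (θ - h) y - c2) + c * (4 - s ^ 2) * Real.cos (2 * h - om) * Real.exp ((s - 2) * t) - 4 * ε * Real.exp (-2 * T) := by
        rw [← e1, ← e2, ← x1, ← x2]; ring
      rw [k3] at j1
      have k4 : ε * Real.exp (-2 * T) < η * Real.exp (s * T) / 2 * Real.exp (-2 * T) := mul_lt_mul_of_pos_right hε2 (Real.exp_pos _)
      have k5 := mul_le_mul_of_nonneg_left x3 hη.le
      nlinarith [f1.1, f2.2]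

lemma C1 {T om M κ B δ δ₀ s : ℝ} {w F : ℝ → ℝ → ℝ → ℝ} (H : PD T om M κ B δ δ₀ w F) (ho0 : 0 < om) (ho : om < π / 2)
    (hM : 0 ≤ M) (hs : s ∈ ({δ₀, 1 + δ} : Set ℝ)) (hs0 : 0 < s) (hs2 : s < 2) {t : ℝ} (ht : t ≤ T) (θ₁ θ₂ y : ℝ) :
    w t θ₁ y - w t θ₂ y ≤ 2 / ((4 - s ^ 2) * Real.cos om) * M * Real.exp (s * t) := by
  have hco : 0 < Real.cos om := Real.cos_pos_of_mem_Ioo ⟨by linarith, ho⟩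
  have h4 : 0 < 4 - s ^ 2 := by nlinarith
  obtain ⟨k, hk, n, hn⟩ := exists_per (show 0 < 2 * om by linarith) (θ₁ - θ₂)
  have e1 : w t θ₁ y = w t ((θ₂ + k / 2) + k / 2) y := by
    rw [← H.perTz ht (θ₂ + k / 2 + k / 2) y n]; congr 1; linarith
  have e2 : w t θ₂ y = w t ((θ₂ + k / 2) - k / 2) y := by congr 1; ring
  rw [e1, e2]
  refine le_of_forall_pos_le_add fun η hη => ?_
  set c := 2 / ((4 - s ^ 2) * Real.cos om) with hc
  have hc0 : 0 < c := by positivity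
  have hE := Real.exp_pos (s * t)
  have := C1a H ho0 ho hM hs hs0 hs2 (η := η / (c * Real.exp (s * t))) (by positivity) (θ₂ + k / 2) t ht (y, k / 2) ⟨by linarith [hk.1], by linarith [hk.2]⟩
  simp only at this
  rw [← hc] at this
  have e3 : c * (M + η / (c * Real.exp (s * t))) * (Real.exp (s * t) * Real.cos (2 * (k / 2) - om)) ≤ c * (M + η / (c * Real.exp (s * t))) * Real.exp (s * t) := by
    refine mul_le_mul_of_nonneg_left ?_ (by positivity)
    exact mul_le_of_le_one_right hE.le (Real.cos_le_one _)
  have e4 : c * (M + η / (c * Real.exp (s * t))) * Real.exp (s * t) = c * M * Real.exp (s * t) + η := by field_simp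
  linarith

open scoped ContDiff

lemma lin_SD {a b p x : ℝ} (h : 0 < a + b * x) : SD (fun x => (a + b * x) ^ p) x (b ^ 2 * (p * (p - 1) * (a + b * x) ^ (p - 2))) := by
  have hl : ∀ y, HasDerivAt (fun y : ℝ => a + b * y) b y := fun y => by simpa using ((hasDerivAt_id y).const_mul b).const_add a
  have hnb : {y | 0 < a + b * y} ∈ 𝓝 x := (isOpen_lt continuous_const (by fun_prop)).mem_nhds h
  obtain ⟨r, hr, hr2⟩ := Metric.mem_nhds_iff.1 hnb
  refine SD_of_deriv (g' := fun y => b * p * (a + b * y) ^ (p - 1)) hr ?_ ?_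
  · intro y hy
    have : 0 < a + b * y := hr2 (by rwa [Metric.mem_ball, Real.dist_eq])
    exact (hl y).rpow_const (Or.inl this.ne')
  · refine (((hl x).rpow_const (p := p - 1) (Or.inl h.ne')).const_mul (b * p)).congr_deriv ?_
    rw [show p - 1 - 1 = p - 2 by ring]; ring

lemma expq_hd {q p : ℝ} (hq : 0 ≤ q) (t : ℝ) : HasDerivAt (fun t => (Real.exp (2 * t) + q) ^ p) (2 * Real.exp (2 * t) * p * (Real.exp (2 * t) + q) ^ (p - 1)) t := by
  have : 0 < Real.exp (2 * t) + q := by positivity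
  exact (((exp_hd 2 t).add_const q).rpow_const (Or.inl this.ne')).congr_deriv (by ring)

lemma expq_SD {q p : ℝ} (hq : 0 ≤ q) (t : ℝ) : SD (fun t => (Real.exp (2 * t) + q) ^ p) t
    (4 * Real.exp (2 * t) * p * (Real.exp (2 * t) + q) ^ (p - 1) + 4 * Real.exp (2 * t) ^ 2 * p * (p - 1) * (Real.exp (2 * t) + q) ^ (p - 2)) := by
  refine SD_of_deriv one_pos (fun y _ => expq_hd hq y) ?_
  refine ((((exp_hd 2 t).const_mul 2).mul_const p).mul (expq_hd (p := p - 1) hq t)).congr_deriv ?_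
  rw [show p - 1 - 1 = p - 2 by ring]; ring

lemma psiL {p ρ h k Λ : ℝ} (hp0 : 0 < p) (hp1 : p < 1) (hρ : 0 < ρ) (hh : 0 < h) (hk : 0 < k) (hq : h * k ≤ 16) (hΛ : 16 ≤ Λ) :
    ρ⁻¹ * (p * (1 - p) / Λ * (h * k) ^ p * (4 * ρ) + (4 * ρ * p * (ρ + h * k) ^ (p - 1) + 4 * ρ ^ 2 * p * (p - 1) * (ρ + h * k) ^ (p - 2)) - 4 * p ^ 2 * ρ ^ p)
      + (1/2) * (h ^ 2 + k ^ 2) * ((8 / (1 - p) + p * (1 - p) / Λ * ρ) * (p * (p - 1) * (h * k) ^ (p - 2)) + p * (p - 1) * (ρ + h * k) ^ (p - 2)) ≤ - (4 * p ^ 2 * ρ ^ (p - 1)) := by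
  set q := h * k with hqd
  have hq0 : 0 < q := by positivity
  have hΛ0 : 0 < Λ := by linarith
  have h1p : 0 < 1 - p := by linarith
  have r1 : ρ ^ p = ρ * ρ ^ (p - 1) := by
    rw [← Real.rpow_one_add' hρ.le (by linarith)]; congr 1; ring
  have q1 : q ^ (p - 1) = q * q ^ (p - 2) := by
    rw [mul_comm, ← Real.rpow_add_one hq0.ne']; congr 1; ring
  have q2 : q ^ p = q * q ^ (p - 1) := by
    rw [← Real.rpow_one_add' hq0.le (by linarith)]; congr 1; ring
  have m1 : (ρ + q) ^ (p - 1) ≤ q ^ (p - 1) := Real.rpow_le_rpow_of_nonpos hq0 (by linarith) (by linarith)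
  have hX : 0 ≤ (ρ + q) ^ (p - 2) := by positivity
  have hY : 0 ≤ q ^ (p - 1) := by positivity
  have hZ : 0 ≤ q ^ (p - 2) := by positivity
  have hs : q ≤ (1/2) * (h ^ 2 + k ^ 2) := by rw [hqd]; nlinarith [sq_nonneg (h - k)]
  have t1 : (1/2) * (h ^ 2 + k ^ 2) * ((8 / (1 - p) + p * (1 - p) / Λ * ρ) * (p * (p - 1) * q ^ (p - 2)) + p * (p - 1) * (ρ + q) ^ (p - 2)) ≤ - (8 * p * q ^ (p - 1)) := by
    have e : (8 / (1 - p) + p * (1 - p) / Λ * ρ) * (p * (p - 1) * q ^ (p - 2)) + p * (p - 1) * (ρ + q) ^ (p - 2)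
      ≤ - (8 * p * q ^ (p - 2)) := by
      have e1 : 8 / (1 - p) * (p * (p - 1) * q ^ (p - 2)) = - (8 * p * q ^ (p - 2)) := by field_simp; ring
      have e2 : 0 ≤ p * (1 - p) / Λ * ρ * (p * (1 - p) * q ^ (p - 2)) := by positivity
      have e3 : 0 ≤ p * (1 - p) * (ρ + q) ^ (p - 2) := by positivity
      nlinarith
    have e' := mul_le_mul_of_nonneg_left e (hq0.le.trans hs)
    have e'' := mul_le_mul_of_nonneg_right hs (show 0 ≤ 8 * p * q ^ (p - 2) by positivity)
    rw [q1]; nlinarith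
  have t2 : p * (1 - p) / Λ * q ^ p * 4 ≤ 4 * p * q ^ (p - 1) := by
    rw [q2]
    have : (1 - p) / Λ * q ≤ 1 := by
      rw [div_mul_eq_mul_div, div_le_one hΛ0]; nlinarith
    have := mul_le_mul_of_nonneg_left this (show 0 ≤ 4 * p * q ^ (p - 1) by positivity)
    calc _ = 4 * p * q ^ (p - 1) * ((1 - p) / Λ * q) := by ring
      _ ≤ _ := by linarith
  have t3 : 0 ≤ 4 * ρ * p * (1 - p) * (ρ + q) ^ (p - 2) := by positivity
  have e0 : ρ⁻¹ * (p * (1 - p) / Λ * q ^ p * (4 * ρ) + (4 * ρ * p * (ρ + q) ^ (p - 1) + 4 * ρ ^ 2 * p * (p - 1) * (ρ + q) ^ (p - 2)) - 4 * p ^ 2 * ρ ^ p)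
     = p * (1 - p) / Λ * q ^ p * 4 + 4 * p * (ρ + q) ^ (p - 1) - 4 * ρ * p * (1 - p) * (ρ + q) ^ (p - 2) - 4 * p ^ 2 * ρ ^ (p - 1) := by
    rw [r1]; field_simp; ring
  rw [e0]
  nlinarith

lemma psiT {p Λ q : ℝ} (hp0 : 0 < p) (hp1 : p < 1) (hq0 : 0 < q) (hq : q ≤ 16) (hΛ : 16 ≤ Λ) :
    0 ≤ p * (1 - p) / Λ * q ^ p * (2 * Λ) + 2 * Λ * p * (Λ + q) ^ (p - 1) - 2 * p * Λ ^ p := by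
  have hΛ0 : 0 < Λ := by linarith
  have h1p : 0 < 1 - p := by linarith
  have r1 : Λ ^ p = Λ * Λ ^ (p - 1) := by
    rw [← Real.rpow_one_add' hΛ0.le (by linarith)]; congr 1; ring
  have q2 : q ^ p = q * q ^ (p - 1) := by
    rw [← Real.rpow_one_add' hq0.le (by linarith)]; congr 1; ring
  have m1 : Λ ^ (p - 1) ≤ q ^ (p - 1) := Real.rpow_le_rpow_of_nonpos hq0 (by linarith) (by linarith)
  have m2 : (Λ + q) ^ (p - 1) = Λ ^ (p - 1) * (1 + q / Λ) ^ (p - 1) := by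
    rw [← Real.mul_rpow hΛ0.le (by positivity)]; congr 1; field_simp
  have m3 : 1 + (p - 1) * (q / Λ) ≤ (1 + q / Λ) ^ (p - 1) := by
    have hx : 0 ≤ q / Λ := by positivity
    have n1 := rpow_one_add_le_one_add_mul_self (s := q / Λ) (by linarith) h1p.le (by linarith)
    rw [show p - 1 = -(1 - p) by ring, Real.rpow_neg (by positivity)]
    have n2 : (1 + (1 - p) * (q / Λ))⁻¹ ≤ ((1 + q / Λ) ^ (1 - p))⁻¹ := inv_anti₀ (by positivity) n1
    refine le_trans ?_ n2
    rw [inv_eq_one_div, le_div_iff₀ (by positivity)]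
    nlinarith [sq_nonneg ((1 - p) * (q / Λ))]
  have hY : 0 ≤ Λ ^ (p - 1) := by positivity
  have m4 := mul_le_mul_of_nonneg_left m3 hY
  rw [← m2] at m4
  have m5 : Λ * (Λ ^ (p - 1) * (1 + (p - 1) * (q / Λ))) = Λ ^ (p - 1) * (Λ - (1 - p) * q) := by field_simp; ring
  have m6 := mul_le_mul_of_nonneg_left m4 hΛ0.le
  rw [m5] at m6
  have e : p * (1 - p) / Λ * q ^ p * (2 * Λ) = 2 * p * (1 - p) * q * q ^ (p - 1) := by rw [q2]; field_simp
  rw [e, r1]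
  have m7 := mul_le_mul_of_nonneg_left m6 (show 0 ≤ 2 * p by positivity)
  have m8 := mul_le_mul_of_nonneg_left m1 (show 0 ≤ 2 * p * (1 - p) * q by positivity)
  nlinarith

set_option maxHeartbeats 1000000 in
lemma C2a {T om M κ B δ δ₀ p : ℝ} {w F : ℝ → ℝ → ℝ → ℝ} (H : PD T om M κ B δ δ₀ w F) (ho0 : 0 < om)
    (hM : 0 ≤ M) (hδ0 : 0 < δ) (hδ1 : δ < 1) (hp : p = (1 + δ) / 2) (hT : 16 ≤ Real.exp (2 * T)) {η : ℝ} (hη : 0 < η) (y : ℝ) :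
    ∀ t ≤ T, ∀ z ∈ {z : ℝ × ℝ × ℝ | z.2.1 ∈ Icc 0 π ∧ z.2.2 ∈ Icc 0 π},
     (w t z.1 (y + z.2.1 + z.2.2) - w t z.1 (y + z.2.1 - z.2.2) - w t z.1 (y - z.2.1 + z.2.2) + w t z.1 (y - z.2.1 - z.2.2)) -
      (M + η) / p ^ 2 * ((8 / (1 - p) + p * (1 - p) / Real.exp (2 * T) * Real.exp (2 * t)) * (z.2.1 * z.2.2) ^ p + (Real.exp (2 * t) + z.2.1 * z.2.2) ^ p - Real.exp (2 * p * t)) ≤ 0 := by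
  have hp0 : 0 < p := by rw [hp]; linarith
  have hp1 : p < 1 := by rw [hp]; linarith
  have h1p : 0 < 1 - p := by linarith
  have hpi := Real.pi_pos
  have hpi4 : π ≤ 4 := Real.pi_le_four
  set c := (M + η) / p ^ 2 with hc
  have hcpos : 0 < c := by positivity
  have hcc : c * p ^ 2 = M + η := by rw [hc]; field_simp
  set Λ := Real.exp (2 * T) with hΛ
  have hΛ0 : 0 < Λ := by linarith
  have hρp : ∀ t, Real.exp (2 * p * t) = Real.exp (2 * t) ^ p := fun t => by rw [← Real.exp_mul]; congr 1; ring
  have hψ : ∀ t h k : ℝ, 0 ≤ h → 0 ≤ k → 0 ≤ ((8 / (1 - p) + p * (1 - p) / Λ * Real.exp (2 * t)) * (h * k) ^ p + (Real.exp (2 * t) + h * k) ^ p - Real.exp (2 * p * t)) := by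
    intro t h k hh hk
    have e1 : Real.exp (2 * t) ^ p ≤ (Real.exp (2 * t) + h * k) ^ p := Real.rpow_le_rpow (Real.exp_pos _).le (by nlinarith [mul_nonneg hh hk]) hp0.le
    rw [hρp]
    have : 0 ≤ (8 / (1 - p) + p * (1 - p) / Λ * Real.exp (2 * t)) * (h * k) ^ p := by positivity
    linarith
  refine MP (B := 4 * B) (K := Icc 0 (2 * om) ×ˢ (Icc 0 π ×ˢ Icc 0 π)) (ε₀ := η * Real.exp (2 * p * T)) (isCompact_Icc.prod (isCompact_Icc.prod isCompact_Icc)) (fun z hz => hz.2)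
    (fun t (z : ℝ × ℝ × ℝ) => (w t z.1 (y + z.2.1 + z.2.2) - w t z.1 (y + z.2.1 - z.2.2) - w t z.1 (y - z.2.1 + z.2.2) + w t z.1 (y - z.2.1 - z.2.2)) -
      c * ((8 / (1 - p) + p * (1 - p) / Λ * Real.exp (2 * t)) * (z.2.1 * z.2.2) ^ p + (Real.exp (2 * t) + z.2.1 * z.2.2) ^ p - Real.exp (2 * p * t))) ?_ ?_ ?_ (by positivity) ?_
  · refine ContinuousOn.sub (ContinuousOn.add (ContinuousOn.sub (ContinuousOn.sub ?_ ?_) ?_) ?_) (Continuous.continuousOn ?_)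
    · exact H.cont.comp (f := fun p : ℝ × ℝ × ℝ × ℝ => (p.1, p.2.1, y + p.2.2.1 + p.2.2.2)) (Continuous.continuousOn (by fun_prop)) (fun p hp => hp.1)
    · exact H.cont.comp (f := fun p : ℝ × ℝ × ℝ × ℝ => (p.1, p.2.1, y + p.2.2.1 - p.2.2.2)) (Continuous.continuousOn (by fun_prop)) (fun p hp => hp.1)
    · exact H.cont.comp (f := fun p : ℝ × ℝ × ℝ × ℝ => (p.1, p.2.1, y - p.2.2.1 + p.2.2.2)) (Continuous.continuousOn (by fun_prop)) (fun p hp => hp.1)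
    · exact H.cont.comp (f := fun p : ℝ × ℝ × ℝ × ℝ => (p.1, p.2.1, y - p.2.2.1 - p.2.2.2)) (Continuous.continuousOn (by fun_prop)) (fun p hp => hp.1)
    · have k1 : Continuous (fun z : ℝ × ℝ × ℝ × ℝ => (z.2.2.1 * z.2.2.2) ^ p) := Continuous.rpow_const (by fun_prop) (fun _ => Or.inr hp0.le)
      have k2 : Continuous (fun z : ℝ × ℝ × ℝ × ℝ => (Real.exp (2 * z.1) + z.2.2.1 * z.2.2.2) ^ p) := Continuous.rpow_const (by fun_prop) (fun _ => Or.inr hp0.le)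
      exact continuous_const.mul ((((continuous_const.add (continuous_const.mul (by fun_prop))).mul k1).add k2).sub (by fun_prop))
  · rintro ⟨θ, h, k⟩ hz
    obtain ⟨θ', hθ', n, hn⟩ := exists_per (show 0 < 2 * om by linarith) θ
    refine ⟨(θ', h, k), ⟨hθ', hz⟩, fun t ht => ?_⟩
    rw [hn, H.perTz ht, H.perTz ht, H.perTz ht, H.perTz ht]
  · intro t ht z hz
    have h1 := abs_le.1 (H.bd t ht z.1 (y + z.2.1 + z.2.2))
    have h2 := abs_le.1 (H.bd t ht z.1 (y + z.2.1 - z.2.2))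
    have h3 := abs_le.1 (H.bd t ht z.1 (y - z.2.1 + z.2.2))
    have h4 := abs_le.1 (H.bd t ht z.1 (y - z.2.1 - z.2.2))
    have h5 := mul_nonneg hcpos.le (hψ t z.2.1 z.2.2 hz.2.1.1 hz.2.2.1)
    linarith [h1.2, h2.1, h3.1, h4.2]
  · rintro ε hε hε2 t ht ⟨θ, h, k⟩ ⟨⟨hh0, hh1⟩, hk0, hk1⟩ hmax hpos
    simp only at hh0 hh1 hk0 hk1 hpos
    have h5 := mul_nonneg hcpos.le (hψ t h k hh0 hk0)
    have hz : (θ, h, k) ∈ {z : ℝ × ℝ × ℝ | z.2.1 ∈ Icc 0 π ∧ z.2.2 ∈ Icc 0 π} := ⟨⟨hh0, hh1⟩, hk0, hk1⟩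
    have hh0' : 0 < h := by
      refine lt_of_le_of_ne hh0 ?_
      rintro rfl
      simp only [add_zero, sub_zero] at hpos
      linarith
    have hk0' : 0 < k := by
      refine lt_of_le_of_ne hk0 ?_
      rintro rfl
      simp only [add_zero, sub_zero] at hpos
      linarith
    have hh1' : h < π := by
      refine lt_of_le_of_ne hh1 ?_
      rintro rfl
      have e1 := H.perY t ht θ (y - π + k)
      have e2 := H.perY t ht θ (y - π - k)
      rw [show y - π + k + 2 * π = y + π + k by ring] at e1
      rw [show y - π - k + 2 * π = y + π - k by ring] at e2
      rw [e1, e2] at hpos; linarith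
    have hk1' : k < π := by
      refine lt_of_le_of_ne hk1 ?_
      rintro rfl
      have e1 := H.perY t ht θ (y + h - π)
      have e2 := H.perY t ht θ (y - h - π)
      rw [show y + h - π + 2 * π = y + h + π by ring] at e1
      rw [show y - h - π + 2 * π = y - h + π by ring] at e2
      rw [e1, e2] at hpos; linarith
    have hq0 : 0 < h * k := by positivity
    have hq16 : h * k ≤ 16 := by nlinarith
    rcases ht.eq_or_lt with htt | htT
    · have hd : HasDerivWithinAt (fun t' => (w t' θ (y + h + k) - w t' θ (y + h - k) - w t' θ (y - h + k) + w t' θ (y - h - k)) -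
          c * ((8 / (1 - p) + p * (1 - p) / Λ * Real.exp (2 * t')) * (h * k) ^ p + (Real.exp (2 * t') + h * k) ^ p - Real.exp (2 * p * t')) - ε * ee T t')
          ((κ - κ - κ + κ) - c * ((p * (1 - p) / Λ * (2 * Real.exp (2 * T))) * (h * k) ^ p + 2 * Real.exp (2 * T) * p * (Real.exp (2 * T) + h * k) ^ (p - 1) - 2 * p * Real.exp (2 * p * T)) - ε * (-1 + 2 * Real.exp (2 * (T - T)))) (Iic T) T :=
        (((((H.der _ _).sub (H.der _ _)).sub (H.der _ _)).add (H.der _ _)).sub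
          (((((((exp_hd 2 T).const_mul (p * (1 - p) / Λ)).const_add (8 / (1 - p))).mul_const ((h * k) ^ p)).add (expq_hd hq0.le T)).sub (exp_hd (2 * p) T)).const_mul c).hasDerivWithinAt).sub ((ee_hd T T).const_mul ε).hasDerivWithinAt
      have h7 := deriv_max hd (fun t' ht' => by rw [← htt]; exact htt ▸ hmax t' (htt ▸ ht') (θ, h, k) hz)
      have h6 := mul_nonneg hcpos.le (psiT hp0 hp1 hq0 hq16 hT)
      rw [hρp T, ← hΛ, sub_self T, mul_zero, Real.exp_zero] at h7
      linarith
    · obtain ⟨a1, b1, c1, p1, q1, r1, e1⟩ := H.sd t htT θ (y + h + k)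
      obtain ⟨a2, b2, c2, p2, q2, r2, e2⟩ := H.sd t htT θ (y + h - k)
      obtain ⟨a3, b3, c3, p3, q3, r3, e3⟩ := H.sd t htT θ (y - h + k)
      obtain ⟨a4, b4, c4, p4, q4, r4, e4⟩ := H.sd t htT θ (y - h - k)
      have hs : 1 + δ ∈ ({δ₀, 1 + δ} : Set ℝ) := Or.inr rfl
      have f1 := abs_le.1 (H.Fb _ hs t htT θ (y + h + k))
      have f2 := abs_le.1 (H.Fb _ hs t htT θ (y + h - k))
      have f3 := abs_le.1 (H.Fb _ hs t htT θ (y - h + k))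
      have f4 := abs_le.1 (H.Fb _ hs t htT θ (y - h - k))
      set ρ := Real.exp (2 * t) with hρ
      have hρ0 : 0 < ρ := Real.exp_pos _
      have ex : Real.exp ((1 + δ - 2) * t) = ρ ^ (p - 1) := by rw [hρ, ← Real.exp_mul]; congr 1; rw [hp]; ring
      rw [ex] at f1 f2 f3 f4
      have i1 : (a1 - a2 - a3 + a4) - c * ((h * k) ^ p * (p * (1 - p) / Λ * (2 ^ 2 * ρ)) + (4 * ρ * p * (ρ + h * k) ^ (p - 1) + 4 * ρ ^ 2 * p * (p - 1) * (ρ + h * k) ^ (p - 2)) - (2 * p) ^ 2 * Real.exp (2 * p * t)) - ε * (4 * Real.exp (2 * (t - T))) ≤ 0 := by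
        refine SD.nonpos_Ioo (Iic_mem_nhds htT) (((((p1.sub p2).sub p3).add p4).sub ((((((exp_SD 2 t).cmul (p * (1 - p) / Λ)).cmul ((h * k) ^ p)).add (expq_SD hq0.le t)).sub (exp_SD (2 * p) t)).cmul c)).sub ((ee_SD T t).cmul ε)) ?_
        intro t' ht'
        have := hmax t' ht' (θ, h, k) hz
        simp only at this ⊢
        linarith
      have i2 : b1 - b2 - b3 + b4 ≤ 0 := by
        refine SD.nonpos_Ioo univ_mem (((q1.sub q2).sub q3).add q4) ?_
        intro θ' _
        have := hmax t ht (θ', h, k) hz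
        simp only at this ⊢
        linarith
      have i3 : (c1 - c2 - c3 + c4) - c * ((8 / (1 - p) + p * (1 - p) / Λ * ρ) * (k ^ 2 * (p * (p - 1) * (0 + k * h) ^ (p - 2))) + (k ^ 2 * (p * (p - 1) * (ρ + k * h) ^ (p - 2)))) ≤ 0 := by
        have s1 : SD (fun h' => w t θ (y + k + h')) h c1 := SD.shift (by rw [show y + k + h = y + h + k by ring]; exact r1)
        have s2 : SD (fun h' => w t θ (y - k + h')) h c2 := SD.shift (by rw [show y - k + h = y + h - k by ring]; exact r2)
        have s3 : SD (fun h' => w t θ (y + k - h')) h c3 := SD.rshift (by rw [show y + k - h = y - h + k by ring]; exact r3)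
        have s4 : SD (fun h' => w t θ (y - k - h')) h c4 := SD.rshift (by rw [show y - k - h = y - h - k by ring]; exact r4)
        have l1 := lin_SD (a := 0) (b := k) (p := p) (x := h) (by positivity)
        have l2 := lin_SD (a := ρ) (b := k) (p := p) (x := h) (by positivity)
        refine SD.nonpos_Ioo (Icc_mem_nhds hh0' hh1') ((((s1.sub s2).sub s3).add s4).sub (((l1.cmul (8 / (1 - p) + p * (1 - p) / Λ * ρ)).add l2).cmul c)) ?_
        intro h' hh'
        have := hmax t ht (θ, h', k) ⟨hh', hk0, hk1⟩
        simp only at this ⊢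
        have g : ∀ x : ℝ, y + k + x = y + x + k ∧ y - k + x = y + x - k ∧ y + k - x = y - x + k ∧ y - k - x = y - x - k ∧ 0 + k * x = x * k ∧ ρ + k * x = ρ + x * k := fun x => ⟨by ring, by ring, by ring, by ring, by ring, by ring⟩
        obtain ⟨g1, g2, g3, g4, g5, g6⟩ := g h'
        obtain ⟨g1', g2', g3', g4', g5', g6'⟩ := g h
        rw [g1, g2, g3, g4, g5, g6, g1', g2', g3', g4', g5', g6']
        linarith
      have i4 : (c1 - c2 - c3 + c4) - c * ((8 / (1 - p) + p * (1 - p) / Λ * ρ) * (h ^ 2 * (p * (p - 1) * (0 + h * k) ^ (p - 2))) + (h ^ 2 * (p * (p - 1) * (ρ + h * k) ^ (p - 2)))) ≤ 0 := by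
        have s1 : SD (fun h' => w t θ (y + h + h')) k c1 := SD.shift r1
        have s2 : SD (fun h' => w t θ (y + h - h')) k c2 := SD.rshift r2
        have s3 : SD (fun h' => w t θ (y - h + h')) k c3 := SD.shift r3
        have s4 : SD (fun h' => w t θ (y - h - h')) k c4 := SD.rshift r4
        have l1 := lin_SD (a := 0) (b := h) (p := p) (x := k) (by positivity)
        have l2 := lin_SD (a := ρ) (b := h) (p := p) (x := k) (by positivity)
        refine SD.nonpos_Ioo (Icc_mem_nhds hk0' hk1') ((((s1.sub s2).sub s3).add s4).sub (((l1.cmul (8 / (1 - p) + p * (1 - p) / Λ * ρ)).add l2).cmul c)) ?_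
        intro k' hk'
        have := hmax t ht (θ, h, k') ⟨⟨hh0, hh1⟩, hk'⟩
        simp only [zero_add] at this ⊢
        linarith
      have E : Real.exp (-2 * t) = ρ⁻¹ := by rw [hρ, ← Real.exp_neg]; congr 1; ring
      rw [E] at e1 e2 e3 e4
      have j1 := mul_le_mul_of_nonneg_left (add_le_add i1 i2) (inv_pos.2 hρ0).le
      have x2 : ρ⁻¹ * Real.exp (2 * (t - T)) = Real.exp (-2 * T) := by rw [← E, ← Real.exp_add]; congr 1; ring
      have x3 : Real.exp (2 * p * T) * Real.exp (-2 * T) ≤ ρ ^ (p - 1) := by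
        rw [hρ, ← Real.exp_mul, ← Real.exp_add]; apply Real.exp_le_exp.2; nlinarith
      have P := mul_le_mul_of_nonneg_left (psiL hp0 hp1 hρ0 hh0' hk0' hq16 hT) hcpos.le
      rw [hρp t] at j1
      rw [← hρ] at j1
      rw [zero_add] at i3 i4
      rw [mul_comm k h] at i3
      have hcc2 : c * (4 * p ^ 2 * ρ ^ (p - 1)) = 4 * (M + η) * ρ ^ (p - 1) := by rw [← hcc]; ring
      have k3 : ρ⁻¹ * ((a1 - a2 - a3 + a4) - c * ((h * k) ^ p * (p * (1 - p) / Λ * (2 ^ 2 * ρ)) + (4 * ρ * p * (ρ + h * k) ^ (p - 1) + 4 * ρ ^ 2 * p * (p - 1) * (ρ + h * k) ^ (p - 2)) - (2 * p) ^ 2 * ρ ^ p) - ε * (4 * Real.exp (2 * (t - T))) + (b1 - b2 - b3 + b4))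
         = ((F t θ (y + h + k) - c1) - (F t θ (y + h - k) - c2) - (F t θ (y - h + k) - c3) + (F t θ (y - h - k) - c4)) -
           c * (ρ⁻¹ * (p * (1 - p) / Λ * (h * k) ^ p * (4 * ρ) + (4 * ρ * p * (ρ + h * k) ^ (p - 1) + 4 * ρ ^ 2 * p * (p - 1) * (ρ + h * k) ^ (p - 2)) - 4 * p ^ 2 * ρ ^ p))
           - 4 * ε * Real.exp (-2 * T) := by
        rw [← e1, ← e2, ← e3, ← e4, ← x2]; ring
      rw [k3] at j1
      have k4 : ε * Real.exp (-2 * T) < η * Real.exp (2 * p * T) * Real.exp (-2 * T) := mul_lt_mul_of_pos_right hε2 (Real.exp_pos _)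
      have k5 := mul_le_mul_of_nonneg_left x3 hη.le
      rw [mul_neg, hcc2] at P
      linarith [f1.1, f2.2, f3.2, f4.1]

lemma C2 {T om M κ B δ δ₀ : ℝ} {w F : ℝ → ℝ → ℝ → ℝ} (H : PD T om M κ B δ δ₀ w F) (ho0 : 0 < om)
    (hM : 0 ≤ M) (hδ0 : 0 < δ) (hδ1 : δ < 1) (hT : 16 ≤ Real.exp (2 * T)) {t : ℝ} (ht : t ≤ T) (θ y : ℝ) {h : ℝ} (hh0 : 0 ≤ h) (hh1 : h ≤ 2 * π) :
     w t θ (y + h) + w t θ (y - h) - 2 * w t θ y ≤ (4 * (16 / (1 - δ) + 2)) * M * h ^ (1 + δ) := by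
  set p := (1 + δ) / 2 with hp
  have hp0 : 0 < p := by rw [hp]; linarith
  have hp1 : p < 1 := by rw [hp]; linarith
  have h1p : 0 < 1 - p := by linarith
  refine le_of_forall_pos_le_add fun η hη => ?_
  rcases hh0.eq_or_lt with rfl | hh0'
  · simp only [add_zero, sub_zero]
    have : (0:ℝ) ≤ 4 * (16 / (1 - δ) + 2) * M * 0 ^ (1 + δ) := by rw [Real.zero_rpow (by linarith)]; simp
    linarith
  set D := 4 * (16 / (1 - δ) + 2) * h ^ (1 + δ) with hD
  have h1d : 0 < 1 - δ := by linarith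
  have hD0 : 0 < D := by positivity
  have := C2a H ho0 hM hδ0 hδ1 hp hT (η := η / D) (by positivity) y t ht (θ, h / 2, h / 2) ⟨⟨by positivity, by linarith⟩, by positivity, by linarith⟩
  simp only at this
  rw [show y + h / 2 + h / 2 = y + h by ring, show y + h / 2 - h / 2 = y by ring, show y - h / 2 + h / 2 = y by ring, show y - h / 2 - h / 2 = y - h by ring] at this
  have e1 : (h / 2 * (h / 2)) ^ p ≤ h ^ (1 + δ) := by
    rw [show h ^ (1 + δ) = (h ^ 2) ^ p by rw [← Real.rpow_natCast, ← Real.rpow_mul hh0]; congr 1; push_cast; rw [hp]; ring]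
    exact Real.rpow_le_rpow (by positivity) (by nlinarith) hp0.le
  have e2 : (Real.exp (2 * t) + h / 2 * (h / 2)) ^ p ≤ Real.exp (2 * p * t) + (h / 2 * (h / 2)) ^ p := by
    have := Real.rpow_add_le_add_rpow (Real.exp_pos (2 * t)).le (show 0 ≤ h / 2 * (h / 2) by positivity) hp0.le hp1.le
    rwa [← Real.exp_mul, show 2 * t * p = 2 * p * t by ring] at this
  have e3 : p * (1 - p) / Real.exp (2 * T) * Real.exp (2 * t) ≤ 1 := by
    rw [div_mul_eq_mul_div, div_le_one (Real.exp_pos _)]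
    have := Real.exp_le_exp.2 (show 2 * t ≤ 2 * T by linarith)
    have := Real.exp_pos (2 * t)
    nlinarith
  have e4 : 8 / (1 - p) = 16 / (1 - δ) := by
    rw [show 1 - p = (1 - δ) / 2 by rw [hp]; ring]; field_simp; norm_num
  have hp4 : 1 / p ^ 2 ≤ 4 := by rw [div_le_iff₀ (by positivity)]; rw [hp]; nlinarith
  have X : (8 / (1 - p) + p * (1 - p) / Real.exp (2 * T) * Real.exp (2 * t)) * (h / 2 * (h / 2)) ^ p + (Real.exp (2 * t) + h / 2 * (h / 2)) ^ p - Real.exp (2 * p * t) ≤ (16 / (1 - δ) + 2) * h ^ (1 + δ) := by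
    rw [e4]
    have hX : 0 ≤ (h / 2 * (h / 2)) ^ p := by positivity
    have : (16 / (1 - δ) + p * (1 - p) / Real.exp (2 * T) * Real.exp (2 * t)) * (h / 2 * (h / 2)) ^ p ≤ (16 / (1 - δ) + 1) * (h / 2 * (h / 2)) ^ p := mul_le_mul_of_nonneg_right (by linarith) hX
    have h16 : 0 ≤ 16 / (1 - δ) + 2 := by positivity
    have := mul_le_mul_of_nonneg_left e1 h16
    linarith
  have Y : (M + η / D) / p ^ 2 ≤ 4 * (M + η / D) := by
    rw [div_eq_mul_one_div, mul_comm 4]; exact mul_le_mul_of_nonneg_left hp4 (by positivity)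
  have Z : (M + η / D) / p ^ 2 * ((8 / (1 - p) + p * (1 - p) / Real.exp (2 * T) * Real.exp (2 * t)) * (h / 2 * (h / 2)) ^ p + (Real.exp (2 * t) + h / 2 * (h / 2)) ^ p - Real.exp (2 * p * t)) ≤ 4 * (M + η / D) * ((16 / (1 - δ) + 2) * h ^ (1 + δ)) :=
    (mul_le_mul_of_nonneg_left X (by positivity)).trans (mul_le_mul_of_nonneg_right Y (by positivity))
  have W : 4 * (M + η / D) * ((16 / (1 - δ) + 2) * h ^ (1 + δ)) = 4 * (16 / (1 - δ) + 2) * M * h ^ (1 + δ) + η := by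
    rw [show 4 * (M + η / D) * ((16 / (1 - δ) + 2) * h ^ (1 + δ)) = (M + η / D) * D by rw [hD]; ring, add_mul, div_mul_cancel₀ _ hD0.ne', hD]; ring
  linarith

open scoped ContDiff

lemma half_iter {S : Set ℝ} {B C : ℝ} (hB : ∀ x ∈ S, x ≤ B) (hC : 0 ≤ C) (h : ∀ m, 0 ≤ m → (∀ x ∈ S, x ≤ m) → ∀ x ∈ S, x ≤ m / 2 + C) :
    ∀ x ∈ S, x ≤ 2 * C := by
  intro x hx
  have hne : S.Nonempty := ⟨x, hx⟩
  have hbd : BddAbove S := ⟨B, hB⟩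
  have h1 : ∀ x ∈ S, x ≤ max (sSup S) 0 := fun x hx => (le_csSup hbd hx).trans (le_max_left _ _)
  have h2 := h _ (le_max_right _ _) h1
  have h3 : sSup S ≤ max (sSup S) 0 / 2 + C := csSup_le hne h2
  have h4 : sSup S ≤ 2 * C := by
    rcases le_total (sSup S) 0 with h | h
    · linarith
    · rw [max_eq_left h] at h3; linarith
  exact (le_csSup hbd hx).trans h4

lemma sq_SD (a h : ℝ) : SD (fun h => a * h ^ 2) h (2 * a) := by
  refine SD_of_deriv (g' := fun h => a * (2 * h)) one_pos (fun y _ => ?_) ?_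
  · simpa using (hasDerivAt_pow 2 y).const_mul a
  · exact (((hasDerivAt_id h).const_mul 2).const_mul a).congr_deriv (by ring)

set_option maxHeartbeats 1000000 in
lemma C2b {T om M κ B δ δ₀ K m τ W : ℝ} {w F : ℝ → ℝ → ℝ → ℝ} (H : PD T om M κ B δ δ₀ w F) (ho0 : 0 < om)
    (hM : 0 ≤ M) (hδ0 : 0 < δ) (hδ1 : δ < 1) (hτ : τ ≤ T) (z : ℝ) (hm : 0 ≤ m) (hK : 0 ≤ K)
    (b1 : ∀ θ h, |h| ≤ Real.exp τ → w τ θ (z + h) + w τ θ (z - h) ≤ W + K)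
    (b2 : ∀ t ≤ τ, ∀ θ h, |h| = Real.exp τ → w t θ (z + h) + w t θ (z - h) ≤ W + K + m) {η : ℝ} (hη : 0 < η) :
    ∀ t ≤ τ, ∀ x ∈ {x : ℝ × ℝ | x.2 ∈ Icc (-Real.exp τ) (Real.exp τ)},
     w t x.1 (z + x.2) + w t x.1 (z - x.2) - W - K - m * ((Real.exp τ ^ 2)⁻¹ * x.2 ^ 2 + (1 / 2 - (Real.exp τ ^ 2)⁻¹ / 2 * Real.exp (2 * t)))
       - 2 * (M + η) * (Real.exp ((1 + δ) * τ) - Real.exp ((1 + δ) * t)) ≤ 0 := by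
  set ρ := Real.exp τ with hρ
  have hρ0 : 0 < ρ := Real.exp_pos _
  have hρ2 : Real.exp (2 * τ) = ρ ^ 2 := by rw [hρ, ← Real.exp_nat_mul]; norm_num
  have hψ : ∀ t ≤ τ, 0 ≤ Real.exp ((1 + δ) * τ) - Real.exp ((1 + δ) * t) := fun t ht => by
    have := Real.exp_le_exp.2 (show (1 + δ) * t ≤ (1 + δ) * τ by nlinarith)
    linarith
  have hβ : ∀ t ≤ τ, 0 ≤ 1 / 2 - (ρ ^ 2)⁻¹ / 2 * Real.exp (2 * t) := fun t ht => by
    have h1 := Real.exp_le_exp.2 (show 2 * t ≤ 2 * τ by linarith)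
    rw [hρ2] at h1
    have h2 : (ρ ^ 2)⁻¹ * Real.exp (2 * t) ≤ 1 := by rw [inv_mul_le_iff₀ (by positivity)]; linarith
    linarith
  refine MP (B := 2 * B - W - K) (K := Icc 0 (2 * om) ×ˢ Icc (-ρ) ρ) (ε₀ := η * Real.exp ((1 + δ) * τ) / 2) (isCompact_Icc.prod isCompact_Icc) (fun z hz => hz.2)
    (fun t (x : ℝ × ℝ) => w t x.1 (z + x.2) + w t x.1 (z - x.2) - W - K - m * ((ρ ^ 2)⁻¹ * x.2 ^ 2 + (1 / 2 - (ρ ^ 2)⁻¹ / 2 * Real.exp (2 * t)))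
       - 2 * (M + η) * (Real.exp ((1 + δ) * τ) - Real.exp ((1 + δ) * t))) ?_ ?_ ?_ (by positivity) ?_
  · refine ContinuousOn.sub (ContinuousOn.sub (ContinuousOn.sub (ContinuousOn.sub (ContinuousOn.add ?_ ?_) continuousOn_const) continuousOn_const) (Continuous.continuousOn (by fun_prop))) (Continuous.continuousOn (by fun_prop))
    · exact H.cont.comp (f := fun p : ℝ × ℝ × ℝ => (p.1, p.2.1, z + p.2.2)) (Continuous.continuousOn (by fun_prop)) (fun p hp => le_trans hp.1 hτ)
    · exact H.cont.comp (f := fun p : ℝ × ℝ × ℝ => (p.1, p.2.1, z - p.2.2)) (Continuous.continuousOn (by fun_prop)) (fun p hp => le_trans hp.1 hτ)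
  · rintro ⟨θ, h⟩ hz
    obtain ⟨θ', hθ', n, hn⟩ := exists_per (show 0 < 2 * om by linarith) θ
    refine ⟨(θ', h), ⟨hθ', hz⟩, fun t ht => ?_⟩
    rw [hn, H.perTz (ht.trans hτ), H.perTz (ht.trans hτ)]
  · intro t ht x hx
    have h1 := abs_le.1 (H.bd t (ht.trans hτ) x.1 (z + x.2))
    have h2 := abs_le.1 (H.bd t (ht.trans hτ) x.1 (z - x.2))
    have h3 := mul_nonneg hm (add_nonneg (show 0 ≤ (ρ ^ 2)⁻¹ * x.2 ^ 2 by positivity) (hβ t ht))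
    have h4 := mul_nonneg (show 0 ≤ 2 * (M + η) by positivity) (hψ t ht)
    linarith [h1.2, h2.2]
  · rintro ε hε hε2 t ht ⟨θ, h⟩ ⟨hh0, hh1⟩ hmax hpos
    simp only at hh0 hh1 hpos
    have h3 := mul_nonneg hm (add_nonneg (show 0 ≤ (ρ ^ 2)⁻¹ * h ^ 2 by positivity) (hβ t ht))
    have h4 := mul_nonneg (show 0 ≤ 2 * (M + η) by positivity) (hψ t ht)
    have hz : (θ, h) ∈ {x : ℝ × ℝ | x.2 ∈ Icc (-ρ) ρ} := ⟨hh0, hh1⟩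
    have habs : |h| ≠ ρ := by
      intro he
      have e1 := b2 t ht θ h he
      have e2 : (ρ ^ 2)⁻¹ * h ^ 2 = 1 := by rw [← sq_abs h, he]; field_simp
      have e3 := mul_nonneg hm (hβ t ht)
      rw [e2, mul_add] at hpos
      linarith
    have hh0' : -ρ < h := lt_of_le_of_ne hh0 (fun he => habs (by rw [← he, abs_neg, abs_of_pos hρ0]))
    have hh1' : h < ρ := lt_of_le_of_ne hh1 (fun he => habs (by rw [he, abs_of_pos hρ0]))
    rcases ht.eq_or_lt with htt | htT
    · have e1 := b1 θ h (abs_le.2 ⟨hh0, hh1⟩)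
      rw [← htt] at e1 h4
      rw [← htt] at hpos
      linarith
    · have htT' : t < T := htT.trans_le hτ
      obtain ⟨a1, b1, c1, p1, q1, r1, e1⟩ := H.sd t htT' θ (z + h)
      obtain ⟨a2, b2, c2, p2, q2, r2, e2⟩ := H.sd t htT' θ (z - h)
      have hs : 1 + δ ∈ ({δ₀, 1 + δ} : Set ℝ) := Or.inr rfl
      have f1 := abs_le.1 (H.Fb _ hs t htT' θ (z + h))
      have f2 := abs_le.1 (H.Fb _ hs t htT' θ (z - h))
      have i1 : (a1 + a2) + m * (ρ ^ 2)⁻¹ / 2 * (2 ^ 2 * Real.exp (2 * t)) + 2 * (M + η) * ((1 + δ) ^ 2 * Real.exp ((1 + δ) * t)) - ε * (4 * Real.exp (2 * (t - τ))) ≤ 0 := by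
        refine SD.nonpos_Ioo (Iic_mem_nhds htT) ((((p1.add p2).add ((exp_SD 2 t).cmul (m * (ρ ^ 2)⁻¹ / 2))).add ((exp_SD (1 + δ) t).cmul (2 * (M + η)))).sub ((ee_SD τ t).cmul ε)) ?_
        intro t' ht'
        have := hmax t' ht' (θ, h) hz
        simp only at this ⊢
        linarith
      have i2 : b1 + b2 ≤ 0 := by
        refine SD.nonpos_Ioo univ_mem (q1.add q2) ?_
        intro θ' _
        have := hmax t ht (θ', h) hz
        simp only at this ⊢
        linarith
      have i3 : (c1 + c2) - 2 * (m * (ρ ^ 2)⁻¹) ≤ 0 := by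
        refine SD.nonpos_Ioo (Icc_mem_nhds hh0' hh1') ((r1.shift.add r2.rshift).sub (sq_SD (m * (ρ ^ 2)⁻¹) h)) ?_
        intro h' hh'
        have := hmax t ht (θ, h') hh'
        simp only at this ⊢
        linarith
      have E : 0 < Real.exp (-2 * t) := Real.exp_pos _
      have j1 := mul_le_mul_of_nonneg_left (add_le_add i1 i2) E.le
      have x0 : Real.exp (-2 * t) * Real.exp (2 * t) = 1 := by rw [← Real.exp_add]; simp
      have x1 : Real.exp (-2 * t) * Real.exp ((1 + δ) * t) = Real.exp ((1 + δ - 2) * t) := by rw [← Real.exp_add]; congr 1; ring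
      have x2 : Real.exp (-2 * t) * Real.exp (2 * (t - τ)) = Real.exp (-2 * τ) := by rw [← Real.exp_add]; congr 1; ring
      have x3 : Real.exp ((1 + δ) * τ) * Real.exp (-2 * τ) ≤ Real.exp ((1 + δ - 2) * t) := by
        rw [← Real.exp_add]; apply Real.exp_le_exp.2; nlinarith
      have k3 : Real.exp (-2 * t) * ((a1 + a2) + m * (ρ ^ 2)⁻¹ / 2 * (2 ^ 2 * Real.exp (2 * t)) + 2 * (M + η) * ((1 + δ) ^ 2 * Real.exp ((1 + δ) * t)) - ε * (4 * Real.exp (2 * (t - τ))) + (b1 + b2))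
          = (F t θ (z + h) - c1) + (F t θ (z - h) - c2) + m * (ρ ^ 2)⁻¹ * 2 + 2 * (M + η) * (1 + δ) ^ 2 * Real.exp ((1 + δ - 2) * t) - 4 * ε * Real.exp (-2 * τ) := by
        rw [← e1, ← e2, ← x1, ← x2]; linear_combination (m * (ρ ^ 2)⁻¹ * 2) * x0
      rw [k3] at j1
      have k4 : ε * Real.exp (-2 * τ) < η * Real.exp ((1 + δ) * τ) / 2 * Real.exp (-2 * τ) := mul_lt_mul_of_pos_right hε2 (Real.exp_pos _)
      have k5 := mul_le_mul_of_nonneg_left x3 hη.le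
      have k6 : 2 * (M + η) * Real.exp ((1 + δ - 2) * t) ≤ 2 * (M + η) * (1 + δ) ^ 2 * Real.exp ((1 + δ - 2) * t) :=
        mul_le_mul_of_nonneg_right (by nlinarith [mul_nonneg hM hδ0.le, mul_pos hη hδ0]) (Real.exp_pos _).le
      linarith [f1.1, f2.1]

lemma C2c {T om M κ B δ δ₀ : ℝ} {w F : ℝ → ℝ → ℝ → ℝ} (H : PD T om M κ B δ δ₀ w F) (ho0 : 0 < om) (ho : om < π / 2)
    (hM : 0 ≤ M) (hδ0 : 0 < δ) (hδ1 : δ < 1) (hT : 16 ≤ Real.exp (2 * T)) {t τ : ℝ} (htτ : t ≤ τ) (hτ : τ ≤ T) (hτ2 : Real.exp τ ≤ 2) (θ θ' z : ℝ) :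
    w t θ z - w τ θ' z ≤ (2 * (2 / ((4 - (1 + δ) ^ 2) * Real.cos om)) + (4 * (16 / (1 - δ) + 2)) + 2) * M * Real.exp ((1 + δ) * τ) := by
  have hco : 0 < Real.cos om := Real.cos_pos_of_mem_Ioo ⟨by linarith, ho⟩
  have h4 : 0 < 4 - (1 + δ) ^ 2 := by nlinarith
  have h1d : 0 < 1 - δ := by linarith
  set k1 := 2 / ((4 - (1 + δ) ^ 2) * Real.cos om) with hk1
  set k2 := 4 * (16 / (1 - δ) + 2) with hk2
  have hk1' : 0 < k1 := by positivity
  have hk2' : 0 < k2 := by positivity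
  set E := Real.exp ((1 + δ) * τ) with hE
  have hE0 : 0 < E := Real.exp_pos _
  have hEr : Real.exp τ ^ (1 + δ) = E := by rw [← Real.exp_mul, hE]; congr 1; ring
  have hpi := Real.pi_gt_three
  have hs : 1 + δ ∈ ({δ₀, 1 + δ} : Set ℝ) := Or.inr rfl
  have key : ∀ x ∈ {x : ℝ | ∃ t ≤ τ, ∃ θ θ', x = 2 * w t θ z - 2 * w τ θ' z}, x ≤ 2 * ((2 * k1 + k2 + 2) * M * E) := by
    refine half_iter (B := 4 * B) ?_ (by positivity) ?_
    · rintro x ⟨t, ht, θ, θ', rfl⟩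
      have h1 := abs_le.1 (H.bd t (ht.trans hτ) θ z)
      have h2 := abs_le.1 (H.bd τ hτ θ' z)
      linarith [h1.2, h2.1]
    · rintro m hm hmS x ⟨t, ht, θ, θ', rfl⟩
      have Z : ∀ t ≤ τ, ∀ θ h, |h| ≤ Real.exp τ → w t θ (z + h) + w t θ (z - h) - 2 * w t θ z ≤ k2 * M * E := by
        intro t ht θ h hh
        have h1 : w t θ (z + |h|) + w t θ (z - |h|) - 2 * w t θ z ≤ k2 * M * |h| ^ (1 + δ) :=
          C2 H ho0 hM hδ0 hδ1 hT (ht.trans hτ) θ z (abs_nonneg h) (by linarith)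
        have h2 : |h| ^ (1 + δ) ≤ E := by rw [← hEr]; exact Real.rpow_le_rpow (abs_nonneg _) hh (by linarith)
        have h3 := mul_le_mul_of_nonneg_left h2 (show 0 ≤ k2 * M by positivity)
        rcases abs_choice h with h' | h'
        · rw [h'] at h1; rw [h'] at h3; linarith
        · rw [h', ← sub_eq_add_neg, sub_neg_eq_add] at h1; rw [h'] at h3; linarith
      refine le_of_forall_pos_le_add fun η hη => ?_
      have hη' : 0 < η / (2 * E) := by positivity
      have := C2b (K := 2 * (k1 * M * E) + k2 * M * E) (W := 2 * w τ θ' z) (m := m) H ho0 hM hδ0 hδ1 hτ z hm (by positivity) ?_ ?_ hη' t ht (θ, 0)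
        ⟨by simpa using (Real.exp_pos τ).le, (Real.exp_pos τ).le⟩
      · simp only [add_zero, sub_zero] at this
        have e1 : Real.exp ((1 + δ) * τ) - Real.exp ((1 + δ) * t) ≤ E := by have := Real.exp_pos ((1 + δ) * t); rw [hE]; linarith
        have e2 := mul_le_mul_of_nonneg_left e1 (show 0 ≤ 2 * (M + η / (2 * E)) by positivity)
        have e3 : 2 * (M + η / (2 * E)) * E = 2 * M * E + η := by field_simp
        have e4 : 0 ≤ m * ((Real.exp τ ^ 2)⁻¹ / 2 * Real.exp (2 * t)) := by positivity
        have e5 : m * ((Real.exp τ ^ 2)⁻¹ * 0 ^ 2 + (1 / 2 - (Real.exp τ ^ 2)⁻¹ / 2 * Real.exp (2 * t))) = m / 2 - m * ((Real.exp τ ^ 2)⁻¹ / 2 * Real.exp (2 * t)) := by ring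
        rw [e5] at this
        linarith
      · intro θ₁ h hh
        have := Z τ le_rfl θ₁ h hh
        have := C1 H ho0 ho hM hs (by linarith) (by linarith) hτ θ₁ θ' z
        linarith
      · intro t₁ ht₁ θ₁ h hh
        have := Z t₁ ht₁ θ₁ h hh.le
        have := hmS _ ⟨t₁, ht₁, θ₁, θ', rfl⟩
        have : 0 ≤ k1 * M * E := by positivity
        linarith
  have := key _ ⟨t, htτ, θ, θ', rfl⟩
  linarith

lemma oneD {g : ℝ → ℝ} {K δ : ℝ} (hδ : 0 < δ) (hg : Differentiable ℝ g)
    (hZ : ∀ y h, |h| ≤ 2 * π → |g (y + h) + g (y - h) - 2 * g y| ≤ K * |h| ^ (1 + δ)) (y h : ℝ) (hh : |h| ≤ 2 * π) :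
    |g (y + h) - g y - deriv g y * h| ≤ (1 / (1 - 2⁻¹ ^ δ)) * K * |h| ^ (1 + δ) := by
  rcases eq_or_ne h 0 with rfl | h0
  · simp [Real.zero_rpow (show 1 + δ ≠ 0 by linarith)]
  have hr1 : (2⁻¹ : ℝ) ^ δ < 1 := Real.rpow_lt_one (by norm_num) (by norm_num) hδ
  have hr0 : 0 < (2⁻¹ : ℝ) ^ δ := by positivity
  have habs : 0 < |h| := abs_pos.2 h0
  have hK : 0 ≤ K := by
    have := (abs_nonneg _).trans (hZ y h hh)
    exact nonneg_of_mul_nonneg_left this (by positivity)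
  set D : ℕ → ℝ := fun n => (g (y + h / 2 ^ n) - g y) / (h / 2 ^ n) with hD
  have hlim : Tendsto D atTop (𝓝 (deriv g y)) := by
    have h1 : HasDerivAt g (deriv g y) y := (hg y).hasDerivAt
    have h2 := h1.tendsto_slope_zero
    have h3 : Tendsto (fun n : ℕ => h / 2 ^ n) atTop (𝓝[≠] 0) := by
      refine tendsto_nhdsWithin_iff.2 ⟨?_, Eventually.of_forall fun n => ?_⟩
      · have := (tendsto_pow_atTop_nhds_zero_of_lt_one (show (0:ℝ) ≤ 1/2 by norm_num) (by norm_num)).const_mul h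
        rw [mul_zero] at this
        refine this.congr fun n => ?_
        rw [one_div, inv_pow]; rfl
      · show h / 2 ^ n ≠ 0
        positivity
    refine (h2.comp h3).congr fun n => ?_
    show (h / 2 ^ n)⁻¹ • _ = _
    rw [smul_eq_mul, hD]; ring
  have hstep : ∀ n, dist (D n) (D (n + 1)) ≤ (K * |h| ^ δ) * ((2⁻¹ : ℝ) ^ δ) ^ n := by
    intro n
    set k := h / 2 ^ (n + 1) with hk
    have hk0 : k ≠ 0 := by positivity
    have hkk : h / 2 ^ n = 2 * k := by rw [hk, pow_succ]; field_simp
    have hkabs : |k| = |h| * (2⁻¹) ^ n * 2⁻¹ := by rw [hk, abs_div, abs_of_pos (show (0:ℝ) < 2 ^ (n+1) by positivity), pow_succ, inv_pow]; field_simp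
    have hle : (2⁻¹:ℝ) ^ n ≤ 1 := pow_le_one₀ (by norm_num) (by norm_num)
    have hle' : |h| * (2⁻¹) ^ n ≤ |h| := mul_le_of_le_one_right habs.le hle
    have hZ' := hZ (y + k) k (by rw [hkabs]; linarith)
    rw [show y + k + k = y + 2 * k by ring, show y + k - k = y by ring] at hZ'
    have e : D n - D (n + 1) = (g (y + 2 * k) + g y - 2 * g (y + k)) / (2 * k) := by
      simp only [hD]; rw [hkk, ← hk]; field_simp; ring
    rw [Real.dist_eq, e, abs_div, abs_mul, abs_of_pos (show (0:ℝ) < 2 by norm_num)]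
    have hkp : 0 < |k| := abs_pos.2 hk0
    rw [div_le_iff₀ (by positivity)]
    refine hZ'.trans ?_
    rw [Real.rpow_add hkp, Real.rpow_one]
    have e2 : |k| ^ δ ≤ |h| ^ δ * ((2⁻¹ : ℝ) ^ δ) ^ n := by
      rw [show ((2⁻¹ : ℝ) ^ δ) ^ n = ((2⁻¹ : ℝ) ^ n) ^ δ by rw [← Real.rpow_natCast, ← Real.rpow_natCast, ← Real.rpow_mul (by norm_num), ← Real.rpow_mul (by norm_num), mul_comm],
        ← Real.mul_rpow habs.le (by positivity)]
      refine Real.rpow_le_rpow hkp.le ?_ hδ.le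
      rw [hkabs]; exact mul_le_of_le_one_right (by positivity) (by norm_num)
    have e3 := mul_le_mul_of_nonneg_left e2 (show 0 ≤ K * |k| by positivity)
    have e4 : 0 ≤ K * |h| ^ δ * ((2⁻¹ : ℝ) ^ δ) ^ n * |k| := by positivity
    nlinarith
  have := dist_le_of_le_geometric_of_tendsto₀ _ _ hr1 hstep hlim
  have e0 : D 0 = (g (y + h) - g y) / h := by simp [hD]
  rw [Real.dist_eq, e0] at this
  have e1 : g (y + h) - g y - deriv g y * h = ((g (y + h) - g y) / h - deriv g y) * h := by field_simp
  rw [e1, abs_mul]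
  have := mul_le_mul_of_nonneg_right this habs.le
  refine this.trans (le_of_eq ?_)
  rw [Real.rpow_add habs, Real.rpow_one]; field_simp

open scoped ContDiff

lemma C2abs {T om M κ B δ δ₀ : ℝ} {w F : ℝ → ℝ → ℝ → ℝ} (H : PD T om M κ B δ δ₀ w F) (ho0 : 0 < om)
    (hM : 0 ≤ M) (hδ0 : 0 < δ) (hδ1 : δ < 1) (hT : 16 ≤ Real.exp (2 * T)) {t : ℝ} (ht : t ≤ T) (θ y h : ℝ) (hh1 : |h| ≤ 2 * π) :
     |w t θ (y + h) + w t θ (y - h) - 2 * w t θ y| ≤ (4 * (16 / (1 - δ) + 2)) * M * |h| ^ (1 + δ) := by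
  have h1 := C2 H ho0 hM hδ0 hδ1 hT ht θ y (abs_nonneg h) hh1
  have h2 := C2 H.neg ho0 hM hδ0 hδ1 hT ht θ y (abs_nonneg h) hh1
  set R := 4 * (16 / (1 - δ) + 2) * M * |h| ^ (1 + δ)
  rw [abs_le]
  rcases abs_choice h with h' | h'
  · rw [h'] at h1 h2; constructor <;> linarith
  · rw [h', show y + -h = y - h by ring, show y - -h = y + h by ring] at h1 h2; constructor <;> linarith

lemma oneD' {g : ℝ → ℝ} {K δ : ℝ} (hδ : 0 < δ) (hδ1 : δ < 1) (hg : Differentiable ℝ g) (hper : ∀ y, g (y + 2 * π) = g y) (hK : 0 ≤ K)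
    (hZ : ∀ y h, |h| ≤ 2 * π → |g (y + h) + g (y - h) - 2 * g y| ≤ K * |h| ^ (1 + δ)) :
    (∀ y, |deriv g y| ≤ 8 * ((1 / (1 - 2⁻¹ ^ δ)) * K)) ∧ (∀ y y', g y - g y' ≤ 128 * ((1 / (1 - 2⁻¹ ^ δ)) * K)) := by
  have hr1 : (2⁻¹ : ℝ) ^ δ < 1 := Real.rpow_lt_one (by norm_num) (by norm_num) hδ
  set C := (1 / (1 - 2⁻¹ ^ δ)) * K with hC
  have hC0 : 0 ≤ C := mul_nonneg (by rw [one_div]; exact inv_nonneg.2 (by linarith)) hK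
  have hpi := Real.pi_gt_three
  have hpi4 := Real.pi_le_four
  have h8 : (2 * π) ^ δ ≤ 8 := by
    calc (2 * π) ^ δ ≤ (2 * π) ^ (1:ℝ) := Real.rpow_le_rpow_of_exponent_le (by linarith) hδ1.le
      _ ≤ 8 := by rw [Real.rpow_one]; linarith
  have hd : ∀ y, |deriv g y| ≤ 8 * C := by
    intro y
    have := oneD hδ hg hZ y (2 * π) (by rw [abs_of_pos (by linarith)])
    rw [hper, sub_self, zero_sub, abs_neg, abs_mul, abs_of_pos (show 0 < 2 * π by linarith), Real.rpow_add (by linarith), Real.rpow_one, ← hC] at this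
    have h1 : |deriv g y| * (2 * π) ≤ (C * (2 * π) ^ δ) * (2 * π) := by linarith
    have h2 := le_of_mul_le_mul_right h1 (by linarith)
    have := mul_le_mul_of_nonneg_left h8 hC0
    linarith
  refine ⟨hd, fun y y' => ?_⟩
  obtain ⟨k, hk, n, hn⟩ := exists_per (show 0 < 2 * π by linarith) (y - y')
  have e1 : g y = g (y' + k) := by
    have hp : Function.Periodic g (2 * π) := hper
    rw [← hp.int_mul n (y' + k)]; congr 1; linarith
  have h1 := oneD hδ hg hZ y' k (by rw [abs_of_nonneg hk.1]; exact hk.2)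
  rw [← hC, abs_of_nonneg hk.1] at h1
  have h2 : k ^ (1 + δ) ≤ 64 := by
    calc k ^ (1 + δ) ≤ (8:ℝ) ^ (1 + δ) := Real.rpow_le_rpow hk.1 (by linarith [hk.2]) (by linarith)
      _ ≤ (8:ℝ) ^ (2:ℝ) := Real.rpow_le_rpow_of_exponent_le (by norm_num) (by linarith)
      _ = 64 := by norm_num
  have h3 : deriv g y' * k ≤ 8 * C * 8 := by
    calc deriv g y' * k ≤ |deriv g y'| * k := mul_le_mul_of_nonneg_right (le_abs_self _) hk.1
      _ ≤ 8 * C * 8 := mul_le_mul (hd y') (by linarith [hk.2]) hk.1 (by positivity)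
  have h4 := mul_le_mul_of_nonneg_left h2 hC0
  rw [e1]
  have := (abs_le.1 h1).2
  linarith

lemma C3a {T om M κ B δ δ₀ τ S : ℝ} {w F : ℝ → ℝ → ℝ → ℝ} (H : PD T om M κ B δ δ₀ w F) (ho0 : 0 < om)
    (hM : 0 ≤ M) (hδ0 : 0 < δ₀) (hδ1 : δ₀ < 1) (hτ : τ ≤ T) (hS : ∀ θ y, w τ θ y ≤ S) {η : ℝ} (hη : 0 < η) :
    ∀ t ≤ τ, ∀ x ∈ (univ : Set (ℝ × ℝ)), w t x.1 x.2 - S + (M + η) / δ₀ ^ 2 * (Real.exp (δ₀ * t) - Real.exp (δ₀ * τ)) ≤ 0 := by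
  have hcc : (M + η) / δ₀ ^ 2 * δ₀ ^ 2 = M + η := by field_simp
  set c := (M + η) / δ₀ ^ 2 with hc
  have hcpos : 0 < c := by positivity
  have hψ : ∀ t ≤ τ, Real.exp (δ₀ * t) - Real.exp (δ₀ * τ) ≤ 0 := fun t ht => by
    have := Real.exp_le_exp.2 (show δ₀ * t ≤ δ₀ * τ by nlinarith)
    linarith
  refine MP (B := B - S) (K := Icc 0 (2 * om) ×ˢ Icc 0 (2 * π)) (ε₀ := η * Real.exp (δ₀ * τ) / 4) (isCompact_Icc.prod isCompact_Icc) (fun z hz => trivial)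
    (fun t (x : ℝ × ℝ) => w t x.1 x.2 - S + c * (Real.exp (δ₀ * t) - Real.exp (δ₀ * τ))) ?_ ?_ ?_ (by positivity) ?_
  · refine ContinuousOn.add (ContinuousOn.sub ?_ continuousOn_const) (Continuous.continuousOn (by fun_prop))
    exact H.cont.mono (fun p hp => le_trans hp.1 hτ)
  · rintro ⟨θ, y⟩ hz
    obtain ⟨θ', hθ', n, hn⟩ := exists_per (show 0 < 2 * om by linarith) θ
    obtain ⟨y', hy', n', hn'⟩ := exists_per Real.two_pi_pos y
    refine ⟨(θ', y'), ⟨hθ', hy'⟩, fun t ht => ?_⟩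
    rw [hn, hn', H.perTz (ht.trans hτ), H.perYz (ht.trans hτ)]
  · intro t ht x hx
    have h1 := abs_le.1 (H.bd t (ht.trans hτ) x.1 x.2)
    have h4 := mul_nonpos_of_nonneg_of_nonpos hcpos.le (hψ t ht)
    linarith [h1.2]
  · rintro ε hε hε2 t ht ⟨θ, y⟩ - hmax hpos
    simp only at hpos
    have h4 := mul_nonpos_of_nonneg_of_nonpos hcpos.le (hψ t ht)
    rcases ht.eq_or_lt with htt | htT
    · have := hS θ y
      rw [htt] at hpos h4
      linarith
    · have htT' : t < T := htT.trans_le hτ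
      obtain ⟨a1, b1, c1, p1, q1, r1, e1⟩ := H.sd t htT' θ y
      have hs : δ₀ ∈ ({δ₀, 1 + δ} : Set ℝ) := Or.inl rfl
      have f1 := abs_le.1 (H.Fb _ hs t htT' θ y)
      have i1 : a1 + c * (δ₀ ^ 2 * Real.exp (δ₀ * t)) - ε * (4 * Real.exp (2 * (t - τ))) ≤ 0 := by
        refine SD.nonpos_Ioo (Iic_mem_nhds htT) ((p1.add ((exp_SD δ₀ t).cmul c)).sub ((ee_SD τ t).cmul ε)) ?_
        intro t' ht'
        have := hmax t' ht' (θ, y) trivial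
        simp only at this ⊢
        linarith
      have i2 : b1 ≤ 0 := by
        refine SD.nonpos_Ioo univ_mem q1 ?_
        intro θ' _
        have := hmax t ht (θ', y) trivial
        simp only at this ⊢
        linarith
      have i3 : c1 ≤ 0 := by
        refine SD.nonpos_Ioo univ_mem r1 ?_
        intro y' hh'
        have := hmax t ht (θ, y') trivial
        simp only at this ⊢
        linarith
      have E : 0 < Real.exp (-2 * t) := Real.exp_pos _
      have j1 := mul_le_mul_of_nonneg_left (add_le_add i1 i2) E.le
      have x1 : Real.exp (-2 * t) * Real.exp (δ₀ * t) = Real.exp ((δ₀ - 2) * t) := by rw [← Real.exp_add]; congr 1; ring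
      have x2 : Real.exp (-2 * t) * Real.exp (2 * (t - τ)) = Real.exp (-2 * τ) := by rw [← Real.exp_add]; congr 1; ring
      have x3 : Real.exp (δ₀ * τ) * Real.exp (-2 * τ) ≤ Real.exp ((δ₀ - 2) * t) := by
        rw [← Real.exp_add]; apply Real.exp_le_exp.2; nlinarith
      have k3 : Real.exp (-2 * t) * (a1 + c * (δ₀ ^ 2 * Real.exp (δ₀ * t)) - ε * (4 * Real.exp (2 * (t - τ))) + b1)
          = (F t θ y - c1) + (M + η) * Real.exp ((δ₀ - 2) * t) - 4 * ε * Real.exp (-2 * τ) := by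
        rw [← e1, ← x1, ← x2, ← hcc]; ring
      rw [k3] at j1
      have k4 : ε * Real.exp (-2 * τ) < η * Real.exp (δ₀ * τ) / 4 * Real.exp (-2 * τ) := mul_lt_mul_of_pos_right hε2 (Real.exp_pos _)
      have k5 := mul_le_mul_of_nonneg_left x3 hη.le
      linarith [f1.1]

lemma C3b {T om M κ B δ δ₀ τ S : ℝ} {w F : ℝ → ℝ → ℝ → ℝ} (H : PD T om M κ B δ δ₀ w F) (ho0 : 0 < om)
    (hM : 0 ≤ M) (hδ0 : 0 < δ₀) (hδ1 : δ₀ < 1) (hτ : τ ≤ T) (hS : ∀ θ y, w τ θ y ≤ S) :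
    0 ≤ S + M / δ₀ ^ 2 * Real.exp (δ₀ * τ) := by
  refine le_of_forall_pos_le_add fun η hη => ?_
  have hη' : 0 < η * δ₀ ^ 2 / Real.exp (δ₀ * τ) := by positivity
  have h1 := C3a H ho0 hM hδ0 hδ1 hτ hS hη'
  refine le_of_tendsto H.zero ?_
  filter_upwards [eventually_le_atBot τ] with t ht
  have h2 := h1 t ht (0, 0) trivial
  simp only at h2
  set c := (M + η * δ₀ ^ 2 / Real.exp (δ₀ * τ)) / δ₀ ^ 2 with hc
  have hc0 : 0 < c := by positivity
  have e1 : c * Real.exp (δ₀ * τ) = M / δ₀ ^ 2 * Real.exp (δ₀ * τ) + η := by rw [hc]; field_simp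
  have e2 : 0 ≤ c * Real.exp (δ₀ * t) := by positivity
  linarith

theorem PDbound {om δ δ₀ : ℝ} (ho0 : 0 < om) (ho : om < π / 2) (hδ0 : 0 < δ) (hδ1 : δ < 1) (hδ₀0 : 0 < δ₀) (hδ₀1 : δ₀ < 1) :
    ∃ C, 1 ≤ C ∧ ∀ T M κ B w F, 16 ≤ Real.exp (2 * T) → 0 ≤ M → PD T om M κ B δ δ₀ w F →
      (∀ t τ, t ≤ τ → τ ≤ T → Real.exp τ ≤ 2 → ∀ θ θ' z, |w t θ z - w τ θ' z| ≤ C * M * Real.exp ((1 + δ) * τ)) ∧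
      (∀ t ≤ T, ∀ θ y h, |h| ≤ 2 * π → |w t θ (y + h) - w t θ y - deriv (fun y => w t θ y) y * h| ≤ C * M * |h| ^ (1 + δ)) ∧
      (∀ t ≤ T, ∀ θ y, |deriv (fun y => w t θ y) y| ≤ C * M) ∧
      (∀ t ≤ T, ∀ θ y, |w t θ y| ≤ C * M * (1 + Real.exp (δ₀ * t))) := by
  have hco : 0 < Real.cos om := Real.cos_pos_of_mem_Ioo ⟨by linarith, ho⟩
  have h4 : 0 < 4 - (1 + δ) ^ 2 := by nlinarith
  have h4' : 0 < 4 - δ₀ ^ 2 := by nlinarith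
  have h1d : 0 < 1 - δ := by linarith
  have hr1 : (2⁻¹ : ℝ) ^ δ < 1 := Real.rpow_lt_one (by norm_num) (by norm_num) hδ0
  set k1 := 2 / ((4 - (1 + δ) ^ 2) * Real.cos om) with hk1
  set k1' := 2 / ((4 - δ₀ ^ 2) * Real.cos om) with hk1d
  set k2 := 4 * (16 / (1 - δ) + 2) with hk2
  set k3 := 1 / (1 - (2⁻¹ : ℝ) ^ δ) with hk3
  have hk1' : 0 < k1 := by positivity
  have hk1d' : 0 < k1' := by positivity
  have hk2' : 0 < k2 := by positivity
  have hk3' : 0 < k3 := by rw [hk3, one_div]; exact inv_pos.2 (by linarith)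
  have hd2 : 0 < 1 / δ₀ ^ 2 := by positivity
  refine ⟨1 + (2 * k1 + k2 + 2) + k1' + 128 * (k3 * k2) + 1 / δ₀ ^ 2, ?_, ?_⟩
  · have : 0 < k3 * k2 := by positivity
    linarith
  intro T M κ B w F hT hM H
  set C := 1 + (2 * k1 + k2 + 2) + k1' + 128 * (k3 * k2) + 1 / δ₀ ^ 2 with hC
  have hk32 : 0 < k3 * k2 := by positivity
  have hosc : ∀ t ≤ T, ∀ θ, (∀ y, |deriv (fun y => w t θ y) y| ≤ 8 * (k3 * (k2 * M))) ∧ (∀ y y', w t θ y - w t θ y' ≤ 128 * (k3 * (k2 * M))) := fun t ht θ =>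
    oneD' hδ0 hδ1 (H.dy t ht θ) (H.perY t ht θ) (by positivity) (fun y h hh => C2abs H ho0 hM hδ0 hδ1 hT ht θ y h hh)
  have hle : ∀ c, c ≤ C → c * M ≤ C * M := fun c hc => mul_le_mul_of_nonneg_right hc hM
  refine ⟨?_, ?_, ?_, ?_⟩
  · intro t τ h1 h2 h3 θ θ' z
    have a1 := C2c H ho0 ho hM hδ0 hδ1 hT h1 h2 h3 θ θ' z
    have a2 := C2c H.neg ho0 ho hM hδ0 hδ1 hT h1 h2 h3 θ θ' z
    have a3 := mul_le_mul_of_nonneg_right (hle (2 * k1 + k2 + 2) (by linarith)) (Real.exp_pos ((1 + δ) * τ)).le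
    rw [abs_le]; constructor <;> linarith
  · intro t ht θ y h hh
    have := oneD hδ0 (H.dy t ht θ) (fun y h hh => C2abs H ho0 hM hδ0 hδ1 hT ht θ y h hh) y h hh
    refine this.trans (mul_le_mul_of_nonneg_right ?_ (by positivity))
    calc _ = (k3 * k2) * M := by ring
      _ ≤ _ := hle _ (by linarith)
  · intro t ht θ y
    refine ((hosc t ht θ).1 y).trans ?_
    calc _ = (8 * (k3 * k2)) * M := by ring
      _ ≤ _ := hle _ (by linarith)
  · intro t ht θ y
    have hs : δ₀ ∈ ({δ₀, 1 + δ} : Set ℝ) := Or.inl rfl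
    have a1 : ∀ θ' y', w t θ' y' ≤ w t θ y + (k1' * M * Real.exp (δ₀ * t) + 128 * (k3 * (k2 * M))) := fun θ' y' => by
      have := C1 H ho0 ho hM hs hδ₀0 (by linarith) ht θ' θ y'
      have := (hosc t ht θ).2 y' y
      linarith
    have a2 : ∀ θ' y', -w t θ' y' ≤ -w t θ y + (k1' * M * Real.exp (δ₀ * t) + 128 * (k3 * (k2 * M))) := fun θ' y' => by
      have := C1 H ho0 ho hM hs hδ₀0 (by linarith) ht θ θ' y'
      have := (hosc t ht θ).2 y y'
      linarith
    have b1 := C3b H ho0 hM hδ₀0 hδ₀1 ht a1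
    have b2 := C3b H.neg ho0 hM hδ₀0 hδ₀1 ht a2
    have c1 := hle (128 * (k3 * k2)) (by linarith)
    have c2 := mul_le_mul_of_nonneg_right (hle (k1' + 1 / δ₀ ^ 2) (by linarith)) (Real.exp_pos (δ₀ * t)).le
    have c3 : M / δ₀ ^ 2 * Real.exp (δ₀ * t) = 1 / δ₀ ^ 2 * M * Real.exp (δ₀ * t) := by ring
    rw [abs_le]; constructor <;> linarith

open scoped ContDiff

/-! ### density -/
lemma SL_dense {b₀ L : ℝ} : SL b₀ L ⊆ closure (wedgeQL b₀ L ∩ {x | rx x ≠ 1}) := by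
  intro x hx
  have h : wedgeQL b₀ L ⊆ closure (wedgeQL b₀ L ∩ {x | rx x ≠ 1}) := by
    intro x hx
    have ht : Tendsto (fun t : ℝ => t • x) (𝓝[<] 1) (𝓝 ((1:ℝ) • x)) :=
      ((continuous_id.smul continuous_const).tendsto 1).mono_left nhdsWithin_le_nhds
    rw [one_smul] at ht
    refine mem_closure_of_tendsto ht ?_
    have hl : ∀ᶠ t : ℝ in 𝓝[<] 1, t * rx x ≠ 1 := by
      by_cases h1 : rx x = 1
      · filter_upwards [self_mem_nhdsWithin] with t ht
        have : t < 1 := ht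
        rw [h1]; linarith [this.ne]
      · have : ContinuousAt (fun t : ℝ => t * rx x) 1 := by fun_prop
        have := this.eventually_ne (y := 1) (by simpa using h1)
        exact this.filter_mono nhdsWithin_le_nhds
    filter_upwards [hl, Ioo_mem_nhdsLT (show (0:ℝ) < 1 by norm_num)] with t h1 h2
    have hr : rx (t • x) = t * rx x := by rw [rx_smul, abs_of_pos h2.1]
    refine ⟨⟨⟨?_, ?_⟩, ?_⟩, ?_⟩
    · have := hx.1.1; simp; exact mul_pos h2.1 this
    · have := hx.1.2; simp; nlinarith [h2.1]
    · rw [hr]; have := hx.2; nlinarith [rx_nonneg x, h2.2]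
    · show rx (t • x) ≠ 1
      rw [hr]; exact h1
  exact closure_minimal h isClosed_closure hx.1

lemma SL_le {b₀ L : ℝ} {g k : V3 → ℝ} (hg : ContinuousOn g (SL b₀ L)) (hk : ContinuousOn k (SL b₀ L))
    (h : ∀ x ∈ wedgeQL b₀ L, rx x ≠ 1 → g x ≤ k x) : ∀ x ∈ SL b₀ L, g x ≤ k x := by
  intro x hx
  have hsub : wedgeQL b₀ L ∩ {x | rx x ≠ 1} ⊆ SL b₀ L := fun y hy => wedgeQL_sub_SL hy.1
  exact ContinuousWithinAt.closure_le (SL_dense hx) ((hg x hx).mono hsub) ((hk x hx).mono hsub) (fun y hy => h y hy.1 hy.2)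

/-! ### polar coordinates -/
def Pp (t φ y : ℝ) : V3 := !₂[Real.exp t * Real.cos φ, y, Real.exp t * Real.sin φ]

lemma Pp_rx (t φ y : ℝ) : rx (Pp t φ y) = Real.exp t := by
  have h : rx (Pp t φ y) ^ 2 = Real.exp t ^ 2 := by
    rw [rx_sq]; simp [Pp]; nlinarith [Real.sin_sq_add_cos_sq φ]
  exact (pow_left_inj₀ (rx_nonneg _) (Real.exp_pos t).le two_ne_zero).1 h

lemma tan_face {b₀ φ : ℝ} : Real.sin φ - b₀ * Real.cos φ = Real.sin (φ - Real.arctan b₀) / Real.cos (Real.arctan b₀) := by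
  have h := Real.cos_arctan_pos b₀
  rw [Real.sin_sub]
  have h2 : Real.sin (Real.arctan b₀) = b₀ * Real.cos (Real.arctan b₀) := by
    have := Real.tan_arctan b₀
    rw [Real.tan_eq_sin_div_cos, div_eq_iff h.ne'] at this
    exact this
  rw [h2]; field_simp

lemma Pp_mem {b₀ L t φ y : ℝ} (hb₀ : 0 < b₀) (hL : 0 < L) (h1 : Real.arctan b₀ ≤ φ) (h2 : φ ≤ π / 2) (ht : Real.exp t ≤ L) :
    Pp t φ y ∈ SL b₀ L := by
  rw [mem_SL hL, Pp_rx]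
  have h0 : 0 < Real.arctan b₀ := Real.arctan_pos.2 hb₀
  refine ⟨⟨?_, ?_⟩, Real.exp_pos t, ht⟩
  · have : 0 ≤ Real.cos φ := Real.cos_nonneg_of_mem_Icc ⟨by linarith, h2⟩
    simp [Pp]; positivity
  · have : 0 ≤ Real.sin φ - b₀ * Real.cos φ := by
      rw [tan_face]
      exact div_nonneg (Real.sin_nonneg_of_nonneg_of_le_pi (by linarith) (by linarith [Real.pi_pos])) (Real.cos_arctan_pos b₀).le
    simp [Pp]; nlinarith [Real.exp_pos t]

lemma Pp_surj {b₀ : ℝ} (hb₀ : 0 < b₀) {x : V3} (hx : x ∈ SQ b₀) :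
    ∃ φ, Real.arctan b₀ ≤ φ ∧ φ ≤ π / 2 ∧ x = Pp (Real.log (rx x)) φ (x 1) := by
  rw [mem_SQ] at hx
  obtain ⟨⟨h0, h2⟩, hr⟩ := hx
  have hsq := rx_sq x
  set r := rx x with hrd
  have hx2 : 0 ≤ x 2 := le_trans (by positivity) h2
  have hq0 : 0 ≤ x 0 / r := by positivity
  have hx0r : x 0 ≤ r := by nlinarith [sq_nonneg (x 2)]
  have hq1 : x 0 / r ≤ 1 := by rw [div_le_one hr]; exact hx0r
  have hc : Real.cos (Real.arccos (x 0 / r)) = x 0 / r := Real.cos_arccos (by linarith) hq1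
  have hs : Real.sin (Real.arccos (x 0 / r)) = x 2 / r := by
    rw [Real.sin_arccos]
    rw [show 1 - (x 0 / r) ^ 2 = (x 2 / r) ^ 2 by field_simp; linarith]
    exact Real.sqrt_sq (by positivity)
  refine ⟨Real.arccos (x 0 / r), ?_, Real.arccos_le_pi_div_two.2 hq0, ?_⟩
  · by_contra! h
    have h3 : Real.sin (Real.arccos (x 0 / r) - Real.arctan b₀) < 0 := by
      refine Real.sin_neg_of_neg_of_neg_pi_lt (by linarith) ?_
      have := Real.arctan_lt_pi_div_two b₀
      have := Real.arccos_nonneg (x 0 / r)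
      linarith [Real.pi_pos]
    have h4 := @tan_face b₀ (Real.arccos (x 0 / r))
    rw [hc, hs] at h4
    have h5 : 0 ≤ x 2 / r - b₀ * (x 0 / r) := by
      rw [show x 2 / r - b₀ * (x 0 / r) = (x 2 - b₀ * x 0) / r by ring]
      exact div_nonneg (by linarith) hr.le
    rw [h4] at h5
    exact absurd h5 (not_le.2 (div_neg_of_neg_of_pos h3 (Real.cos_arctan_pos b₀)))
  · ext i
    fin_cases i
    · simp [Pp, Real.exp_log hr, hc]; field_simp
    · simp [Pp]
    · simp [Pp, Real.exp_log hr, hs]; field_simp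

lemma Pp_cont : Continuous (fun p : ℝ × ℝ × ℝ => Pp p.1 p.2.1 p.2.2) := by
  unfold Pp
  refine (PiLp.continuous_toLp 2 _).comp (continuous_pi fun i => ?_)
  fin_cases i <;> simp <;> fun_prop

/-- curve lemmas -/
lemma curve1 {S : Set V3} (hS : UniqueDiffOn ℝ S) {v : V3 → ℝ} (hv : ContDiffOn ℝ 2 v S) {c : ℝ → V3} {c1 : V3} {I : Set ℝ} {s : ℝ}
    (hc : MapsTo c I S) (hs : s ∈ I) (h : HasDerivWithinAt c c1 I s) :
    HasDerivWithinAt (fun s => v (c s)) (fderivWithin ℝ v S (c s) c1) I s :=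
  ((hv.differentiableOn (by norm_num)) (c s) (hc hs)).hasFDerivWithinAt.comp_hasDerivWithinAt s h hc

lemma curve2 {S : Set V3} (hS : UniqueDiffOn ℝ S) {v : V3 → ℝ} (hv : ContDiffOn ℝ 2 v S) {c c' : ℝ → V3} {c2 : V3} {I : Set ℝ} {s : ℝ}
    (hc : MapsTo c I S) (hs : s ∈ I) (h : HasDerivWithinAt c (c' s) I s) (h2 : HasDerivWithinAt c' c2 I s) :
    HasDerivWithinAt (fun s => fderivWithin ℝ v S (c s) (c' s))
      (fderivWithin ℝ (fderivWithin ℝ v S) S (c s) (c' s) (c' s) + fderivWithin ℝ v S (c s) c2) I s := by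
  have h3 : DifferentiableOn ℝ (fderivWithin ℝ v S) S := (hv.fderivWithin hS (m := 1) (by norm_num)).differentiableOn (by norm_num)
  have h4 := (h3 (c s) (hc hs)).hasFDerivWithinAt.comp_hasDerivWithinAt s h hc
  exact h4.clm_apply h2

lemma hd_vec {a b c : ℝ → ℝ} {a' b' c' s : ℝ} (ha : HasDerivAt a a' s) (hb : HasDerivAt b b' s) (hc : HasDerivAt c c' s) :
    HasDerivAt (fun s => (!₂[a s, b s, c s] : V3)) !₂[a', b', c'] s := by
  have h : HasDerivAt (fun s => (![a s, b s, c s] : Fin 3 → ℝ)) ![a', b', c'] s := by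
    rw [hasDerivAt_pi]
    intro i; fin_cases i <;> simpa
  exact (PiLp.continuousLinearEquiv 2 ℝ (fun _ : Fin 3 => ℝ)).symm.hasFDerivAt.comp_hasDerivAt s h

/-! ### folding -/
def fold (om θ : ℝ) : ℝ := om / π * Real.arccos (Real.cos (π * θ / om))

lemma fold_mem {om : ℝ} (ho : 0 < om) (θ : ℝ) : fold om θ ∈ Icc 0 om := by
  have h1 := Real.arccos_nonneg (Real.cos (π * θ / om))
  have h2 := Real.arccos_le_pi (Real.cos (π * θ / om))
  have := Real.pi_pos
  refine ⟨by unfold fold; positivity, ?_⟩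
  calc fold om θ ≤ om / π * π := mul_le_mul_of_nonneg_left h2 (by positivity)
    _ = om := by field_simp

lemma fold_id {om s : ℝ} (ho : 0 < om) (hs : s ∈ Icc 0 om) : fold om s = s := by
  have := Real.pi_pos
  unfold fold
  rw [Real.arccos_cos (by have := hs.1; positivity)]
  · field_simp
  · rw [div_le_iff₀ ho]; nlinarith [hs.2]

lemma fold_neg (om θ : ℝ) : fold om (-θ) = fold om θ := by
  unfold fold; rw [show π * -θ / om = -(π * θ / om) by ring, Real.cos_neg]

lemma fold_per {om : ℝ} (ho : 0 < om) (θ : ℝ) : fold om (θ + 2 * om) = fold om θ := by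
  unfold fold
  rw [show π * (θ + 2 * om) / om = π * θ / om + 2 * π by field_simp, Real.cos_add_two_pi]

lemma fold_per_int {om : ℝ} (ho : 0 < om) (θ : ℝ) (n : ℤ) : fold om (θ + 2 * n * om) = fold om θ := by
  unfold fold
  rw [show π * (θ + 2 * n * om) / om = π * θ / om + n * (2 * π) by field_simp, Real.cos_add_int_mul_two_pi]

lemma fold_cont (om : ℝ) : Continuous (fold om) := by
  unfold fold; exact continuous_const.mul (Real.continuous_arccos.comp (by fun_prop))

lemma fold_rep {om : ℝ} (ho : 0 < om) (θ : ℝ) : ∃ n : ℤ, θ = fold om θ + 2 * n * om ∨ θ = - fold om θ + 2 * n * om := by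
  have hp := Real.pi_pos
  have h : Real.cos (π * fold om θ / om) = Real.cos (π * θ / om) := by
    unfold fold
    rw [show π * (om / π * Real.arccos (Real.cos (π * θ / om))) / om = Real.arccos (Real.cos (π * θ / om)) by field_simp]
    exact Real.cos_arccos (Real.neg_one_le_cos _) (Real.cos_le_one _)
  obtain ⟨k, hk⟩ := Real.cos_eq_cos_iff.1 h
  refine ⟨k, ?_⟩
  rcases hk with hk | hk
  · left; field_simp at hk; linarith
  · right; field_simp at hk; linarith

lemma oneside {k k1 : ℝ → ℝ} {r l : ℝ} (hr : 0 < r) (h1 : ∀ s ∈ Icc 0 r, HasDerivWithinAt k (k1 s) (Icc 0 r) s)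
    (h2 : HasDerivWithinAt k1 l (Icc 0 r) 0) (h0 : k1 0 = 0) :
    Tendsto (fun ε : ℝ => (k ε + k ε - 2 * k 0) / ε ^ 2) (𝓝[>] 0) (𝓝 l) := by
  have hp : ∀ ε ∈ Ioo 0 r, HasDerivAt (fun ε => k ε + k ε - 2 * k 0) (2 * k1 ε) ε := by
    intro ε hε
    have a := (h1 ε ⟨hε.1.le, hε.2.le⟩).hasDerivAt (Icc_mem_nhds hε.1 hε.2)
    exact ((a.add a).sub_const _).congr_deriv (by ring)
  have hle : 𝓝[>] (0:ℝ) ≤ 𝓝[Icc 0 r] 0 := by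
    rw [← nhdsWithin_Ioo_eq_nhdsGT hr]
    exact nhdsWithin_mono _ Ioo_subset_Icc_self
  refine HasDerivAt.lhopital_zero_nhdsGT (f' := fun ε => 2 * k1 ε) (g' := fun ε => 2 * ε) ?_ ?_ ?_ ?_ ?_ ?_
  · filter_upwards [Ioo_mem_nhdsGT hr] with ε hε using hp ε hε
  · filter_upwards with ε
    simpa using hasDerivAt_pow 2 ε
  · filter_upwards [self_mem_nhdsWithin] with ε hε
    have : 0 < ε := hε
    positivity
  · have c := ((h1 0 ⟨le_rfl, hr.le⟩).continuousWithinAt.tendsto).mono_left hle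
    have := (c.add c).sub_const (2 * k 0)
    simpa [two_mul] using this
  · have := ((continuous_pow 2).tendsto (0:ℝ)).mono_left (nhdsWithin_le_nhds (s := Ioi 0))
    simpa using this
  · have d := hasDerivWithinAt_iff_tendsto_slope.1 h2
    have hle' : 𝓝[>] (0:ℝ) ≤ 𝓝[Icc 0 r \ {0}] 0 := by
      rw [← nhdsWithin_Ioo_eq_nhdsGT hr]
      refine nhdsWithin_mono _ fun x hx => ⟨⟨hx.1.le, hx.2.le⟩, ?_⟩
      exact hx.1.ne'
    refine (d.mono_left hle').congr' ?_
    filter_upwards [self_mem_nhdsWithin] with ε hε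
    have : 0 < ε := hε
    rw [slope_def_field, h0, sub_zero, sub_zero, mul_div_mul_left _ _ two_ne_zero]

lemma fold_SD {om : ℝ} (ho : 0 < om) {h h1 h2 : ℝ → ℝ} (hd1 : ∀ s ∈ Icc 0 om, HasDerivWithinAt h (h1 s) (Icc 0 om) s)
    (hd2 : ∀ s ∈ Icc 0 om, HasDerivWithinAt h1 (h2 s) (Icc 0 om) s) (z0 : h1 0 = 0) (z1 : h1 om = 0) (θ : ℝ) :
    SD (fun θ => h (fold om θ)) θ (h2 (fold om θ)) := by
  have hs := fold_mem ho θ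
  obtain ⟨n, hn⟩ := fold_rep ho θ
  set s := fold om θ with hsd
  have red : SD (fun θ => h (fold om θ)) s (h2 s) → SD (fun θ => h (fold om θ)) θ (h2 s) := by
    intro H
    refine Tendsto.congr (fun ε => ?_) H
    have e0 : fold om s = fold om θ := fold_id ho hs
    rcases hn with hn | hn
    · have e1 : fold om (θ + ε) = fold om (s + ε) := by
        rw [hn, show s + 2 * n * om + ε = (s + ε) + 2 * n * om by ring, fold_per_int ho]
      have e2 : fold om (θ - ε) = fold om (s - ε) := by
        rw [hn, show s + 2 * n * om - ε = (s - ε) + 2 * n * om by ring, fold_per_int ho]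
      simp only [e1, e2, e0]
    · have e1 : fold om (θ + ε) = fold om (s - ε) := by
        rw [hn, show - s + 2 * n * om + ε = -(s - ε) + 2 * n * om by ring, fold_per_int ho, fold_neg]
      have e2 : fold om (θ - ε) = fold om (s + ε) := by
        rw [hn, show - s + 2 * n * om - ε = -(s + ε) + 2 * n * om by ring, fold_per_int ho, fold_neg]
      simp only [e1, e2, e0]; ring
  apply red
  rcases hs.1.eq_or_lt with h0 | h0
  · rw [← h0]
    refine Tendsto.congr' ?_ (oneside ho hd1 (hd2 0 ⟨le_rfl, ho.le⟩) z0)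
    filter_upwards [Ioo_mem_nhdsGT ho] with ε hε
    rw [zero_add, zero_sub, fold_neg, fold_id ho ⟨hε.1.le, hε.2.le⟩, fold_id ho ⟨le_rfl, ho.le⟩]
  rcases hs.2.eq_or_lt with h0' | h0'
  · rw [h0']
    have hm : MapsTo (fun e : ℝ => om - e) (Icc 0 om) (Icc 0 om) := fun e he => ⟨by linarith [he.2], by linarith [he.1]⟩
    have hid : ∀ e : ℝ, HasDerivWithinAt (fun e : ℝ => om - e) (-1) (Icc 0 om) e := fun e => by
      simpa using ((hasDerivAt_id e).const_sub om).hasDerivWithinAt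
    have k1 : ∀ e ∈ Icc 0 om, HasDerivWithinAt (fun e => h (om - e)) (- h1 (om - e)) (Icc 0 om) e := fun e he =>
      ((hd1 (om - e) (hm he)).comp e (hid e) hm).congr_deriv (by ring)
    have k2 : HasDerivWithinAt (fun e => - h1 (om - e)) (h2 om) (Icc 0 om) 0 := by
      have hq : HasDerivWithinAt h1 (h2 om) (Icc 0 om) (om - 0) := by
        rw [sub_zero]; exact hd2 om ⟨ho.le, le_rfl⟩
      exact (hq.comp 0 (hid 0) hm).neg.congr_deriv (by ring)
    refine Tendsto.congr' ?_ (oneside ho k1 k2 (by simp [z1]))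
    filter_upwards [Ioo_mem_nhdsGT ho] with ε hε
    have e1 : fold om (om + ε) = fold om (om - ε) := by
      rw [← fold_neg, ← fold_per ho, show -(om + ε) + 2 * om = om - ε by ring]
    rw [e1, fold_id ho (hm ⟨hε.1.le, hε.2.le⟩), fold_id ho ⟨ho.le, le_rfl⟩, sub_zero]
  · have hI : Icc 0 om ∈ 𝓝 s := Icc_mem_nhds h0 h0'
    have hr : 0 < min s (om - s) := lt_min h0 (by linarith)
    refine Tendsto.congr' ?_ (SD_of_deriv (g := h) (g' := h1) hr (fun y hy => ?_) ((hd2 s hs).hasDerivAt hI))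
    · filter_upwards [Ioo_mem_nhdsGT hr] with ε hε
      have a1 := min_le_left s (om - s)
      have a2 := min_le_right s (om - s)
      have a3 := hε.1
      have a4 := hε.2
      rw [fold_id ho ⟨by linarith, by linarith⟩, fold_id ho ⟨by linarith, by linarith⟩, fold_id ho hs]
    · have a1 := min_le_left s (om - s)
      have a2 := min_le_right s (om - s)
      rw [abs_lt] at hy
      exact (hd1 y ⟨by linarith [hy.1], by linarith [hy.2]⟩).hasDerivAt (Icc_mem_nhds (by linarith [hy.1]) (by linarith [hy.2]))

open scoped ContDiff

lemma SL_sub_SQ {b₀ L : ℝ} (hL : 0 < L) : SL b₀ L ⊆ SQ b₀ := fun x hx => mem_SQ.2 ⟨((mem_SL hL).1 hx).1, ((mem_SL hL).1 hx).2.1⟩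

lemma wt_aux {r N M a s : ℝ} (hr : 0 < r) (h : r ^ a * N ≤ M) (hs : (r ≤ 1 ∧ s ≤ -a) ∨ (1 ≤ r ∧ -a ≤ s)) (hM : 0 ≤ M) : N ≤ M * r ^ s := by
  have h1 : N ≤ M * r ^ (-a) := by
    rw [Real.rpow_neg hr.le, ← div_eq_mul_inv, le_div_iff₀ (by positivity)]; linarith
  refine h1.trans (mul_le_mul_of_nonneg_left ?_ hM)
  rcases hs with hs | hs
  · exact Real.rpow_le_rpow_of_exponent_ge hr hs.1 hs.2
  · exact Real.rpow_le_rpow_of_exponent_le hs.1 hs.2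

lemma f_bound {b₀ L α δ δ₀ M : ℝ} (hL : 0 < L) (hδ0 : 0 < δ) (hδ1 : δ < 1) (hM : 0 ≤ M) {f : V3 → ℝ}
    (hf : ContDiffOn ℝ 4 f (SQ b₀)) (h : wnormLE (SQ b₀) 4 α (1 - δ) (2 - δ₀) (wedgeQL b₀ L) f M) {s : ℝ} (hs : s ∈ Icc δ₀ (1 + δ)) :
    ∀ j : ℕ, j ≤ 4 → ∀ x ∈ SL b₀ L, ‖iteratedFDerivWithin ℝ j f (SQ b₀) x‖ ≤ M * rx x ^ (s - 2 - j) := by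
  intro j hj
  have hsub := SL_sub_SQ (b₀ := b₀) hL
  refine SL_le ?_ ?_ ?_
  · exact ((hf.continuousOn_iteratedFDerivWithin (by exact_mod_cast hj) (SQ_ud b₀)).mono hsub).norm
  · refine continuousOn_const.mul (ContinuousOn.rpow_const rx_cont.continuousOn fun x hx => Or.inl ?_)
    exact ((mem_SL hL).1 hx).2.1.ne'
  · intro x hx h1
    have hr := ((mem_SL hL).1 (wedgeQL_sub_SL hx)).2.1
    rcases lt_or_gt_of_ne h1 with h1 | h1
    · have := h.1.1 j hj x hx hr h1
      have hj0 : (0:ℝ) ≤ j := Nat.cast_nonneg j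
      rw [max_eq_left (by linarith)] at this
      exact wt_aux hr this (Or.inl ⟨h1.le, by linarith [hs.2]⟩) hM
    · have := h.1.2 j hj x hx h1
      exact wt_aux hr this (Or.inr ⟨h1.le, by linarith [hs.1]⟩) hM

lemma f_hold {b₀ L α δ δ₀ M : ℝ} (hL : 0 < L) (hα0 : 0 < α) (hδ0 : 0 < δ) (hδ1 : δ < 1) (hM : 0 ≤ M) {f : V3 → ℝ}
    (hf : ContDiffOn ℝ 4 f (SQ b₀)) (h : wnormLE (SQ b₀) 4 α (1 - δ) (2 - δ₀) (wedgeQL b₀ L) f M) {s : ℝ} (hs : s ∈ Icc δ₀ (1 + δ)) :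
    ∀ x ∈ SL b₀ L, ∀ y ∈ SL b₀ L, ‖iteratedFDerivWithin ℝ 4 f (SQ b₀) x - iteratedFDerivWithin ℝ 4 f (SQ b₀) y‖ ≤ M * ‖x - y‖ ^ α * min (rx x) (rx y) ^ (s - 6 - α) := by
  have hsub := SL_sub_SQ (b₀ := b₀) hL
  have hpos : ∀ x ∈ SL b₀ L, 0 < rx x := fun x hx => ((mem_SL hL).1 hx).2.1
  have hc : ContinuousOn (iteratedFDerivWithin ℝ 4 f (SQ b₀)) (SL b₀ L) := (hf.continuousOn_iteratedFDerivWithin (by norm_num) (SQ_ud b₀)).mono hsub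
  have hE : ∀ x ∈ wedgeQL b₀ L, rx x ≠ 1 → ∀ y ∈ wedgeQL b₀ L, rx y ≠ 1 → ‖iteratedFDerivWithin ℝ 4 f (SQ b₀) x - iteratedFDerivWithin ℝ 4 f (SQ b₀) y‖ ≤ M * ‖x - y‖ ^ α * min (rx x) (rx y) ^ (s - 6 - α) := by
    intro x hx hx1 y hy hy1
    have hr : 0 < min (rx x) (rx y) := lt_min (hpos x (wedgeQL_sub_SL hx)) (hpos y (wedgeQL_sub_SL hy))
    have h1 : min (rx x) (rx y) ≠ 1 := by rcases min_choice (rx x) (rx y) with h | h <;> rw [h] <;> assumption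
    rcases lt_or_gt_of_ne h1 with h1 | h1
    · have := h.2.1 x hx y hy hr h1
      rw [max_eq_left (by push_cast; linarith)] at this
      exact wt_aux hr this (Or.inl ⟨h1.le, by push_cast; linarith [hs.2]⟩) (by positivity)
    · have := h.2.2 x hx y hy h1
      exact wt_aux hr this (Or.inr ⟨h1.le, by push_cast; linarith [hs.1]⟩) (by positivity)
  intro x hx
  refine SL_le (continuousOn_const.sub hc).norm ?_ ?_
  · refine ContinuousOn.mul ?_ (ContinuousOn.rpow_const (continuous_const.min rx_cont).continuousOn fun y hy => Or.inl (lt_min (hpos x hx) (hpos y hy)).ne')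
    exact continuousOn_const.mul ((continuousOn_const.sub continuousOn_id).norm.rpow_const fun _ _ => Or.inr hα0.le)
  intro y hy hy1
  refine SL_le (g := fun x => ‖iteratedFDerivWithin ℝ 4 f (SQ b₀) x - iteratedFDerivWithin ℝ 4 f (SQ b₀) y‖) (k := fun x => M * ‖x - y‖ ^ α * min (rx x) (rx y) ^ (s - 6 - α)) (hc.sub continuousOn_const).norm ?_ ?_ x hx
  · refine ContinuousOn.mul ?_ (ContinuousOn.rpow_const (rx_cont.min continuous_const).continuousOn fun x hx => Or.inl (lt_min (hpos x hx) (hpos y (wedgeQL_sub_SL hy))).ne')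
    exact continuousOn_const.mul ((continuousOn_id.sub continuousOn_const).norm.rpow_const fun _ _ => Or.inr hα0.le)
  · intro x hx hx1
    exact hE x hx hx1 y hy hy1

lemma v_bd {b₀ L δ δ₀ M : ℝ} (hL : 1 ≤ L) (hδ0 : 0 < δ) (hδ₀0 : 0 < δ₀) {v : V3 → ℝ} (hv : ContinuousOn v (SL b₀ L))
    (h : wsupLE (SL b₀ L) 0 (-1 - δ) (-δ₀) (wedgeQL b₀ L) v M) : ∀ x ∈ SL b₀ L, |v x| ≤ |M| * L ^ δ₀ := by
  have hL0 : 0 < L := by linarith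
  refine SL_le hv.norm continuousOn_const ?_
  intro x hx h1
  have hr := ((mem_SL hL0).1 (wedgeQL_sub_SL hx)).2
  have hL1 : 1 ≤ L ^ δ₀ := Real.one_le_rpow hL hδ₀0.le
  rcases lt_or_gt_of_ne h1 with h1 | h1
  · have := h.1 0 le_rfl x hx hr.1 h1
    rw [max_eq_right (by push_cast; linarith), Real.rpow_zero, one_mul, norm_iteratedFDerivWithin_zero] at this
    have h2 := le_abs_self M
    exact (this.trans h2).trans (le_mul_of_one_le_right (abs_nonneg M) hL1)
  · have := h.2 0 le_rfl x hx h1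
    rw [norm_iteratedFDerivWithin_zero] at this
    have h2 := wt_aux hr.1 (this.trans (le_abs_self M)) (Or.inr ⟨h1.le, le_rfl⟩) (abs_nonneg M)
    refine h2.trans (mul_le_mul_of_nonneg_left ?_ (abs_nonneg M))
    have : -(-δ₀ + ((0:ℕ):ℝ)) = δ₀ := by push_cast; ring
    rw [this]
    exact Real.rpow_le_rpow hr.1.le hr.2 hδ₀0.le

lemma lapW_H {S : Set V3} (hS : UniqueDiffOn ℝ S) {v : V3 → ℝ} (hv : ContDiffOn ℝ 2 v S) {x : V3} (hx : x ∈ S) :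
    lapW S v x = fderivWithin ℝ (fderivWithin ℝ v S) S x (EuclideanSpace.single 0 1) (EuclideanSpace.single 0 1) +
      fderivWithin ℝ (fderivWithin ℝ v S) S x (EuclideanSpace.single 1 1) (EuclideanSpace.single 1 1) +
      fderivWithin ℝ (fderivWithin ℝ v S) S x (EuclideanSpace.single 2 1) (EuclideanSpace.single 2 1) := by
  unfold lapW
  rw [Fin.sum_univ_three]
  rw [← pd_pd hS hx hv, ← pd_pd hS hx hv, ← pd_pd hS hx hv]
  rfl

lemma lap_SL {b₀ L : ℝ} (hL : 0 < L) {f v : V3 → ℝ} (hf : ContinuousOn f (SQ b₀)) (hv : ContDiffOn ℝ 2 v (SL b₀ L))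
    (h : ∀ y ∈ wedgeQL b₀ L, lapW (SL b₀ L) v y = f y) : ∀ y ∈ SL b₀ L, lapW (SL b₀ L) v y = f y := by
  have hS := SL_ud b₀ hL
  have hc : ContinuousOn (lapW (SL b₀ L) v) (SL b₀ L) := by
    have h1 : ∀ i : Fin 3, ContinuousOn (pdW (SL b₀ L) i (pdW (SL b₀ L) i v)) (SL b₀ L) := by
      intro i
      have a := pd_contDiffOn hS (m := 1) (n := 2) (by norm_num) hv (EuclideanSpace.single i 1)
      exact (pd_contDiffOn hS (m := 0) (n := 1) (by norm_num) a (EuclideanSpace.single i 1)).continuousOn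
    unfold lapW
    exact continuousOn_finsetSum _ fun i _ => h1 i
  have hf' := hf.mono (SL_sub_SQ (b₀ := b₀) hL)
  intro y hy
  exact le_antisymm (SL_le hc hf' (fun x hx _ => (h x hx).le) y hy) (SL_le hf' hc (fun x hx _ => (h x hx).ge) y hy)

lemma vec_dec (a b c : ℝ) : (!₂[a, b, c] : V3) = a • EuclideanSpace.single 0 1 + b • EuclideanSpace.single 1 1 + c • EuclideanSpace.single 2 1 := by
  ext i; fin_cases i <;> simp

lemma Pp_per (t φ y : ℝ) : Pp t φ (y + 2 * π) = Pp t φ y + EuclideanSpace.single 1 (2 * π) := by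
  ext i; fin_cases i <;> simp [Pp]

lemma Pp_ht (φ y s : ℝ) : HasDerivAt (fun s => Pp s φ y) !₂[Real.exp s * Real.cos φ, 0, Real.exp s * Real.sin φ] s :=
  hd_vec ((Real.hasDerivAt_exp s).mul_const _) (hasDerivAt_const _ _) ((Real.hasDerivAt_exp s).mul_const _)
lemma Pp_htt (φ s : ℝ) : HasDerivAt (fun s => (!₂[Real.exp s * Real.cos φ, 0, Real.exp s * Real.sin φ] : V3)) !₂[Real.exp s * Real.cos φ, 0, Real.exp s * Real.sin φ] s :=
  hd_vec ((Real.hasDerivAt_exp s).mul_const _) (hasDerivAt_const _ _) ((Real.hasDerivAt_exp s).mul_const _)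
lemma Pp_hy (t φ y : ℝ) : HasDerivAt (fun y => Pp t φ y) !₂[0, 1, 0] y :=
  hd_vec (hasDerivAt_const _ _) (hasDerivAt_id _) (hasDerivAt_const _ _)
lemma Pp_hφ (t a y s : ℝ) : HasDerivAt (fun s => Pp t (a + s) y) !₂[-(Real.exp t * Real.sin (a + s)), 0, Real.exp t * Real.cos (a + s)] s :=
  hd_vec ((((Real.hasDerivAt_cos _).comp_const_add a s).const_mul _).congr_deriv (by ring)) (hasDerivAt_const _ _)
    (((Real.hasDerivAt_sin _).comp_const_add a s).const_mul _)
lemma Pp_hφφ (t a s : ℝ) : HasDerivAt (fun s => (!₂[-(Real.exp t * Real.sin (a + s)), 0, Real.exp t * Real.cos (a + s)] : V3)) !₂[-(Real.exp t * Real.cos (a + s)), 0, -(Real.exp t * Real.sin (a + s))] s :=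
  hd_vec (((Real.hasDerivAt_sin _).comp_const_add a s).const_mul _).neg (hasDerivAt_const _ _)
    ((((Real.hasDerivAt_cos _).comp_const_add a s).const_mul _).congr_deriv (by ring))

set_option maxHeartbeats 1000000 in
lemma toPD {b₀ L α δ δ₀ M M0 : ℝ} (hb₀ : 0 < b₀) (hL : 1 ≤ L) (hδ0 : 0 < δ) (hδ1 : δ < 1) (hδ₀0 : 0 < δ₀) (hδ₀1 : δ₀ < 1) (hM : 0 ≤ M)
    {f v : V3 → ℝ} (hf : ContDiffOn ℝ 4 f (SQ b₀)) (h : wnormLE (SQ b₀) 4 α (1 - δ) (2 - δ₀) (wedgeQL b₀ L) f M)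
    (hv : IsCutoffSolution b₀ L f v) (hvb : wsupLE (SL b₀ L) 0 (-1 - δ) (-δ₀) (wedgeQL b₀ L) v M0) :
    PD (Real.log L) (π / 2 - Real.arctan b₀) M (L * cutoffConst b₀ L f) (|M0| * L ^ δ₀) δ δ₀
      (fun t θ y => v (Pp t (Real.arctan b₀ + fold (π / 2 - Real.arctan b₀) θ) y))
      (fun t θ y => f (Pp t (Real.arctan b₀ + fold (π / 2 - Real.arctan b₀) θ) y)) := by
  obtain ⟨hv2, hlap, hN1, hN2, hN3, hper, hzero⟩ := hv
  have hL0 : 0 < L := by linarith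
  have ho : 0 < π / 2 - Real.arctan b₀ := by linarith [Real.arctan_lt_pi_div_two b₀]
  set a := Real.arctan b₀ with ha
  set om := π / 2 - a with hom
  have hS := SL_ud b₀ hL0
  set S := SL b₀ L with hSd
  have hexp : ∀ t, t ≤ Real.log L → Real.exp t ≤ L := fun t ht => by
    have := Real.exp_le_exp.2 ht; rwa [Real.exp_log hL0] at this
  have hmem : ∀ t s y, t ≤ Real.log L → s ∈ Icc 0 om → Pp t (a + s) y ∈ S := fun t s y ht hs =>
    Pp_mem hb₀ hL0 (by linarith [hs.1]) (by have := hs.2; rw [hom] at this; linarith) (hexp t ht)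
  refine ⟨?_, ?_, ?_, ?_, ?_, ?_, ?_, ?_, ?_⟩
  · refine hv2.continuousOn.comp (g := v) (f := fun p : ℝ × ℝ × ℝ => Pp p.1 (a + fold om p.2.1) p.2.2) ?_ ?_
    · refine (Pp_cont.comp (g := fun p : ℝ × ℝ × ℝ => Pp p.1 p.2.1 p.2.2) (f := fun p : ℝ × ℝ × ℝ => (p.1, a + fold om p.2.1, p.2.2)) ?_).continuousOn
      have := fold_cont om
      fun_prop
    · intro p hp
      exact hmem _ _ _ hp (fold_mem ho _)
  · intro t _ θ y
    rw [fold_per ho]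
  · intro t ht θ y
    rw [Pp_per]
    exact hper _ (hmem t _ y ht (fold_mem ho _)).1
  · intro t ht θ y
    set s := fold om θ with hs
    have hsm := fold_mem ho θ
    have hx := hmem t s y ht.le hsm
    set x := Pp t (a + s) y with hxd
    set G := fderivWithin ℝ v S x
    set H := fderivWithin ℝ (fderivWithin ℝ v S) S x
    set p1 : V3 := !₂[Real.exp t * Real.cos (a + s), 0, Real.exp t * Real.sin (a + s)] with hp1
    set q1 : V3 := !₂[-(Real.exp t * Real.sin (a + s)), 0, Real.exp t * Real.cos (a + s)] with hq1
    set q2 : V3 := !₂[-(Real.exp t * Real.cos (a + s)), 0, -(Real.exp t * Real.sin (a + s))] with hq2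
    refine ⟨H p1 p1 + G p1, H q1 q1 + G q2, H !₂[0, 1, 0] !₂[0, 1, 0] + G 0, ?_, ?_, ?_, ?_⟩
    · have hI : MapsTo (fun t => Pp t (a + s) y) (Iic (Real.log L)) S := fun t ht => hmem t s y ht hsm
      refine SD_of_deriv (r := Real.log L - t) (g' := fun t => fderivWithin ℝ v S (Pp t (a + s) y) !₂[Real.exp t * Real.cos (a + s), 0, Real.exp t * Real.sin (a + s)]) (by linarith) ?_ ?_
      · intro t' ht'
        have ht2 : t' < Real.log L := by linarith [(abs_lt.1 ht').2]
        exact (curve1 hS hv2 hI ht2.le (Pp_ht (a + s) y t').hasDerivWithinAt).hasDerivAt (Iic_mem_nhds ht2)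
      · exact (curve2 hS hv2 (c' := fun t => !₂[Real.exp t * Real.cos (a + s), 0, Real.exp t * Real.sin (a + s)]) hI ht.le (Pp_ht (a + s) y t).hasDerivWithinAt (Pp_htt (a + s) t).hasDerivWithinAt).hasDerivAt (Iic_mem_nhds ht)
    · have hI : MapsTo (fun s => Pp t (a + s) y) (Icc 0 om) S := fun s hs => hmem t s y ht.le hs
      have hrl : ∀ s, rx (Pp t (a + s) y) < L := fun s => by
        rw [Pp_rx]
        have := Real.exp_lt_exp.2 ht
        rwa [Real.exp_log hL0] at this
      refine fold_SD ho (h := fun s => v (Pp t (a + s) y)) (h1 := fun s => fderivWithin ℝ v S (Pp t (a + s) y) !₂[-(Real.exp t * Real.sin (a + s)), 0, Real.exp t * Real.cos (a + s)])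
        (h2 := fun s => fderivWithin ℝ (fderivWithin ℝ v S) S (Pp t (a + s) y) !₂[-(Real.exp t * Real.sin (a + s)), 0, Real.exp t * Real.cos (a + s)] !₂[-(Real.exp t * Real.sin (a + s)), 0, Real.exp t * Real.cos (a + s)] + fderivWithin ℝ v S (Pp t (a + s) y) !₂[-(Real.exp t * Real.cos (a + s)), 0, -(Real.exp t * Real.sin (a + s))]) ?_ ?_ ?_ ?_ θ
      · intro s hs
        exact curve1 hS hv2 hI hs (Pp_hφ t a y s).hasDerivWithinAt
      · intro s hs
        exact curve2 hS hv2 (c' := fun s => !₂[-(Real.exp t * Real.sin (a + s)), 0, Real.exp t * Real.cos (a + s)]) hI hs (Pp_hφ t a y s).hasDerivWithinAt (Pp_hφφ t a s).hasDerivWithinAt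
      · have hsc : Real.sin a = b₀ * Real.cos a := by
          have := @tan_face b₀ a
          rw [sub_self, Real.sin_zero, zero_div] at this
          linarith
        have hm := hmem t 0 y ht.le ⟨le_rfl, ho.le⟩
        have := hN1 (Pp t (a + 0) y) hm (by simp [Pp, hsc]; ring) (hrl 0)
        rw [vec_dec]
        simp only [map_add, map_smul, smul_eq_mul]
        unfold pdW at this
        rw [add_zero] at this ⊢
        rw [hsc]
        linear_combination (-(Real.exp t * Real.cos a)) * this
      · have hpi : a + om = π / 2 := by rw [hom]; ring
        have hm := hmem t om y ht.le ⟨ho.le, le_rfl⟩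
        have := hN2 (Pp t (a + om) y) hm (by simp [Pp, hpi]) (hrl om)
        rw [vec_dec]
        simp only [map_add, map_smul, smul_eq_mul]
        unfold pdW at this
        rw [this, hpi]; simp
    · have hI : MapsTo (fun y => Pp t (a + s) y) univ S := fun y _ => hmem t s y ht.le hsm
      refine SD_of_deriv (r := 1) (g' := fun y => fderivWithin ℝ v S (Pp t (a + s) y) !₂[0, 1, 0]) one_pos ?_ ?_
      · intro y' _
        exact hasDerivWithinAt_univ.1 (curve1 hS hv2 hI (mem_univ _) (Pp_hy t (a + s) y').hasDerivWithinAt)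
      · exact hasDerivWithinAt_univ.1 (curve2 hS hv2 (c' := fun y => !₂[0, 1, 0]) hI (mem_univ _) (Pp_hy t (a + s) y).hasDerivWithinAt (hasDerivAt_const _ _).hasDerivWithinAt)
    · rw [← lap_SL hL0 hf.continuousOn hv2 hlap x hx, lapW_H hS hv2 hx]
      have he : Real.exp (-2 * t) * (Real.exp t * Real.exp t) = 1 := by
        rw [← Real.exp_add, ← Real.exp_add]; simp; ring
      have hcs := Real.sin_sq_add_cos_sq (a + s)
      rw [hp1, hq1, hq2, vec_dec, vec_dec, vec_dec, vec_dec]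
      simp only [map_add, map_smul, smul_eq_mul, zero_smul, add_zero, zero_add, map_zero, one_smul, add_apply, smul_apply]
      show _ = H _ _ + H _ _ + H _ _
      set h00 := H (EuclideanSpace.single 0 1) (EuclideanSpace.single 0 1)
      set h02 := H (EuclideanSpace.single 0 1) (EuclideanSpace.single 2 1)
      set h20 := H (EuclideanSpace.single 2 1) (EuclideanSpace.single 0 1)
      set h22 := H (EuclideanSpace.single 2 1) (EuclideanSpace.single 2 1)
      set c := Real.cos (a + s)
      set sn := Real.sin (a + s)
      set r := Real.exp t
      linear_combination (sn ^ 2 + c ^ 2) * (h00 + h22) * he + (h00 + h22) * hcs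
  · intro s hs t ht θ y
    have hx := hmem t _ y ht.le (fold_mem ho θ)
    have hs' : s ∈ Icc δ₀ (1 + δ) := by
      rcases hs with hs | hs
      · rw [hs]; exact ⟨le_rfl, by linarith⟩
      · rw [hs]; exact ⟨by linarith, le_rfl⟩
    have := f_bound hL0 hδ0 hδ1 hM hf h hs' 0 (by norm_num) _ hx
    rw [norm_iteratedFDerivWithin_zero, Pp_rx, ← Real.exp_mul] at this
    refine this.trans_eq ?_
    congr 2; push_cast; ring
  · intro θ y
    have hsm := fold_mem ho θ
    have hI : MapsTo (fun t => Pp t (a + fold om θ) y) (Iic (Real.log L)) S := fun t ht => hmem t _ y ht hsm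
    refine (curve1 hS hv2 hI (mem_Iic.2 le_rfl) (Pp_ht (a + fold om θ) y _).hasDerivWithinAt).congr_deriv ?_
    have := hN3 _ (hmem (Real.log L) _ y le_rfl hsm) (by rw [Pp_rx, Real.exp_log hL0])
    rw [← this, vec_dec]
    simp only [map_add, map_smul, smul_eq_mul]
    unfold pdW
    simp [Pp, Real.exp_log hL0]
    field_simp
  · intro t ht θ y
    exact v_bd hL hδ0 hδ₀0 hv2.continuousOn hvb _ (hmem t _ y ht (fold_mem ho θ))
  · intro t ht θ y
    have hI : MapsTo (fun y => Pp t (a + fold om θ) y) univ S := fun y _ => hmem t _ y ht (fold_mem ho θ)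
    exact (hasDerivWithinAt_univ.1 (curve1 hS hv2 hI (mem_univ y) (Pp_hy t _ y).hasDerivWithinAt)).differentiableAt
  · have h0 : fold om 0 = 0 := fold_id ho ⟨le_rfl, ho.le⟩
    refine hzero.comp (tendsto_nhdsWithin_iff.2 ⟨?_, ?_⟩)
    · have e : Tendsto (fun t : ℝ => Real.exp t • (!₂[Real.cos (a + fold om 0), 0, Real.sin (a + fold om 0)] : V3)) atBot (𝓝 ((0:ℝ) • _)) :=
        Real.tendsto_exp_atBot.smul_const _
      rw [zero_smul] at e
      refine e.congr fun t => ?_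
      ext i; fin_cases i <;> simp [Pp]
    · filter_upwards [Iic_mem_atBot (Real.log L)] with t ht
      exact hmem t _ 0 ht (fold_mem ho 0)

open scoped ContDiff

def aff (A0 A1 z : ℝ) (x : V3) : ℝ := A0 + A1 * (x 1 - z)

lemma aff_hfd (A0 A1 z : ℝ) (x : V3) : HasFDerivAt (aff A0 A1 z) (A1 • (EuclideanSpace.proj 1 : V3 →L[ℝ] ℝ)) x := by
  have h : HasFDerivAt (fun x : V3 => x 1) (EuclideanSpace.proj 1 : V3 →L[ℝ] ℝ) x := (EuclideanSpace.proj 1 : V3 →L[ℝ] ℝ).hasFDerivAt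
  exact ((h.sub_const z).const_mul A1).const_add A0

lemma aff_cd (A0 A1 z : ℝ) {n : WithTop ℕ∞} : ContDiff ℝ n (aff A0 A1 z) := by
  unfold aff; fun_prop

lemma pdW_sub_aff {S : Set V3} (hS : UniqueDiffOn ℝ S) {v : V3 → ℝ} {x : V3} (hx : x ∈ S) (hv : DifferentiableWithinAt ℝ v S x) (A0 A1 z : ℝ) (i : Fin 3) :
    pdW S i (fun x => v x - aff A0 A1 z x) x = pdW S i v x - A1 * (EuclideanSpace.single i (1:ℝ) : V3) 1 := by
  unfold pdW
  have h := (hv.hasFDerivWithinAt.sub (aff_hfd A0 A1 z x).hasFDerivWithinAt).fderivWithin (hS x hx)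
  exact (congrArg (fun (T : V3 →L[ℝ] ℝ) => T (EuclideanSpace.single i (1:ℝ))) h).trans (by simp)

lemma lapW_sub_aff {S : Set V3} (hS : UniqueDiffOn ℝ S) {v : V3 → ℝ} {x : V3} (hx : x ∈ S) (hv : ContDiffOn ℝ 2 v S) (A0 A1 z : ℝ) :
    lapW S (fun x => v x - aff A0 A1 z x) x = lapW S v x := by
  unfold lapW
  refine Finset.sum_congr rfl fun i _ => ?_
  have h1 : ∀ y ∈ S, pdW S i (fun x => v x - aff A0 A1 z x) y = pdW S i v y - A1 * (EuclideanSpace.single i (1:ℝ) : V3) 1 := fun y hy =>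
    pdW_sub_aff hS hy (hv.differentiableOn (by norm_num) y hy) A0 A1 z i
  have h2 := pd_congr h1 (EuclideanSpace.single i 1) hx
  refine Eq.trans (show _ = pd S (EuclideanSpace.single i 1) (fun y => pdW S i v y - A1 * (EuclideanSpace.single i (1:ℝ) : V3) 1) x from h2) ?_
  unfold pd
  rw [fderivWithin_sub_const]
  rfl

lemma half_rpow {r ρ s : ℝ} (hρ : 0 < ρ) (hr : ρ / 2 ≤ r) (hs : s ≤ 0) (n : ℕ) (hn : -s ≤ n) : r ^ s ≤ 2 ^ n * ρ ^ s := by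
  calc r ^ s ≤ (ρ / 2) ^ s := Real.rpow_le_rpow_of_nonpos (by positivity) hr hs
    _ = 2 ^ (-s) * ρ ^ s := by rw [Real.div_rpow hρ.le (by norm_num), Real.rpow_neg (by norm_num)]; ring
    _ ≤ 2 ^ (n:ℝ) * ρ ^ s := by
      gcongr
      norm_num
    _ = _ := by rw [Real.rpow_natCast]

lemma ball_rx {b₀ : ℝ} {x₀ x : V3} (h : x ∈ Metric.ball x₀ (rx x₀ / 2)) : rx x₀ / 2 ≤ rx x ∧ rx x ≤ 3 / 2 * rx x₀ := by
  rw [Metric.mem_ball, dist_eq_norm] at h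
  have h1 := rx_lip x x₀
  have h2 := rx_lip x₀ x
  rw [norm_sub_rev] at h2
  constructor <;> linarith

lemma f_IB {b₀ L α δ δ₀ M : ℝ} (hL : 0 < L) (hα0 : 0 < α) (hα1 : α < 1) (hδ0 : 0 < δ) (hδ1 : δ < 1) (hδ₀0 : 0 < δ₀) (hM : 0 ≤ M) {f : V3 → ℝ}
    (hf : ContDiffOn ℝ 4 f (SQ b₀)) (h : wnormLE (SQ b₀) 4 α (1 - δ) (2 - δ₀) (wedgeQL b₀ L) f M) {s : ℝ} (hs : s ∈ Icc δ₀ (1 + δ))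
    {x₀ : V3} (hx₀ : x₀ ∈ SL b₀ L) (hr₀ : rx x₀ ≤ L / 2) :
    IB (SQ b₀ ∩ Metric.ball x₀ (rx x₀ / 2)) α (rx x₀) 4 (128 * M * rx x₀ ^ s / rx x₀ ^ 2) f := by
  have hr : 0 < rx x₀ := ((mem_SL hL).1 hx₀).2.1
  have hsub : ∀ x ∈ SQ b₀ ∩ Metric.ball x₀ (rx x₀ / 2), x ∈ SL b₀ L := fun x hx =>
    (mem_SL hL).2 ⟨(mem_SQ.1 hx.1).1, (mem_SQ.1 hx.1).2, by linarith [(ball_rx (b₀ := b₀) hx.2).2]⟩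
  have hs1 := hs.1
  have hs2 := hs.2
  refine ⟨hf.mono inter_subset_left, fun k hk x hx => ?_, fun x hx y hy => ?_⟩
  · rw [iteratedFDerivWithin_inter_open Metric.isOpen_ball hx.2]
    have hk4 : (k:ℝ) ≤ 4 := by exact_mod_cast hk
    have hk0 : (0:ℝ) ≤ k := Nat.cast_nonneg k
    refine (f_bound hL hδ0 hδ1 hM hf h hs k hk x (hsub x hx)).trans ?_
    have := half_rpow (s := s - 2 - k) hr (ball_rx (b₀ := b₀) hx.2).1 (by linarith) 7 (by push_cast; linarith)
    calc M * rx x ^ (s - 2 - k) ≤ M * (2 ^ 7 * rx x₀ ^ (s - 2 - k)) := mul_le_mul_of_nonneg_left this hM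
      _ = _ := by
        rw [Real.rpow_sub hr, Real.rpow_sub hr, Real.rpow_natCast, show (2:ℝ) = ((2:ℕ):ℝ) by norm_num, Real.rpow_natCast]; push_cast; ring
  · rw [iteratedFDerivWithin_inter_open Metric.isOpen_ball hx.2, iteratedFDerivWithin_inter_open Metric.isOpen_ball hy.2]
    refine (f_hold hL hα0 hδ0 hδ1 hM hf h hs x (hsub x hx) y (hsub y hy)).trans ?_
    have := half_rpow (s := s - 6 - α) hr (le_min (ball_rx (b₀ := b₀) hx.2).1 (ball_rx (b₀ := b₀) hy.2).1) (by linarith) 7 (by push_cast; linarith)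
    calc M * ‖x - y‖ ^ α * min (rx x) (rx y) ^ (s - 6 - α) ≤ M * ‖x - y‖ ^ α * (2 ^ 7 * rx x₀ ^ (s - 6 - α)) := mul_le_mul_of_nonneg_left this (by positivity)
      _ = _ := by
        rw [Real.rpow_sub hr, Real.rpow_sub hr, Real.div_rpow (norm_nonneg _) hr.le, show (6:ℝ) = ((6:ℕ):ℝ) by norm_num, Real.rpow_natCast]; field_simp; ring

set_option maxHeartbeats 1000000 in
lemma loc {b₀ α δ δ₀ : ℝ} (hb₀ : 0 < b₀) (hα0 : 0 < α) (hα1 : α < 1) (hδ0 : 0 < δ) (hδ1 : δ < 1) (hδ₀0 : 0 < δ₀) (hδ₀1 : δ₀ < 1) :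
    ∃ C c, 1 ≤ C ∧ 0 < c ∧ c < 1/8 ∧ ∀ (L : ℝ), 4 ≤ L → ∀ (f v : V3 → ℝ) (M M0 : ℝ), 0 ≤ M → ContDiffOn ℝ 4 f (SQ b₀) →
      wnormLE (SQ b₀) 4 α (1 - δ) (2 - δ₀) (wedgeQL b₀ L) f M → IsCutoffSolution b₀ L f v →
      wsupLE (SL b₀ L) 0 (-1 - δ) (-δ₀) (wedgeQL b₀ L) v M0 → ∀ x₀ ∈ SL b₀ L, rx x₀ ≤ L / 2 → ∀ s, ((rx x₀ < 1 ∧ s = 1 + δ) ∨ (1 ≤ rx x₀ ∧ s = δ₀)) →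
      ∃ A0 A1, |A0| ≤ C * M ∧ |A1| ≤ C * M ∧ (1 ≤ rx x₀ → A0 = 0 ∧ A1 = 0) ∧
        (rx x₀ < 1 → ∀ ρ, rx x₀ ≤ ρ → ρ ≤ 1 → ∀ x ∈ SL b₀ L, rx x ≤ ρ → |x 1 - x₀ 1| ≤ ρ → |v x - aff A0 A1 (x₀ 1) x| ≤ C * M * ρ ^ (1 + δ)) ∧
        IB (SQ b₀ ∩ Metric.ball x₀ (c * rx x₀)) α (rx x₀) 6 (C * M * rx x₀ ^ s) (fun x => v x - aff A0 A1 (x₀ 1) x) := by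
  have ho0 : 0 < π / 2 - Real.arctan b₀ := by linarith [Real.arctan_lt_pi_div_two b₀]
  have ho1 : π / 2 - Real.arctan b₀ < π / 2 := by linarith [Real.arctan_pos.2 hb₀]
  obtain ⟨C1, hC1, H1⟩ := PDbound ho0 ho1 hδ0 hδ1 hδ₀0 hδ₀1
  obtain ⟨C2, c, hC2, hc0, hc1, H2⟩ := local_est hb₀ hα0 hα1
  refine ⟨C2 * (128 * C1), c, by nlinarith, hc0, hc1, ?_⟩
  intro L hL f v M M0 hM hf hfn hv hvb x₀ hx₀ hr₀ s hs
  have hL0 : 0 < L := by linarith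
  have hpd := toPD hb₀ (by linarith) hδ0 hδ1 hδ₀0 hδ₀1 hM hf hfn hv hvb
  obtain ⟨b1, b2, b3, b4⟩ := H1 _ _ _ _ _ _ (by rw [mul_comm, Real.exp_mul, Real.exp_log hL0]; norm_num; nlinarith) hM hpd
  clear H1 hpd
  obtain ⟨hv2, hlap, hN1, hN2, hN3, hper, hzero⟩ := hv
  have hlap' := lap_SL hL0 hf.continuousOn hv2 hlap
  have hr : 0 < rx x₀ := ((mem_SL hL0).1 hx₀).2.1
  have hSS := SL_sub_SQ (b₀ := b₀) hL0
  set D := SQ b₀ ∩ Metric.ball x₀ (rx x₀ / 2) with hD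
  have hDS : D = SL b₀ L ∩ Metric.ball x₀ (rx x₀ / 2) := by
    ext x
    refine ⟨fun hx => ⟨(mem_SL hL0).2 ⟨(mem_SQ.1 hx.1).1, (mem_SQ.1 hx.1).2, by linarith [(ball_rx (b₀ := b₀) hx.2).2]⟩, hx.2⟩, fun hx => ⟨hSS hx.1, hx.2⟩⟩
  have hDu : UniqueDiffOn ℝ D := (SQ_ud b₀).inter Metric.isOpen_ball
  have hDsub : D ⊆ SL b₀ L := by rw [hDS]; exact inter_subset_left
  have hpdW : ∀ i, ∀ u : V3 → ℝ, ∀ x ∈ D, pdW D i u x = pdW (SL b₀ L) i u x := by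
    intro i u x hx
    rw [hDS]
    exact pd_inter Metric.isOpen_ball _ u hx.2
  have hvD : ContDiffOn ℝ 2 v D := hv2.mono hDsub
  have hlapD : ∀ x ∈ D, lapW D v x = f x := by
    intro x hx
    rw [← hlap' x (hDsub hx)]
    unfold lapW
    refine Finset.sum_congr rfl fun i _ => ?_
    rw [← hpdW i _ x hx]
    exact pd_congr (fun y hy => hpdW i v y hy) _ hx
  have hsI : s ∈ Icc δ₀ (1 + δ) := by
    rcases hs with hs | hs <;> rw [hs.2] <;> constructor <;> linarith
  have hfI := f_IB hL0 hα0 hα1 hδ0 hδ1 hδ₀0 hM hf hfn hsI hx₀ hr₀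
  have hrs : 0 < rx x₀ ^ s := by positivity
  set A := 128 * C1 * M * rx x₀ ^ s with hA
  have hA0 : 0 ≤ A := by positivity
  have hfI' : IB D α (rx x₀) 4 (A / rx x₀ ^ 2) f := by
    refine hfI.mono hr ?_
    rw [hA]
    have : M * rx x₀ ^ s ≤ C1 * (M * rx x₀ ^ s) := le_mul_of_one_le_left (by positivity) hC1
    exact div_le_div_of_nonneg_right (by linarith) (by positivity)
  have hCM : 0 ≤ C1 * M := by positivity
  -- main reduction
  have key : ∀ A0 A1, (∀ x ∈ D, |v x - aff A0 A1 (x₀ 1) x| ≤ A) →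
      IB (SQ b₀ ∩ Metric.ball x₀ (c * rx x₀)) α (rx x₀) 6 (C2 * (128 * C1) * M * rx x₀ ^ s) (fun x => v x - aff A0 A1 (x₀ 1) x) := by
    intro A0 A1 hb
    rw [show C2 * (128 * C1) * M * rx x₀ ^ s = C2 * A by rw [hA]; ring]
    have hdv : ∀ x ∈ D, DifferentiableWithinAt ℝ v D x := fun x hx => hvD.differentiableOn (by norm_num) x hx
    have hrl : ∀ x ∈ D, rx x < L := fun x hx => by linarith [(ball_rx (b₀ := b₀) hx.2).2]
    refine H2 x₀ (hSS hx₀) _ f A hA0 (hvD.sub (aff_cd A0 A1 _).contDiffOn) ?_ hb ?_ ?_ hfI'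
    · intro x hx
      rw [lapW_sub_aff hDu hx hvD, hlapD x hx]
    · intro x hx h0
      rw [pdW_sub_aff hDu hx (hdv x hx), hpdW 0 v x hx, hN2 x (hDsub hx) h0 (hrl x hx)]
      simp
    · intro x hx h0
      rw [pdW_sub_aff hDu hx (hdv x hx), pdW_sub_aff hDu hx (hdv x hx), hpdW 0 v x hx, hpdW 2 v x hx]
      have := hN1 x (hDsub hx) h0 (hrl x hx)
      simp
      linarith
  -- polar representation
  have hpol : ∀ x ∈ SL b₀ L, ∃ θ, v x = v (Pp (Real.log (rx x)) (Real.arctan b₀ + fold (π / 2 - Real.arctan b₀) θ) (x 1)) := by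
    intro x hx
    obtain ⟨φ, h1, h2, h3⟩ := Pp_surj hb₀ (hSS hx)
    refine ⟨φ - Real.arctan b₀, ?_⟩
    rw [fold_id ho0 ⟨by linarith, by linarith⟩, add_sub_cancel, ← h3]
  have hlog : ∀ x ∈ SL b₀ L, Real.log (rx x) ≤ Real.log L := fun x hx =>
    Real.log_le_log ((mem_SL hL0).1 hx).2.1 ((mem_SL hL0).1 hx).2.2
  have hlog0 : Real.log (rx x₀) ≤ Real.log L := Real.log_le_log hr (by linarith)
  have hCC : C1 * M ≤ C2 * (128 * C1) * M := by nlinarith [mul_le_mul_of_nonneg_right hC2 hCM]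
  rcases hs with ⟨h1, hs⟩ | ⟨h1, hs⟩
  · set t₀ := Real.log (rx x₀) with ht₀
    have he0 : Real.exp t₀ = rx x₀ := Real.exp_log hr
    set z := x₀ 1 with hz
    set g : ℝ → ℝ := fun y => v (Pp t₀ (Real.arctan b₀ + fold (π / 2 - Real.arctan b₀) 0) y) with hg
    have glob : ∀ ρ, rx x₀ ≤ ρ → ρ ≤ 2 → ∀ x ∈ SL b₀ L, rx x ≤ ρ → |x 1 - z| ≤ ρ → |v x - aff (g z) (deriv g z) z x| ≤ 2 * (C1 * M * ρ ^ (1 + δ)) := by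
      intro ρ hρ0 hρ2 x hx hxρ hzρ
      obtain ⟨θ, hθ⟩ := hpol x hx
      have hrx : 0 < rx x := ((mem_SL hL0).1 hx).2.1
      set t := Real.log (rx x) with ht
      have he : Real.exp t = rx x := Real.exp_log hrx
      have p1 : |v x - g (x 1)| ≤ C1 * M * ρ ^ (1 + δ) := by
        have aux : ∀ τ, Real.exp τ ≤ ρ → C1 * M * Real.exp ((1 + δ) * τ) ≤ C1 * M * ρ ^ (1 + δ) := by
          intro τ hτ
          refine mul_le_mul_of_nonneg_left ?_ hCM
          rw [mul_comm, Real.exp_mul]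
          exact Real.rpow_le_rpow (Real.exp_pos _).le hτ (by linarith)
        rcases le_total t t₀ with htt | htt
        · have := b1 t t₀ htt hlog0 (by rw [he0]; linarith) θ 0 (x 1)
          rw [← hθ] at this
          exact this.trans (aux t₀ (by rw [he0]; linarith))
        · have := b1 t₀ t htt (hlog x hx) (by rw [he]; linarith) 0 θ (x 1)
          rw [← hθ, abs_sub_comm] at this
          exact this.trans (aux t (by rw [he]; exact hxρ))
      have p2 : |g (x 1) - g z - deriv g z * (x 1 - z)| ≤ C1 * M * ρ ^ (1 + δ) := by
        have := b2 t₀ hlog0 0 z (x 1 - z) (by linarith [Real.pi_gt_three])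
        rw [add_sub_cancel] at this
        refine this.trans (mul_le_mul_of_nonneg_left ?_ hCM)
        exact Real.rpow_le_rpow (abs_nonneg _) hzρ (by linarith)
      have : v x - aff (g z) (deriv g z) z x = (v x - g (x 1)) + (g (x 1) - g z - deriv g z * (x 1 - z)) := by unfold aff; ring
      rw [this]
      refine (abs_add_le _ _).trans ((add_le_add p1 p2).trans ?_)
      linarith
    refine ⟨g z, deriv g z, ?_, ?_, fun h => absurd h (not_le.2 h1), ?_, key _ _ ?_⟩
    · refine (b4 t₀ hlog0 0 z).trans ?_
      have : Real.exp (δ₀ * t₀) ≤ 1 := by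
        rw [Real.exp_le_one_iff]
        exact mul_nonpos_of_nonneg_of_nonpos hδ₀0.le (Real.log_nonpos hr.le h1.le)
      have h3 : C1 * M * (1 + Real.exp (δ₀ * t₀)) ≤ C1 * M * 2 := mul_le_mul_of_nonneg_left (by linarith) hCM
      nlinarith [mul_le_mul_of_nonneg_right hC2 hCM]
    · exact (b3 t₀ hlog0 0 z).trans hCC
    · intro _ ρ hρ hρ1 x hx h2 h3
      refine (glob ρ hρ (by linarith) x hx h2 h3).trans ?_
      have hρ0 : 0 ≤ ρ ^ (1 + δ) := Real.rpow_nonneg (hr.le.trans hρ) _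
      have := mul_nonneg hCM hρ0
      nlinarith [mul_le_mul_of_nonneg_right hC2 this]
    · intro x hx
      have hbx := ball_rx (b₀ := b₀) hx.2
      have hd : |x 1 - z| ≤ 3 / 2 * rx x₀ := by
        have h3 := hx.2
        rw [Metric.mem_ball, dist_eq_norm] at h3
        have := abs_coord_le (x - x₀) 1
        simp only [PiLp.sub_apply] at this
        rw [hz]; linarith
      refine (glob (3 / 2 * rx x₀) (by linarith) (by linarith) x (hDsub hx) hbx.2 hd).trans ?_
      have : (3 / 2 * rx x₀) ^ (1 + δ) ≤ 4 * rx x₀ ^ s := by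
        rw [Real.mul_rpow (by norm_num) hr.le, ← hs]
        refine mul_le_mul_of_nonneg_right ?_ hrs.le
        calc ((3:ℝ) / 2) ^ s ≤ (3 / 2) ^ (2:ℝ) := Real.rpow_le_rpow_of_exponent_le (by norm_num) (by linarith)
          _ ≤ 4 := by norm_num
      have h5 := mul_le_mul_of_nonneg_left this hCM
      rw [hA]
      nlinarith [mul_nonneg hCM hrs.le]
  · refine ⟨0, 0, by rw [abs_zero]; positivity, by rw [abs_zero]; positivity, fun _ => ⟨rfl, rfl⟩, fun h => absurd h1 (not_le.2 h), key _ _ ?_⟩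
    intro x hx
    obtain ⟨θ, hθ⟩ := hpol x (hDsub hx)
    have hbx := ball_rx (b₀ := b₀) hx.2
    have hrx : 0 < rx x := (mem_SQ.1 hx.1).2
    have := b4 _ (hlog x (hDsub hx)) θ (x 1)
    rw [← hθ, mul_comm δ₀, Real.exp_mul, Real.exp_log hrx] at this
    have e : v x - aff 0 0 (x₀ 1) x = v x := by unfold aff; ring
    rw [e]
    have q1 : rx x ^ δ₀ ≤ 2 * rx x₀ ^ s := by
      rw [hs]
      calc rx x ^ δ₀ ≤ (3 / 2 * rx x₀) ^ δ₀ := Real.rpow_le_rpow hrx.le hbx.2 hδ₀0.le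
        _ = (3 / 2) ^ δ₀ * rx x₀ ^ δ₀ := Real.mul_rpow (by norm_num) hr.le
        _ ≤ _ := by
          refine mul_le_mul_of_nonneg_right ?_ (by positivity)
          calc ((3:ℝ) / 2) ^ δ₀ ≤ (3 / 2) ^ (1:ℝ) := Real.rpow_le_rpow_of_exponent_le (by norm_num) hδ₀1.le
            _ ≤ 2 := by norm_num
    have q2 : 1 ≤ rx x₀ ^ s := by rw [hs]; exact Real.one_le_rpow h1 hδ₀0.le
    refine this.trans ((mul_le_mul_of_nonneg_left (show 1 + rx x ^ δ₀ ≤ 3 * rx x₀ ^ s by linarith) hCM).trans ?_)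
    rw [hA]
    nlinarith [mul_nonneg hCM hrs.le]

open scoped ContDiff

lemma aff_iFDW {B : Set V3} (hB : UniqueDiffOn ℝ B) {x : V3} (hx : x ∈ B) (A0 A1 z : ℝ) {j : ℕ} (hj : 2 ≤ j) :
    iteratedFDerivWithin ℝ j (aff A0 A1 z) B x = 0 := by
  obtain ⟨k, rfl⟩ : ∃ k, j = (k + 1) + 1 := ⟨j - 2, by omega⟩
  rw [← norm_eq_zero, ← norm_iteratedFDerivWithin_fderivWithin hB hx,
    iteratedFDerivWithin_congr (f := fun _ => A1 • (EuclideanSpace.proj 1 : V3 →L[ℝ] ℝ)) (fun y hy => (aff_hfd A0 A1 z y).hasFDerivWithinAt.fderivWithin (hB y hy)) hx,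
    iteratedFDerivWithin_succ_const]
  simp

set_option maxHeartbeats 1000000 in
lemma unpack {S O : Set V3} (hO : IsOpen O) (hB : UniqueDiffOn ℝ (S ∩ O)) (hconv : Convex ℝ (S ∩ O)) {α r N A0 A1 : ℝ} {x₀ : V3} {v : V3 → ℝ}
    (hx₀ : x₀ ∈ S ∩ O) (hr : 0 < r) (h : IB (S ∩ O) α r 6 N (fun x => v x - aff A0 A1 (x₀ 1) x)) :
    ContDiffWithinAt ℝ 6 v S x₀ ∧ |v x₀ - A0| ≤ N ∧
    (∀ x ∈ S ∩ O, ‖fderivWithin ℝ v S x - A1 • (EuclideanSpace.proj 1 : V3 →L[ℝ] ℝ)‖ ≤ N / r) ∧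
    (∀ j, 2 ≤ j → j ≤ 6 → ∀ x ∈ S ∩ O, ‖iteratedFDerivWithin ℝ j v S x‖ ≤ N / r ^ j) ∧
    (∀ x ∈ S ∩ O, ‖iteratedFDerivWithin ℝ 6 v S x₀ - iteratedFDerivWithin ℝ 6 v S x‖ ≤ N / r ^ 6 * (‖x₀ - x‖ / r) ^ α) ∧
    (∀ x ∈ S ∩ O, ‖fderivWithin ℝ v S x - fderivWithin ℝ v S x₀‖ ≤ N / r ^ 2 * ‖x - x₀‖) := by
  obtain ⟨h1, h2, h3⟩ := h
  set B := S ∩ O with hBd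
  have hu6 : ContDiffOn ℝ 6 (fun x => v x - aff A0 A1 (x₀ 1) x) B := by exact_mod_cast h1
  have hv6 : ContDiffOn ℝ 6 v B := by
    refine (hu6.add (aff_cd A0 A1 (x₀ 1)).contDiffOn).congr fun x _ => ?_
    ring
  have heq : ∀ j : ℕ, 2 ≤ j → j ≤ 6 → ∀ x ∈ B, iteratedFDerivWithin ℝ j (fun x => v x - aff A0 A1 (x₀ 1) x) B x = iteratedFDerivWithin ℝ j v S x := by
    intro j hj hj6 x hx
    have hj6' : (j : WithTop ℕ∞) ≤ 6 := by exact_mod_cast hj6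
    have := iteratedFDerivWithin_sub_apply (i := j) ((hv6 x hx).of_le hj6') (aff_cd A0 A1 (x₀ 1)).contDiffWithinAt hB hx
    rw [aff_iFDW hB hx _ _ _ hj, sub_zero, hBd, iteratedFDerivWithin_inter_open (f := v) hO hx.2] at this
    exact this
  have hfd : ∀ x ∈ B, fderivWithin ℝ (fun x => v x - aff A0 A1 (x₀ 1) x) B x = fderivWithin ℝ v S x - A1 • (EuclideanSpace.proj 1 : V3 →L[ℝ] ℝ) := by
    intro x hx
    have hd := hv6.differentiableOn (by norm_num) x hx
    have := (hd.hasFDerivWithinAt.sub (aff_hfd A0 A1 (x₀ 1) x).hasFDerivWithinAt).fderivWithin (hB x hx)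
    have e : fderivWithin ℝ v B x = fderivWithin ℝ v S x := fderivWithin_inter (hO.mem_nhds hx.2)
    rw [e] at this
    exact this
  refine ⟨?_, ?_, ?_, ?_, ?_, ?_⟩
  · exact (contDiffWithinAt_inter (hO.mem_nhds hx₀.2)).1 (hv6 x₀ hx₀)
  · have := h2 0 (by norm_num) x₀ hx₀
    rw [norm_iteratedFDerivWithin_zero, pow_zero, div_one] at this
    simpa [aff] using this
  · intro x hx
    have := h2 1 (by norm_num) x hx
    rwa [norm_iteratedFDerivWithin_one _ (hB x hx), hfd x hx, pow_one] at this
  · intro j hj hj6 x hx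
    have := h2 j hj6 x hx
    rwa [heq j hj hj6 x hx] at this
  · intro x hx
    have := h3 x₀ hx₀ x hx
    rwa [heq 6 (by norm_num) le_rfl x hx, heq 6 (by norm_num) le_rfl x₀ hx₀] at this
  · intro x hx
    have hdG : DifferentiableOn ℝ (fderivWithin ℝ (fun x => v x - aff A0 A1 (x₀ 1) x) B) B :=
      (hu6.fderivWithin hB (m := 1) (by norm_num)).differentiableOn (by norm_num)
    have := hconv.norm_image_sub_le_of_norm_fderivWithin_le (C := N / r ^ 2) hdG (fun y hy => ?_) hx₀ hx
    · rw [hfd x hx, hfd x₀ hx₀, sub_sub_sub_cancel_right] at this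
      exact this
    · rw [← norm_iteratedFDerivWithin_one _ (hB y hy), norm_iteratedFDerivWithin_fderivWithin hB hy]
      exact h2 2 (by norm_num) y hy

lemma cW_convex (b₀ : ℝ) : Convex ℝ (cW b₀) := by
  have : cW b₀ = closure (wedgeQ b₀) := by ext x; exact mem_clQ.symm
  rw [this]; exact (wedgeQ_convex b₀).closure

/-- everything known near a point -/
structure LocP (b₀ L α δ δ₀ N c : ℝ) (v : V3 → ℝ) (x₀ : V3) (s A0 A1 : ℝ) : Prop where
  a0 : |A0| ≤ N
  a1 : |A1| ≤ N
  az : 1 ≤ rx x₀ → A0 = 0 ∧ A1 = 0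
  gl : rx x₀ < 1 → ∀ ρ, rx x₀ ≤ ρ → ρ ≤ 1 → ∀ x ∈ SL b₀ L, rx x ≤ ρ → |x 1 - x₀ 1| ≤ ρ → |v x - aff A0 A1 (x₀ 1) x| ≤ N * ρ ^ (1 + δ)
  cd : ContDiffWithinAt ℝ 6 v (SL b₀ L) x₀
  b0 : |v x₀ - A0| ≤ N * rx x₀ ^ s
  b1 : ‖fderivWithin ℝ v (SL b₀ L) x₀ - A1 • (EuclideanSpace.proj 1 : V3 →L[ℝ] ℝ)‖ ≤ N * rx x₀ ^ (s - 1)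
  bj : ∀ j : ℕ, 2 ≤ j → j ≤ 6 → ‖iteratedFDerivWithin ℝ j v (SL b₀ L) x₀‖ ≤ N * rx x₀ ^ (s - j)
  hol : ∀ x ∈ SL b₀ L, ‖x₀ - x‖ < c * rx x₀ → ‖iteratedFDerivWithin ℝ 6 v (SL b₀ L) x₀ - iteratedFDerivWithin ℝ 6 v (SL b₀ L) x‖ ≤ N * rx x₀ ^ (s - 6 - α) * ‖x₀ - x‖ ^ α
  lip : ∀ x ∈ SL b₀ L, ‖x₀ - x‖ < c * rx x₀ → ‖fderivWithin ℝ v (SL b₀ L) x₀ - fderivWithin ℝ v (SL b₀ L) x‖ ≤ N * rx x₀ ^ (s - 2) * ‖x₀ - x‖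

lemma loc2 {b₀ α δ δ₀ : ℝ} (hb₀ : 0 < b₀) (hα0 : 0 < α) (hα1 : α < 1) (hδ0 : 0 < δ) (hδ1 : δ < 1) (hδ₀0 : 0 < δ₀) (hδ₀1 : δ₀ < 1) :
    ∃ C c, 1 ≤ C ∧ 0 < c ∧ c < 1/8 ∧ ∀ (L : ℝ), 4 ≤ L → ∀ (f v : V3 → ℝ) (M M0 : ℝ), 0 ≤ M → ContDiffOn ℝ 4 f (SQ b₀) →
      wnormLE (SQ b₀) 4 α (1 - δ) (2 - δ₀) (wedgeQL b₀ L) f M → IsCutoffSolution b₀ L f v →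
      wsupLE (SL b₀ L) 0 (-1 - δ) (-δ₀) (wedgeQL b₀ L) v M0 → ∀ x₀ ∈ SL b₀ L, rx x₀ ≤ L / 2 → ∀ s, ((rx x₀ < 1 ∧ s = 1 + δ) ∨ (1 ≤ rx x₀ ∧ s = δ₀)) →
      ∃ A0 A1, LocP b₀ L α δ δ₀ (C * M) c v x₀ s A0 A1 := by
  obtain ⟨C, c, hC, hc0, hc1, H⟩ := loc hb₀ hα0 hα1 hδ0 hδ1 hδ₀0 hδ₀1
  refine ⟨C, c, hC, hc0, hc1, ?_⟩
  intro L hL f v M M0 hM hf hfn hv hvb x₀ hx₀ hr₀ s hs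
  obtain ⟨A0, A1, e0, e1, ez, eg, hI⟩ := H L hL f v M M0 hM hf hfn hv hvb x₀ hx₀ hr₀ s hs
  have hL0 : 0 < L := by linarith
  have hr : 0 < rx x₀ := ((mem_SL hL0).1 hx₀).2.1
  have hbb : Metric.ball x₀ (c * rx x₀) ⊆ Metric.ball x₀ (rx x₀ / 2) := Metric.ball_subset_ball (by nlinarith)
  have hBS : SQ b₀ ∩ Metric.ball x₀ (c * rx x₀) = SL b₀ L ∩ Metric.ball x₀ (c * rx x₀) := by
    ext x
    refine ⟨fun hx => ⟨(mem_SL hL0).2 ⟨(mem_SQ.1 hx.1).1, (mem_SQ.1 hx.1).2, by linarith [(ball_rx (b₀ := b₀) (hbb hx.2)).2]⟩, hx.2⟩, fun hx => ⟨SL_sub_SQ hL0 hx.1, hx.2⟩⟩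
  have hconv : Convex ℝ (SQ b₀ ∩ Metric.ball x₀ (c * rx x₀)) := by
    have : SQ b₀ ∩ Metric.ball x₀ (c * rx x₀) = cW b₀ ∩ Metric.ball x₀ (c * rx x₀) := by
      ext x
      refine ⟨fun hx => ⟨(mem_SQ.1 hx.1).1, hx.2⟩, fun hx => ⟨mem_SQ.2 ⟨hx.1, by linarith [(ball_rx (b₀ := b₀) (hbb hx.2)).1]⟩, hx.2⟩⟩
    rw [this]
    exact (cW_convex b₀).inter (convex_ball _ _)
  rw [hBS] at hI hconv
  have hud : UniqueDiffOn ℝ (SL b₀ L ∩ Metric.ball x₀ (c * rx x₀)) := (SL_ud b₀ hL0).inter Metric.isOpen_ball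
  have hxB : x₀ ∈ SL b₀ L ∩ Metric.ball x₀ (c * rx x₀) := ⟨hx₀, Metric.mem_ball_self (by positivity)⟩
  obtain ⟨u1, u2, u3, u4, u5, u6⟩ := unpack Metric.isOpen_ball hud hconv hxB hr hI
  have hpw : ∀ j : ℕ, C * M * rx x₀ ^ s / rx x₀ ^ j = C * M * rx x₀ ^ (s - j) := by
    intro j; rw [Real.rpow_sub hr, Real.rpow_natCast]; ring
  have hmb : ∀ x ∈ SL b₀ L, ‖x₀ - x‖ < c * rx x₀ → x ∈ SL b₀ L ∩ Metric.ball x₀ (c * rx x₀) := fun x hx h =>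
    ⟨hx, by rw [Metric.mem_ball, dist_comm, dist_eq_norm]; exact h⟩
  refine ⟨A0, A1, e0, e1, ez, eg, u1, u2, ?_, ?_, ?_, ?_⟩
  · have := u3 x₀ hxB
    have h1 := hpw 1
    rw [pow_one] at h1
    rw [h1] at this
    simpa using this
  · intro j hj hj6
    rw [← hpw]
    exact u4 j hj hj6 x₀ hxB
  · intro x hx hn
    refine (u5 x (hmb x hx hn)).trans_eq ?_
    rw [hpw, Real.div_rpow (norm_nonneg _) hr.le, Real.rpow_sub hr]
    push_cast
    rw [Real.rpow_sub hr, Real.rpow_sub hr]; ring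
  · intro x hx hn
    have := u6 x (hmb x hx hn)
    rw [norm_sub_rev, norm_sub_rev x x₀, hpw] at this
    exact_mod_cast this

open scoped ContDiff

/-- The local information at all points of the half-size truncated wedge. -/
def LocAll (b₀ L α δ δ₀ N c : ℝ) (v : V3 → ℝ) : Prop :=
  ∀ x₀ ∈ SL b₀ L, rx x₀ ≤ L / 2 → ∀ s, ((rx x₀ < 1 ∧ s = 1 + δ) ∨ (1 ≤ rx x₀ ∧ s = δ₀)) →
      ∃ A0 A1, LocP b₀ L α δ δ₀ N c v x₀ s A0 A1

lemma d6_cmp {b₀ L α δ δ₀ N c : ℝ} (hδ0 : 0 < δ) (hδ1 : δ < 1) (hδ₀0 : 0 < δ₀) (hδ₀1 : δ₀ < 1) (hN : 0 ≤ N) {v : V3 → ℝ}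
    (H : LocAll b₀ L α δ δ₀ N c v) {r s : ℝ} (hr : 0 < r) (hs : (r < 1 ∧ s = 1 + δ) ∨ (1 ≤ r ∧ s = δ₀))
    {y : V3} (hy : y ∈ SL b₀ L) (hyL : rx y ≤ L / 2) (hry : r ≤ rx y) :
    ‖iteratedFDerivWithin ℝ 6 v (SL b₀ L) y‖ ≤ N * r ^ (s - 6) := by
  have hdec : ∀ t : ℝ, t - 6 ≤ 0 → rx y ^ (t - 6) ≤ r ^ (t - 6) := fun t ht =>
    Real.rpow_le_rpow_of_nonpos hr hry ht
  rcases lt_or_ge (rx y) 1 with h1 | h1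
  · obtain ⟨A0, A1, P⟩ := H y hy hyL (1 + δ) (Or.inl ⟨h1, rfl⟩)
    have := P.bj 6 (by norm_num) le_rfl
    have hs' : s = 1 + δ := by
      rcases hs with h | h
      · exact h.2
      · linarith [h.1]
    subst hs'
    refine this.trans (mul_le_mul_of_nonneg_left ?_ hN)
    exact hdec _ (by linarith)
  · obtain ⟨A0, A1, P⟩ := H y hy hyL δ₀ (Or.inr ⟨h1, rfl⟩)
    have := P.bj 6 (by norm_num) le_rfl
    refine this.trans (mul_le_mul_of_nonneg_left ?_ hN)
    push_cast
    rcases hs with h | h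
    · calc rx y ^ (δ₀ - 6) ≤ 1 := Real.rpow_le_one_of_one_le_of_nonpos h1 (by linarith)
        _ ≤ r ^ (s - 6) := Real.one_le_rpow_of_pos_of_le_one_of_nonpos hr h.1.le (by linarith [h.2])
    · rw [h.2]; exact hdec _ (by linarith)

lemma hol_pair {b₀ L α δ δ₀ N c : ℝ} (hα0 : 0 < α) (hα1 : α < 1) (hδ0 : 0 < δ) (hδ1 : δ < 1) (hδ₀0 : 0 < δ₀) (hδ₀1 : δ₀ < 1) (hN : 0 ≤ N)
    (hc0 : 0 < c) (hc1 : c < 1) {v : V3 → ℝ}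
    (H : LocAll b₀ L α δ δ₀ N c v) {x y : V3} (hx : x ∈ SL b₀ L) (hxL : rx x ≤ L / 2) (hr : 0 < rx x)
    (hy : y ∈ SL b₀ L) (hyL : rx y ≤ L / 2) (hry : rx x ≤ rx y) {s : ℝ} (hs : (rx x < 1 ∧ s = 1 + δ) ∨ (1 ≤ rx x ∧ s = δ₀)) :
    ‖iteratedFDerivWithin ℝ 6 v (SL b₀ L) x - iteratedFDerivWithin ℝ 6 v (SL b₀ L) y‖ ≤ 2 * N / c * rx x ^ (s - 6 - α) * ‖x - y‖ ^ α := by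
  rcases lt_or_ge ‖x - y‖ (c * rx x) with h | h
  · obtain ⟨A0, A1, P⟩ := H x hx hxL s hs
    refine (P.hol y hy h).trans ?_
    gcongr
    rw [le_div_iff₀ hc0]; nlinarith
  · have h1 := d6_cmp hδ0 hδ1 hδ₀0 hδ₀1 hN H hr hs hx hxL le_rfl
    have h2 := d6_cmp hδ0 hδ1 hδ₀0 hδ₀1 hN H hr hs hy hyL hry
    have h3 := norm_sub_le (iteratedFDerivWithin ℝ 6 v (SL b₀ L) x) (iteratedFDerivWithin ℝ 6 v (SL b₀ L) y)
    have h4 : (c * rx x) ^ α ≤ ‖x - y‖ ^ α := Real.rpow_le_rpow (by positivity) h hα0.le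
    have h5 : c ≤ c ^ α := by
      simpa using Real.rpow_le_rpow_of_exponent_ge hc0 hc1.le hα1.le
    rw [Real.mul_rpow hc0.le hr.le] at h4
    have h6 : c * rx x ^ α ≤ ‖x - y‖ ^ α := le_trans (mul_le_mul_of_nonneg_right h5 (by positivity)) h4
    calc _ ≤ 2 * N * rx x ^ (s - 6) := by linarith
      _ = 2 * N / c * rx x ^ (s - 6 - α) * (c * rx x ^ α) := by
          have : rx x ^ (s - 6) = rx x ^ (s - 6 - α) * rx x ^ α := by
            rw [← Real.rpow_add hr]; congr 1; ring
          rw [this]; field_simp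
      _ ≤ _ := by gcongr

lemma fd_bd {b₀ L α δ δ₀ N c : ℝ} (hδ0 : 0 < δ) (hδ₀1 : δ₀ < 1) (hN : 0 ≤ N) {v : V3 → ℝ}
    (H : LocAll b₀ L α δ δ₀ N c v) {x : V3} (hx : x ∈ SL b₀ L) (hxL : rx x ≤ L / 2) (hr : 0 < rx x) :
    ‖fderivWithin ℝ v (SL b₀ L) x‖ ≤ 2 * N := by
  have hp : ‖(EuclideanSpace.proj 1 : V3 →L[ℝ] ℝ)‖ ≤ 1 := by
    refine ContinuousLinearMap.opNorm_le_bound _ zero_le_one fun z => ?_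
    rw [one_mul]; exact PiLp.norm_apply_le z 1
  have key : ∀ s A0 A1, LocP b₀ L α δ δ₀ N c v x s A0 A1 → rx x ^ (s - 1) ≤ 1 → ‖fderivWithin ℝ v (SL b₀ L) x‖ ≤ 2 * N := by
    intro s A0 A1 P h
    have h1 := P.b1
    have h2 : ‖A1 • (EuclideanSpace.proj 1 : V3 →L[ℝ] ℝ)‖ ≤ N := by
      rw [norm_smul, Real.norm_eq_abs]
      calc _ ≤ N * 1 := mul_le_mul P.a1 hp (norm_nonneg _) hN
        _ = N := mul_one N
    have h3 := norm_le_norm_sub_add (fderivWithin ℝ v (SL b₀ L) x) (A1 • (EuclideanSpace.proj 1 : V3 →L[ℝ] ℝ))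
    nlinarith
  rcases lt_or_ge (rx x) 1 with h1 | h1
  · obtain ⟨A0, A1, P⟩ := H x hx hxL (1 + δ) (Or.inl ⟨h1, rfl⟩)
    exact key _ _ _ P (Real.rpow_le_one hr.le h1.le (by linarith))
  · obtain ⟨A0, A1, P⟩ := H x hx hxL δ₀ (Or.inr ⟨h1, rfl⟩)
    exact key _ _ _ P (Real.rpow_le_one_of_one_le_of_nonpos h1 (by linarith))

lemma wnorm_fin {b₀ L α δ δ₀ N c : ℝ} (hL : 0 < L) (hα0 : 0 < α) (hα1 : α < 1) (hδ0 : 0 < δ) (hδ1 : δ < 1) (hδ₀0 : 0 < δ₀) (hδ₀1 : δ₀ < 1) (hN : 0 ≤ N)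
    (hc0 : 0 < c) (hc1 : c < 1) {v : V3 → ℝ}
    (H : LocAll b₀ L α δ δ₀ N c v) : wnormLE (SL b₀ L) 6 α (-1 - δ) (-δ₀) (wedgeQL b₀ (L / 2)) v (2 * N / c) := by
  have hmem : ∀ x ∈ wedgeQL b₀ (L / 2), x ∈ SL b₀ L ∧ rx x ≤ L / 2 ∧ 0 < rx x := by
    intro x hx
    have h1 : x ∈ SL b₀ L := wedgeQL_sub_SL ⟨hx.1, by linarith [hx.2]⟩
    exact ⟨h1, hx.2.le, ((mem_SL hL).1 h1).2.1⟩
  have h2N : 2 * N ≤ 2 * N / c := by rw [le_div_iff₀ hc0]; nlinarith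
  have hcan : ∀ {r a b : ℝ}, 0 < r → a + b = 0 → r ^ a * r ^ b = 1 := by
    intro r a b hr h; rw [← Real.rpow_add hr, h, Real.rpow_zero]
  refine ⟨⟨?_, ?_⟩, ?_, ?_⟩
  · intro j hj x hx hr h1
    obtain ⟨hxS, hxL, -⟩ := hmem x hx
    obtain ⟨A0, A1, P⟩ := H x hxS hxL (1 + δ) (Or.inl ⟨h1, rfl⟩)
    rcases Nat.lt_or_ge j 2 with h2 | h2
    · interval_cases j
      · rw [max_eq_right (by push_cast; linarith), Real.rpow_zero, one_mul, norm_iteratedFDerivWithin_zero, Real.norm_eq_abs]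
        have e1 := P.b0
        have e2 := P.a0
        have e3 : rx x ^ (1 + δ) ≤ 1 := Real.rpow_le_one hr.le h1.le (by linarith)
        have e4 : |v x| ≤ |v x - A0| + |A0| := by simpa using abs_add_le (v x - A0) A0
        nlinarith
      · rw [max_eq_right (by push_cast; linarith), Real.rpow_zero, one_mul, norm_iteratedFDerivWithin_one _ (SL_ud b₀ hL x hxS)]
        exact (fd_bd hδ0 hδ₀1 hN H hxS hxL hr).trans h2N
    · have h2' : (2:ℝ) ≤ j := by exact_mod_cast h2
      rw [max_eq_left (by linarith)]
      have := P.bj j h2 hj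
      calc _ ≤ rx x ^ (-1 - δ + j) * (N * rx x ^ (1 + δ - j)) := by gcongr
        _ = N * (rx x ^ (-1 - δ + j) * rx x ^ (1 + δ - j)) := by ring
        _ = N := by rw [hcan hr (by ring), mul_one]
        _ ≤ _ := by linarith
  · intro j hj x hx h1
    obtain ⟨hxS, hxL, hr⟩ := hmem x hx
    obtain ⟨A0, A1, P⟩ := H x hxS hxL δ₀ (Or.inr ⟨h1.le, rfl⟩)
    have hb : ‖iteratedFDerivWithin ℝ j v (SL b₀ L) x‖ ≤ N * rx x ^ (δ₀ - j) := by
      obtain ⟨z0, z1⟩ := P.az h1.le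
      rcases Nat.lt_or_ge j 2 with h2 | h2
      · interval_cases j
        · rw [norm_iteratedFDerivWithin_zero, Real.norm_eq_abs]
          simpa [z0] using P.b0
        · rw [norm_iteratedFDerivWithin_one _ (SL_ud b₀ hL x hxS)]
          simpa [z1] using P.b1
      · exact P.bj j h2 hj
    calc _ ≤ rx x ^ (-δ₀ + j) * (N * rx x ^ (δ₀ - j)) := by gcongr
      _ = N * (rx x ^ (-δ₀ + j) * rx x ^ (δ₀ - j)) := by ring
      _ = N := by rw [hcan hr (by ring), mul_one]
      _ ≤ _ := by linarith
  · intro x hx y hy hr h1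
    obtain ⟨hxS, hxL, hx0⟩ := hmem x hx
    obtain ⟨hyS, hyL, hy0⟩ := hmem y hy
    have key : ‖iteratedFDerivWithin ℝ 6 v (SL b₀ L) x - iteratedFDerivWithin ℝ 6 v (SL b₀ L) y‖ ≤ 2 * N / c * min (rx x) (rx y) ^ (1 + δ - 6 - α) * ‖x - y‖ ^ α := by
      rcases le_total (rx x) (rx y) with h | h
      · rw [min_eq_left h] at h1 ⊢
        exact hol_pair hα0 hα1 hδ0 hδ1 hδ₀0 hδ₀1 hN hc0 hc1 H hxS hxL hx0 hyS hyL h (Or.inl ⟨h1, rfl⟩)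
      · rw [min_eq_right h] at h1 ⊢
        rw [norm_sub_rev, norm_sub_rev x y]
        exact hol_pair hα0 hα1 hδ0 hδ1 hδ₀0 hδ₀1 hN hc0 hc1 H hyS hyL hy0 hxS hxL h (Or.inl ⟨h1, rfl⟩)
    rw [max_eq_left (by push_cast; linarith)]
    calc _ ≤ min (rx x) (rx y) ^ (-1 - δ + (6:ℕ) + α) * (2 * N / c * min (rx x) (rx y) ^ (1 + δ - 6 - α) * ‖x - y‖ ^ α) := by gcongr
      _ = (min (rx x) (rx y) ^ (-1 - δ + (6:ℕ) + α) * min (rx x) (rx y) ^ (1 + δ - 6 - α)) * (2 * N / c * ‖x - y‖ ^ α) := by ring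
      _ = _ := by rw [hcan hr (by push_cast; ring), one_mul]
  · intro x hx y hy h1
    obtain ⟨hxS, hxL, hx0⟩ := hmem x hx
    obtain ⟨hyS, hyL, hy0⟩ := hmem y hy
    have hr : 0 < min (rx x) (rx y) := by linarith
    have key : ‖iteratedFDerivWithin ℝ 6 v (SL b₀ L) x - iteratedFDerivWithin ℝ 6 v (SL b₀ L) y‖ ≤ 2 * N / c * min (rx x) (rx y) ^ (δ₀ - 6 - α) * ‖x - y‖ ^ α := by
      rcases le_total (rx x) (rx y) with h | h
      · rw [min_eq_left h] at h1 ⊢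
        exact hol_pair hα0 hα1 hδ0 hδ1 hδ₀0 hδ₀1 hN hc0 hc1 H hxS hxL hx0 hyS hyL h (Or.inr ⟨h1.le, rfl⟩)
      · rw [min_eq_right h] at h1 ⊢
        rw [norm_sub_rev, norm_sub_rev x y]
        exact hol_pair hα0 hα1 hδ0 hδ1 hδ₀0 hδ₀1 hN hc0 hc1 H hyS hyL hy0 hxS hxL h (Or.inr ⟨h1.le, rfl⟩)
    calc _ ≤ min (rx x) (rx y) ^ (-δ₀ + (6:ℕ) + α) * (2 * N / c * min (rx x) (rx y) ^ (δ₀ - 6 - α) * ‖x - y‖ ^ α) := by gcongr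
      _ = (min (rx x) (rx y) ^ (-δ₀ + (6:ℕ) + α) * min (rx x) (rx y) ^ (δ₀ - 6 - α)) * (2 * N / c * ‖x - y‖ ^ α) := by ring
      _ = _ := by rw [hcan hr (by push_cast; ring), one_mul]

open scoped ContDiff

lemma a1_cmp {b₀ L α δ δ₀ N c : ℝ} (hb₀ : 0 < b₀) (hL : 4 ≤ L) (hδ0 : 0 < δ) (hδ1 : δ < 1) (hN : 0 ≤ N) {v : V3 → ℝ}
    {x y : V3} {s s' A0 A1 B0 B1 ρ : ℝ} (P : LocP b₀ L α δ δ₀ N c v x s A0 A1) (Q : LocP b₀ L α δ δ₀ N c v y s' B0 B1)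
    (hρ : 0 < ρ) (hρ1 : ρ < 1 / 2) (hx : rx x ≤ ρ) (hy : rx y ≤ ρ) (hxy : ‖x - y‖ ≤ ρ) : |A1 - B1| ≤ 16 * N * ρ ^ δ := by
  have hL0 : 0 < L := by linarith
  have hexp : Real.exp (Real.log ρ) = ρ := Real.exp_log hρ
  have hmem : ∀ t, Pp (Real.log ρ) (π / 2) t ∈ SL b₀ L := fun t =>
    Pp_mem hb₀ hL0 (Real.arctan_lt_pi_div_two b₀).le le_rfl (by rw [hexp]; linarith)
  have hrx : ∀ t, rx (Pp (Real.log ρ) (π / 2) t) ≤ 2 * ρ := fun t => by rw [Pp_rx, hexp]; linarith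
  have h1 : ∀ t, Pp (Real.log ρ) (π / 2) t 1 = t := fun t => by simp [Pp]
  have hd : |x 1 - y 1| ≤ ρ := by
    have := PiLp.norm_apply_le (x - y) 1
    rw [Real.norm_eq_abs] at this
    exact this.trans hxy
  have hd' := abs_le.1 hd
  have gx : ∀ t, |t - x 1| ≤ 2 * ρ → |v (Pp (Real.log ρ) (π / 2) t) - (A0 + A1 * (t - x 1))| ≤ N * (2 * ρ) ^ (1 + δ) := by
    intro t ht
    have := P.gl (by linarith) (2 * ρ) (by linarith) (by linarith) _ (hmem t) (hrx t) (by rwa [h1])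
    rwa [aff, h1] at this
  have gy : ∀ t, |t - y 1| ≤ 2 * ρ → |v (Pp (Real.log ρ) (π / 2) t) - (B0 + B1 * (t - y 1))| ≤ N * (2 * ρ) ^ (1 + δ) := by
    intro t ht
    have := Q.gl (by linarith) (2 * ρ) (by linarith) (by linarith) _ (hmem t) (hrx t) (by rwa [h1])
    rwa [aff, h1] at this
  have e1 := abs_le.1 (gx (x 1) (by simp; linarith))
  have e2 := abs_le.1 (gx (x 1 + ρ) (by rw [abs_le]; constructor <;> linarith))
  have e3 := abs_le.1 (gy (x 1) (by rw [abs_le]; constructor <;> linarith))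
  have e4 := abs_le.1 (gy (x 1 + ρ) (by rw [abs_le]; constructor <;> linarith))
  have hE : (2 * ρ) ^ (1 + δ) ≤ 4 * ρ * ρ ^ δ := by
    rw [Real.rpow_add (by positivity), Real.rpow_one, Real.mul_rpow (by norm_num) hρ.le]
    have : (2:ℝ) ^ δ ≤ 2 := by simpa using Real.rpow_le_rpow_of_exponent_le (by norm_num : (1:ℝ) ≤ 2) hδ1.le
    have h0 : 0 ≤ ρ ^ δ := by positivity
    calc 2 * ρ * (2 ^ δ * ρ ^ δ) = 2 * ρ * ρ ^ δ * 2 ^ δ := by ring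
      _ ≤ 2 * ρ * ρ ^ δ * 2 := by gcongr
      _ = _ := by ring
  have hNE : N * (2 * ρ) ^ (1 + δ) ≤ N * (4 * ρ * ρ ^ δ) := mul_le_mul_of_nonneg_left hE hN
  have hfin : |(A1 - B1) * ρ| ≤ 16 * N * ρ ^ δ * ρ := by
    rw [abs_le]
    constructor <;> nlinarith
  rw [abs_mul, abs_of_pos hρ] at hfin
  exact le_of_mul_le_mul_right hfin hρ

lemma lip_case {b₀ L α δ δ₀ N c : ℝ} (hδ1 : δ < 1) (hδ₀1 : δ₀ < 1) (hN : 0 ≤ N) (hc1 : c < 1) {v : V3 → ℝ}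
    (H : LocAll b₀ L α δ δ₀ N c v) {x y : V3} (hx : x ∈ SL b₀ L) (hxL : rx x ≤ L / 2) (hr : 0 < rx x)
    (hy : y ∈ SL b₀ L) (hd0 : 0 < ‖x - y‖) (hd1 : ‖x - y‖ ≤ 1) (hd : ‖x - y‖ < c * rx x) :
    ‖fderivWithin ℝ v (SL b₀ L) x - fderivWithin ℝ v (SL b₀ L) y‖ ≤ N * ‖x - y‖ ^ δ := by
  have hdr : ‖x - y‖ ≤ rx x := by nlinarith
  rcases lt_or_ge (rx x) 1 with h1 | h1
  · obtain ⟨A0, A1, P⟩ := H x hx hxL (1 + δ) (Or.inl ⟨h1, rfl⟩)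
    refine (P.lip y hy hd).trans ?_
    have h2 : rx x ^ (1 + δ - 2) ≤ ‖x - y‖ ^ (1 + δ - 2) := Real.rpow_le_rpow_of_nonpos hd0 hdr (by linarith)
    have h3 : ‖x - y‖ ^ (1 + δ - 2) * ‖x - y‖ = ‖x - y‖ ^ δ := by
      rw [← Real.rpow_add_one hd0.ne']; congr 1; ring
    calc _ ≤ N * ‖x - y‖ ^ (1 + δ - 2) * ‖x - y‖ := by gcongr
      _ = _ := by rw [mul_assoc, h3]
  · obtain ⟨A0, A1, P⟩ := H x hx hxL δ₀ (Or.inr ⟨h1, rfl⟩)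
    refine (P.lip y hy hd).trans ?_
    have h2 : rx x ^ (δ₀ - 2) ≤ 1 := Real.rpow_le_one_of_one_le_of_nonpos h1 (by linarith)
    have h3 : ‖x - y‖ ≤ ‖x - y‖ ^ δ := by
      simpa using Real.rpow_le_rpow_of_exponent_ge hd0 hd1 hδ1.le
    calc _ ≤ N * 1 * ‖x - y‖ ^ δ := by gcongr
      _ = _ := by ring

lemma c1_pair {b₀ L α δ δ₀ N c : ℝ} (hb₀ : 0 < b₀) (hL : 4 ≤ L) (hδ0 : 0 < δ) (hδ1 : δ < 1) (hδ₀1 : δ₀ < 1) (hN : 0 ≤ N)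
    (hc0 : 0 < c) (hc1 : c < 1) {v : V3 → ℝ}
    (H : LocAll b₀ L α δ δ₀ N c v) {x y : V3} (hx : x ∈ SL b₀ L) (hxL : rx x ≤ L / 2)
    (hy : y ∈ SL b₀ L) (hyL : rx y ≤ L / 2) :
    ‖fderivWithin ℝ v (SL b₀ L) x - fderivWithin ℝ v (SL b₀ L) y‖ ≤ 18 * N / c * ‖x - y‖ ^ δ := by
  have hL0 : 0 < L := by linarith
  have hrx : 0 < rx x := ((mem_SL hL0).1 hx).2.1
  have hry : 0 < rx y := ((mem_SL hL0).1 hy).2.1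
  rcases (norm_nonneg (x - y)).eq_or_lt with h0 | hd0
  · have : x = y := sub_eq_zero.1 (norm_eq_zero.1 h0.symm)
    rw [this, sub_self, norm_zero]; positivity
  have hN18 : N ≤ 18 * N / c := by rw [le_div_iff₀ hc0]; nlinarith
  set ρ := ‖x - y‖ / c with hρd
  have hρ0 : 0 < ρ := by positivity
  have hdρ : ‖x - y‖ = c * ρ := by rw [hρd]; field_simp
  suffices h : ‖fderivWithin ℝ v (SL b₀ L) x - fderivWithin ℝ v (SL b₀ L) y‖ ≤ 18 * N * ρ ^ δ ∨
      ‖fderivWithin ℝ v (SL b₀ L) x - fderivWithin ℝ v (SL b₀ L) y‖ ≤ N * ‖x - y‖ ^ δ by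
    rcases h with h | h
    · refine h.trans ?_
      rw [hdρ, Real.mul_rpow hc0.le hρ0.le]
      have h5 : c ≤ c ^ δ := by
        simpa using Real.rpow_le_rpow_of_exponent_ge hc0 hc1.le hδ1.le
      calc 18 * N * ρ ^ δ = 18 * N / c * (c * ρ ^ δ) := by field_simp
        _ ≤ _ := by gcongr
    · exact h.trans (by gcongr)
  rcases le_or_gt (1 / 2) ρ with hρ | hρ
  · left
    have h1 := fd_bd hδ0 hδ₀1 hN H hx hxL hrx
    have h2 := fd_bd hδ0 hδ₀1 hN H hy hyL hry
    have h3 := norm_sub_le (fderivWithin ℝ v (SL b₀ L) x) (fderivWithin ℝ v (SL b₀ L) y)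
    have h4 : (1 / 2 : ℝ) ≤ ρ ^ δ := by
      calc (1 / 2 : ℝ) ≤ (1 / 2) ^ δ := by
            simpa using Real.rpow_le_rpow_of_exponent_ge (by norm_num : (0:ℝ) < 1 / 2) (by norm_num) hδ1.le
        _ ≤ ρ ^ δ := Real.rpow_le_rpow (by norm_num) hρ hδ0.le
    nlinarith
  have hd1 : ‖x - y‖ ≤ 1 := by rw [hdρ]; nlinarith
  rcases lt_or_ge ‖x - y‖ (c * rx x) with hA | hA
  · right
    exact lip_case hδ1 hδ₀1 hN hc1 H hx hxL hrx hy hd0 hd1 hA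
  rcases lt_or_ge ‖x - y‖ (c * rx y) with hB | hB
  · right
    rw [norm_sub_rev] at hd0 hd1 hB
    rw [norm_sub_rev, norm_sub_rev x y]
    exact lip_case hδ1 hδ₀1 hN hc1 H hy hyL hry hx hd0 hd1 hB
  left
  rw [hdρ] at hA hB
  have hA' : rx x ≤ ρ := le_of_mul_le_mul_left hA hc0
  have hB' : rx y ≤ ρ := le_of_mul_le_mul_left hB hc0
  obtain ⟨A0, A1, P⟩ := H x hx hxL (1 + δ) (Or.inl ⟨by linarith, rfl⟩)
  obtain ⟨B0, B1, Q⟩ := H y hy hyL (1 + δ) (Or.inl ⟨by linarith, rfl⟩)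
  have hAB := a1_cmp hb₀ hL hδ0 hδ1 hN P Q hρ0 hρ hA' hB' (by rw [hdρ]; nlinarith)
  have hp : ‖(EuclideanSpace.proj 1 : V3 →L[ℝ] ℝ)‖ ≤ 1 := by
    refine ContinuousLinearMap.opNorm_le_bound _ zero_le_one fun z => ?_
    rw [one_mul]; exact PiLp.norm_apply_le z 1
  have hAB' : ‖(A1 - B1) • (EuclideanSpace.proj 1 : V3 →L[ℝ] ℝ)‖ ≤ 16 * N * ρ ^ δ := by
    rw [norm_smul, Real.norm_eq_abs]
    calc _ ≤ 16 * N * ρ ^ δ * 1 := mul_le_mul hAB hp (norm_nonneg _) (by positivity)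
      _ = _ := mul_one _
  have hP : ‖fderivWithin ℝ v (SL b₀ L) x - A1 • (EuclideanSpace.proj 1 : V3 →L[ℝ] ℝ)‖ ≤ N * ρ ^ δ := by
    refine P.b1.trans (mul_le_mul_of_nonneg_left ?_ hN)
    rw [add_sub_cancel_left]; exact Real.rpow_le_rpow hrx.le hA' hδ0.le
  have hQ : ‖fderivWithin ℝ v (SL b₀ L) y - B1 • (EuclideanSpace.proj 1 : V3 →L[ℝ] ℝ)‖ ≤ N * ρ ^ δ := by
    refine Q.b1.trans (mul_le_mul_of_nonneg_left ?_ hN)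
    rw [add_sub_cancel_left]; exact Real.rpow_le_rpow hry.le hB' hδ0.le
  have e : fderivWithin ℝ v (SL b₀ L) x - fderivWithin ℝ v (SL b₀ L) y =
      (fderivWithin ℝ v (SL b₀ L) x - A1 • (EuclideanSpace.proj 1 : V3 →L[ℝ] ℝ)) - (fderivWithin ℝ v (SL b₀ L) y - B1 • (EuclideanSpace.proj 1 : V3 →L[ℝ] ℝ))
        + (A1 - B1) • (EuclideanSpace.proj 1 : V3 →L[ℝ] ℝ) := by
    rw [sub_smul]; abel
  rw [e]
  refine (norm_add_le _ _).trans ?_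
  have := norm_sub_le (fderivWithin ℝ v (SL b₀ L) x - A1 • (EuclideanSpace.proj 1 : V3 →L[ℝ] ℝ)) (fderivWithin ℝ v (SL b₀ L) y - B1 • (EuclideanSpace.proj 1 : V3 →L[ℝ] ℝ))
  linarith

lemma pd_edge {b₀ L α δ δ₀ N c : ℝ} (hL : 4 ≤ L) (hδ0 : 0 < δ) {v : V3 → ℝ}
    (H : LocAll b₀ L α δ δ₀ N c v) {z : V3} (hz : z ∈ edge) {i : Fin 3} (hi : i ≠ 1) :
    Tendsto (pdW (SL b₀ L) i v) (𝓝[SL b₀ (L / 2)] z) (𝓝 0) := by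
  have hL0 : 0 < L := by linarith
  have hrz : rx z = 0 := (rx_zero_iff z).2 hz
  have hT : Tendsto (fun x => N * rx x ^ δ) (𝓝[SL b₀ (L / 2)] z) (𝓝 0) := by
    have : ContinuousAt (fun x => N * rx x ^ δ) z := (continuous_const.mul (rx_cont.rpow_const fun _ => Or.inr hδ0.le)).continuousAt
    have h := this.tendsto
    rw [hrz, Real.zero_rpow hδ0.ne', mul_zero] at h
    exact h.mono_left nhdsWithin_le_nhds
  refine squeeze_zero_norm' ?_ hT
  have h1 : ∀ᶠ x in 𝓝[SL b₀ (L / 2)] z, rx x < 1 :=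
    nhdsWithin_le_nhds (rx_cont.continuousAt.eventually_lt continuousAt_const (by rw [hrz]; norm_num))
  filter_upwards [h1, self_mem_nhdsWithin] with x hx1 hx
  obtain ⟨a1, a2, a3⟩ := (mem_SL (by linarith)).1 hx
  have hxS : x ∈ SL b₀ L := (mem_SL hL0).2 ⟨a1, a2, by linarith⟩
  obtain ⟨A0, A1, P⟩ := H x hxS a3 (1 + δ) (Or.inl ⟨hx1, rfl⟩)
  have h2 := ContinuousLinearMap.le_opNorm (fderivWithin ℝ v (SL b₀ L) x - A1 • (EuclideanSpace.proj 1 : V3 →L[ℝ] ℝ)) (EuclideanSpace.single i 1)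
  have h3 : (fderivWithin ℝ v (SL b₀ L) x - A1 • (EuclideanSpace.proj 1 : V3 →L[ℝ] ℝ)) (EuclideanSpace.single i 1) = pdW (SL b₀ L) i v x := by
    simp [pdW, hi, Ne.symm hi]
  rw [h3] at h2
  have h4 : ‖(EuclideanSpace.single i 1 : V3)‖ = 1 := by simp
  rw [h4, mul_one] at h2
  have h5 := P.b1
  rw [add_sub_cancel_left] at h5
  exact h2.trans h5

/-- Lemma 5.2: the weighted estimate `‖v_L‖^{(−1−δ,−δ₀)}_{6,α;Q_{L/2}} ≤
C‖f_L‖^{(1−δ,2−δ₀)}_{4,α;Q_L}` with `C` independent of `L` and `f`; in particular `v_L` is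
`C^{1,δ}` up to the edge in `Q_{L/2}` and `∂_{y₁}v_L`, `∂_{y₃}v_L` vanish on the edge. -/
theorem stmt14 (b₀ α δ δ₀ : ℝ) (hb₀ : 0 < b₀) (hα0 : 0 < α) (hα1 : α < 1)
    (hδ0 : 0 < δ) (hδ1 : δ < 1) (hδ₀0 : 0 < δ₀) (hδ₀1 : δ₀ < 1) :
    ∃ C : ℝ, 0 < C ∧
      ∀ L : ℝ, 4 ≤ L → ∀ f : V3 → ℝ,
        memH (SQ b₀) 4 α (1 - δ) (2 - δ₀) (wedgeQ b₀) f →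
        Per2On (closure (wedgeQ b₀)) f →
        ∀ v : V3 → ℝ, IsCutoffSolution b₀ L f v →
          (∃ M, wsupLE (SL b₀ L) 0 (-1 - δ) (-δ₀) (wedgeQL b₀ L) v M) →
          ContDiffOn ℝ 6 v (SL b₀ (L / 2)) ∧
          (∀ M : ℝ, 0 ≤ M →
            wnormLE (SQ b₀) 4 α (1 - δ) (2 - δ₀) (wedgeQL b₀ L) f M →
            wnormLE (SL b₀ L) 6 α (-1 - δ) (-δ₀) (wedgeQL b₀ (L / 2)) v (C * M)) ∧
          (∃ C' : ℝ, 0 < C' ∧ ∀ i : Fin 3,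
            ∀ x ∈ SL b₀ (L / 2), ∀ y ∈ SL b₀ (L / 2),
              |pdW (SL b₀ L) i v x - pdW (SL b₀ L) i v y| ≤ C' * ‖x - y‖ ^ δ) ∧
          (∀ z ∈ closure (wedgeQL b₀ (L / 2)) ∩ edge,
            Tendsto (pdW (SL b₀ L) 0 v) (𝓝[SL b₀ (L / 2)] z) (𝓝 0) ∧
            Tendsto (pdW (SL b₀ L) 2 v) (𝓝[SL b₀ (L / 2)] z) (𝓝 0)) := by
  obtain ⟨C, c, hC, hc0, hc1, H⟩ := loc2 hb₀ hα0 hα1 hδ0 hδ1 hδ₀0 hδ₀1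
  have hc1' : c < 1 := by linarith
  refine ⟨2 * C / c, by positivity, ?_⟩
  intro L hL f hf _ v hv hvM
  obtain ⟨M0, hM0⟩ := hvM
  have hL0 : 0 < L := by linarith
  have HM : ∀ M : ℝ, 0 ≤ M → wnormLE (SQ b₀) 4 α (1 - δ) (2 - δ₀) (wedgeQL b₀ L) f M →
      LocAll b₀ L α δ δ₀ (C * M) c v := fun M hM hfM =>
    H L hL f v M M0 hM (by exact_mod_cast hf.1) hfM hv hM0
  obtain ⟨Mf, hMf, hw⟩ := hf.2
  have hsub := wedgeQL_sub b₀ L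
  have hA := HM Mf hMf ⟨⟨fun j hj x hx => hw.1.1 j hj x (hsub hx), fun j hj x hx => hw.1.2 j hj x (hsub hx)⟩,
    fun x hx y hy => hw.2.1 x (hsub hx) y (hsub hy), fun x hx y hy => hw.2.2 x (hsub hx) y (hsub hy)⟩
  have hN : 0 ≤ C * Mf := by positivity
  have hhalf : ∀ x ∈ SL b₀ (L / 2), x ∈ SL b₀ L ∧ rx x ≤ L / 2 := by
    intro x hx
    obtain ⟨a1, a2, a3⟩ := (mem_SL (by linarith)).1 hx
    exact ⟨(mem_SL hL0).2 ⟨a1, a2, by linarith⟩, a3⟩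
  refine ⟨?_, ?_, ?_, ?_⟩
  · intro x hx
    obtain ⟨hxS, hxL⟩ := hhalf x hx
    have hcd : ContDiffWithinAt ℝ 6 v (SL b₀ L) x := by
      rcases lt_or_ge (rx x) 1 with h1 | h1
      · obtain ⟨A0, A1, P⟩ := hA x hxS hxL (1 + δ) (Or.inl ⟨h1, rfl⟩)
        exact P.cd
      · obtain ⟨A0, A1, P⟩ := hA x hxS hxL δ₀ (Or.inr ⟨h1, rfl⟩)
        exact P.cd
    exact hcd.mono fun y hy => (hhalf y hy).1
  · intro M hM hfM
    have := wnorm_fin hL0 hα0 hα1 hδ0 hδ1 hδ₀0 hδ₀1 (by positivity : 0 ≤ C * M) hc0 hc1' (HM M hM hfM)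
    have e : 2 * C / c * M = 2 * (C * M) / c := by ring
    rw [e]; exact this
  · refine ⟨18 * (C * Mf) / c + 1, by positivity, ?_⟩
    intro i x hx y hy
    obtain ⟨hxS, hxL⟩ := hhalf x hx
    obtain ⟨hyS, hyL⟩ := hhalf y hy
    have h1 := c1_pair hb₀ hL hδ0 hδ1 hδ₀1 hN hc0 hc1' hA hxS hxL hyS hyL
    have h2 := ContinuousLinearMap.le_opNorm (fderivWithin ℝ v (SL b₀ L) x - fderivWithin ℝ v (SL b₀ L) y) (EuclideanSpace.single i 1)
    have h4 : ‖(EuclideanSpace.single i 1 : V3)‖ = 1 := by simp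
    rw [h4, mul_one] at h2
    have h5 : 0 ≤ ‖x - y‖ ^ δ := by positivity
    calc |pdW (SL b₀ L) i v x - pdW (SL b₀ L) i v y| ≤ 18 * (C * Mf) / c * ‖x - y‖ ^ δ := h2.trans h1
      _ ≤ _ := by linarith
  · intro z hz
    exact ⟨pd_edge hL hδ0 hA hz.2 (by decide), pd_edge hL hδ0 hA hz.2 (by decide)⟩
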